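/- Let p be an odd prime, let V be a finite vector space over the field with p elements, and let G ≤ GL(V) be a solvable linear group with gcd(|G|, |V|) = 1. Then there exist vectors x, y ∈ V such that C_G(x) ∩ C_G(y) = 1, i.e., the only element of G fixing both x and y is the identity. -/

import Mathlib

open scoped Pointwise

universe u

section Basic

variable {G V : Type*} [Group G] [AddCommGroup V] [DistribMulAction G V]

/-- The setwise stabilizer of an additive subgroup. -/
def AddSubgroup.setStab (G : Type*) {V : Type*} [Group G] [AddCommGroup V] [DistribMulAction G V]
    (U : AddSubgroup V) : Subgroup G where
  carrier := {g | ∀ v, g • v ∈ U ↔ v ∈ U}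
  mul_mem' {a b} ha hb v := by rw [mul_smul, ha, hb]
  one_mem' v := by rw [one_smul]
  inv_mem' {a} ha v := by rw [← ha (a⁻¹ • v), smul_inv_smul]

theorem AddSubgroup.mem_setStab {U : AddSubgroup V} {g : G} :
    g ∈ U.setStab G ↔ ∀ v, g • v ∈ U ↔ v ∈ U := Iff.rfl

theorem AddSubgroup.smul_mem_of_mem_setStab {U : AddSubgroup V} {g : G} (hg : g ∈ U.setStab G)
    {v : V} (hv : v ∈ U) : g • v ∈ U := (hg v).2 hv

theorem AddSubgroup.mem_setStab_of_forall [Finite V] {U : AddSubgroup V} {g : G}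
    (h : ∀ v ∈ U, g • v ∈ U) : g ∈ U.setStab G := by
  have hb : Function.Surjective (fun v : U => (⟨g • v.1, h _ v.2⟩ : U)) := by
    apply Finite.surjective_of_injective
    intro a b hab
    apply Subtype.ext
    simpa using congrArg Subtype.val hab
  intro v
  refine ⟨fun hv => ?_, h v⟩
  obtain ⟨w, hw⟩ := hb ⟨_, hv⟩
  have : w.1 = v := by simpa using congrArg Subtype.val hw
  exact this ▸ w.2

theorem AddSubgroup.setStab_top : (⊤ : AddSubgroup V).setStab G = ⊤ := by
  ext g; simp [AddSubgroup.mem_setStab]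

/-- Two vectors whose common stabilizer acts trivially. -/
def HasBase (G V : Type*) [Group G] [AddCommGroup V] [DistribMulAction G V] : Prop :=
  ∃ x y : V, ∀ g : G, g • x = x → g • y = y → ∀ v : V, g • v = v

/-- `x, y` form a base for the subgroup `H` on the additive subgroup `U`. -/
def IsBaseOn (H : Subgroup G) (U : AddSubgroup V) (x y : V) : Prop :=
  ∀ h ∈ H, h • x = x → h • y = y → ∀ v ∈ U, h • v = v

/-- A nontrivial additive subgroup with no proper nontrivial subgroup stable under `B`. -/
def IsIrredOn (B : Subgroup G) (U : AddSubgroup V) : Prop :=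
  U ≠ ⊥ ∧ ∀ W ≤ U, (∀ b ∈ B, ∀ w ∈ W, b • w ∈ W) → W = ⊥ ∨ W = U

/-- `x` is moved by every element of `B` stabilizing `U` and not trivial on it. -/
def IsRegOn (B : Subgroup G) (U : AddSubgroup V) (x : V) : Prop :=
  ∀ b ∈ B ⊓ U.setStab G, b • x = x → ∀ v ∈ U, b • v = v

/-- The subgroup of fixed points of `g` in `U`. -/
def fixedIn (U : AddSubgroup V) (g : G) : AddSubgroup V where
  carrier := {v | v ∈ U ∧ g • v = v}
  zero_mem' := ⟨U.zero_mem, smul_zero _⟩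
  add_mem' {a b} ha hb := ⟨U.add_mem ha.1 hb.1, by rw [smul_add, ha.2, hb.2]⟩
  neg_mem' {a} ha := ⟨U.neg_mem ha.1, by rw [smul_neg, ha.2]⟩

theorem mem_fixedIn {U : AddSubgroup V} {g : G} {v : V} :
    v ∈ fixedIn U g ↔ v ∈ U ∧ g • v = v := Iff.rfl

theorem smul_nsmul_comm (g : G) (n : ℕ) (v : V) : g • (n • v) = n • (g • v) :=
  smul_comm g n v

theorem smul_zsmul_comm (g : G) (n : ℤ) (v : V) : g • (n • v) = n • (g • v) :=
  smul_comm g n v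

theorem pow_smul_eq_self_of {g : G} {v : V} (h : g • v = v) (n : ℕ) : g ^ n • v = v := by
  induction n with
  | zero => simp
  | succ n ih => rw [pow_succ, mul_smul, h, ih]

theorem inv_smul_eq_self_of {g : G} {v : V} (h : g • v = v) : g⁻¹ • v = v := by
  rw [inv_smul_eq_iff, h]

theorem eq_zero_of_coprime_nsmul {p n : ℕ} (hp : p.Prime) (hn : ¬ p ∣ n) {v : V}
    (hv : p • v = 0) (h : n • v = 0) : v = 0 := by
  have h1 := addOrderOf_dvd_of_nsmul_eq_zero hv
  have h2 := addOrderOf_dvd_of_nsmul_eq_zero h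
  have h3 := Nat.dvd_gcd h1 h2
  rw [(Nat.Prime.coprime_iff_not_dvd hp).2 hn] at h3
  exact AddMonoid.addOrderOf_eq_one_iff.1 (Nat.dvd_one.1 h3)

/-- An element of order prime to `p` cannot act as a nontrivial transvection. -/
theorem eq_zero_of_smul_eq_add [Finite G] {p : ℕ} (hp : p.Prime) (hG : ¬ p ∣ Nat.card G)
    (hV : ∀ v : V, p • v = 0) {g : G} {x y : V} (hx : g • x = x) (hy : g • y = y + x) : x = 0 := by
  have key : ∀ n : ℕ, g ^ n • y = y + n • x := by
    intro n
    induction n with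
    | zero => simp
    | succ n ih =>
      rw [pow_succ', mul_smul, ih, smul_add, hy, smul_nsmul_comm, hx, succ_nsmul]; abel
  have h1 := key (Nat.card G)
  rw [pow_card_eq_one', one_smul] at h1
  exact eq_zero_of_coprime_nsmul hp hG (hV x) (by simpa using h1)

theorem card_subgroup_not_dvd [Finite G] {p : ℕ} (hG : ¬ p ∣ Nat.card G) (H : Subgroup G) :
    ¬ p ∣ Nat.card H := fun h => hG (h.trans H.card_subgroup_dvd_card)

theorem exists_addMonoidHom_proj {K V : Type*} [Field K] [AddCommGroup V] [Module K V]
    (P : Submodule K V) : ∃ f : V →+ V, (∀ v, f v ∈ P) ∧ ∀ v ∈ P, f v = v := by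
  obtain ⟨Q, hQ⟩ := Submodule.exists_isCompl P
  refine ⟨(P.subtype.comp (Submodule.projectionOnto P Q hQ)).toAddMonoidHom,
    fun v => Subtype.prop _, fun v hv => ?_⟩
  exact congrArg Subtype.val (Submodule.projectionOnto_apply_left hQ ⟨v, hv⟩)

/-- Maschke: there is an equivariant projection onto a stable subgroup. -/
theorem exists_equivariant_proj [Finite G] {p : ℕ} (hp : p.Prime) (hG : ¬ p ∣ Nat.card G)
    (hV : ∀ v : V, p • v = 0) (H : Subgroup G) (U : AddSubgroup V)
    (hU : ∀ h ∈ H, ∀ v ∈ U, h • v ∈ U) :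
    ∃ P : V →+ V, (∀ h ∈ H, ∀ v, P (h • v) = h • P v) ∧ (∀ v, P v ∈ U) ∧ ∀ v ∈ U, P v = v := by
  classical
  have : Fact p.Prime := ⟨hp⟩
  let _ : Module (ZMod p) V := AddCommGroup.zmodModule hV
  obtain ⟨f, hf1, hf2⟩ := exists_addMonoidHom_proj (AddSubgroup.toZModSubmodule p U)
  have := Fintype.ofFinite H
  let F : V →+ V :=
    ∑ h : H, (DistribSMul.toAddMonoidHom V h.1).comp
      (f.comp (DistribSMul.toAddMonoidHom V h.1⁻¹))
  have hF : ∀ v, F v = ∑ h : H, h.1 • f (h.1⁻¹ • v) := fun v => by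
    simp [F, AddMonoidHom.finsetSum_apply]
  have hFU : ∀ v, F v ∈ U := fun v => by
    rw [hF]; exact AddSubgroup.sum_mem _ fun h _ => hU _ h.2 _ (hf1 _)
  have hFu : ∀ v ∈ U, F v = Nat.card H • v := fun v hv => by
    rw [hF]
    have : ∀ h : H, h.1 • f (h.1⁻¹ • v) = v := fun h => by
      rw [hf2 _ (hU _ (H.inv_mem h.2) _ hv), smul_inv_smul]
    simp [this, Nat.card_eq_fintype_card]
  have hFc : ∀ k ∈ H, ∀ v, F (k • v) = k • F v := fun k hk v => by
    rw [hF, hF, Finset.smul_sum]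
    refine Fintype.sum_equiv (Equiv.mulLeft (⟨k, hk⟩⁻¹ : H)) _ _ fun h => ?_
    simp [mul_smul]
  have hH := card_subgroup_not_dvd hG H
  obtain ⟨m, hm⟩ : ∃ m : ℕ, ∀ v : V, m • (Nat.card H • v) = v := by
    have hc : Nat.Coprime (Nat.card H) p := ((Nat.Prime.coprime_iff_not_dvd hp).2 hH).symm
    obtain ⟨m, -, hm⟩ := Nat.exists_mul_mod_eq_one_of_coprime hc hp.one_lt
    refine ⟨m, fun v => ?_⟩
    rw [← mul_nsmul, ← Nat.div_add_mod (Nat.card H * m) p, hm, add_nsmul, one_nsmul, mul_comm p,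
      mul_nsmul', hV, nsmul_zero, zero_add]
  refine ⟨m • F, fun h hh v => ?_, fun v => ?_, fun v hv => ?_⟩
  · rw [AddMonoidHom.nsmul_apply, hFc h hh, AddMonoidHom.nsmul_apply, smul_nsmul_comm]
  · exact U.nsmul_mem (hFU v) m
  · rw [AddMonoidHom.nsmul_apply, hFu v hv, hm]

/-- Maschke: a stable subgroup has a stable complement. -/
theorem exists_stable_compl [Finite G] {p : ℕ} (hp : p.Prime) (hG : ¬ p ∣ Nat.card G)
    (hV : ∀ v : V, p • v = 0) (H : Subgroup G) (U : AddSubgroup V)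
    (hU : ∀ h ∈ H, ∀ v ∈ U, h • v ∈ U) :
    ∃ U' : AddSubgroup V, (∀ h ∈ H, ∀ v ∈ U', h • v ∈ U') ∧ U ⊓ U' = ⊥ ∧ U ⊔ U' = ⊤ := by
  obtain ⟨P, hP, hPU, hPu⟩ := exists_equivariant_proj hp hG hV H U hU
  refine ⟨P.ker, fun h hh v hv => ?_, ?_, ?_⟩
  · rw [AddMonoidHom.mem_ker] at hv ⊢
    rw [hP h hh, hv, smul_zero]
  · rw [eq_bot_iff]
    rintro v ⟨hv, hv'⟩
    exact (hPu v hv).symm.trans hv'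
  · rw [eq_top_iff]
    intro v _
    have : v = P v + (v - P v) := by abel
    rw [this]
    refine AddSubgroup.add_mem_sup (hPU v) ?_
    change P _ = 0
    rw [map_sub, hPu _ (hPU v), sub_self]

end Basic

/-- Every solvable group of order prime to `p` acting on a group of exponent `p` with fewer than
`n` elements has a base of size two. -/
def BaseBelow (p n : ℕ) : Prop :=
  ∀ (G V : Type u) [Group G] [AddCommGroup V] [DistribMulAction G V] [Finite G] [Finite V],
    Group.IsSolvable G → ¬ p ∣ Nat.card G → (∀ v : V, p • v = 0) → Nat.card V < n → HasBase G V

section Ambient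

variable {G V : Type u} [Group G] [AddCommGroup V] [DistribMulAction G V] [Finite G] [Finite V]

theorem AddSubgroup.card_lt_of_ne_top {U : AddSubgroup V} (h : U ≠ ⊤) :
    Nat.card U < Nat.card V := by
  have := AddSubgroup.card_le_card_addGroup U
  refine lt_of_le_of_ne this fun h' => h (AddSubgroup.eq_top_of_card_eq U h')

theorem BaseBelow.exists_isBaseOn {p n : ℕ} (ih : BaseBelow.{u} p n) [Group.IsSolvable G]
    (hG : ¬ p ∣ Nat.card G) (hV : ∀ v : V, p • v = 0) (H : Subgroup G) (U : AddSubgroup V)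
    (hU : ∀ h ∈ H, ∀ v ∈ U, h • v ∈ U) (hn : Nat.card U < n) :
    ∃ x ∈ U, ∃ y ∈ U, IsBaseOn H U x y := by
  let _ : DistribMulAction H U :=
    { smul := fun h v => ⟨h.1 • v.1, hU _ h.2 _ v.2⟩
      one_smul := fun v => Subtype.ext (one_smul _ _)
      mul_smul := fun a b v => Subtype.ext (mul_smul _ _ _)
      smul_zero := fun a => Subtype.ext (smul_zero _)
      smul_add := fun a v w => Subtype.ext (smul_add _ _ _) }
  obtain ⟨x, y, h⟩ := ih H U inferInstance (card_subgroup_not_dvd hG H)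
    (fun v => Subtype.ext (hV v.1)) hn
  refine ⟨x, x.2, y, y.2, fun g hg hx hy v hv => ?_⟩
  exact congrArg Subtype.val (h ⟨g, hg⟩ (Subtype.ext hx) (Subtype.ext hy) ⟨v, hv⟩)

/-- A base can be chosen to start with a nonzero vector. -/
theorem BaseBelow.exists_isBaseOn_ne_zero {p n : ℕ} (ih : BaseBelow.{u} p n) [Group.IsSolvable G]
    (hG : ¬ p ∣ Nat.card G) (hV : ∀ v : V, p • v = 0) (H : Subgroup G) (U : AddSubgroup V)
    (hU : ∀ h ∈ H, ∀ v ∈ U, h • v ∈ U) (hn : Nat.card U < n) (hb : U ≠ ⊥) :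
    ∃ x ∈ U, ∃ y ∈ U, x ≠ 0 ∧ IsBaseOn H U x y := by
  obtain ⟨x, hx, y, hy, h⟩ := ih.exists_isBaseOn hG hV H U hU hn
  by_cases hx0 : x = 0
  · by_cases hy0 : y = 0
    · obtain ⟨z, hz, hz0⟩ := U.ne_bot_iff_exists_ne_zero.1 hb |>.elim fun a ha =>
        (⟨a.1, a.2, fun h => ha (Subtype.ext h)⟩ : ∃ z, z ∈ U ∧ z ≠ 0)
      refine ⟨z, hz, y, hy, hz0, fun g hg _ hgy => h g hg ?_ hgy⟩
      rw [hx0, smul_zero]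
    · exact ⟨y, hy, x, hx, hy0, fun g hg h1 h2 => h g hg h2 h1⟩
  · exact ⟨x, hx, y, hy, hx0, h⟩

/-- A reducible action has a base if smaller actions do. -/
theorem hasBase_of_reducible {p : ℕ} (hp : p.Prime) (ih : BaseBelow.{u} p (Nat.card V))
    [Group.IsSolvable G] (hG : ¬ p ∣ Nat.card G) (hV : ∀ v : V, p • v = 0) (U : AddSubgroup V)
    (hU : ∀ h : G, ∀ v ∈ U, h • v ∈ U) (hb : U ≠ ⊥) (ht : U ≠ ⊤) : HasBase G V := by
  obtain ⟨U', hU', hinf, hsup⟩ := exists_stable_compl hp hG hV ⊤ U fun h _ => hU h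
  have ht' : U' ≠ ⊤ := by
    rintro rfl
    exact hb (by simpa using hinf)
  obtain ⟨x, hx, y, hy, h⟩ := ih.exists_isBaseOn hG hV ⊤ U (fun h _ => hU h)
    (AddSubgroup.card_lt_of_ne_top ht)
  obtain ⟨x', hx', y', hy', h'⟩ := ih.exists_isBaseOn hG hV ⊤ U' hU'
    (AddSubgroup.card_lt_of_ne_top ht')
  have key : ∀ a ∈ U, ∀ b ∈ U', ∀ g : G, g • (a + b) = a + b → g • a = a ∧ g • b = b := by
    intro a ha b hb g hg
    have h1 : g • a - a = b - g • b := by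
      rw [smul_add] at hg
      rw [sub_eq_sub_iff_add_eq_add, hg, add_comm]
    have h2 : g • a - a ∈ U ⊓ U' :=
      ⟨U.sub_mem (hU _ _ ha) ha, by rw [h1]; exact U'.sub_mem hb (hU' _ trivial _ hb)⟩
    rw [hinf, AddSubgroup.mem_bot] at h2
    refine ⟨sub_eq_zero.1 h2, ?_⟩
    rw [h2] at h1
    exact (sub_eq_zero.1 h1.symm).symm
  refine ⟨x + x', y + y', fun g h1 h2 v => ?_⟩
  obtain ⟨a, ha, b, hb, rfl⟩ := AddSubgroup.mem_sup.1 (hsup ▸ AddSubgroup.mem_top v)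
  obtain ⟨h3, h4⟩ := key _ hx _ hx' g h1
  obtain ⟨h5, h6⟩ := key _ hy _ hy' g h2
  rw [smul_add, h g trivial h3 h5 a ha, h' g trivial h4 h6 b hb]

end Ambient

section OrbSum

variable {G V : Type*} [Group G] [AddCommGroup V] [DistribMulAction G V]

/-- The sum of `c ^ j • v` for `j < r`. -/
def orbSum (r : ℕ) (c : G) (v : V) : V := ∑ j ∈ Finset.range r, c ^ j • v

theorem orbSum_add (r : ℕ) (c : G) (v w : V) :
    orbSum r c (v + w) = orbSum r c v + orbSum r c w := by
  simp [orbSum, smul_add, Finset.sum_add_distrib]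

theorem orbSum_mem {r : ℕ} {c : G} {v : V} {U : AddSubgroup V} (hc : c ∈ U.setStab G) (hv : v ∈ U) :
    orbSum r c v ∈ U :=
  U.sum_mem fun j _ => AddSubgroup.smul_mem_of_mem_setStab (Subgroup.pow_mem _ hc j) hv

theorem smul_orbSum {r : ℕ} {c : G} (hc : c ^ r = 1) (v : V) : c • orbSum r c v = orbSum r c v := by
  have h := Finset.sum_range_succ' (fun j => c ^ j • v) r
  rw [Finset.sum_range_succ, hc] at h
  simp only [pow_zero, add_left_inj] at h
  rw [orbSum, Finset.smul_sum, h]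
  exact Finset.sum_congr rfl fun j _ => by rw [pow_succ', mul_smul]

theorem orbSum_of_smul_eq {r : ℕ} {c : G} {v : V} (h : c • v = v) : orbSum r c v = r • v := by
  simp [orbSum, pow_smul_eq_self_of h]

end OrbSum

/-- A group `B` of odd prime exponent `r`, normal in `G`, with commutators in the group generated
by an element `ζ` without nonzero fixed points. -/
structure OddHeisenberg (p r : ℕ) {G : Type*} (V : Type*) [Group G] [AddCommGroup V]
    [DistribMulAction G V] (B : Subgroup G) (ζ : G) : Prop where
  prime : p.Prime
  odd : p ≠ 2
  nsmul : ∀ v : V, p • v = 0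
  rprime : r.Prime
  rodd : r ≠ 2
  not_dvd : ¬ p ∣ r
  normal : ∀ g : G, ∀ b ∈ B, g * b * g⁻¹ ∈ B
  mem : ζ ∈ B
  fixed : ∀ v : V, ζ • v = v → v = 0
  norm : ∀ g : G, ∃ k : ℤ, g * ζ * g⁻¹ = ζ ^ k
  cent : ∀ b ∈ B, Commute b ζ
  comm : ∀ a ∈ B, ∀ b ∈ B, ∃ k : ℤ, a * b = ζ ^ k * (b * a)
  exp : ∀ b ∈ B, b ^ r = 1

namespace OddHeisenberg

variable {p r : ℕ} {G V : Type*} [Group G] [AddCommGroup V] [DistribMulAction G V]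
  {B : Subgroup G} {ζ : G}

/-- The inductive statement: a base of regular type together with two regular orbits. -/
def Good (B : Subgroup G) (U : AddSubgroup V) : Prop :=
  ∃ x ∈ U, ∃ y ∈ U, ∃ w ∈ U, ∃ w' ∈ U, y ≠ 0 ∧ w ≠ 0 ∧ w' ≠ 0 ∧ IsBaseOn (U.setStab G) U x y ∧
    IsRegOn B U x ∧ IsRegOn B U w ∧ IsRegOn B U w' ∧ ∀ b ∈ B ⊓ U.setStab G, b • w ≠ w'

theorem zpow_eq_one (h : OddHeisenberg p r V B ζ) {k : ℤ} (hk : (r : ℤ) ∣ k) : ζ ^ k = 1 := by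
  obtain ⟨m, rfl⟩ := hk
  rw [zpow_mul, zpow_natCast, h.exp _ h.mem, one_zpow]

theorem dvd_of_smul_eq (h : OddHeisenberg p r V B ζ) {k : ℤ} {v : V} (hv : v ≠ 0)
    (hk : ζ ^ k • v = v) : (r : ℤ) ∣ k := by
  by_contra hn
  have hc : IsCoprime (r : ℤ) k :=
    (Nat.prime_iff_prime_int.1 h.rprime).irreducible.coprime_iff_not_dvd.2 hn
  obtain ⟨a, b, hab⟩ := hc
  apply hv
  apply h.fixed
  have : ζ = (ζ ^ k) ^ b := by
    rw [← zpow_mul]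
    conv_lhs => rw [← zpow_one ζ, ← hab, zpow_add, h.zpow_eq_one (Dvd.intro_left a rfl), one_mul,
      mul_comm]
  rw [this]
  have : ζ ^ k ∈ MulAction.stabilizer G v := hk
  exact (MulAction.stabilizer G v).zpow_mem this b

theorem eq_of_nsmul (h : OddHeisenberg p r V B ζ) {v w : V} (hvw : r • v = r • w) : v = w := by
  rw [← sub_eq_zero]
  refine eq_zero_of_coprime_nsmul h.prime h.not_dvd (h.nsmul _) ?_
  rw [nsmul_sub, hvw, sub_self]

theorem orbSum_zpow (h : OddHeisenberg p r V B ζ) {m : ℤ} (hm : ¬ (r : ℤ) ∣ m) (v : V) :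
    orbSum r (ζ ^ m) v = 0 := by
  by_contra hn
  refine hm (h.dvd_of_smul_eq hn (smul_orbSum ?_ v))
  rw [← zpow_natCast, ← zpow_mul, mul_comm, zpow_mul, zpow_natCast, h.exp _ h.mem, one_zpow]

theorem orbSum_of_smul {c : G} (hc : Commute c ζ) {m : ℤ} {v : V}
    (hv : c • v = ζ ^ m • v) : orbSum r c v = orbSum r (ζ ^ m) v := by
  have key : ∀ j : ℕ, c ^ j • v = (ζ ^ m) ^ j • v := fun j => by
   induction j with
   | zero => simp
   | succ j ih =>
    rw [pow_succ', mul_smul, ih, ← mul_smul, ((hc.zpow_right m).pow_right j).eq, mul_smul, hv,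
      ← mul_smul, ← pow_succ]
  exact Finset.sum_congr rfl fun j _ => key j

/-- `v` has weight `i` for `d`. -/
def Wt (ζ d : G) (i : ℤ) (v : V) : Prop := d • v = ζ ^ i • v

theorem Wt.proj (h : OddHeisenberg p r V B ζ) {d : G} (hd : d ∈ B) {i : ℤ} {v : V}
    (hv : Wt ζ d i v) (k : ℤ) :
    orbSum r (ζ ^ (-k) * d) v = if (r : ℤ) ∣ i - k then r • v else 0 := by
  have h1 : (ζ ^ (-k) * d) • v = ζ ^ (i - k) • v := by
    rw [mul_smul, hv, ← mul_smul, ← zpow_add]; congr 2; ring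
  have h2 : Commute (ζ ^ (-k) * d) ζ :=
    ((Commute.refl ζ).zpow_left _).mul_left (h.cent d hd)
  rw [orbSum_of_smul h2 h1]
  split_ifs with hi
  · rw [h.zpow_eq_one hi]; exact orbSum_of_smul_eq (one_smul _ _)
  · exact h.orbSum_zpow hi v

theorem wt_orbSum (h : OddHeisenberg p r V B ζ) {d : G} (hd : d ∈ B) (k : ℤ) (v : V) :
    Wt ζ d k (orbSum r (ζ ^ (-k) * d) v) := by
  have hm : ζ ^ (-k) * d ∈ B := B.mul_mem (B.zpow_mem h.mem _) hd
  have := smul_orbSum (h.exp _ hm) v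
  rw [mul_smul] at this
  nth_rewrite 1 [zpow_neg] at this
  rwa [inv_smul_eq_iff] at this

theorem sum_orbSum (h : OddHeisenberg p r V B ζ) {d : G} (hd : d ∈ B) (v : V) :
    ∑ k ∈ Finset.range r, orbSum r (ζ ^ (-(k : ℤ)) * d) v = r • v := by
  unfold orbSum
  rw [Finset.sum_comm]
  have : ∀ j ∈ Finset.range r, ∑ k ∈ Finset.range r, (ζ ^ (-(k : ℤ)) * d) ^ j • v =
      if j = 0 then r • v else 0 := by
    intro j hj
    have h1 : ∀ k : ℕ, (ζ ^ (-(k : ℤ)) * d) ^ j • v = (ζ ^ (-(j : ℤ))) ^ k • (d ^ j • v) := by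
      intro k
      rw [((h.cent d hd).zpow_right _).symm.mul_pow, mul_smul, ← zpow_natCast (ζ ^ _),
        ← zpow_natCast (ζ ^ _), ← zpow_mul, ← zpow_mul]
      congr 2; ring
    simp only [h1]
    change orbSum r _ _ = _
    split_ifs with h0
    · subst h0; simpa using orbSum_of_smul_eq (one_smul G v)
    · refine h.orbSum_zpow ?_ _
      rw [dvd_neg, Int.natCast_dvd_natCast]
      exact Nat.not_dvd_of_pos_of_lt (Nat.pos_of_ne_zero h0) (Finset.mem_range.1 hj)
  rw [Finset.sum_congr rfl this, Finset.sum_ite_eq']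
  simp [h.rprime.pos]

/-- Comparison of weight components in an equality of sums. -/
theorem wt_match (h : OddHeisenberg p r V B ζ) {d : G} (hd : d ∈ B) {i₀ i₁ i₂ j₀ j₁ j₂ : ℤ}
    {a₀ a₁ a₂ b₀ b₁ b₂ : V} (ha₀ : Wt ζ d i₀ a₀) (ha₁ : Wt ζ d i₁ a₁) (ha₂ : Wt ζ d i₂ a₂)
    (hb₀ : Wt ζ d j₀ b₀) (hb₁ : Wt ζ d j₁ b₁) (hb₂ : Wt ζ d j₂ b₂)
    (h₁ : ¬ (r : ℤ) ∣ i₁ - i₀) (h₂ : ¬ (r : ℤ) ∣ i₂ - i₀)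
    (k₁ : ¬ (r : ℤ) ∣ j₁ - j₀) (k₂ : ¬ (r : ℤ) ∣ j₂ - j₀) (k₁₂ : ¬ (r : ℤ) ∣ j₂ - j₁)
    (hab : a₀ + a₁ + a₂ = b₀ + b₁ + b₂) :
    a₀ = 0 ∨ ((r : ℤ) ∣ j₀ - i₀ ∧ a₀ = b₀) ∨ ((r : ℤ) ∣ j₁ - i₀ ∧ a₀ = b₁) ∨
      ((r : ℤ) ∣ j₂ - i₀ ∧ a₀ = b₂) := by
  have key := congrArg (orbSum r (ζ ^ (-i₀) * d)) hab
  simp only [orbSum_add, ha₀.proj h hd, ha₁.proj h hd, ha₂.proj h hd, hb₀.proj h hd,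
    hb₁.proj h hd, hb₂.proj h hd, sub_self, dvd_zero, if_true, if_neg h₁, if_neg h₂,
    add_zero] at key
  by_cases c₀ : (r : ℤ) ∣ j₀ - i₀
  · have c₁ : ¬ (r : ℤ) ∣ j₁ - i₀ := fun c => k₁ (by have := dvd_sub c c₀; simpa using this)
    have c₂ : ¬ (r : ℤ) ∣ j₂ - i₀ := fun c => k₂ (by have := dvd_sub c c₀; simpa using this)
    simp only [if_pos c₀, if_neg c₁, if_neg c₂, add_zero] at key
    exact Or.inr (Or.inl ⟨c₀, h.eq_of_nsmul key⟩)
  by_cases c₁ : (r : ℤ) ∣ j₁ - i₀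
  · have c₂ : ¬ (r : ℤ) ∣ j₂ - i₀ := fun c => k₁₂ (by have := dvd_sub c c₁; simpa using this)
    simp only [if_neg c₀, if_pos c₁, if_neg c₂, add_zero, zero_add] at key
    exact Or.inr (Or.inr (Or.inl ⟨c₁, h.eq_of_nsmul key⟩))
  by_cases c₂ : (r : ℤ) ∣ j₂ - i₀
  · simp only [if_neg c₀, if_neg c₁, if_pos c₂, zero_add] at key
    exact Or.inr (Or.inr (Or.inr ⟨c₂, h.eq_of_nsmul key⟩))
  · simp only [if_neg c₀, if_neg c₁, if_neg c₂, add_zero] at key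
    exact Or.inl (h.eq_of_nsmul (by rw [key, nsmul_zero]))

/-- Multiplication by an element shifting `d` shifts weights. -/
theorem Wt.smul (h : OddHeisenberg p r V B ζ) {c d : G} (hc : c ∈ B) {s i : ℤ} {v : V}
    (hcd : d * c = ζ ^ s * (c * d)) (hv : Wt ζ d i v) : Wt ζ d (s + i) (c • v) := by
  unfold Wt at *
  rw [← mul_smul, hcd, mul_smul, mul_smul, hv, ← mul_smul c, ((h.cent c hc).zpow_right i).eq,
    mul_smul, ← mul_smul, ← zpow_add]

theorem Wt.congr (h : OddHeisenberg p r V B ζ) {d : G} {i j : ℤ} {v : V} (hv : Wt ζ d i v)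
    (hij : (r : ℤ) ∣ i - j) : Wt ζ d j v := by
  have := h.zpow_eq_one hij
  rw [zpow_sub, mul_inv_eq_one] at this
  rwa [Wt, ← this]

theorem Wt.dvd_sub (h : OddHeisenberg p r V B ζ) {d : G} {i j : ℤ} {v : V} (hv : Wt ζ d i v)
    (hv' : Wt ζ d j v) (hne : v ≠ 0) : (r : ℤ) ∣ i - j := by
  refine h.dvd_of_smul_eq hne ?_
  rw [sub_eq_neg_add, zpow_add, mul_smul, ← hv, hv', ← mul_smul, ← zpow_add, neg_add_cancel,
    zpow_zero,
    one_smul]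

/-- The abelian case. -/
theorem good_of_abelian (h : OddHeisenberg p r V B ζ) {U : AddSubgroup V}
    (hζ : ζ ∈ U.setStab G) (hirr : IsIrredOn (B ⊓ U.setStab G) U)
    (hab : ∀ a ∈ B ⊓ U.setStab G, ∀ b ∈ B ⊓ U.setStab G, a * b = b * a) : Good B U := by
  obtain ⟨x, hx, hx0⟩ := U.ne_bot_iff_exists_ne_zero.1 hirr.1 |>.elim fun a ha =>
    (⟨a.1, a.2, fun h => ha (Subtype.ext h)⟩ : ∃ z, z ∈ U ∧ z ≠ 0)
  have scal : ∀ b ∈ B ⊓ U.setStab G, ∃ k : ℤ, ∀ v ∈ U, b • v = ζ ^ k • v := by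
    intro b hb
    obtain ⟨k, -, hk⟩ : ∃ k ∈ Finset.range r, orbSum r (ζ ^ (-(k : ℤ)) * b) x ≠ 0 := by
      apply Finset.exists_ne_zero_of_sum_ne_zero
      rw [h.sum_orbSum hb.1]
      exact fun h' => hx0 (h.eq_of_nsmul (by rw [h', nsmul_zero]))
    have hc : ζ ^ (-(k : ℤ)) * b ∈ B ⊓ U.setStab G :=
      mul_mem (Subgroup.zpow_mem _ (Subgroup.mem_inf.2 ⟨h.mem, hζ⟩) _) hb
    refine ⟨k, fun v hv => ?_⟩
    have hst : ∀ a ∈ B ⊓ U.setStab G, ∀ w ∈ fixedIn U (ζ ^ (-(k : ℤ)) * b),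
        a • w ∈ fixedIn U (ζ ^ (-(k : ℤ)) * b) := by
      intro a ha w hw
      refine ⟨AddSubgroup.smul_mem_of_mem_setStab ha.2 hw.1, ?_⟩
      rw [← mul_smul, ← hab _ ha _ hc, mul_smul, hw.2]
    rcases hirr.2 (fixedIn U (ζ ^ (-(k : ℤ)) * b)) (fun v hv => hv.1) hst with h1 | h1
    · exfalso
      apply hk
      rw [← AddSubgroup.mem_bot, ← h1]
      exact ⟨orbSum_mem hc.2 hx, smul_orbSum (h.exp _ hc.1) x⟩
    · rw [← h1] at hv
      have := hv.2
      rw [mul_smul, zpow_neg, inv_smul_eq_iff] at this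
      exact this
  have hreg : ∀ v ∈ U, v ≠ 0 → IsRegOn B U v := by
    intro v hv hv0 b hb hbv u hu
    obtain ⟨k, hk⟩ := scal b hb
    rw [hk _ hv] at hbv
    rw [hk _ hu, h.zpow_eq_one (h.dvd_of_smul_eq hv0 hbv), one_smul]
  have hspan : ∀ g : G, (∀ k : ℤ, g • ζ ^ k • x = ζ ^ k • x) → ∀ v ∈ U, g • v = v := by
    intro g hg v hv
    have hS : AddSubgroup.closure (Set.range fun k : ℤ => ζ ^ k • x) = U := by
      refine (hirr.2 _ ?_ ?_).resolve_left ?_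
      · rw [AddSubgroup.closure_le]
        rintro _ ⟨k, rfl⟩
        exact AddSubgroup.smul_mem_of_mem_setStab (Subgroup.zpow_mem _ hζ k) hx
      · intro b hb w hw
        obtain ⟨m, hm⟩ := scal b hb
        induction hw using AddSubgroup.closure_induction with
        | mem w hw =>
          obtain ⟨k, rfl⟩ := hw
          refine AddSubgroup.subset_closure ⟨m + k, ?_⟩
          change _ = b • ζ ^ k • x
          rw [hm _ (AddSubgroup.smul_mem_of_mem_setStab (Subgroup.zpow_mem _ hζ k) hx),
            ← mul_smul, ← zpow_add]
        | zero => rw [smul_zero]; exact zero_mem _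
        | add a c _ _ ha hc => rw [smul_add]; exact add_mem ha hc
        | neg a _ ha => rw [smul_neg]; exact neg_mem ha
      · intro h0
        apply hx0
        rw [← AddSubgroup.mem_bot, ← h0]
        exact AddSubgroup.subset_closure ⟨0, by simp⟩
    rw [← hS] at hv
    induction hv using AddSubgroup.closure_induction with
    | mem w hw => obtain ⟨k, rfl⟩ := hw; exact hg k
    | zero => rw [smul_zero]
    | add a c _ _ ha hc => rw [smul_add, ha, hc]
    | neg a _ ha => rw [smul_neg, ha]
  refine ⟨x, hx, ζ • x, AddSubgroup.smul_mem_of_mem_setStab hζ hx, x, hx, -x, U.neg_mem hx,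
    by rwa [smul_ne_zero_iff_ne], hx0, neg_ne_zero.2 hx0, ?_, hreg x hx hx0, hreg x hx hx0,
    hreg _ (U.neg_mem hx) (neg_ne_zero.2 hx0), ?_⟩
  · intro g _ hgx hgy
    apply hspan
    obtain ⟨m, hm⟩ := h.norm g
    have h1 : ζ ^ (m - 1) • x = x := by
      rw [zpow_sub, zpow_one, ← (Commute.refl ζ).zpow_right m |>.inv_left.eq, mul_smul,
        inv_smul_eq_iff,
        ← hm, mul_smul, inv_smul_eq_self_of hgx, mul_smul, hgy]
    have h2 := h.zpow_eq_one (h.dvd_of_smul_eq hx0 h1)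
    rw [zpow_sub, mul_inv_eq_one, zpow_one] at h2
    rw [h2] at hm
    have hc : Commute g ζ := by
      rw [commute_iff_eq, ← mul_inv_eq_iff_eq_mul, hm]
    intro k
    rw [← mul_smul, (hc.zpow_right k).eq, mul_smul, hgx]
  · intro b hb hbx
    obtain ⟨k, hk⟩ := scal b hb
    rw [hk _ hx] at hbx
    have h1 : ζ ^ (2 * k) • x = x := by
      rw [two_mul, zpow_add, mul_smul, hbx, smul_neg, hbx, neg_neg]
    have h2 := h.dvd_of_smul_eq hx0 h1
    have h3 : (r : ℤ) ∣ k := by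
      refine (IsCoprime.dvd_of_dvd_mul_left ?_ h2)
      have := (Nat.coprime_primes h.rprime Nat.prime_two).2 h.rodd
      exact_mod_cast Nat.isCoprime_iff_coprime.2 this
    rw [h.zpow_eq_one h3, one_smul] at hbx
    apply hx0
    refine eq_zero_of_coprime_nsmul h.prime (n := 2) ?_ (h.nsmul x) ?_
    · rw [Nat.prime_dvd_prime_iff_eq h.prime Nat.prime_two]; exact h.odd
    · rw [two_nsmul]; nth_rewrite 1 [hbx]; exact neg_add_cancel x

end OddHeisenberg

namespace OddHeisenberg

variable {p r : ℕ} {G V : Type*} [Group G] [AddCommGroup V] [DistribMulAction G V]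
  {B : Subgroup G} {ζ : G}

theorem not_dvd_two (h : OddHeisenberg p r V B ζ) : ¬ (r : ℤ) ∣ 2 := by
  intro h'
  have : r ∣ 2 := by exact_mod_cast h'
  exact h.rodd ((Nat.prime_dvd_prime_iff_eq h.rprime Nat.prime_two).1 this)

theorem not_dvd_one (h : OddHeisenberg p r V B ζ) : ¬ (r : ℤ) ∣ 1 := fun h' =>
  h.not_dvd_two (h'.trans (one_dvd 2))

theorem conj_zpow (h : OddHeisenberg p r V B ζ) {b d : G} (hb : b ∈ B)
    (hdb : d * b = ζ * (b * d)) (k : ℤ) : d * b ^ k = ζ ^ k * (b ^ k * d) := by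
  have h1 : d * b * d⁻¹ = ζ * b := by rw [hdb]; group
  have h2 : d * b ^ k * d⁻¹ = ζ ^ k * b ^ k := by
    rw [← _root_.conj_zpow, h1, (h.cent b hb).symm.mul_zpow]
  rw [← mul_assoc, ← h2]; group

variable {U : AddSubgroup V} {b d : G}

theorem mem_fixedIn_iff_wt {v : V} : v ∈ fixedIn U d ↔ v ∈ U ∧ Wt ζ d 0 v := by
  rw [mem_fixedIn, Wt, zpow_zero, one_smul]

theorem mem_stab_of_commute {c : G} (hc : c ∈ B ⊓ U.setStab G)
    (hcd : d * c = c * d) : c ∈ B ⊓ (fixedIn U d).setStab G := by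
  refine ⟨hc.1, fun v => ?_⟩
  rw [mem_fixedIn, mem_fixedIn, hc.2 v, ← mul_smul, hcd, mul_smul, smul_left_cancel_iff]

theorem commute_of_smul_mem (h : OddHeisenberg p r V B ζ) (hd : d ∈ B ⊓ U.setStab G) {c : G}
    (hc : c ∈ B ⊓ U.setStab G) {v : V} (hv : v ∈ fixedIn U d) (hv0 : v ≠ 0)
    (hcv : c • v ∈ fixedIn U d) : d * c = c * d := by
  obtain ⟨s, hs⟩ := h.comm d hd.1 c hc.1
  have h1 := Wt.smul h hc.1 hs (mem_fixedIn_iff_wt.1 hv).2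
  have h2 := Wt.dvd_sub h h1 (mem_fixedIn_iff_wt.1 hcv).2 (by rwa [smul_ne_zero_iff_ne])
  rw [hs, h.zpow_eq_one (by simpa using h2), one_mul]

/-- An element fixing all translates of the fixed space of `d` is trivial. -/
theorem smul_eq_of_forall_pow (h : OddHeisenberg p r V B ζ) (hζ : ζ ∈ U.setStab G)
    (hd : d ∈ B ⊓ U.setStab G) (hb : b ∈ B ⊓ U.setStab G) (hdb : d * b = ζ * (b * d)) {g : G}
    (hg : ∀ k : ℕ, ∀ u ∈ fixedIn U d, g • b ^ k • u = b ^ k • u) : ∀ v ∈ U, g • v = v := by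
  intro v hv
  apply h.eq_of_nsmul
  rw [← smul_nsmul_comm, ← h.sum_orbSum hd.1 v, Finset.smul_sum]
  refine Finset.sum_congr rfl fun k _ => ?_
  set e := orbSum r (ζ ^ (-(k : ℤ)) * d) v
  have he : Wt ζ d k e := h.wt_orbSum hd.1 k v
  have heU : e ∈ U := orbSum_mem (mul_mem (Subgroup.zpow_mem _ hζ _) hd.2) hv
  have h1 : b ^ (-(k : ℤ)) • e ∈ fixedIn U d := by
    refine (mem_fixedIn_iff_wt (ζ := ζ)).2
      ⟨AddSubgroup.smul_mem_of_mem_setStab (Subgroup.zpow_mem _ hb.2 _) heU, ?_⟩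
    have := Wt.smul h (B.zpow_mem hb.1 _) (h.conj_zpow hb.1 hdb (-(k : ℤ))) he
    rwa [neg_add_cancel] at this
  have h2 := hg k _ h1
  rwa [zpow_neg, zpow_natCast, smul_inv_smul] at h2

theorem zeta_mem_stab_fixedIn (h : OddHeisenberg p r V B ζ) (hζ : ζ ∈ U.setStab G)
    (hd : d ∈ B ⊓ U.setStab G) : ζ ∈ (fixedIn U d).setStab G :=
  (mem_stab_of_commute ⟨h.mem, hζ⟩ (h.cent d hd.1)).2

theorem isIrredOn_fixedIn (h : OddHeisenberg p r V B ζ)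
    (hirr : IsIrredOn (B ⊓ U.setStab G) U)
    (hd : d ∈ B ⊓ U.setStab G) (hb : b ∈ B ⊓ U.setStab G) (hdb : d * b = ζ * (b * d))
    (hne : fixedIn U d ≠ ⊥) : IsIrredOn (B ⊓ (fixedIn U d).setStab G) (fixedIn U d) := by
  refine ⟨hne, fun W hW hst => ?_⟩
  by_cases hW0 : W = ⊥
  · exact Or.inl hW0
  right
  refine le_antisymm hW fun v hv => ?_
  have hS : AddSubgroup.closure {u | ∃ k : ℤ, ∃ w ∈ W, u = b ^ k • w} = U := by
    refine (hirr.2 _ ?_ ?_).resolve_left ?_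
    · rw [AddSubgroup.closure_le]
      rintro _ ⟨k, w, hw, rfl⟩
      exact AddSubgroup.smul_mem_of_mem_setStab (Subgroup.zpow_mem _ hb.2 k) (hW hw).1
    · intro c hc u hu
      induction hu using AddSubgroup.closure_induction with
      | mem u hu =>
        obtain ⟨k, w, hw, rfl⟩ := hu
        obtain ⟨s, hs⟩ := h.comm d hd.1 (c * b ^ k) (B.mul_mem hc.1 (B.zpow_mem hb.1 k))
        have hm : b ^ (-s) * (c * b ^ k) ∈ B ⊓ U.setStab G :=
          mul_mem (zpow_mem hb _) (mul_mem hc (zpow_mem hb _))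
        have hcomm : d * (b ^ (-s) * (c * b ^ k)) = b ^ (-s) * (c * b ^ k) * d := by
          rw [← mul_assoc, h.conj_zpow hb.1 hdb, mul_assoc, mul_assoc, hs,
            ← mul_assoc (b ^ (-s)), ((h.cent b hb.1).zpow_zpow (-s) s).eq, zpow_neg]
          group
        refine AddSubgroup.subset_closure ⟨s, _, hst _ (mem_stab_of_commute hm hcomm) w hw, ?_⟩
        rw [← mul_smul, ← mul_smul]; congr 1; group
      | zero => rw [smul_zero]; exact zero_mem _
      | add a c _ _ ha hc => rw [smul_add]; exact add_mem ha hc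
      | neg a _ ha => rw [smul_neg]; exact neg_mem ha
    · intro h0
      apply hW0
      rw [eq_bot_iff, ← h0]
      exact fun w hw => AddSubgroup.subset_closure ⟨0, w, hw, by simp⟩
  have key : ∀ u ∈ U, orbSum r d u ∈ W := by
    intro u hu
    rw [← hS] at hu
    induction hu using AddSubgroup.closure_induction with
    | mem u hu =>
      obtain ⟨k, w, hw, rfl⟩ := hu
      have h1 := Wt.smul h (B.zpow_mem hb.1 _) (h.conj_zpow hb.1 hdb k)
        (mem_fixedIn_iff_wt.1 (hW hw)).2
      have h2 := h1.proj h hd.1 0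
      simp only [neg_zero, zpow_zero, one_mul, add_zero, sub_zero] at h2
      rw [h2]
      split_ifs with hk
      · obtain ⟨m, rfl⟩ := hk
        rw [zpow_mul, zpow_natCast, h.exp _ hb.1, one_zpow, one_smul]
        exact nsmul_mem hw _
      · exact zero_mem _
    | zero => simp [orbSum]
    | add a c _ _ ha hc => rw [orbSum_add]; exact add_mem ha hc
    | neg a _ ha =>
      have : orbSum r d (-a) = - orbSum r d a := by simp [orbSum]
      rw [this]; exact neg_mem ha
  have h3 := key v hv.1
  rw [orbSum_of_smul_eq hv.2] at h3
  obtain ⟨n, hn⟩ : ∃ n : ℕ, n • r • v = v := by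
    have hc : Nat.Coprime r p := ((Nat.Prime.coprime_iff_not_dvd h.prime).2 h.not_dvd).symm
    obtain ⟨m, -, hm⟩ := Nat.exists_mul_mod_eq_one_of_coprime hc h.prime.one_lt
    refine ⟨m, ?_⟩
    rw [← mul_nsmul, ← Nat.div_add_mod (r * m) p, hm, add_nsmul, one_nsmul, mul_comm p,
      mul_nsmul', h.nsmul, nsmul_zero, zero_add]
  rw [← hn]
  exact nsmul_mem h3 n

end OddHeisenberg

namespace OddHeisenberg

variable {p r : ℕ} {G V : Type*} [Group G] [AddCommGroup V] [DistribMulAction G V]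
  {B : Subgroup G} {ζ : G} {U : AddSubgroup V} {b d : G}

/-- An element stabilizing `U` and a regular vector of the fixed space of `d` acts on weights
through multiplication by a nonzero residue. -/
theorem exists_wt_mul (h : OddHeisenberg p r V B ζ) (hζ : ζ ∈ U.setStab G)
    (hd : d ∈ B ⊓ U.setStab G) (hb : b ∈ B ⊓ U.setStab G) (hdb : d * b = ζ * (b * d))
    {x : V} (hx : x ∈ fixedIn U d) (hx0 : x ≠ 0) (hreg : IsRegOn B (fixedIn U d) x) {g : G}
    (hg : g ∈ U.setStab G) (hgx : g • x = x) :
    ∃ κ : ℤ, ¬ (r : ℤ) ∣ κ ∧ ∀ i : ℤ, ∀ v ∈ U, Wt ζ d i v → Wt ζ d (i * κ) (g • v) := by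
  have hr : Prime (r : ℤ) := Nat.prime_iff_prime_int.1 h.rprime
  set d' := g * d * g⁻¹ with hd'
  have hd'B : d' ∈ B ⊓ U.setStab G :=
    ⟨h.normal g d hd.1, Subgroup.mul_mem _ (Subgroup.mul_mem _ hg hd.2) (Subgroup.inv_mem _ hg)⟩
  have hd'x : d' • x = x := by
    rw [hd', mul_smul, mul_smul, inv_smul_eq_self_of hgx, hx.2, hgx]
  have hcomm := h.commute_of_smul_mem hd hd'B hx hx0 (by rwa [hd'x])
  have htriv := hreg d' (mem_stab_of_commute hd'B hcomm) hd'x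
  obtain ⟨s, hs⟩ := h.comm d' hd'B.1 b hb.1
  have hpow : ∀ k : ℕ, ∀ u ∈ fixedIn U d, d' • b ^ k • u = ζ ^ (s * k) • b ^ k • u := by
    intro k u hu
    have h1 : d' * b * d'⁻¹ = ζ ^ s * b := by rw [hs]; group
    have h2 : d' * b ^ k * d'⁻¹ = ζ ^ (s * k) * b ^ k := by
      rw [← conj_pow, h1, (((h.cent b hb.1).zpow_right s).symm).mul_pow, zpow_mul, zpow_natCast]
    have h3 : d' * b ^ k = ζ ^ (s * k) * b ^ k * d' := by rw [← h2]; group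
    rw [← mul_smul, h3, mul_smul, htriv u hu, mul_smul]
  have hds : ∀ v ∈ U, d' • v = d ^ s • v := by
    intro v hv
    have h1 : ∀ w ∈ U, (d ^ (-s) * d') • w = w := by
      refine h.smul_eq_of_forall_pow hζ hd hb hdb fun k u hu => ?_
      have h2 : d * b ^ k = ζ ^ (k : ℤ) * (b ^ k * d) := by
        simpa using h.conj_zpow hb.1 hdb k
      have h3 : d ^ (-s) • b ^ k • u = ζ ^ (-s * k) • b ^ k • u := by
        have h4 : d • b ^ k • u = ζ ^ (k : ℤ) • b ^ k • u := by
          rw [← mul_smul, h2, mul_smul, mul_smul, hu.2]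
        have h5 : (ζ ^ (-(k : ℤ)) * d) ∈ MulAction.stabilizer G (b ^ k • u) := by
          rw [MulAction.mem_stabilizer_iff, mul_smul, h4, zpow_neg, inv_smul_smul]
        have h6 := Subgroup.zpow_mem _ h5 (-s)
        rw [((h.cent d hd.1).zpow_right _).symm.mul_zpow, ← zpow_mul] at h6
        have h7 := MulAction.mem_stabilizer_iff.1 h6
        rw [mul_smul] at h7
        rw [show -s * (k : ℤ) = -(-(k : ℤ) * -s) by ring, zpow_neg ζ, eq_inv_smul_iff]
        exact h7
      rw [mul_smul, hpow k u hu, ← mul_smul, ((h.cent d hd.1).zpow_zpow _ _).eq, mul_smul, h3,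
        ← mul_smul, ← zpow_add]
      rw [show s * (k : ℤ) + -s * k = 0 by ring, zpow_zero, one_smul]
    have := h1 v hv
    rwa [mul_smul, zpow_neg, inv_smul_eq_iff] at this
  have hs0 : ¬ (r : ℤ) ∣ s := by
    intro hs0
    have h1 : ∀ v ∈ U, d' • v = v := by
      refine h.smul_eq_of_forall_pow hζ hd hb hdb fun k u hu => ?_
      rw [hpow k u hu, h.zpow_eq_one (hs0.mul_right _), one_smul]
    have h2 : b • x ∈ U := AddSubgroup.smul_mem_of_mem_setStab hb.2 hx.1
    have h3 : d • b • x = b • x := by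
      have := h1 _ (AddSubgroup.smul_mem_of_mem_setStab hg h2)
      rwa [hd', mul_smul, mul_smul, inv_smul_smul, smul_left_cancel_iff] at this
    rw [← mul_smul, hdb, mul_smul, mul_smul, hx.2] at h3
    exact hx0 ((smul_eq_zero_iff_eq b).1 (h.fixed _ h3))
  obtain ⟨m, hm⟩ := h.norm g
  have hm0 : ¬ (r : ℤ) ∣ m := by
    intro hm0
    rw [h.zpow_eq_one hm0] at hm
    have : ζ = 1 := by simpa using hm
    exact hx0 (h.fixed x (by rw [this, one_smul]))
  obtain ⟨t, e, hte⟩ := hr.irreducible.coprime_iff_not_dvd.2 hs0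
  have hedvd : ¬ (r : ℤ) ∣ e := by
    intro he
    apply h.not_dvd_one
    rw [← hte]
    exact dvd_add (Dvd.intro_left t rfl) (he.mul_right _)
  refine ⟨e * m, hr.not_dvd_mul hedvd hm0, fun i v hv hw => ?_⟩
  have hde : d = d ^ (s * e) := by
    conv_lhs => rw [← zpow_one d, ← hte, zpow_add, mul_comm t, zpow_mul, zpow_natCast,
      h.exp _ hd.1, one_zpow, one_mul, mul_comm]
  have hd'e : ∀ w ∈ U, d • w = d' ^ e • w := by
    intro w hw
    rw [hde, zpow_mul]
    have h5 : ((d ^ s)⁻¹ * d') ∈ fixingSubgroup G (U : Set V) := by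
      rw [mem_fixingSubgroup_iff]
      intro y hy
      rw [mul_smul, hds y hy, inv_smul_smul]
    have h7 : Commute d' (d ^ s) := Commute.zpow_right hcomm.symm s
    have h6 := (mem_fixingSubgroup_iff G).1 (Subgroup.zpow_mem _ h5 e) w hw
    rw [h7.inv_right.symm.mul_zpow, mul_smul, inv_zpow, inv_smul_eq_iff] at h6
    exact h6.symm
  have h8 : g * d ^ e = d' ^ e * g := by rw [hd', _root_.conj_zpow]; group
  have h9 : g * ζ ^ (i * e) = ζ ^ (i * (e * m)) * g := by
    rw [show i * (e * m) = m * (i * e) by ring, zpow_mul ζ m, ← hm, _root_.conj_zpow]; group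
  have h10 : d ^ e • v = ζ ^ (i * e) • v := by
    have h5 : (ζ ^ (-i) * d) ∈ MulAction.stabilizer G v := by
      rw [MulAction.mem_stabilizer_iff, mul_smul, hw, zpow_neg, inv_smul_smul]
    have h6 := Subgroup.zpow_mem _ h5 e
    rw [((h.cent d hd.1).zpow_right _).symm.mul_zpow, ← zpow_mul] at h6
    have h7 := MulAction.mem_stabilizer_iff.1 h6
    rwa [mul_smul, neg_mul, zpow_neg, inv_smul_eq_iff] at h7
  rw [Wt, hd'e _ (AddSubgroup.smul_mem_of_mem_setStab hg hv), ← mul_smul, ← h8, mul_smul, h10,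
    ← mul_smul, h9, mul_smul]

theorem good_step (h : OddHeisenberg p r V B ζ) (hζ : ζ ∈ U.setStab G)
    (hd : d ∈ B ⊓ U.setStab G) (hb : b ∈ B ⊓ U.setStab G) (hdb : d * b = ζ * (b * d))
    (hgood : Good B (fixedIn U d)) : Good B U := by
  have hr : Prime (r : ℤ) := Nat.prime_iff_prime_int.1 h.rprime
  have n1 := h.not_dvd_one
  have n2 := h.not_dvd_two
  obtain ⟨x, hx, y, hy, w, hw, w', hw', hy0, hw0, hw'0, hbase, hxr, hwr, hw'r, hne⟩ := hgood
  have hζ0 := h.zeta_mem_stab_fixedIn hζ hd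
  have hx0 : x ≠ 0 := by
    rintro rfl
    exact hy0 (h.fixed y (hxr ζ ⟨h.mem, hζ0⟩ (smul_zero _) y hy))
  have sU : ∀ {c : G} {v : V}, c ∈ B ⊓ U.setStab G → v ∈ U → c • v ∈ U := fun hc hv =>
    AddSubgroup.smul_mem_of_mem_setStab hc.2 hv
  have hcom := fun c (hc : c ∈ B ⊓ U.setStab G) => h.comm d hd.1 c hc.1
  have wt0 : ∀ {v}, v ∈ fixedIn U d → Wt ζ d 0 v := fun hv => (mem_fixedIn_iff_wt.1 hv).2
  have hb1 : d * b = ζ ^ (1 : ℤ) * (b * d) := by rw [zpow_one, hdb]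
  have wt1 : ∀ {v}, v ∈ fixedIn U d → Wt ζ d 1 (b • v) := fun hv => by
    simpa using Wt.smul h hb.1 hb1 (wt0 hv)
  have wt2 : ∀ {v}, v ∈ fixedIn U d → Wt ζ d 2 (b • b • v) := fun hv => by
    simpa using Wt.smul h hb.1 hb1 (wt1 hv)
  have orb : ∀ c ∈ B ⊓ U.setStab G, c • w ≠ w' := fun c hc hcw =>
    hne c (mem_stab_of_commute hc (h.commute_of_smul_mem hd hc hw hw0 (hcw ▸ hw'))) hcw
  have o1 : ∀ c ∈ B ⊓ U.setStab G, c • b • w ≠ b • b • w' := fun c hc hcw =>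
    orb (b⁻¹ * (b⁻¹ * (c * b))) (mul_mem (inv_mem hb) (mul_mem (inv_mem hb) (mul_mem hc hb)))
      (by rw [mul_smul, mul_smul, mul_smul, hcw, inv_smul_smul, inv_smul_smul])
  have o2 : ∀ c ∈ B ⊓ U.setStab G, c • b • b • w' ≠ b • w := fun c hc hcw =>
    o1 c⁻¹ (inv_mem hc) (by rw [← hcw, inv_smul_smul])
  -- elements of `B` trivial on the fixed space and commuting with `b`
  have fin : ∀ c ∈ B ⊓ U.setStab G, (∀ v ∈ fixedIn U d, c • v = v) → c * b = b * c →
      ∀ v ∈ U, c • v = v := fun c hc hc0 hcb =>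
    h.smul_eq_of_forall_pow hζ hd hb hdb fun k u hu => by
      rw [← mul_smul, (Commute.pow_right (show Commute c b from hcb) k).eq, mul_smul, hc0 u hu]
  have regw : ∀ c ∈ B ⊓ U.setStab G, d * c = c * d → c • b • w = b • w →
      ∃ t : ℤ, c * b = ζ ^ t * (b * c) ∧ ∀ v ∈ fixedIn U d, ζ ^ t • c • v = v := by
    intro c hc hdc hcw
    obtain ⟨t, ht⟩ := h.comm c hc.1 b hb.1
    have hm : ζ ^ t * c ∈ B ⊓ U.setStab G :=
      mul_mem (zpow_mem (Subgroup.mem_inf.2 ⟨h.mem, hζ⟩) t) hc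
    refine ⟨t, ht, fun v hv => ?_⟩
    rw [← mul_smul]
    refine hwr _ (mem_stab_of_commute hm ?_) ?_ v hv
    · rw [← mul_assoc, ((h.cent d hd.1).zpow_right t).eq, mul_assoc, hdc, mul_assoc]
    · rw [← smul_left_cancel_iff b, ← mul_smul, ← mul_assoc, ((h.cent b hb.1).zpow_right t).eq,
        mul_assoc, ← ht, mul_smul, hcw]
  have hw1U : b • w ∈ U := sU hb hw.1
  have hw2U : b • b • w' ∈ U := sU hb (sU hb hw'.1)
  have hw10 : b • w ≠ 0 := by rwa [smul_ne_zero_iff_ne]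
  have hw20 : b • b • w' ≠ 0 := by rwa [smul_ne_zero_iff_ne, smul_ne_zero_iff_ne]
  have shift : ∀ c ∈ B ⊓ U.setStab G, ∀ s : ℤ, d * c = ζ ^ s * (c * d) → (r : ℤ) ∣ s →
      d * c = c * d := fun c hc s hs hrs => by rw [hs, h.zpow_eq_one hrs, one_mul]
  have ht0 : ∀ {v : V} (t : ℤ), v ≠ 0 → ζ ^ t • v = v → ζ ^ t = 1 := fun t hv ht =>
    h.zpow_eq_one (h.dvd_of_smul_eq hv ht)
  have reg1 : IsRegOn B U (y + b • w + b • b • w') := by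
    intro c hc hcy
    obtain ⟨s, hs⟩ := hcom c hc
    have a0 := Wt.smul h hc.1 hs (wt0 hy)
    have a1 := Wt.smul h hc.1 hs (wt1 hw)
    have a2 := Wt.smul h hc.1 hs (wt2 hw')
    rw [smul_add, smul_add] at hcy
    have hs0 : (r : ℤ) ∣ s := by
      have m1 := h.wt_match hd.1 a1 a0 a2 (wt0 hy) (wt1 hw) (wt2 hw')
        (by rw [show s + 0 - (s + 1) = -1 by ring, dvd_neg]; exact n1)
        (by rw [show s + 2 - (s + 1) = 1 by ring]; exact n1)
        (by simpa using n1) (by simpa using n2) (by simpa using n1) (by rw [← hcy]; abel)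
      rcases m1 with m1 | ⟨m1, -⟩ | ⟨m1, -⟩ | ⟨m1, m1'⟩
      · exact absurd m1 (by simpa only [smul_eq_zero_iff_eq])
      · have m2 := h.wt_match hd.1 a2 a0 a1 (wt0 hy) (wt1 hw) (wt2 hw')
          (by rw [show s + 0 - (s + 2) = -2 by ring, dvd_neg]; exact n2)
          (by rw [show s + 1 - (s + 2) = -1 by ring, dvd_neg]; exact n1)
          (by simpa using n1) (by simpa using n2) (by simpa using n1) (by rw [← hcy]; abel)
        rcases m2 with m2 | ⟨m2, -⟩ | ⟨-, m2⟩ | ⟨m2, -⟩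
        · exact absurd m2 (by simpa only [smul_eq_zero_iff_eq])
        · exact absurd (dvd_sub m1 m2) (by ring_nf; exact n1)
        · exact absurd m2 (o2 c hc)
        · rwa [show (2 : ℤ) - (s + 2) = -s by ring, dvd_neg] at m2
      · rwa [show (1 : ℤ) - (s + 1) = -s by ring, dvd_neg] at m1
      · exact absurd m1' (o1 c hc)
    have hdc := shift c hc s hs hs0
    have a0' := a0.congr h (j := 0) (by simpa using hs0)
    have a1' := a1.congr h (j := 1) (by simpa using hs0)
    have a2' := a2.congr h (j := 2) (by simpa using hs0)
    have e1 : c • b • w = b • w := by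
      have m1 := h.wt_match hd.1 a1' a0' a2' (wt0 hy) (wt1 hw) (wt2 hw')
        (by simpa using n1) (by simpa using n1)
        (by simpa using n1) (by simpa using n2) (by simpa using n1) (by rw [← hcy]; abel)
      rcases m1 with m1 | ⟨m1, -⟩ | ⟨-, m1⟩ | ⟨m1, -⟩
      · exact absurd m1 (by simpa only [smul_eq_zero_iff_eq])
      · exact absurd m1 (by simpa using n1)
      · exact m1
      · exact absurd m1 (by simpa using n1)
    have e0 : c • y = y := by
      have m1 := h.wt_match hd.1 a0' a1' a2' (wt0 hy) (wt1 hw) (wt2 hw')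
        (by simpa using n1) (by simpa using n2)
        (by simpa using n1) (by simpa using n2) (by simpa using n1) (by rw [← hcy])
      rcases m1 with m1 | ⟨-, m1⟩ | ⟨m1, -⟩ | ⟨m1, -⟩
      · exact absurd m1 (by simpa only [smul_eq_zero_iff_eq])
      · exact m1
      · exact absurd m1 (by simpa using n1)
      · exact absurd m1 (by simpa using n2)
    obtain ⟨t, ht, ht'⟩ := regw c hc hdc e1
    have hζt := ht0 t hy0 (by have := ht' y hy; rwa [e0] at this)
    rw [hζt, one_mul] at ht
    simp only [hζt, one_smul] at ht'
    exact fin c hc ht' ht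
  have reg2 : IsRegOn B U (b • w + b • b • w') := by
    intro c hc hcy
    obtain ⟨s, hs⟩ := hcom c hc
    have z : Wt ζ d 0 (0 : V) := by simp [Wt]
    have z' : Wt ζ d (s + 0) (0 : V) := by simp [Wt]
    have a1 := Wt.smul h hc.1 hs (wt1 hw)
    have a2 := Wt.smul h hc.1 hs (wt2 hw')
    rw [smul_add] at hcy
    have hs0 : (r : ℤ) ∣ s ∧ c • b • w = b • w := by
      have m1 := h.wt_match hd.1 a1 z' a2 z (wt1 hw) (wt2 hw')
        (by rw [show s + 0 - (s + 1) = -1 by ring, dvd_neg]; exact n1)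
        (by rw [show s + 2 - (s + 1) = 1 by ring]; exact n1)
        (by simpa using n1) (by simpa using n2) (by simpa using n1)
        (by rw [add_zero, hcy, zero_add])
      rcases m1 with m1 | ⟨-, m1⟩ | ⟨m1, m1'⟩ | ⟨-, m1⟩
      · exact absurd m1 (by simpa only [smul_eq_zero_iff_eq])
      · exact absurd m1 (by simpa only [smul_eq_zero_iff_eq])
      · exact ⟨by rwa [show (1 : ℤ) - (s + 1) = -s by ring, dvd_neg] at m1, m1'⟩
      · exact absurd m1 (o1 c hc)
    have hdc := shift c hc s hs hs0.1
    have e1 := hs0.2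
    rw [e1, add_right_inj] at hcy
    obtain ⟨t, ht, ht'⟩ := regw c hc hdc e1
    have h2 : ζ ^ t • w' = w' := by
      have h3 : c * (b * b) = ζ ^ t * (b * (b * (ζ ^ t * c))) := by
        rw [← mul_assoc c, ht, ← mul_assoc b (ζ ^ t), ((h.cent b hb.1).zpow_right t).eq, mul_assoc,
          mul_assoc b c b, ht, ← mul_assoc b (ζ ^ t), ((h.cent b hb.1).zpow_right t).eq]
        simp only [mul_assoc]
        rw [← mul_assoc b (ζ ^ t), ((h.cent b hb.1).zpow_right t).eq, mul_assoc]
      rw [← mul_smul b b, ← mul_smul, h3, mul_smul, mul_smul, mul_smul, mul_smul, ht' w' hw',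
        ← mul_smul b b, ← mul_smul, ← ((h.cent _ (B.mul_mem hb.1 hb.1)).zpow_right t).eq,
        mul_smul, mul_smul, mul_smul, smul_left_cancel_iff, smul_left_cancel_iff] at hcy
      exact hcy
    have hζt := ht0 t hw'0 h2
    rw [hζt, one_mul] at ht
    simp only [hζt, one_smul] at ht'
    exact fin c hc ht' ht
  refine ⟨y + b • w + b • b • w', U.add_mem (U.add_mem hy.1 hw1U) hw2U, x, hx.1,
    y + b • w + b • b • w', U.add_mem (U.add_mem hy.1 hw1U) hw2U, b • w + b • b • w',
    U.add_mem hw1U hw2U, hx0, ?_, ?_, ?_, reg1, reg1, reg2, ?_⟩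
  · intro h0
    have := reg1 ζ ⟨h.mem, hζ⟩ (by rw [h0, smul_zero]) x hx.1
    exact hx0 (h.fixed x this)
  · intro h0
    have := reg2 ζ ⟨h.mem, hζ⟩ (by rw [h0, smul_zero]) x hx.1
    exact hx0 (h.fixed x this)
  · intro g hg hgy hgx
    obtain ⟨κ, hκ, hwt⟩ := h.exists_wt_mul hζ hd hb hdb hx hx0 hxr hg hgx
    have a0 := hwt 0 y hy.1 (wt0 hy)
    have a1 := hwt 1 _ hw1U (wt1 hw)
    have a2 := hwt 2 _ hw2U (wt2 hw')
    rw [zero_mul] at a0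
    rw [one_mul] at a1
    rw [smul_add, smul_add] at hgy
    have n2κ : ¬ (r : ℤ) ∣ 2 * κ := hr.not_dvd_mul n2 hκ
    have e0 : g • y = y := by
      have m1 := h.wt_match hd.1 a0 a1 a2 (wt0 hy) (wt1 hw) (wt2 hw')
        (by simpa using hκ) (by simpa using n2κ)
        (by simpa using n1) (by simpa using n2) (by simpa using n1) (by rw [← hgy])
      rcases m1 with m1 | ⟨-, m1⟩ | ⟨m1, -⟩ | ⟨m1, -⟩
      · exact absurd m1 (by simpa only [smul_eq_zero_iff_eq])
      · exact m1
      · exact absurd m1 (by simpa using n1)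
      · exact absurd m1 (by simpa using n2)
    have hginv : g⁻¹ • x = x := inv_smul_eq_self_of hgx
    obtain ⟨κ', -, hwt'⟩ := h.exists_wt_mul hζ hd hb hdb hx hx0 hxr (Subgroup.inv_mem _ hg) hginv
    have hgV : g ∈ (fixedIn U d).setStab G := by
      intro v
      rw [mem_fixedIn_iff_wt (ζ := ζ), mem_fixedIn_iff_wt (ζ := ζ), hg v]
      refine and_congr_right fun hv => ⟨fun hv' => ?_, fun hv' => ?_⟩
      · have := hwt' 0 _ (AddSubgroup.smul_mem_of_mem_setStab hg hv) hv'
        rwa [zero_mul, inv_smul_smul] at this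
      · have := hwt 0 _ hv hv'
        rwa [zero_mul] at this
    have gtriv := hbase g hgV hgx e0
    have hb'B : g * b * g⁻¹ ∈ B ⊓ U.setStab G :=
      ⟨h.normal g b hb.1, Subgroup.mul_mem _ (Subgroup.mul_mem _ hg hb.2) (Subgroup.inv_mem _ hg)⟩
    set b' := g * b * g⁻¹ with hb'
    have hb'w : ∀ v ∈ fixedIn U d, g • b • v = b' • v := fun v hv => by
      rw [hb', mul_smul, mul_smul, inv_smul_eq_self_of (gtriv v hv)]
    have hκ1 : (r : ℤ) ∣ 1 - κ ∧ g • b • w = b • w := by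
      have m1 := h.wt_match hd.1 a1 a0 a2 (wt0 hy) (wt1 hw) (wt2 hw')
        (by simpa using hκ) (by rw [show 2 * κ - κ = κ by ring]; exact hκ)
        (by simpa using n1) (by simpa using n2) (by simpa using n1) (by rw [← hgy]; abel)
      rcases m1 with m1 | ⟨m1, -⟩ | m1 | ⟨-, m1⟩
      · exact absurd m1 (by simpa only [smul_eq_zero_iff_eq])
      · exact absurd m1 (by simpa using hκ)
      · exact m1
      · rw [hb'w w hw] at m1
        exact absurd (by rw [mul_smul, mul_smul, m1, inv_smul_smul, inv_smul_smul])
          (orb (b⁻¹ * (b⁻¹ * b')) (mul_mem (inv_mem hb) (mul_mem (inv_mem hb) hb'B)))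
    have e2 : g • b • b • w' = b • b • w' := by
      have m1 := h.wt_match hd.1 a2 a0 a1 (wt0 hy) (wt1 hw) (wt2 hw')
        (by simpa using n2κ) (by rw [show κ - 2 * κ = -κ by ring, dvd_neg]; exact hκ)
        (by simpa using n1) (by simpa using n2) (by simpa using n1) (by rw [← hgy]; abel)
      rcases m1 with m1 | ⟨m1, -⟩ | ⟨m1, -⟩ | ⟨-, m1⟩
      · exact absurd m1 (by simpa only [smul_eq_zero_iff_eq])
      · exact absurd m1 (by simpa using n2κ)
      · refine absurd (dvd_sub m1 hκ1.1) ?_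
        rw [show 1 - 2 * κ - (1 - κ) = -κ by ring, dvd_neg]; exact hκ
      · exact m1
    have hcB : b⁻¹ * b' ∈ B ⊓ U.setStab G := mul_mem (inv_mem hb) hb'B
    set c := b⁻¹ * b' with hc
    have hcw : c • w = w := by rw [hc, mul_smul, ← hb'w w hw, hκ1.2, inv_smul_smul]
    have hdc := h.commute_of_smul_mem hd hcB hw hw0 (by rwa [hcw])
    have hctriv := hwr c (mem_stab_of_commute hcB hdc) hcw
    have hbc : b' = b * c := by rw [hc]; group
    obtain ⟨t, ht⟩ := h.comm c hcB.1 b hb.1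
    have hgb : ∀ k : ℕ, ∀ u ∈ fixedIn U d, g • b ^ k • u = b' ^ k • u := fun k u hu => by
      rw [hb', conj_pow, mul_smul, mul_smul, inv_smul_eq_self_of (gtriv u hu)]
    have h3 : ζ ^ t • w' = w' := by
      have h4 := hgb 2 w' hw'
      rw [pow_two, mul_smul, e2, pow_two, hbc, show b * c * (b * c) = b * (c * b) * c by group, ht,
        ← mul_assoc b, ((h.cent b hb.1).zpow_right t).eq, mul_assoc, mul_assoc, mul_assoc,
        mul_smul, mul_smul, mul_smul, mul_smul, hctriv w' hw', hctriv w' hw', ← mul_smul b b,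
        ← mul_smul, ← ((h.cent _ (B.mul_mem hb.1 hb.1)).zpow_right t).eq,
        mul_smul, mul_smul, mul_smul, smul_left_cancel_iff, smul_left_cancel_iff] at h4
      exact h4.symm
    rw [ht0 t hw'0 h3, one_mul] at ht
    refine h.smul_eq_of_forall_pow hζ hd hb hdb fun k u hu => ?_
    rw [hgb k u hu, hbc, (Commute.symm ht).mul_pow, mul_smul, pow_smul_eq_self_of (hctriv u hu)]
  · intro c hc hcy
    obtain ⟨s, hs⟩ := hcom c hc
    have z : Wt ζ d 0 (0 : V) := by simp [Wt]
    have a0 := Wt.smul h hc.1 hs (wt0 hy)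
    have a1 := Wt.smul h hc.1 hs (wt1 hw)
    have a2 := Wt.smul h hc.1 hs (wt2 hw')
    rw [smul_add, smul_add] at hcy
    have m0 := h.wt_match hd.1 a0 a1 a2 z (wt1 hw) (wt2 hw')
      (by rw [show s + 1 - (s + 0) = 1 by ring]; exact n1)
      (by rw [show s + 2 - (s + 0) = 2 by ring]; exact n2)
      (by simpa using n1) (by simpa using n2) (by simpa using n1)
      (by rw [hcy, zero_add])
    have m1 := h.wt_match hd.1 a1 a0 a2 z (wt1 hw) (wt2 hw')
      (by rw [show s + 0 - (s + 1) = -1 by ring, dvd_neg]; exact n1)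
      (by rw [show s + 2 - (s + 1) = 1 by ring]; exact n1)
      (by simpa using n1) (by simpa using n2) (by simpa using n1)
      (by rw [zero_add, ← hcy]; abel)
    rcases m1 with m1 | ⟨-, m1⟩ | ⟨m1, -⟩ | ⟨-, m1⟩
    · exact absurd m1 (by simpa only [smul_eq_zero_iff_eq])
    · exact absurd m1 (by simpa only [smul_eq_zero_iff_eq])
    · rcases m0 with m0 | ⟨-, m0⟩ | ⟨m0, -⟩ | ⟨m0, -⟩
      · exact absurd m0 (by simpa only [smul_eq_zero_iff_eq])
      · exact absurd m0 (by simpa only [smul_eq_zero_iff_eq])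
      · exact absurd (dvd_sub m0 m1) (by ring_nf; exact n1)
      · exact absurd (dvd_sub m0 m1) (by ring_nf; exact n2)
    · exact absurd m1 (o1 c hc)

end OddHeisenberg

namespace OddHeisenberg

variable {p r : ℕ} {G V : Type*} [Group G] [AddCommGroup V] [DistribMulAction G V]
  {B : Subgroup G} {ζ : G}

theorem good_of_isIrredOn [Finite V] (h : OddHeisenberg p r V B ζ) (U : AddSubgroup V)
    (hζ : ζ ∈ U.setStab G) (hirr : IsIrredOn (B ⊓ U.setStab G) U) : Good B U := by
  induction hn : Nat.card U using Nat.strong_induction_on generalizing U with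
  | _ n ih =>
  by_cases hab : ∀ a ∈ B ⊓ U.setStab G, ∀ b ∈ B ⊓ U.setStab G, a * b = b * a
  · exact h.good_of_abelian hζ hirr hab
  push Not at hab
  obtain ⟨d, hd, c, hc, hne⟩ := hab
  have hr : Prime (r : ℤ) := Nat.prime_iff_prime_int.1 h.rprime
  obtain ⟨b, hb, hdb⟩ : ∃ b ∈ B ⊓ U.setStab G, d * b = ζ * (b * d) := by
    obtain ⟨m, hm⟩ := h.comm d hd.1 c hc.1
    have hm0 : ¬ (r : ℤ) ∣ m := fun hm0 => hne (by rw [hm, h.zpow_eq_one hm0, one_mul])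
    obtain ⟨t, e, hte⟩ := hr.irreducible.coprime_iff_not_dvd.2 hm0
    refine ⟨c ^ e, zpow_mem hc e, ?_⟩
    have h1 : d * c * d⁻¹ = ζ ^ m * c := by rw [hm]; group
    have h2 : d * c ^ e * d⁻¹ = ζ * c ^ e := by
      rw [← _root_.conj_zpow, h1, ((h.cent c hc.1).zpow_right m).symm.mul_zpow, ← zpow_mul,
        show m * e = 1 - t * r by rw [← hte]; ring, zpow_sub, zpow_one,
        h.zpow_eq_one (Dvd.intro_left t rfl), inv_one, mul_one]
    rw [← mul_assoc, ← h2]; group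
  obtain ⟨x, hx, hx0⟩ := (U.bot_or_exists_ne_zero).resolve_left hirr.1
  obtain ⟨k, -, hk⟩ : ∃ k ∈ Finset.range r, orbSum r (ζ ^ (-(k : ℤ)) * d) x ≠ 0 := by
    by_contra! hcon
    have := h.sum_orbSum hd.1 x
    rw [Finset.sum_eq_zero hcon] at this
    exact hx0 (eq_zero_of_coprime_nsmul h.prime h.not_dvd (h.nsmul x) this.symm)
  set e := ζ ^ (-(k : ℤ)) * d with he
  have heB : e ∈ B ⊓ U.setStab G := mul_mem (zpow_mem (Subgroup.mem_inf.2 ⟨h.mem, hζ⟩) _) hd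
  have heb : e * b = ζ * (b * e) := by
    rw [he, mul_assoc, hdb, ← mul_assoc b, ((h.cent b hb.1).zpow_right _).eq, ← mul_assoc,
      ← mul_assoc, ← ((Commute.refl ζ).zpow_right _).eq]
    simp only [mul_assoc]
  have hu : orbSum r e x ∈ fixedIn U e :=
    ⟨orbSum_mem heB.2 hx, smul_orbSum (h.exp _ heB.1) x⟩
  have hbot : fixedIn U e ≠ ⊥ := fun h0 => hk (by rw [h0] at hu; exact hu)
  refine h.good_step hζ heB hb heb (ih _ ?_ _ (h.zeta_mem_stab_fixedIn hζ heB)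
    (h.isIrredOn_fixedIn hirr heB hb heb hbot) rfl)
  rw [← hn]
  apply Set.ncard_lt_ncard (s := (fixedIn U e : Set V)) (t := (U : Set V)) _ (Set.toFinite _)
  refine ⟨fun v hv => hv.1, fun hle => ?_⟩
  have h1 := (hle (AddSubgroup.smul_mem_of_mem_setStab hb.2 hu.1)).2
  rw [← mul_smul, heb, mul_smul, mul_smul, hu.2] at h1
  exact hk ((smul_eq_zero_iff_eq b).1 (h.fixed _ h1))

theorem hasBase [Finite V] (h : OddHeisenberg p r V B ζ) (hirr : IsIrredOn B (⊤ : AddSubgroup V)) :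
    HasBase G V := by
  have h1 : B ⊓ (⊤ : AddSubgroup V).setStab G = B := by rw [AddSubgroup.setStab_top, inf_top_eq]
  obtain ⟨x, -, y, -, -, -, -, -, -, -, -, hbase, -⟩ := h.good_of_isIrredOn ⊤
    (by rw [AddSubgroup.setStab_top]; trivial) (by rwa [h1])
  exact ⟨x, y, fun g hx hy v => hbase g (by rw [AddSubgroup.setStab_top]; trivial) hx hy v trivial⟩

end OddHeisenberg

/-- A normal subgroup `B` of `G` whose squares and commutators lie in `{1, z}`, where `z` acts as
negation. -/
structure EvenHeisenberg (p : ℕ) {G : Type*} (V : Type*) [Group G] [AddCommGroup V]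
    [DistribMulAction G V] (B : Subgroup G) (z : G) : Prop where
  prime : p.Prime
  odd : p ≠ 2
  nsmul : ∀ v : V, p • v = 0
  not_dvd : ¬ p ∣ Nat.card G
  normal : ∀ g b : G, b ∈ B → g * b * g⁻¹ ∈ B
  mem : z ∈ B
  neg : ∀ v : V, z • v = -v
  mul_self : z * z = 1
  cent : ∀ g : G, g * z = z * g
  comm : ∀ a ∈ B, ∀ b ∈ B, a * b = b * a ∨ a * b = z * (b * a)
  sq : ∀ b ∈ B, b * b = 1 ∨ b * b = z

namespace EvenHeisenberg

variable {p : ℕ} {G V : Type*} [Group G] [AddCommGroup V] [DistribMulAction G V]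
  {B : Subgroup G} {z : G} {U : AddSubgroup V} {b c d : G}

/-- The inductive statement: a base starting with a regular vector and a regular vector outside
the orbit of the second base vector. -/
def Good (B : Subgroup G) (U : AddSubgroup V) : Prop :=
  ∃ x ∈ U, ∃ y ∈ U, ∃ w ∈ U, y ≠ 0 ∧ w ≠ 0 ∧ IsBaseOn (U.setStab G) U x y ∧
    IsRegOn B U x ∧ IsRegOn B U w ∧ ∀ b ∈ B ⊓ U.setStab G, b • y ≠ w

theorem eq_zero_of_two (h : EvenHeisenberg p V B z) {v : V} (hv : (2 : ℕ) • v = 0) : v = 0 :=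
  eq_zero_of_coprime_nsmul h.prime
    (fun h' => h.odd ((Nat.prime_dvd_prime_iff_eq h.prime Nat.prime_two).1 h')) (h.nsmul v) hv

theorem eq_zero_of_neg (h : EvenHeisenberg p V B z) {v : V} (hv : v = -v) : v = 0 :=
  h.eq_zero_of_two (by rw [two_nsmul]; nth_rewrite 1 [hv]; abel)

theorem exists_half (h : EvenHeisenberg p V B z) {v : V} (hv : v ∈ U) : ∃ w ∈ U, w + w = v := by
  obtain ⟨k, hk⟩ := h.prime.odd_of_ne_two h.odd
  refine ⟨(k + 1) • v, U.nsmul_mem hv _, ?_⟩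
  have := h.nsmul v
  rw [hk] at this
  rw [← add_nsmul, show k + 1 + (k + 1) = 2 * k + 1 + 1 by ring, add_nsmul, this, zero_add,
    one_nsmul]

theorem neg_mem_stab (h : EvenHeisenberg p V B z) : z ∈ B ⊓ U.setStab G :=
  ⟨h.mem, fun v => by rw [h.neg, neg_mem_iff]⟩

/-- Elements of `B` map eigenvectors to eigenvectors. -/
theorem smul_smul_eq (h : EvenHeisenberg p V B z) (hd : d ∈ B) (hc : c ∈ B) (v : V) :
    (d * c = c * d ∧ d • c • v = c • d • v) ∨ (d * c = z * (c * d) ∧ d • c • v = -(c • d • v)) := by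
  rcases h.comm d hd c hc with h1 | h1
  · exact Or.inl ⟨h1, by rw [← mul_smul, h1, mul_smul]⟩
  · exact Or.inr ⟨h1, by rw [← mul_smul, h1, mul_smul, h.neg, mul_smul]⟩

theorem anti_smul (h : EvenHeisenberg p V B z) (hdc : d * c = z * (c * d)) (v : V) :
    d • c • v = -(c • d • v) := by
  rw [← mul_smul, hdc, mul_smul, h.neg, mul_smul]

theorem anti_symm (h : EvenHeisenberg p V B z) (hdc : d * c = z * (c * d)) :
    c * d = z * (d * c) := by
  rw [hdc, ← mul_assoc, h.mul_self, one_mul]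

theorem commute_of_smul_eq (h : EvenHeisenberg p V B z) (hd : d ∈ B) (hc : c ∈ B) {v : V}
    (hv : d • v = v) (hv0 : v ≠ 0) (hcv : d • c • v = c • v) : d * c = c * d := by
  rcases h.smul_smul_eq hd hc v with ⟨h1, -⟩ | ⟨-, h1⟩
  · exact h1
  · rw [hv, hcv] at h1
    exact absurd ((smul_eq_zero_iff_eq c).1 (h.eq_zero_of_neg h1)) hv0

theorem mem_stab_of_commute (hc : c ∈ B ⊓ U.setStab G) (hcd : d * c = c * d) :
    c ∈ B ⊓ (fixedIn U d).setStab G := by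
  refine ⟨hc.1, fun v => ?_⟩
  rw [mem_fixedIn, mem_fixedIn, hc.2 v, ← mul_smul, hcd, mul_smul, smul_left_cancel_iff]

/-- Uniqueness of the decomposition into eigenvectors of `d`. -/
theorem eq_of_add_eq (h : EvenHeisenberg p V B z) {a₀ a₁ b₀ b₁ : V} (ha₀ : d • a₀ = a₀)
    (ha₁ : d • a₁ = -a₁) (hb₀ : d • b₀ = b₀) (hb₁ : d • b₁ = -b₁) (hab : a₀ + a₁ = b₀ + b₁) :
    a₀ = b₀ ∧ a₁ = b₁ := by
  have h1 := congrArg (d • ·) hab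
  simp only [smul_add, ha₀, ha₁, hb₀, hb₁] at h1
  have h2 : a₀ - b₀ = 0 := by
    refine h.eq_zero_of_two ?_
    rw [two_nsmul]
    have : a₀ - b₀ + (a₀ - b₀) = (a₀ + a₁ - (b₀ + b₁)) + (a₀ + -a₁ - (b₀ + -b₁)) := by abel
    rw [this, hab, h1, sub_self, sub_self, add_zero]
  have h3 := sub_eq_zero.1 h2
  refine ⟨h3, ?_⟩
  rwa [h3, add_right_inj] at hab

theorem exists_add (h : EvenHeisenberg p V B z) (hd : d ∈ B ⊓ U.setStab G) (hd2 : d * d = 1)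
    {v : V} (hv : v ∈ U) : ∃ v₀ ∈ U, ∃ v₁ ∈ U, d • v₀ = v₀ ∧ d • v₁ = -v₁ ∧ v = v₀ + v₁ := by
  obtain ⟨w, hw, rfl⟩ := h.exists_half hv
  have hdw := AddSubgroup.smul_mem_of_mem_setStab hd.2 hw
  have hdd : d • d • w = w := by rw [← mul_smul, hd2, one_smul]
  refine ⟨w + d • w, U.add_mem hw hdw, w - d • w, U.sub_mem hw hdw, ?_, ?_, by abel⟩
  · rw [smul_add, hdd, add_comm]
  · rw [smul_sub, hdd, neg_sub]

theorem anti_inv_smul (h : EvenHeisenberg p V B z) (hdb : d * b = z * (b * d)) {v : V}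
    (hv : d • v = -v) : d • b⁻¹ • v = b⁻¹ • v := by
  have h1 := h.anti_smul hdb (b⁻¹ • v)
  rw [smul_inv_smul, hv, neg_inj] at h1
  rw [eq_inv_smul_iff]; exact h1.symm

theorem smul_eq_of_fixedIn (h : EvenHeisenberg p V B z)
    (hd : d ∈ B ⊓ U.setStab G) (hd2 : d * d = 1) (hb : b ∈ B ⊓ U.setStab G)
    (hdb : d * b = z * (b * d)) {g : G} (h0 : ∀ v ∈ fixedIn U d, g • v = v)
    (h1 : ∀ v ∈ fixedIn U d, g • b • v = b • v) : ∀ v ∈ U, g • v = v := by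
  intro v hv
  obtain ⟨v₀, hv₀, v₁, hv₁, e₀, e₁, rfl⟩ := h.exists_add hd hd2 hv
  have h2 := h1 (b⁻¹ • v₁)
    ⟨AddSubgroup.smul_mem_of_mem_setStab (inv_mem hb.2) hv₁, h.anti_inv_smul hdb e₁⟩
  rw [smul_inv_smul] at h2
  rw [smul_add, h0 _ ⟨hv₀, e₀⟩, h2]

theorem fixedIn_irred (h : EvenHeisenberg p V B z) (hirr : IsIrredOn (B ⊓ U.setStab G) U)
    (hd : d ∈ B ⊓ U.setStab G) (hd2 : d * d = 1) (hb : b ∈ B ⊓ U.setStab G)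
    (hdb : d * b = z * (b * d)) :
    IsIrredOn (B ⊓ (fixedIn U d).setStab G) (fixedIn U d) := by
  obtain ⟨x, hx, hx0⟩ := (U.bot_or_exists_ne_zero).resolve_left hirr.1
  have hne : fixedIn U d ≠ ⊥ := by
    intro hbot
    obtain ⟨v₀, hv₀, v₁, hv₁, e₀, e₁, rfl⟩ := h.exists_add hd hd2 hx
    have k0 : v₀ ∈ fixedIn U d := ⟨hv₀, e₀⟩
    have k1 : b⁻¹ • v₁ ∈ fixedIn U d :=
      ⟨AddSubgroup.smul_mem_of_mem_setStab (inv_mem hb.2) hv₁, h.anti_inv_smul hdb e₁⟩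
    rw [hbot, AddSubgroup.mem_bot] at k0 k1
    rw [smul_eq_zero_iff_eq] at k1
    exact hx0 (by rw [k0, k1, add_zero])
  refine ⟨hne, fun W hW hst => ?_⟩
  by_cases hW0 : W = ⊥
  · exact Or.inl hW0
  right
  obtain ⟨w, hw, hw0⟩ := (W.bot_or_exists_ne_zero).resolve_left hW0
  -- the span of the translates of `W`
  let X : AddSubgroup V := AddSubgroup.closure {v | ∃ c ∈ B ⊓ U.setStab G, ∃ w ∈ W, v = c • w}
  have hXU : X ≤ U := by
    rw [AddSubgroup.closure_le]
    rintro v ⟨c, hc, w, hw, rfl⟩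
    exact AddSubgroup.smul_mem_of_mem_setStab hc.2 (hW hw).1
  have hX : X = U := by
    refine (hirr.2 X hXU fun c hc v hv => ?_).resolve_left fun hbot => ?_
    · induction hv using AddSubgroup.closure_induction with
      | mem v hv =>
        obtain ⟨c', hc', w, hw, rfl⟩ := hv
        exact AddSubgroup.subset_closure ⟨c * c', mul_mem hc hc', w, hw, (mul_smul _ _ _).symm⟩
      | zero => rw [smul_zero]; exact X.zero_mem
      | add a b _ _ ha hb => rw [smul_add]; exact X.add_mem ha hb
      | neg a _ ha => rw [smul_neg]; exact X.neg_mem ha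
    · have : w ∈ X := AddSubgroup.subset_closure ⟨1, one_mem _, w, hw, (one_smul _ _).symm⟩
      rw [hbot] at this
      exact hw0 this
  have key : ∀ v ∈ X, v + d • v ∈ W := by
    intro v hv
    induction hv using AddSubgroup.closure_induction with
    | mem v hv =>
      obtain ⟨c, hc, w, hw, rfl⟩ := hv
      rcases h.smul_smul_eq hd.1 hc.1 w with ⟨h1, h2⟩ | ⟨h1, h2⟩
      · rw [h2, (hW hw).2]
        have := hst c (mem_stab_of_commute hc h1) w hw
        exact W.add_mem this this
      · rw [h2, (hW hw).2, add_neg_cancel]; exact W.zero_mem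
    | zero => rw [smul_zero, add_zero]; exact W.zero_mem
    | add a b _ _ ha hb =>
      rw [smul_add, show a + b + (d • a + d • b) = a + d • a + (b + d • b) by abel]
      exact W.add_mem ha hb
    | neg a _ ha => rw [smul_neg, ← neg_add]; exact W.neg_mem ha
  refine le_antisymm hW fun v hv => ?_
  obtain ⟨w, hw, hwv⟩ := h.exists_half hv
  have := key w (by rw [hX]; exact hw.1)
  rwa [hw.2, hwv] at this

/-- Elements fixing a regular vector of the fixed space of `d` commute with `d` on `U`. -/
theorem conj_smul_eq (h : EvenHeisenberg p V B z)
    (hd : d ∈ B ⊓ U.setStab G) (hd2 : d * d = 1) (hb : b ∈ B ⊓ U.setStab G)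
    (hdb : d * b = z * (b * d)) {x : V} (hx : x ∈ fixedIn U d) (hx0 : x ≠ 0)
    (hreg : IsRegOn B (fixedIn U d) x) {g : G} (hg : g ∈ U.setStab G) (hgx : g • x = x) :
    ∀ v ∈ U, g • d • v = d • g • v := by
  set d' := g * d * g⁻¹ with hd'
  have hd'B : d' ∈ B ⊓ U.setStab G :=
    ⟨h.normal g d hd.1, Subgroup.mul_mem _ (Subgroup.mul_mem _ hg hd.2) (Subgroup.inv_mem _ hg)⟩
  have hd'x : d' • x = x := by
    rw [hd', mul_smul, mul_smul, inv_smul_eq_self_of hgx, hx.2, hgx]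
  have hcomm := h.commute_of_smul_eq hd.1 hd'B.1 hx.2 hx0 (by rw [hd'x, hx.2])
  have htriv := hreg d' (mem_stab_of_commute hd'B hcomm) hd'x
  have hconj : ∀ v : V, d' • g • v = g • d • v := fun v => by
    rw [hd', mul_smul, mul_smul, inv_smul_smul]
  rcases h.comm d' hd'B.1 b hb.1 with h1 | h1
  · exfalso
    have h2 := h.smul_eq_of_fixedIn hd hd2 hb hdb htriv fun v hv => by
      rw [← mul_smul, h1, mul_smul, htriv v hv]
    have h3 : b • x ∈ U := AddSubgroup.smul_mem_of_mem_setStab hb.2 hx.1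
    have h4 := h2 _ (AddSubgroup.smul_mem_of_mem_setStab hg h3)
    rw [hconj, smul_left_cancel_iff, h.anti_smul hdb, hx.2] at h4
    exact hx0 ((smul_eq_zero_iff_eq b).1 (h.eq_zero_of_neg h4.symm))
  · have h2 : ∀ v ∈ U, (d⁻¹ * d') • v = v := by
      refine h.smul_eq_of_fixedIn hd hd2 hb hdb (fun v hv => ?_) fun v hv => ?_
      · rw [mul_smul, htriv v hv, inv_smul_eq_self_of hv.2]
      · rw [mul_smul, h.anti_smul h1, htriv v hv, inv_smul_eq_iff, h.anti_smul hdb, hv.2]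
    intro v hv
    have := h2 _ (AddSubgroup.smul_mem_of_mem_setStab hg hv)
    rw [mul_smul, inv_smul_eq_iff, hconj] at this
    exact this

/-- An element trivial on the fixed space of `d` and fixing a translate of a regular vector is
trivial. -/
theorem smul_eq_of_base (h : EvenHeisenberg p V B z)
    (hd : d ∈ B ⊓ U.setStab G) (hd2 : d * d = 1) (hb : b ∈ B ⊓ U.setStab G)
    (hdb : d * b = z * (b * d)) {x y w : V} (hx : x ∈ fixedIn U d) (hx0 : x ≠ 0)
    (hy : y ∈ fixedIn U d) (hw : w ∈ fixedIn U d) (hw0 : w ≠ 0)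
    (hxr : IsRegOn B (fixedIn U d) x) (hwr : IsRegOn B (fixedIn U d) w)
    (hbase : IsBaseOn ((fixedIn U d).setStab G) (fixedIn U d) x y) :
    IsBaseOn (U.setStab G) U x (y + b • w) := by
  intro g hg hgx hgy
  have hc := h.conj_smul_eq hd hd2 hb hdb hx hx0 hxr hg hgx
  have hgV : g ∈ (fixedIn U d).setStab G := fun v => by
    rw [mem_fixedIn, mem_fixedIn, hg v]
    exact and_congr_right fun hv => by rw [← hc v hv, smul_left_cancel_iff]
  have hbw : d • b • w = -(b • w) := by rw [h.anti_smul hdb, hw.2]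
  have hbwU : b • w ∈ U := AddSubgroup.smul_mem_of_mem_setStab hb.2 hw.1
  rw [smul_add] at hgy
  obtain ⟨e0, e1⟩ := h.eq_of_add_eq (by rw [← hc y hy.1, hy.2])
    (by rw [← hc _ hbwU, hbw, smul_neg]) hy.2 hbw hgy
  have gtriv := hbase g hgV hgx e0
  set b' := g * b * g⁻¹ with hb'
  have hb'B : b' ∈ B ⊓ U.setStab G :=
    ⟨h.normal g b hb.1, Subgroup.mul_mem _ (Subgroup.mul_mem _ hg hb.2) (Subgroup.inv_mem _ hg)⟩
  have hb'w : ∀ v ∈ fixedIn U d, g • b • v = b' • v := fun v hv => by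
    rw [hb', mul_smul, mul_smul, inv_smul_eq_self_of (gtriv v hv)]
  have hcB : b⁻¹ * b' ∈ B ⊓ U.setStab G := mul_mem (inv_mem hb) hb'B
  have hcw : (b⁻¹ * b') • w = w := by rw [mul_smul, ← hb'w w hw, e1, inv_smul_smul]
  have hdc := h.commute_of_smul_eq hd.1 hcB.1 hw.2 hw0 (by rw [hcw, hw.2])
  have hctriv := hwr _ (mem_stab_of_commute hcB hdc) hcw
  refine h.smul_eq_of_fixedIn hd hd2 hb hdb gtriv fun v hv => ?_
  have := hctriv v hv
  rwa [mul_smul, inv_smul_eq_iff, ← hb'w v hv] at this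

theorem good_step (h : EvenHeisenberg p V B z)
    (hd : d ∈ B ⊓ U.setStab G) (hd2 : d * d = 1) (hb : b ∈ B ⊓ U.setStab G)
    (hdb : d * b = z * (b * d)) (hgood : Good B (fixedIn U d)) : Good B U := by
  obtain ⟨x, hx, y, hy, w, hw, hy0, hw0, hbase, hxr, hwr, hne⟩ := hgood
  have hx0 : x ≠ 0 := by
    rintro rfl
    have := hxr z h.neg_mem_stab (smul_zero _) y hy
    rw [h.neg] at this
    exact hy0 (h.eq_zero_of_neg this.symm)
  have hbw : d • b • w = -(b • w) := by rw [h.anti_smul hdb, hw.2]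
  have hbwU : b • w ∈ U := AddSubgroup.smul_mem_of_mem_setStab hb.2 hw.1
  have hbw0 : b • w ≠ 0 := by rwa [smul_ne_zero_iff_ne]
  have hreg : IsRegOn B U (y + b • w) := by
    intro c hc hcy
    rw [smul_add] at hcy
    rcases h.comm d hd.1 c hc.1 with hdc | hdc
    · obtain ⟨e0, e1⟩ := h.eq_of_add_eq (by rw [← mul_smul, hdc, mul_smul, hy.2])
        (by rw [← mul_smul, hdc, mul_smul, hbw, smul_neg]) hy.2 hbw hcy
      have hcV := mem_stab_of_commute hc hdc
      rcases h.comm c hc.1 b hb.1 with hcb | hcb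
      · rw [← mul_smul, hcb, mul_smul, smul_left_cancel_iff] at e1
        have := hwr c hcV e1
        exact h.smul_eq_of_fixedIn hd hd2 hb hdb this fun v hv => by
          rw [← mul_smul, hcb, mul_smul, this v hv]
      · exfalso
        rw [h.anti_smul hcb, ← smul_neg, smul_left_cancel_iff] at e1
        have := hwr (z * c) (mul_mem h.neg_mem_stab hcV) (by rw [mul_smul, h.neg, e1]) y hy
        rw [mul_smul, e0, h.neg] at this
        exact hy0 (h.eq_zero_of_neg this.symm)
    · exfalso
      have e := h.eq_of_add_eq (a₀ := c • b • w) (a₁ := c • y)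
        (by rw [h.anti_smul hdc, hbw, smul_neg, neg_neg])
        (by rw [h.anti_smul hdc, hy.2]) hy.2 hbw (by rw [← hcy, add_comm])
      have hcB : b⁻¹ * c ∈ B ⊓ U.setStab G := mul_mem (inv_mem hb) hc
      have hyw : (b⁻¹ * c) • y = w := by rw [mul_smul, e.2, inv_smul_smul]
      exact hne _ (mem_stab_of_commute hcB
        (h.commute_of_smul_eq hd.1 hcB.1 hy.2 hy0 (by rw [hyw, hw.2]))) hyw
  have hW0 : y + b • w ≠ 0 := by
    intro h0
    exact hy0 (h.eq_of_add_eq hy.2 hbw (b₀ := 0) (b₁ := 0) (smul_zero _) (by simp)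
      (by rw [h0, add_zero])).1
  refine ⟨y + b • w, U.add_mem hy.1 hbwU, x, hx.1, y + b • w, U.add_mem hy.1 hbwU, hx0, hW0,
    ?_, hreg, hreg, ?_⟩
  · have := h.smul_eq_of_base hd hd2 hb hdb hx hx0 hy hw hw0 hxr hwr hbase
    exact fun g hg h1 h2 => this g hg h2 h1
  · intro c hc hcx
    rcases h.smul_smul_eq hd.1 hc.1 x with ⟨-, h1⟩ | ⟨-, h1⟩
    · rw [hx.2] at h1
      exact hbw0 (h.eq_of_add_eq h1 (a₁ := 0) (by simp) hy.2 hbw (by rw [hcx, add_zero])).2.symm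
    · rw [hx.2] at h1
      exact hy0 (h.eq_of_add_eq (a₀ := 0) (smul_zero _) h1 hy.2 hbw (by rw [hcx, zero_add])).1.symm

end EvenHeisenberg

/-- The subgroup generated by two elements, in explicit form. -/
def spanTwo {V : Type*} [AddCommGroup V] (x a : V) : AddSubgroup V where
  carrier := {v | ∃ m n : ℤ, v = m • x + n • a}
  zero_mem' := ⟨0, 0, by simp⟩
  add_mem' := by
    rintro _ _ ⟨m, n, rfl⟩ ⟨m', n', rfl⟩
    exact ⟨m + m', n + n', by rw [add_zsmul, add_zsmul]; abel⟩
  neg_mem' := by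
    rintro _ ⟨m, n, rfl⟩
    exact ⟨-m, -n, by rw [neg_zsmul, neg_zsmul]; abel⟩

theorem left_mem_spanTwo {V : Type*} [AddCommGroup V] (x a : V) : x ∈ spanTwo x a :=
  ⟨1, 0, by simp⟩

theorem right_mem_spanTwo {V : Type*} [AddCommGroup V] (x a : V) : a ∈ spanTwo x a :=
  ⟨0, 1, by simp⟩

theorem spanTwo_le {V : Type*} [AddCommGroup V] {x a : V} {U : AddSubgroup V} (hx : x ∈ U)
    (ha : a ∈ U) : spanTwo x a ≤ U := by
  rintro _ ⟨m, n, rfl⟩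
  exact U.add_mem (U.zsmul_mem hx m) (U.zsmul_mem ha n)

theorem smul_mem_spanTwo {G V : Type*} [Group G] [AddCommGroup V] [DistribMulAction G V] {g : G}
    {x a : V} (hx : g • x ∈ spanTwo x a) (ha : g • a ∈ spanTwo x a) {v : V}
    (hv : v ∈ spanTwo x a) : g • v ∈ spanTwo x a := by
  obtain ⟨m, n, rfl⟩ := hv
  rw [smul_add, smul_zsmul_comm, smul_zsmul_comm]
  exact (spanTwo x a).add_mem ((spanTwo x a).zsmul_mem hx m) ((spanTwo x a).zsmul_mem ha n)

theorem smul_eq_of_mem_spanTwo {G V : Type*} [Group G] [AddCommGroup V] [DistribMulAction G V]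
    {g : G} {x a v : V} (hx : g • x = x) (ha : g • a = a) (hv : v ∈ spanTwo x a) : g • v = v := by
  obtain ⟨m, n, rfl⟩ := hv
  rw [smul_add, smul_zsmul_comm, smul_zsmul_comm, hx, ha]

namespace EvenHeisenberg

variable {p : ℕ} {G V : Type*} [Group G] [AddCommGroup V] [DistribMulAction G V]
  {B : Subgroup G} {z : G} {U : AddSubgroup V} {b c d : G}

/-- The exceptional configurations in characteristics `3` and `5`. -/
def IsSmall (p : ℕ) (B : Subgroup G) (U : AddSubgroup V) : Prop :=
  ∃ x ∈ U, ∃ a ∈ U, x ≠ 0 ∧ U ≤ spanTwo x a ∧ (∀ v ∈ U, v ≠ 0 → IsRegOn B U v) ∧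
    (p = 3 ∨ p = 5 ∧ a = 0 ∧ ∃ j ∈ B ⊓ U.setStab G, j • x = (2 : ℕ) • x)

theorem smul_eq_or_neg (h : EvenHeisenberg p V B z) (hirr : IsIrredOn (B ⊓ U.setStab G) U)
    (hc : c ∈ B ⊓ U.setStab G) (hc2 : c * c = 1)
    (hcc : ∀ b ∈ B ⊓ U.setStab G, c * b = b * c) :
    (∀ v ∈ U, c • v = v) ∨ ∀ v ∈ U, c • v = -v := by
  rcases hirr.2 (fixedIn U c) (fun v hv => hv.1) (fun b hb w hw =>
    ⟨AddSubgroup.smul_mem_of_mem_setStab hb.2 hw.1, by rw [← mul_smul, hcc b hb, mul_smul, hw.2]⟩)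
    with h1 | h1
  · right
    intro v hv
    have : v + c • v ∈ fixedIn U c :=
      ⟨U.add_mem hv (AddSubgroup.smul_mem_of_mem_setStab hc.2 hv), by
        rw [smul_add, ← mul_smul, hc2, one_smul, add_comm]⟩
    rw [h1, AddSubgroup.mem_bot] at this
    exact (neg_eq_of_add_eq_zero_right this).symm
  · left
    intro v hv
    rw [← h1] at hv
    exact hv.2

theorem isRegOn_of_involutions_central (h : EvenHeisenberg p V B z)
    (hirr : IsIrredOn (B ⊓ U.setStab G) U)
    (hno : ∀ d ∈ B ⊓ U.setStab G, d * d = 1 → ∀ b ∈ B ⊓ U.setStab G, d * b = b * d)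
    {v : V} (hv : v ∈ U) (hv0 : v ≠ 0) : IsRegOn B U v := by
  intro c hc hcv
  rcases h.sq c hc.1 with h1 | h1
  · refine (h.smul_eq_or_neg hirr hc h1 (hno c hc h1)).resolve_right fun h2 => ?_
    have := h2 v hv
    rw [hcv] at this
    exact hv0 (h.eq_zero_of_neg this)
  · have : (c * c) • v = v := by rw [mul_smul, hcv, hcv]
    rw [h1, h.neg] at this
    exact absurd (h.eq_zero_of_neg this.symm) hv0

theorem exists_sq_add_sq (h : EvenHeisenberg p V B z) :
    ∃ α β β' : ℤ, (∀ v : V, (α * α + β * β) • v = -v) ∧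
      ((∀ v : V, β' • β • v = v) ∨ (∀ v : V, β' • α • v = v)) := by
  have : Fact p.Prime := ⟨h.prime⟩
  have hmod : ∀ m n : ℤ, ((m : ℤ) : ZMod p) = n → ∀ v : V, m • v = n • v := by
    intro m n hmn v
    rw [ZMod.intCast_eq_intCast_iff_dvd_sub] at hmn
    obtain ⟨k, hk⟩ := hmn
    rw [show n = m + k * p by linarith, add_zsmul, mul_zsmul, natCast_zsmul, h.nsmul, zsmul_zero,
      add_zero]
  obtain ⟨s, t, hst⟩ := ZMod.sq_add_sq p (-1)
  obtain ⟨α, rfl⟩ := ZMod.intCast_surjective s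
  obtain ⟨β, rfl⟩ := ZMod.intCast_surjective t
  have h1 : ∀ v : V, (α * α + β * β) • v = -v := fun v => by
    rw [hmod _ (-1) (by push_cast; rw [← hst]; ring), neg_one_zsmul]
  by_cases hβ : (β : ZMod p) = 0
  · have hα : (α : ZMod p) ≠ 0 := fun hα => by
      rw [hα, hβ] at hst
      norm_num at hst
    obtain ⟨β', hβ'⟩ := ZMod.intCast_surjective ((α : ZMod p)⁻¹)
    refine ⟨α, β, β', h1, Or.inr fun v => ?_⟩
    rw [← mul_zsmul, hmod _ 1 (by push_cast; rw [hβ', inv_mul_cancel₀ hα]), one_zsmul]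
  · obtain ⟨β', hβ'⟩ := ZMod.intCast_surjective ((β : ZMod p)⁻¹)
    refine ⟨α, β, β', h1, Or.inl fun v => ?_⟩
    rw [← mul_zsmul, hmod _ 1 (by push_cast; rw [hβ', inv_mul_cancel₀ hβ]), one_zsmul]

/-- For anticommuting elements of square `z` there is a nonzero vector `x` such that the span of
`x` and `a • x` is stable under both. -/
theorem exists_spanTwo_stable (h : EvenHeisenberg p V B z) {a b : G}
    (ha : a ∈ B ⊓ U.setStab G) (hb : b ∈ B ⊓ U.setStab G) (hab : a * b = z * (b * a))
    (ha2 : a * a = z) (hb2 : b * b = z) (hU : U ≠ ⊥) :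
    ∃ x ∈ U, x ≠ 0 ∧ ∃ c ∈ B ⊓ U.setStab G, ∀ v ∈ spanTwo x (c • x),
      a • v ∈ spanTwo x (c • x) ∧ b • v ∈ spanTwo x (c • x) := by
  obtain ⟨α, β, β', hαβ, hβ⟩ := h.exists_sq_add_sq
  wlog hβ0 : ∀ v : V, β' • β • v = v generalizing a b α β
  · obtain ⟨x, hx, hx0, c, hc, hst⟩ := this hb ha (h.anti_symm hab) hb2 ha2 β α
      (fun v => by rw [add_comm]; exact hαβ v) (Or.inl (hβ.resolve_left hβ0)) (hβ.resolve_left hβ0)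
    exact ⟨x, hx, hx0, c, hc, fun v hv => (hst v hv).symm⟩
  have haa : ∀ v : V, a • a • v = -v := fun v => by rw [← mul_smul, ha2, h.neg]
  have hbb : ∀ v : V, b • b • v = -v := fun v => by rw [← mul_smul, hb2, h.neg]
  have haU : ∀ v ∈ U, a • v ∈ U := fun v hv => AddSubgroup.smul_mem_of_mem_setStab ha.2 hv
  have hbU : ∀ v ∈ U, b • v ∈ U := fun v hv => AddSubgroup.smul_mem_of_mem_setStab hb.2 hv
  obtain ⟨v, hv, hv0⟩ := (U.bot_or_exists_ne_zero).resolve_left hU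
  let e : V → V := fun v => α • a • v + β • b • v
  have hee : ∀ v, e (e v) = v := by
    intro v
    simp only [e, smul_add, smul_zsmul_comm, haa, hbb, h.anti_smul hab]
    have h2 := hαβ v
    rw [← neg_eq_iff_eq_neg] at h2
    rw [add_zsmul, mul_zsmul, mul_zsmul] at h2
    nth_rewrite 5 [← h2]
    simp only [zsmul_neg]
    rw [smul_comm β α (b • a • v)]
    abel
  have hadd : ∀ v w, e (v + w) = e v + e w := fun v w => by
    simp only [e, smul_add]; abel
  obtain ⟨x, hx, hx0, ε, hε⟩ : ∃ x ∈ U, x ≠ 0 ∧ ∃ ε : ℤ, e x = ε • x := by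
    by_cases h0 : v + e v = 0
    · refine ⟨v, hv, hv0, -1, ?_⟩
      rw [neg_one_zsmul]
      exact (neg_eq_of_add_eq_zero_right h0).symm
    · refine ⟨v + e v, ?_, h0, 1, ?_⟩
      · exact U.add_mem hv (U.add_mem (U.zsmul_mem (haU v hv) _) (U.zsmul_mem (hbU v hv) _))
      · rw [one_zsmul, hadd, hee, add_comm]
  set S := spanTwo x (a • x) with hS
  have xS : x ∈ S := left_mem_spanTwo _ _
  have aS : a • x ∈ S := right_mem_spanTwo _ _
  have hbx : b • x = β' • (ε • x - α • a • x) := by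
    rw [← hε]
    simp only [e]
    rw [add_sub_cancel_left, hβ0]
  have bS : b • x ∈ S := by
    rw [hbx]
    exact S.zsmul_mem (S.sub_mem (S.zsmul_mem xS _) (S.zsmul_mem aS _)) _
  have stA : ∀ v ∈ S, a • v ∈ S := fun v hv => smul_mem_spanTwo aS
    (by rw [haa]; exact S.neg_mem xS) hv
  refine ⟨x, hx, hx0, a, ha, fun v hv => ⟨stA v hv, smul_mem_spanTwo bS ?_ hv⟩⟩
  rw [h.anti_smul (h.anti_symm hab)]
  exact S.neg_mem (stA _ bS)

theorem exists_span (h : EvenHeisenberg p V B z) (hirr : IsIrredOn (B ⊓ U.setStab G) U)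
    (hno : ∀ d ∈ B ⊓ U.setStab G, d * d = 1 → ∀ b ∈ B ⊓ U.setStab G, d * b = b * d) :
    ∃ x ∈ U, x ≠ 0 ∧ ∃ c₀ ∈ B ⊓ U.setStab G, U ≤ spanTwo x (c₀ • x) ∧
      ((∀ c ∈ B ⊓ U.setStab G, c • x = x ∨ c • x = -x ∨ c • x = c₀ • x ∨ c • x = -(c₀ • x)) ∨
        ∀ c ∈ B ⊓ U.setStab G, c * c = z → ∃ a ∈ B ⊓ U.setStab G, c * a = z * (a * c)) := by
  have sU : ∀ {c : G} {v : V}, c ∈ B ⊓ U.setStab G → v ∈ U → c • v ∈ U := fun hc hv =>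
    AddSubgroup.smul_mem_of_mem_setStab hc.2 hv
  obtain ⟨x, hx, hx0⟩ := (U.bot_or_exists_ne_zero).resolve_left hirr.1
  have full : ∀ {x a : V}, x ∈ U → a ∈ U → x ≠ 0 → (∀ c ∈ B ⊓ U.setStab G, ∀ v ∈ spanTwo x a,
      c • v ∈ spanTwo x a) → U ≤ spanTwo x a := fun {x a} hx ha hx0 hst => by
    rcases hirr.2 _ (spanTwo_le hx ha) hst with h1 | h1
    · have := left_mem_spanTwo x a
      rw [h1] at this
      exact absurd this hx0
    · exact h1.ge
  by_cases hab : ∀ a ∈ B ⊓ U.setStab G, ∀ b ∈ B ⊓ U.setStab G, a * b = b * a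
  · have pm : ∀ c ∈ B ⊓ U.setStab G, c * c = 1 → (∀ v ∈ U, c • v = v) ∨ ∀ v ∈ U, c • v = -v :=
      fun c hc hc2 => h.smul_eq_or_neg hirr hc hc2 (hab c hc)
    by_cases hj : ∃ j ∈ B ⊓ U.setStab G, j * j = z
    · obtain ⟨j, hj, hj2⟩ := hj
      have hjj : ∀ v : V, j • j • v = -v := fun v => by rw [← mul_smul, hj2, h.neg]
      have cases : ∀ c ∈ B ⊓ U.setStab G, (∀ v ∈ U, c • v = v) ∨ (∀ v ∈ U, c • v = -v) ∨
          (∀ v ∈ U, c • v = j • v) ∨ ∀ v ∈ U, c • v = -(j • v) := by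
        intro c hc
        rcases h.sq c hc.1 with h1 | h1
        · rcases pm c hc h1 with h2 | h2
          · exact Or.inl h2
          · exact Or.inr (Or.inl h2)
        · have h3 : c * j * (c * j) = 1 := by
            rw [show c * j * (c * j) = c * (j * c) * j by group, hab j hj c hc,
              show c * (c * j) * j = c * c * (j * j) by group, h1, hj2, h.mul_self]
          have h4 : ∀ v : V, c • v = -((c * j) • j • v) := fun v => by
            rw [mul_smul, hjj, smul_neg, neg_neg]
          rcases pm _ (mul_mem hc hj) h3 with h2 | h2
          · refine Or.inr (Or.inr (Or.inr fun v hv => ?_))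
            rw [h4, h2 _ (sU hj hv)]
          · refine Or.inr (Or.inr (Or.inl fun v hv => ?_))
            rw [h4, h2 _ (sU hj hv), neg_neg]
      refine ⟨x, hx, hx0, j, hj, full hx (sU hj hx) hx0 fun c hc v hv => ?_, Or.inl fun c hc => ?_⟩
      · have hvU := spanTwo_le hx (sU hj hx) hv
        have hjv : j • v ∈ spanTwo x (j • x) := smul_mem_spanTwo (right_mem_spanTwo _ _)
          (by rw [hjj]; exact neg_mem (left_mem_spanTwo _ _)) hv
        rcases cases c hc with h2 | h2 | h2 | h2 <;> rw [h2 v hvU]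
        · exact hv
        · exact neg_mem hv
        · exact hjv
        · exact neg_mem hjv
      · rcases cases c hc with h2 | h2 | h2 | h2 <;> rw [h2 x hx] <;> simp
    · have cases : ∀ c ∈ B ⊓ U.setStab G, (∀ v ∈ U, c • v = v) ∨ (∀ v ∈ U, c • v = -v) :=
        fun c hc => pm c hc ((h.sq c hc.1).resolve_right fun h1 => hj ⟨c, hc, h1⟩)
      refine ⟨x, hx, hx0, 1, one_mem _, full hx (sU (one_mem _) hx) hx0 fun c hc v hv => ?_,
        Or.inl fun c hc => ?_⟩
      · have hvU := spanTwo_le hx (sU (one_mem _) hx) hv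
        rcases cases c hc with h2 | h2 <;> rw [h2 v hvU]
        · exact hv
        · exact neg_mem hv
      · rcases cases c hc with h2 | h2 <;> rw [h2 x hx] <;> simp
  · push Not at hab
    obtain ⟨a, ha, b, hb, hne⟩ := hab
    have hab := (h.comm a ha.1 b hb.1).resolve_left hne
    have ha2 := (h.sq a ha.1).resolve_left fun h1 => hne (hno a ha h1 b hb)
    have hb2 := (h.sq b hb.1).resolve_left fun h1 => hne (hno b hb h1 a ha).symm
    have haa : ∀ v : V, a • a • v = -v := fun v => by rw [← mul_smul, ha2, h.neg]
    have hbb : ∀ v : V, b • b • v = -v := fun v => by rw [← mul_smul, hb2, h.neg]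
    -- elements commuting with `a` and `b` are scalar
    have scal : ∀ c ∈ B ⊓ U.setStab G, c * a = a * c → c * b = b * c →
        c * c = 1 ∧ ((∀ v ∈ U, c • v = v) ∨ ∀ v ∈ U, c • v = -v) := by
      intro c hc hca hcb
      have h1 : c * c = 1 := by
        refine (h.sq c hc.1).resolve_right fun h1 => ?_
        have h2 : c * a * (c * a) = 1 := by
          rw [show c * a * (c * a) = c * (a * c) * a by group, ← hca,
            show c * (c * a) * a = c * c * (a * a) by group, h1, ha2, h.mul_self]
        have h3 := hno _ (mul_mem hc ha) h2 b hb
        rw [mul_assoc, ← mul_assoc b, ← hcb, mul_assoc, mul_right_inj] at h3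
        exact hne h3
      exact ⟨h1, h.smul_eq_or_neg hirr hc h1 (hno c hc h1)⟩
    have flip : ∀ {c m n : G}, c ∈ B ⊓ U.setStab G → m ∈ B ⊓ U.setStab G → n ∈ B ⊓ U.setStab G →
        c * n = z * (n * c) → m * n = z * (n * m) → c * m * n = n * (c * m) := by
      intro c m n hc hm hn h1 h2
      rw [mul_assoc, h2, ← mul_assoc, h.cent, mul_assoc, ← mul_assoc c, h1, ← mul_assoc,
        ← mul_assoc, ← mul_assoc, h.mul_self, one_mul, mul_assoc]
    have keep : ∀ {c m n : G}, c * n = n * c → m * n = n * m → c * m * n = n * (c * m) := by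
      intro c m n h1 h2
      rw [mul_assoc, h2, ← mul_assoc, h1, mul_assoc]
    have rep : ∀ c ∈ B ⊓ U.setStab G, ∃ m : G, (m = 1 ∨ m = a ∨ m = b ∨ m = a * b) ∧
        c * m * a = a * (c * m) ∧ c * m * b = b * (c * m) := by
      intro c hc
      have hba := h.anti_symm hab
      have haba : a * b * a = z * (a * (a * b)) := by
        rw [mul_assoc, hba, ← mul_assoc, h.cent, mul_assoc]
      have habb : a * b * b = z * (b * (a * b)) := by
        rw [hab, mul_assoc, mul_assoc b a b, hab, ← mul_assoc b z, h.cent, ← mul_assoc z (z * b),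
          ← mul_assoc, ← mul_assoc, h.mul_self, one_mul]
      rcases h.comm c hc.1 a ha.1 with h1 | h1 <;> rcases h.comm c hc.1 b hb.1 with h2 | h2
      · exact ⟨1, by simp, by simpa using h1, by simpa using h2⟩
      · exact ⟨a, by simp, keep h1 rfl, flip hc ha hb h2 hab⟩
      · exact ⟨b, by simp, flip hc hb ha h1 hba, keep h2 rfl⟩
      · exact ⟨a * b, by simp, flip hc (mul_mem ha hb) ha h1 haba,
          flip hc (mul_mem ha hb) hb h2 habb⟩
    obtain ⟨x, hx, hx0, c₀, hc₀, hst⟩ := h.exists_spanTwo_stable ha hb hab ha2 hb2 hirr.1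
    have hle := spanTwo_le hx (sU hc₀ hx)
    refine ⟨x, hx, hx0, c₀, hc₀, full hx (sU hc₀ hx) hx0 fun c hc v hv => ?_, Or.inr ?_⟩
    · obtain ⟨m, hm, hma, hmb⟩ := rep c hc
      set S := spanTwo x (c₀ • x)
      have inv : ∀ g : G, (∀ v ∈ S, g • v ∈ S) → (∀ v : V, g • g • v = -v) → ∀ v ∈ S,
          g⁻¹ • v ∈ S := by
        intro g hg hgg v hv
        have : g⁻¹ • v = -(g • v) := by rw [inv_smul_eq_iff, smul_neg, hgg, neg_neg]
        rw [this]; exact S.neg_mem (hg v hv)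
      have ia := inv a (fun v hv => (hst v hv).1) haa
      have ib := inv b (fun v hv => (hst v hv).2) hbb
      have hmB : m ∈ B ⊓ U.setStab G := by
        rcases hm with rfl | rfl | rfl | rfl
        exacts [one_mem _, ha, hb, mul_mem ha hb]
      have hmS : m⁻¹ • v ∈ S := by
        rcases hm with rfl | rfl | rfl | rfl
        · simpa using hv
        · exact ia v hv
        · exact ib v hv
        · rw [mul_inv_rev, mul_smul]; exact ib _ (ia v hv)
      have h4 : c • v = (c * m) • m⁻¹ • v := by rw [mul_smul, smul_inv_smul]
      rw [h4]
      rcases (scal _ (mul_mem hc hmB) hma hmb).2 with h2 | h2 <;> rw [h2 _ (hle hmS)]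
      · exact hmS
      · exact S.neg_mem hmS
    · intro c hc hc2
      by_contra! hcon
      have hca := (h.comm c hc.1 a ha.1).resolve_right (hcon a ha)
      have hcb := (h.comm c hc.1 b hb.1).resolve_right (hcon b hb)
      have h1 := (scal c hc hca hcb).1
      rw [hc2] at h1
      have h2 := h.neg x
      rw [h1, one_smul] at h2
      exact hx0 (h.eq_zero_of_neg h2)

theorem eq_of_prime_nsmul (h : EvenHeisenberg p V B z) {q : ℕ} (hq : q.Prime) {x : V}
    (hx0 : x ≠ 0) (hx : q • x = 0) : p = q := by
  by_contra hne
  exact hx0 (eq_zero_of_coprime_nsmul h.prime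
    (fun h' => hne ((Nat.prime_dvd_prime_iff_eq h.prime hq).1 h')) (h.nsmul x) hx)

theorem good_or_isSmall_of_involutions_central (h : EvenHeisenberg p V B z)
    (hirr : IsIrredOn (B ⊓ U.setStab G) U)
    (hno : ∀ d ∈ B ⊓ U.setStab G, d * d = 1 → ∀ b ∈ B ⊓ U.setStab G, d * b = b * d) :
    Good B U ∨ IsSmall p B U := by
  have hreg := fun v hv hv0 => h.isRegOn_of_involutions_central hirr hno (v := v) hv hv0
  obtain ⟨x, hx, hx0, c₀, hc₀, hspan, hor⟩ := h.exists_span hirr hno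
  have sU : ∀ {c : G} {v : V}, c ∈ B ⊓ U.setStab G → v ∈ U → c • v ∈ U := fun hc hv =>
    AddSubgroup.smul_mem_of_mem_setStab hc.2 hv
  by_cases hp3 : p = 3
  · exact Or.inr ⟨x, hx, c₀ • x, sU hc₀ hx, hx0, hspan, hreg, Or.inl hp3⟩
  have good : ∀ w ∈ U, w ≠ 0 → (∀ b ∈ B ⊓ U.setStab G, b • x ≠ w) → Good B U :=
    fun w hw hw0 hwx => ⟨c₀ • x, sU hc₀ hx, x, hx, w, hw, hx0, hw0,
      fun g hg h1 h2 v hv => smul_eq_of_mem_spanTwo h2 h1 (hspan hv),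
      hreg _ (sU hc₀ hx) (by rwa [smul_ne_zero_iff_ne]), hreg w hw hw0, hwx⟩
  have h2x : (2 : ℕ) • x ≠ 0 := fun h0 => hx0 (h.eq_zero_of_two h0)
  by_cases hb : ∃ b ∈ B ⊓ U.setStab G, b • x = (2 : ℕ) • x
  · obtain ⟨b, hb, hbx⟩ := hb
    have hbb : (b * b) • x = (4 : ℕ) • x := by
      rw [mul_smul, hbx, smul_nsmul_comm, hbx, ← mul_nsmul]
    have hb2 : b * b = z := by
      refine (h.sq b hb.1).resolve_left fun h1 => hp3 (h.eq_of_prime_nsmul Nat.prime_three hx0 ?_)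
      rw [h1, one_smul] at hbb
      have : (3 : ℕ) • x = (4 : ℕ) • x - x := by rw [succ_nsmul (n := 3)]; abel
      rw [this, ← hbb, sub_self]
    have hp5 : p = 5 := by
      refine h.eq_of_prime_nsmul Nat.prime_five hx0 ?_
      rw [hb2, h.neg] at hbb
      rw [succ_nsmul (n := 4), ← hbb, neg_add_cancel]
    rcases hor with hor | hor
    · right
      have hc : c₀ • x ∈ spanTwo x (0 : V) := by
        rcases hor b hb with h1 | h1 | h1 | h1
        · rw [h1, two_nsmul] at hbx
          exact absurd (add_eq_right.1 hbx.symm) hx0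
        · rw [h1] at hbx
          refine absurd (h.eq_of_prime_nsmul Nat.prime_three hx0 ?_) hp3
          rw [succ_nsmul (n := 2), ← hbx, neg_add_cancel]
        · exact ⟨2, 0, by rw [← h1, hbx]; simp [two_nsmul, two_zsmul]⟩
        · exact ⟨-2, 0, by
            rw [← neg_eq_iff_eq_neg.2 h1, hbx]; simp [two_nsmul, two_zsmul]⟩
      exact ⟨x, hx, 0, U.zero_mem, hx0, hspan.trans (spanTwo_le (left_mem_spanTwo _ _) hc), hreg,
        Or.inr ⟨hp5, rfl, b, hb, hbx⟩⟩
    · left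
      obtain ⟨a, ha, hba⟩ := hor b hb hb2
      have h4 : ∀ v : V, v ≠ 0 → (4 : ℕ) • v ≠ 0 := fun v hv h0 =>
        hv (h.eq_zero_of_two (h.eq_zero_of_two (by rw [← mul_nsmul]; exact h0)))
      have hbw : b • (x + a • x) = (2 : ℕ) • x - (2 : ℕ) • a • x := by
        rw [smul_add, h.anti_smul hba, hbx, smul_nsmul_comm, sub_eq_add_neg]
      have hax0 : a • x ≠ 0 := by rwa [smul_ne_zero_iff_ne]
      refine good (x + a • x) (U.add_mem hx (sU ha hx)) (fun h0 => ?_) fun c hc hcx => ?_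
      · rw [h0, smul_zero, eq_comm, sub_eq_zero] at hbw
        refine h4 x hx0 ?_
        rw [show (4 : ℕ) = 2 + 2 by rfl, add_nsmul]
        nth_rewrite 2 [hbw]
        rw [← nsmul_add, h0, nsmul_zero]
      · rcases h.smul_smul_eq hb.1 hc.1 x with ⟨-, h1⟩ | ⟨-, h1⟩
        · rw [hbx, smul_nsmul_comm, hcx, hbw, nsmul_add] at h1
          refine h4 _ hax0 ?_
          rw [show (4 : ℕ) = 2 + 2 by rfl, add_nsmul]
          rw [sub_eq_add_neg, add_right_inj] at h1
          nth_rewrite 1 [← h1]; rw [neg_add_cancel]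
        · rw [hbx, smul_nsmul_comm, hcx, hbw, nsmul_add] at h1
          refine h4 _ hx0 ?_
          rw [show (4 : ℕ) = 2 + 2 by rfl, add_nsmul]
          rw [neg_add, ← sub_eq_add_neg, sub_left_inj] at h1
          nth_rewrite 1 [h1]; rw [neg_add_cancel]
  · push Not at hb
    exact Or.inl (good _ (U.nsmul_mem hx 2) h2x hb)

end EvenHeisenberg

namespace EvenHeisenberg

variable {p : ℕ} {G V : Type*} [Group G] [AddCommGroup V] [DistribMulAction G V]
  {B : Subgroup G} {z : G} {b c d d₁ b₁ d₂ b₂ : G} {x a : V}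

/-- `c` and `d` commute as operators on `V`. -/
def CommOn (V : Type*) {G : Type*} [Group G] [AddCommGroup V] [DistribMulAction G V] (c d : G) :
    Prop := ∀ v : V, c • d • v = d • c • v

/-- `c` and `d` anticommute as operators on `V`. -/
def AntiOn (V : Type*) {G : Type*} [Group G] [AddCommGroup V] [DistribMulAction G V] (c d : G) :
    Prop := ∀ v : V, c • d • v = -(d • c • v)

/-- `c` acts as an involution on `V`. -/
def SqOn (V : Type*) {G : Type*} [Group G] [AddCommGroup V] [DistribMulAction G V] (c : G) :
    Prop := ∀ v : V, c • c • v = v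

theorem CommOn.symm (h : CommOn V c d) : CommOn V d c := fun v => (h v).symm

theorem AntiOn.symm (h : AntiOn V c d) : AntiOn V d c := fun v => by rw [h v, neg_neg]

theorem commOn_or_antiOn (h : EvenHeisenberg p V B z) (hc : c ∈ B) (hd : d ∈ B) :
    CommOn V c d ∨ AntiOn V c d := by
  rcases h.comm c hc d hd with h1 | h1
  · exact Or.inl fun v => by rw [← mul_smul, h1, mul_smul]
  · exact Or.inr fun v => h.anti_smul h1 v

/-- If `c` and `d` both fix a nonzero vector up to sign, then they commute. -/
theorem commOn_of_smul_eq (h : EvenHeisenberg p V B z) (hc : c ∈ B) (hd : d ∈ B) {v : V}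
    (hv0 : v ≠ 0) (hcv : c • v = v ∨ c • v = -v) (hdv : d • v = v ∨ d • v = -v) :
    CommOn V c d := by
  refine (h.commOn_or_antiOn hc hd).resolve_right fun h1 => hv0 (h.eq_zero_of_neg ?_)
  have h2 := h1 v
  rcases hcv with h3 | h3 <;> rcases hdv with h4 | h4 <;>
    simpa [h3, h4, smul_neg, neg_eq_iff_eq_neg] using h2

/-- Two commuting anticommuting pairs of involutions, such that the common fixed space of `d₁`
and `d₂` is spanned by `x` and `a` and is acted upon semiregularly. -/
structure Frame (B : Subgroup G) (d₁ b₁ d₂ b₂ : G) (x a : V) : Prop where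
  d₁_mem : d₁ ∈ B
  b₁_mem : b₁ ∈ B
  d₂_mem : d₂ ∈ B
  b₂_mem : b₂ ∈ B
  d₁_sq : SqOn V d₁
  b₁_sq : SqOn V b₁
  d₂_sq : SqOn V d₂
  b₂_sq : SqOn V b₂
  d₁_b₁ : AntiOn V d₁ b₁
  d₂_b₂ : AntiOn V d₂ b₂
  d₁_d₂ : CommOn V d₁ d₂
  d₁_b₂ : CommOn V d₁ b₂
  b₁_d₂ : CommOn V b₁ d₂
  b₁_b₂ : CommOn V b₁ b₂
  d₁_x : d₁ • x = x
  d₂_x : d₂ • x = x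
  d₁_a : d₁ • a = a
  d₂_a : d₂ • a = a
  x_ne : x ≠ 0
  span : ∀ v : V, d₁ • v = v → d₂ • v = v → v ∈ spanTwo x a
  reg : ∀ c ∈ B, CommOn V d₁ c → CommOn V d₂ c → ∀ v : V, v ≠ 0 → d₁ • v = v → d₂ • v = v →
    c • v = v → ∀ u : V, d₁ • u = u → d₂ • u = u → c • u = u

theorem Frame.swap (F : Frame B d₁ b₁ d₂ b₂ x a) : Frame B d₂ b₂ d₁ b₁ x a where
  d₁_mem := F.d₂_mem
  b₁_mem := F.b₂_mem
  d₂_mem := F.d₁_mem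
  b₂_mem := F.b₁_mem
  d₁_sq := F.d₂_sq
  b₁_sq := F.b₂_sq
  d₂_sq := F.d₁_sq
  b₂_sq := F.b₁_sq
  d₁_b₁ := F.d₂_b₂
  d₂_b₂ := F.d₁_b₁
  d₁_d₂ := F.d₁_d₂.symm
  d₁_b₂ := F.b₁_d₂.symm
  b₁_d₂ := F.d₁_b₂.symm
  b₁_b₂ := F.b₁_b₂.symm
  d₁_x := F.d₂_x
  d₂_x := F.d₁_x
  d₁_a := F.d₂_a
  d₂_a := F.d₁_a
  x_ne := F.x_ne
  span v h1 h2 := F.span v h2 h1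
  reg c hc h1 h2 v hv h3 h4 h5 u h6 h7 := F.reg c hc h2 h1 v hv h4 h3 h5 u h7 h6

theorem Frame.mul_left (F : Frame B d₁ b₁ d₂ b₂ x a) :
    Frame B (d₁ * d₂) b₁ d₂ (b₁ * b₂) x a where
  d₁_mem := mul_mem F.d₁_mem F.d₂_mem
  b₁_mem := F.b₁_mem
  d₂_mem := F.d₂_mem
  b₂_mem := mul_mem F.b₁_mem F.b₂_mem
  d₁_sq v := by simp only [mul_smul, F.d₁_d₂ _, F.d₁_sq _, F.d₂_sq _]
  b₁_sq := F.b₁_sq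
  d₂_sq := F.d₂_sq
  b₂_sq v := by simp only [mul_smul, F.b₁_b₂ _, F.b₁_sq _, F.b₂_sq _]
  d₁_b₁ v := by simp only [mul_smul, ← F.b₁_d₂ _, F.d₁_b₁ _]
  d₂_b₂ v := by simp only [mul_smul, F.d₂_b₂ _, ← F.b₁_d₂ _, smul_neg]
  d₁_d₂ v := by simp only [mul_smul, F.d₁_d₂ _]
  d₁_b₂ v := by
    simp only [mul_smul, F.d₂_b₂ _, ← F.b₁_d₂ _, F.d₁_b₂ _, F.d₁_b₁ _, smul_neg, neg_neg]
  b₁_d₂ := F.b₁_d₂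
  b₁_b₂ v := by simp only [mul_smul, F.b₁_b₂ _]
  d₁_x := by rw [mul_smul, F.d₂_x, F.d₁_x]
  d₂_x := F.d₂_x
  d₁_a := by rw [mul_smul, F.d₂_a, F.d₁_a]
  d₂_a := F.d₂_a
  x_ne := F.x_ne
  span v h1 h2 := F.span v (by rwa [mul_smul, h2] at h1) h2
  reg c hc h1 h2 v hv h3 h4 h5 u h6 h7 := by
    refine F.reg c hc (fun w => ?_) h2 v hv (by rwa [mul_smul, h4] at h3) h4 h5 u
      (by rwa [mul_smul, h7] at h6) h7
    have := h1 (d₂ • w)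
    simpa only [mul_smul, ← h2 _, F.d₂_sq _] using this

/-- Exchanging `d₁` and `b₁`. -/
theorem Frame.rotate (h : EvenHeisenberg p V B z) (F : Frame B d₁ b₁ d₂ b₂ x a) :
    Frame B b₁ d₁ d₂ b₂ (x + b₁ • x) (a + b₁ • a) where
  d₁_mem := F.b₁_mem
  b₁_mem := F.d₁_mem
  d₂_mem := F.d₂_mem
  b₂_mem := F.b₂_mem
  d₁_sq := F.b₁_sq
  b₁_sq := F.d₁_sq
  d₂_sq := F.d₂_sq
  b₂_sq := F.b₂_sq
  d₁_b₁ := F.d₁_b₁.symm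
  d₂_b₂ := F.d₂_b₂
  d₁_d₂ := F.b₁_d₂
  d₁_b₂ := F.b₁_b₂
  b₁_d₂ := F.d₁_d₂
  b₁_b₂ := F.d₁_b₂
  d₁_x := by rw [smul_add, F.b₁_sq, add_comm]
  d₂_x := by rw [smul_add, ← F.b₁_d₂, F.d₂_x]
  d₁_a := by rw [smul_add, F.b₁_sq, add_comm]
  d₂_a := by rw [smul_add, ← F.b₁_d₂, F.d₂_a]
  x_ne h0 := F.x_ne (h.eq_of_add_eq F.d₁_x (by rw [F.d₁_b₁, F.d₁_x]) (b₀ := 0) (b₁ := 0)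
    (smul_zero _) (by simp) (by rw [h0, add_zero])).1
  span v h1 h2 := by
    obtain ⟨w, -, rfl⟩ := h.exists_half (U := ⊤) (v := v) trivial
    have e : ∀ u : V, u + u = 0 → u = 0 := fun u hu => h.eq_zero_of_two (by rw [two_nsmul, hu])
    have e1 : b₁ • w = w := by
      rw [← sub_eq_zero]; apply e; rw [← sub_eq_zero.2 h1, smul_add]; abel
    have e2 : d₂ • w = w := by
      rw [← sub_eq_zero]; apply e; rw [← sub_eq_zero.2 h2, smul_add]; abel
    obtain ⟨m, n, hmn⟩ := F.span (w + d₁ • w) (by rw [smul_add, F.d₁_sq, add_comm])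
      (by rw [smul_add, ← F.d₁_d₂, e2])
    refine ⟨m, n, ?_⟩
    have : w + w = (w + d₁ • w) + b₁ • (w + d₁ • w) := by
      rw [smul_add, F.d₁_b₁.symm, e1]; abel
    rw [this, hmn]
    simp only [smul_add, smul_zsmul_comm]
    abel
  reg c hc h1 h2 v hv h3 h4 h5 u h6 h7 := by
    -- a vector fixed by `b₁` is determined by its component fixed by `d₁`
    have key : ∀ w : V, b₁ • w = w → w + w = (w + d₁ • w) + b₁ • (w + d₁ • w) := fun w hw => by
      rw [smul_add, F.d₁_b₁.symm, hw]; abel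
    have hs : ∀ w : V, d₁ • (w + d₁ • w) = w + d₁ • w := fun w => by
      rw [smul_add, F.d₁_sq, add_comm]
    have hs2 : ∀ w : V, d₂ • w = w → d₂ • (w + d₁ • w) = w + d₁ • w := fun w hw => by
      rw [smul_add, ← F.d₁_d₂, hw]
    have hv' : v + d₁ • v ≠ 0 := fun h0 => hv (h.eq_zero_of_two (by
      rw [two_nsmul, key v h3, h0, smul_zero, add_zero]))
    -- replace `c` by `b₁ * c` if necessary
    obtain ⟨c', hc', k1, k2, k3, k4⟩ : ∃ c' ∈ B, CommOn V d₁ c' ∧ CommOn V b₁ c' ∧ CommOn V d₂ c' ∧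
        ∀ w : V, b₁ • w = w → c' • w = c • w := by
      rcases h.commOn_or_antiOn F.d₁_mem hc with h8 | h8
      · exact ⟨c, hc, h8, h1, h2, fun _ _ => rfl⟩
      · refine ⟨c * b₁, mul_mem hc F.b₁_mem, fun w => ?_, fun w => ?_, fun w => ?_, fun w hw => ?_⟩
        · rw [mul_smul, mul_smul, h8, F.d₁_b₁, smul_neg, neg_neg]
        · rw [mul_smul, mul_smul, h1]
        · rw [mul_smul, mul_smul, h2, ← F.b₁_d₂]
        · rw [mul_smul, hw]
    have hc'v : c' • (v + d₁ • v) = v + d₁ • v := by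
      rw [smul_add, ← k1, k4 v h3, h5]
    have := F.reg c' hc' k1 k3 _ hv' (hs v) (hs2 v h4) hc'v _ (hs u) (hs2 u h7)
    rw [← k4 u h6, ← sub_eq_zero]
    apply h.eq_zero_of_two
    rw [two_nsmul, show c' • u - u + (c' • u - u) = c' • (u + u) - (u + u) by rw [smul_add]; abel,
      key u h6, smul_add, ← k2, this, sub_self]

end EvenHeisenberg

namespace EvenHeisenberg

variable {p : ℕ} {G V : Type*} [Group G] [AddCommGroup V] [DistribMulAction G V]
  {B : Subgroup G} {z : G} {b c c' d d₁ b₁ d₂ b₂ : G} {x a : V}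

theorem Frame.decomp (h : EvenHeisenberg p V B z) (F : Frame B d₁ b₁ d₂ b₂ x a) {u : V}
    (hu : d₁ • u = u) : ∃ e f : V, d₁ • e = e ∧ d₂ • e = e ∧ d₁ • f = f ∧ d₂ • f = f ∧
      u = e + b₂ • f := by
  obtain ⟨w, hw, rfl⟩ := h.exists_half (U := fixedIn ⊤ d₁) (v := u) ⟨trivial, hu⟩
  have hw := hw.2
  refine ⟨w + d₂ • w, b₂ • (w - d₂ • w), ?_, ?_, ?_, ?_, ?_⟩
  · rw [smul_add, F.d₁_d₂, hw]
  · rw [smul_add, F.d₂_sq, add_comm]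
  · rw [F.d₁_b₂, smul_sub, F.d₁_d₂, hw]
  · rw [F.d₂_b₂, ← smul_neg, smul_sub, F.d₂_sq, neg_sub]
  · rw [F.b₂_sq]; abel

theorem CommOn.mul_neg (h : EvenHeisenberg p V B z) (hc : CommOn V d c) :
    CommOn V d (z * c) := fun v => by
  rw [mul_smul, mul_smul, h.neg, h.neg, smul_neg, hc]

theorem Frame.trivial_or (h : EvenHeisenberg p V B z) (F : Frame B d₁ b₁ d₂ b₂ x a)
    (hc : c ∈ B) (h1 : CommOn V d₁ c) (h2 : CommOn V d₂ c) {v : V} (hv : v ≠ 0)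
    (hdv : d₁ • v = v) (hcv : c • v = v) :
    (∀ u : V, d₁ • u = u → c • u = u) ∨
    ((∀ u : V, d₁ • u = u → c • u = d₂ • u) ∧ d₂ • v = v) ∨
    ((∀ u : V, d₁ • u = u → c • u = -(d₂ • u)) ∧ d₂ • v = -v) := by
  obtain ⟨e, f, he1, he2, hf1, hf2, rfl⟩ := F.decomp h hdv
  have hbf : d₂ • b₂ • f = -(b₂ • f) := by rw [F.d₂_b₂, hf2]
  rw [smul_add] at hcv
  obtain ⟨k0, k1⟩ := h.eq_of_add_eq (by rw [h2, he2]) (by rw [h2, hbf, smul_neg]) he2 hbf hcv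
  rcases h.commOn_or_antiOn hc F.b₂_mem with h3 | h3
  · left
    rw [h3, smul_left_cancel_iff] at k1
    have : ∀ u : V, d₁ • u = u → d₂ • u = u → c • u = u := by
      by_cases he0 : e = 0
      · refine F.reg c hc h1 h2 f ?_ hf1 hf2 k1
        rintro rfl
        exact hv (by rw [he0, smul_zero, add_zero])
      · exact F.reg c hc h1 h2 e he0 he1 he2 k0
    intro u hu
    obtain ⟨e', f', he1', he2', hf1', hf2', rfl⟩ := F.decomp h hu
    rw [smul_add, h3, this e' he1' he2', this f' hf1' hf2']
  · right
    rw [h3, ← smul_neg, smul_left_cancel_iff, neg_eq_iff_eq_neg] at k1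
    by_cases he0 : e = 0
    · right
      have hf0 : f ≠ 0 := by
        rintro rfl
        exact hv (by rw [he0, smul_zero, add_zero])
      have := F.reg (z * c) (mul_mem h.mem hc) (h1.mul_neg h) (h2.mul_neg h) f hf0 hf1 hf2
        (by rw [mul_smul, h.neg, k1, neg_neg])
      refine ⟨fun u hu => ?_, by rw [he0, zero_add, hbf]⟩
      obtain ⟨e', f', he1', he2', hf1', hf2', rfl⟩ := F.decomp h hu
      have t1 := this e' he1' he2'
      have t2 := this f' hf1' hf2'
      rw [mul_smul, h.neg, neg_eq_iff_eq_neg] at t1 t2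
      rw [smul_add, smul_add, h3, t1, t2, he2', F.d₂_b₂, hf2', smul_neg]
      abel
    · left
      have := F.reg c hc h1 h2 e he0 he1 he2 k0
      have hf0 : f = 0 := h.eq_zero_of_neg (by rw [← k1, this f hf1 hf2])
      refine ⟨fun u hu => ?_, by rw [hf0, smul_zero, add_zero, he2]⟩
      obtain ⟨e', f', he1', he2', hf1', hf2', rfl⟩ := F.decomp h hu
      rw [smul_add, smul_add, h3, this e' he1' he2', this f' hf1' hf2', he2', F.d₂_b₂, hf2']

theorem sqOn_of_smul_eq (h : EvenHeisenberg p V B z) (hc : c ∈ B) {v : V} (hv : v ≠ 0)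
    (hcv : c • v = v) : SqOn V c := by
  rcases h.sq c hc with h1 | h1
  · exact fun u => by rw [← mul_smul, h1, one_smul]
  · exfalso
    have : (c * c) • v = v := by rw [mul_smul, hcv, hcv]
    rw [h1, h.neg] at this
    exact hv (h.eq_zero_of_neg this.symm)

/-- A nonzero vector of the fixed space of `d₁` is fixed by at most one nontrivial operator
from `B`. -/
theorem Frame.unique (h : EvenHeisenberg p V B z) (F : Frame B d₁ b₁ d₂ b₂ x a)
    (hc : c ∈ B) (hc' : c' ∈ B) (h1 : CommOn V d₁ c) (h1' : CommOn V d₁ c') {v : V} (hv : v ≠ 0)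
    (hdv : d₁ • v = v) (hcv : c • v = v) (hcv' : c' • v = v)
    (hn : ¬ ∀ u : V, d₁ • u = u → c • u = u) (hn' : ¬ ∀ u : V, d₁ • u = u → c' • u = u) :
    ∀ u : V, d₁ • u = u → c • u = c' • u := by
  have aux : ∀ {e}, e ∈ B → CommOn V d₁ e → e • v = v → (d₂ • v = v ∨ d₂ • v = -v) →
      (¬ ∀ u : V, d₁ • u = u → e • u = u) →
      (d₂ • v = v ∧ ∀ u : V, d₁ • u = u → e • u = d₂ • u) ∨
      (d₂ • v = -v ∧ ∀ u : V, d₁ • u = u → e • u = -(d₂ • u)) := by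
    intro e he h2 h3 h4 h5
    have h6 := h.commOn_of_smul_eq F.d₂_mem he hv h4 (Or.inl h3)
    rcases F.trivial_or h he h2 h6 hv hdv h3 with h7 | h7 | h7
    · exact absurd h7 h5
    · exact Or.inl h7.symm
    · exact Or.inr h7.symm
  have aux2 : (d₂ • v = v ∨ d₂ • v = -v) → ∀ u : V, d₁ • u = u → c • u = c' • u := by
    intro h2 u hu
    have hcon : ¬ (d₂ • v = v ∧ d₂ • v = -v) := fun h3 =>
      hv (h.eq_zero_of_neg (h3.1.symm.trans h3.2))
    rcases aux hc h1 hcv h2 hn with h3 | h3 <;> rcases aux hc' h1' hcv' h2 hn' with h4 | h4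
    · rw [h3.2 u hu, h4.2 u hu]
    · exact absurd ⟨h3.1, h4.1⟩ hcon
    · exact absurd ⟨h4.1, h3.1⟩ hcon
    · rw [h3.2 u hu, h4.2 u hu]
  rcases h.commOn_or_antiOn F.d₂_mem hc with h2 | h2
  · rcases F.trivial_or h hc h1 h2 hv hdv hcv with h7 | h7 | h7
    · exact absurd h7 hn
    · exact aux2 (Or.inl h7.2)
    · exact aux2 (Or.inr h7.2)
  rcases h.commOn_or_antiOn F.d₂_mem hc' with h2' | h2'
  · rcases F.trivial_or h hc' h1' h2' hv hdv hcv' with h7 | h7 | h7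
    · exact absurd h7 hn'
    · exact aux2 (Or.inl h7.2)
    · exact aux2 (Or.inr h7.2)
  have hsq := h.sqOn_of_smul_eq hc hv hcv
  have k1 : CommOn V d₁ (c * c') := fun u => by rw [mul_smul, mul_smul, h1, h1']
  have k2 : CommOn V d₂ (c * c') := fun u => by rw [mul_smul, mul_smul, h2, h2', smul_neg, neg_neg]
  rcases F.trivial_or h (mul_mem hc hc') k1 k2 hv hdv (by rw [mul_smul, hcv', hcv])
    with h7 | h7 | h7
  · intro u hu
    have := h7 u hu
    rw [mul_smul] at this
    rw [← this, hsq, this]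
  · exact aux2 (Or.inl h7.2)
  · exact aux2 (Or.inr h7.2)

/-- The analogue of `Frame.unique` for the `-1`-eigenspace of `d₁`. -/
theorem Frame.unique_neg (h : EvenHeisenberg p V B z) (F : Frame B d₁ b₁ d₂ b₂ x a)
    (hc : c ∈ B) (hc' : c' ∈ B) (h1 : CommOn V d₁ c) (h1' : CommOn V d₁ c') {v : V} (hv : v ≠ 0)
    (hdv : d₁ • v = -v) (hcv : c • v = v) (hcv' : c' • v = v)
    (hn : ¬ ∀ u : V, d₁ • u = -u → c • u = u) (hn' : ¬ ∀ u : V, d₁ • u = -u → c' • u = u) :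
    ∀ u : V, d₁ • u = -u → c • u = c' • u := by
  have conj : ∀ (e : G) (u : V), (b₁ * e * b₁⁻¹) • b₁ • u = b₁ • e • u := fun e u => by
    rw [mul_smul, mul_smul, inv_smul_smul]
  have conj' : ∀ (e : G) (u : V), (b₁ * e * b₁⁻¹) • u = b₁ • e • b₁⁻¹ • u := fun e u => by
    rw [mul_smul, mul_smul]
  have hinv : ∀ u : V, b₁⁻¹ • u = b₁ • u := fun u => by rw [inv_smul_eq_iff, F.b₁_sq]
  have hb : ∀ u : V, d₁ • u = -u → d₁ • b₁ • u = b₁ • u := fun u hu => by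
    rw [F.d₁_b₁, hu, smul_neg, neg_neg]
  have hmem : ∀ {e}, e ∈ B → b₁ * e * b₁⁻¹ ∈ B := fun he => h.normal _ _ he
  have hcomm : ∀ {e}, CommOn V d₁ e → CommOn V d₁ (b₁ * e * b₁⁻¹) := fun he u => by
    rw [conj', conj', hinv, hinv, F.d₁_b₁, he, F.d₁_b₁, smul_neg, smul_neg, neg_neg]
  have hnt : ∀ {e}, (¬ ∀ u : V, d₁ • u = -u → e • u = u) →
      ¬ ∀ u : V, d₁ • u = u → (b₁ * e * b₁⁻¹) • u = u := fun he h2 => he fun u hu => by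
    have := h2 _ (hb u hu)
    rwa [conj, smul_left_cancel_iff] at this
  intro u hu
  have := F.unique h (hmem hc) (hmem hc') (hcomm h1) (hcomm h1')
    ((smul_ne_zero_iff_ne b₁).2 hv) (hb v hdv) (by rw [conj, hcv]) (by rw [conj, hcv'])
    (hnt hn) (hnt hn') _ (hb u hu)
  rwa [conj, conj, smul_left_cancel_iff] at this

/-- Every operator of a noncentral involution of `B` commuting with `d` extends from the
`-1`-eigenspace of `d` by the identity. -/
def Bad (V : Type*) {G : Type*} [Group G] [AddCommGroup V] [DistribMulAction G V] (B : Subgroup G)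
    (d : G) : Prop :=
  ∀ β ∈ B, ∀ γ ∈ B, SqOn V β → CommOn V d β → CommOn V d γ → AntiOn V β γ →
    ∃ g : G, (∀ u : V, d • u = u → g • u = u) ∧ ∀ u : V, d • u = -u → g • u = β • u

/-- A second vector for the fixed space of `d₁` which is not an eigenvector of `β`. -/
theorem Frame.exists_not_eigen (h : EvenHeisenberg p V B z)
    (F : Frame B d₁ b₁ d₂ b₂ x a) {β γ : G} (hβ : β ∈ B)
    (hβd : CommOn V d₁ β) (hγd : CommOn V d₁ γ) (hβγ : AntiOn V β γ) :
    ∃ e : V, d₁ • e = e ∧ d₂ • e = e ∧ (∀ v ∈ spanTwo x a, v ∈ spanTwo x e) ∧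
      β • (e + b₂ • x) ≠ e + b₂ • x ∧ β • (e + b₂ • x) ≠ -(e + b₂ • x) := by
  have hspan : ∀ k : ℤ, ∀ v ∈ spanTwo x a, v ∈ spanTwo x (a + k • x) := by
    rintro k _ ⟨m, n, rfl⟩
    exact ⟨m - n * k, n, by rw [sub_zsmul, smul_add, mul_zsmul]; abel⟩
  have hbx : d₂ • b₂ • x = -(b₂ • x) := by rw [F.d₂_b₂, F.d₂_x]
  have hbx0 : b₂ • x ≠ 0 := (smul_ne_zero_iff_ne b₂).2 F.x_ne
  have hd1 : ∀ k : ℤ, d₁ • (a + k • x) = a + k • x := fun k => by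
    rw [smul_add, smul_zsmul_comm, F.d₁_a, F.d₁_x]
  have hd2 : ∀ k : ℤ, d₂ • (a + k • x) = a + k • x := fun k => by
    rw [smul_add, smul_zsmul_comm, F.d₂_a, F.d₂_x]
  rcases h.commOn_or_antiOn F.d₂_mem hβ with h2 | h2
  · obtain ⟨k, hk⟩ : ∃ k : ℤ, a + k • x ≠ 0 := by
      by_cases ha : a = 0
      · exact ⟨1, by rw [ha, zero_add, one_zsmul]; exact F.x_ne⟩
      · exact ⟨0, by rwa [zero_zsmul, add_zero]⟩
    have hy1 : d₁ • (a + k • x + b₂ • x) = a + k • x + b₂ • x := by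
      rw [smul_add, hd1, F.d₁_b₂, F.d₁_x]
    have hy0 : a + k • x + b₂ • x ≠ 0 := fun h0 => hk (h.eq_of_add_eq (hd2 k) hbx (b₀ := 0)
      (b₁ := 0) (smul_zero _) (by simp) (by rw [h0, add_zero])).1
    have hnon : ∀ β' ∈ B, CommOn V d₁ β' → CommOn V d₂ β' → AntiOn V β' γ →
        β' • (a + k • x + b₂ • x) ≠ a + k • x + b₂ • x := by
      intro β' hβ' k1 k2 k3 k4
      rcases F.trivial_or h hβ' k1 k2 hy0 hy1 k4 with h7 | ⟨-, h7⟩ | ⟨-, h7⟩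
      · have := k3 x
        rw [h7 x F.d₁_x, h7 (γ • x) (by rw [hγd, F.d₁_x])] at this
        exact F.x_ne ((smul_eq_zero_iff_eq γ).1 (h.eq_zero_of_neg this))
      · rw [smul_add, hd2, hbx, add_right_inj] at h7
        exact hbx0 (h.eq_zero_of_neg h7.symm)
      · rw [smul_add, hd2, hbx, neg_add, add_left_inj] at h7
        exact hk (h.eq_zero_of_neg h7)
    refine ⟨a + k • x, hd1 k, hd2 k, hspan k, hnon β hβ hβd h2 hβγ, fun h3 => ?_⟩
    refine hnon (z * β) (mul_mem h.mem hβ) (hβd.mul_neg h) (h2.mul_neg h) (fun v => ?_)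
      (by rw [mul_smul, h.neg, h3, neg_neg])
    rw [mul_smul, mul_smul, h.neg, h.neg, hβγ, smul_neg]
  · by_contra hcon
    push Not at hcon
    have key : ∀ k : ℤ, β • (a + k • x) = b₂ • x ∨ β • (a + k • x) = -(b₂ • x) := by
      intro k
      have k0 : d₂ • β • (a + k • x) = -(β • (a + k • x)) := by rw [h2, hd2]
      have k1 : d₂ • β • b₂ • x = β • b₂ • x := by rw [h2, hbx, smul_neg, neg_neg]
      by_cases h3 : β • (a + k • x + b₂ • x) = a + k • x + b₂ • x
      · left
        rw [smul_add, add_comm] at h3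
        exact (h.eq_of_add_eq k1 k0 (hd2 k) hbx h3).2
      · right
        have h4 := hcon _ (hd1 k) (hd2 k) (hspan k) h3
        rw [smul_add, add_comm, neg_add] at h4
        exact (h.eq_of_add_eq k1 k0 (by rw [smul_neg, hd2]) (by rw [smul_neg, hbx]) h4).2
    have e1 : ∀ k l : ℤ, β • (a + k • x) = β • (a + l • x) → k • x = l • x := fun k l hkl => by
      rwa [smul_left_cancel_iff, add_right_inj] at hkl
    have n01 : (0 : ℤ) • x ≠ (1 : ℤ) • x := by
      rw [zero_zsmul, one_zsmul]; exact F.x_ne.symm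
    have n02 : (0 : ℤ) • x ≠ (2 : ℤ) • x := by
      rw [zero_zsmul]
      exact fun h0 => F.x_ne (h.eq_zero_of_two (by rw [two_nsmul, ← two_zsmul, ← h0]))
    have n12 : (1 : ℤ) • x ≠ (2 : ℤ) • x := by
      rw [one_zsmul, two_zsmul]; exact fun h0 => F.x_ne (by simpa using h0.symm)
    rcases key 0 with q0 | q0 <;> rcases key 1 with q1 | q1 <;> rcases key 2 with q2 | q2
    · exact n01 (e1 _ _ (q0.trans q1.symm))
    · exact n01 (e1 _ _ (q0.trans q1.symm))
    · exact n02 (e1 _ _ (q0.trans q2.symm))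
    · exact n12 (e1 _ _ (q1.trans q2.symm))
    · exact n12 (e1 _ _ (q1.trans q2.symm))
    · exact n02 (e1 _ _ (q0.trans q2.symm))
    · exact n01 (e1 _ _ (q0.trans q1.symm))
    · exact n01 (e1 _ _ (q0.trans q1.symm))

theorem mul_self_of_sqOn (h : EvenHeisenberg p V B z) (hc : c ∈ B) (hs : SqOn V c) (hx : x ≠ 0) :
    c * c = 1 := by
  refine (h.sq c hc).resolve_right fun h1 => hx (h.eq_zero_of_neg ?_)
  rw [← h.neg, ← h1, mul_smul, hs]

theorem anti_of_antiOn (h : EvenHeisenberg p V B z) (hc : c ∈ B) (hd : d ∈ B) (ha : AntiOn V c d)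
    (hx : x ≠ 0) : c * d = z * (d * c) := by
  refine (h.comm c hc d hd).resolve_left fun h1 => hx ?_
  have := ha x
  rw [← mul_smul, h1, mul_smul] at this
  exact (smul_eq_zero_iff_eq c).1 ((smul_eq_zero_iff_eq d).1 (h.eq_zero_of_neg this))

theorem Frame.isBaseOn (h : EvenHeisenberg p V B z) (F : Frame B d₁ b₁ d₂ b₂ x a) {e : V}
    (he1 : d₁ • e = e) (he2 : d₂ • e = e) (hspan : ∀ v ∈ spanTwo x a, v ∈ spanTwo x e) :
    IsBaseOn ((fixedIn (⊤ : AddSubgroup V) d₁).setStab G) (fixedIn ⊤ d₁) x (e + b₂ • x) := by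
  have hd : d₂ ∈ B ⊓ (fixedIn (⊤ : AddSubgroup V) d₁).setStab G := ⟨F.d₂_mem, fun v => by
    simp only [mem_fixedIn, AddSubgroup.mem_top, true_and]
    rw [F.d₁_d₂, smul_left_cancel_iff]⟩
  have hb : b₂ ∈ B ⊓ (fixedIn (⊤ : AddSubgroup V) d₁).setStab G := ⟨F.b₂_mem, fun v => by
    simp only [mem_fixedIn, AddSubgroup.mem_top, true_and]
    rw [F.d₁_b₂, smul_left_cancel_iff]⟩
  have hx : x ∈ fixedIn (fixedIn (⊤ : AddSubgroup V) d₁) d₂ := ⟨⟨trivial, F.d₁_x⟩, F.d₂_x⟩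
  have hreg : IsRegOn B (fixedIn (fixedIn (⊤ : AddSubgroup V) d₁) d₂) x := fun c hc hcx v hv =>
    F.reg c hc.1 (h.commOn_of_smul_eq F.d₁_mem hc.1 F.x_ne (Or.inl F.d₁_x) (Or.inl hcx))
      (h.commOn_of_smul_eq F.d₂_mem hc.1 F.x_ne (Or.inl F.d₂_x) (Or.inl hcx)) x F.x_ne F.d₁_x
      F.d₂_x hcx v hv.1.2 hv.2
  exact h.smul_eq_of_base hd (h.mul_self_of_sqOn F.d₂_mem F.d₂_sq F.x_ne) hb
    (h.anti_of_antiOn F.d₂_mem F.b₂_mem F.d₂_b₂ F.x_ne) hx F.x_ne ⟨⟨trivial, he1⟩, he2⟩ hx F.x_ne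
    hreg hreg fun g _ hgx hge v hv =>
      smul_eq_of_mem_spanTwo hgx hge (hspan v (F.span v hv.1.2 hv.2))

end EvenHeisenberg

namespace EvenHeisenberg

variable {p : ℕ} {G V : Type*} [Group G] [AddCommGroup V] [DistribMulAction G V]
  {B : Subgroup G} {z : G} {b c c' d d₁ b₁ d₂ b₂ : G} {x a : V}

theorem Frame.decomp_neg (h : EvenHeisenberg p V B z) (F : Frame B d₁ b₁ d₂ b₂ x a) (u : V) :
    ∃ v w : V, d₁ • v = v ∧ d₁ • w = -w ∧ u = v + w := by
  obtain ⟨v, -, w, -, h1, h2, h3⟩ := h.exists_add (U := ⊤) (d := d₁)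
    ⟨F.d₁_mem, by rw [AddSubgroup.setStab_top]; trivial⟩
    (h.mul_self_of_sqOn F.d₁_mem F.d₁_sq F.x_ne) (v := u) trivial
  exact ⟨v, w, h1, h2, h3⟩

theorem Frame.good_of_not_bad (h : EvenHeisenberg p V B z)
    (F : Frame B d₁ b₁ d₂ b₂ x a) (hC : ∀ g : G, g • x = x → CommOn V d₁ g)
    (hbad : ¬ Bad V B d₁) : Good B (⊤ : AddSubgroup V) := by
  unfold Bad at hbad
  push Not at hbad
  obtain ⟨β, hβ, γ, hγ, hβ2, hβd, hγd, hβγ, hno⟩ := hbad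
  obtain ⟨e, he1, he2, hspan, hne1, hne2⟩ := F.exists_not_eigen h hβ hβd hγd hβγ
  have hbase := F.isBaseOn h he1 he2 hspan
  set y₀ := e + b₂ • x with hy₀
  have hy1 : d₁ • y₀ = y₀ := by rw [hy₀, smul_add, he1, F.d₁_b₂, F.d₁_x]
  have hy0 : y₀ ≠ 0 := by
    intro h0
    rw [h0, smul_zero] at hne1
    exact hne1 rfl
  -- a fixed vector of `β` in the `-1`-eigenspace
  obtain ⟨y₁, hy₁d, hy₁0, hy₁β⟩ : ∃ y : V, d₁ • y = -y ∧ y ≠ 0 ∧ β • y = y := by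
    have hu : d₁ • b₁ • x = -(b₁ • x) := by rw [F.d₁_b₁, F.d₁_x]
    have hu0 : b₁ • x ≠ 0 := (smul_ne_zero_iff_ne b₁).2 F.x_ne
    by_cases h0 : b₁ • x + β • b₁ • x = 0
    · refine ⟨γ • b₁ • x, by rw [hγd, hu, smul_neg], (smul_ne_zero_iff_ne γ).2 hu0, ?_⟩
      rw [hβγ, eq_neg_of_add_eq_zero_right h0, smul_neg, neg_neg]
    · exact ⟨_, by rw [smul_add, hβd, hu, smul_neg, neg_add], h0, by
        rw [smul_add, hβ2, add_comm]⟩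
  have hβn : ¬ ∀ u : V, d₁ • u = -u → β • u = u := fun h1 => by
    have h2 := hβγ y₁
    rw [h1 (γ • y₁) (by rw [hγd, hy₁d, smul_neg]), hy₁β] at h2
    exact hy₁0 ((smul_eq_zero_iff_eq γ).1 (h.eq_zero_of_neg h2))
  have hb1 : ∀ u : V, d₁ • u = u → d₁ • b₁ • u = -(b₁ • u) := fun u hu => by rw [F.d₁_b₁, hu]
  -- an element of `B` trivial on the `-1`-eigenspace is a scalar on the fixed space
  have hscal : ∀ c ∈ B, (∀ u : V, d₁ • u = -u → c • u = u) →
      (∀ u : V, d₁ • u = u → c • u = u) ∨ ∀ u : V, d₁ • u = u → c • u = -u := by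
    intro c hc h1
    rcases h.commOn_or_antiOn hc F.b₁_mem with h2 | h2
    · left
      intro u hu
      have := h1 _ (hb1 u hu)
      rwa [h2, smul_left_cancel_iff] at this
    · right
      intro u hu
      have := h1 _ (hb1 u hu)
      rwa [h2, ← smul_neg, smul_left_cancel_iff, neg_eq_iff_eq_neg] at this
  have hreg : IsRegOn B (⊤ : AddSubgroup V) (y₀ + y₁) := by
    intro c hc hcy v _
    have hc := hc.1
    rw [smul_add] at hcy
    rcases h.commOn_or_antiOn F.d₁_mem hc with h1 | h1
    · obtain ⟨k0, k1⟩ := h.eq_of_add_eq (by rw [h1, hy1]) (by rw [h1, hy₁d, smul_neg]) hy1 hy₁d hcy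
      by_cases hcn : ∀ u : V, d₁ • u = -u → c • u = u
      · rcases hscal c hc hcn with h2 | h2
        · obtain ⟨v₀, v₁, e0, e1, rfl⟩ := F.decomp_neg h v
          rw [smul_add, h2 v₀ e0, hcn v₁ e1]
        · have := h2 _ hy1
          rw [k0] at this
          exact absurd (h.eq_zero_of_neg this) hy0
      · exfalso
        have h2 := F.unique_neg h hβ hc hβd h1 hy₁0 hy₁d hy₁β k1 hβn hcn
        rcases hscal (β * c) (mul_mem hβ hc) (fun u hu => by
          rw [mul_smul, ← h2 u hu, hβ2]) with h3 | h3
        · have := h3 y₀ hy1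
          rw [mul_smul, k0] at this
          exact hne1 this
        · have := h3 y₀ hy1
          rw [mul_smul, k0] at this
          exact hne2 this
    · exfalso
      obtain ⟨k0, k1⟩ := h.eq_of_add_eq (a₀ := c • y₁) (a₁ := c • y₀)
        (by rw [h1, hy₁d, smul_neg, neg_neg]) (by rw [h1, hy1]) hy1 hy₁d (by rw [← hcy, add_comm])
      rw [← k1] at hy₁β
      rcases h.commOn_or_antiOn hβ hc with h2 | h2
      · rw [h2, smul_left_cancel_iff] at hy₁β
        exact hne1 hy₁β
      · rw [h2, ← smul_neg, smul_left_cancel_iff, neg_eq_iff_eq_neg] at hy₁β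
        exact hne2 hy₁β
  have hyne : y₀ + y₁ ≠ 0 := fun h0 => hy0 (h.eq_of_add_eq hy1 hy₁d (b₀ := 0) (b₁ := 0)
    (smul_zero _) (by simp) (by rw [h0, add_zero])).1
  refine ⟨y₀ + y₁, trivial, x, trivial, y₀ + y₁, trivial, F.x_ne, hyne, ?_, hreg, hreg, ?_⟩
  · intro g _ hgy hgx
    have hgd := hC g hgx
    rw [smul_add] at hgy
    obtain ⟨k0, k1⟩ := h.eq_of_add_eq (by rw [hgd, hy1]) (by rw [hgd, hy₁d, smul_neg]) hy1 hy₁d hgy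
    have gtriv := hbase g (fun v => by
      simp only [mem_fixedIn, AddSubgroup.mem_top, true_and]
      rw [hgd, smul_left_cancel_iff]) hgx k0
    have gtriv' : ∀ u : V, d₁ • u = u → g • u = u := fun u hu => gtriv u ⟨trivial, hu⟩
    -- the operator induced by `g` on the `-1`-eigenspace
    have hinv : ∀ u : V, b₁⁻¹ • u = b₁ • u := fun u => by rw [inv_smul_eq_iff, F.b₁_sq]
    have hδ : ∀ u : V, d₁ • u = -u → g • u = (g * b₁ * g⁻¹ * b₁) • u := fun u hu => by
      have h1 : d₁ • b₁ • u = b₁ • u := by rw [F.d₁_b₁, hu, smul_neg, neg_neg]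
      rw [mul_smul, mul_smul, mul_smul, inv_smul_eq_self_of (gtriv' _ h1), F.b₁_sq]
    have hδB : g * b₁ * g⁻¹ * b₁ ∈ B := mul_mem (h.normal _ _ F.b₁_mem) F.b₁_mem
    have hginv : CommOn V d₁ g⁻¹ := fun u => by
      rw [eq_inv_smul_iff, ← hgd, smul_inv_smul]
    have hδd : CommOn V d₁ (g * b₁ * g⁻¹ * b₁) := fun u => by
      simp only [mul_smul]
      rw [hgd, F.d₁_b₁, hginv, F.d₁_b₁, smul_neg, smul_neg, smul_neg, smul_neg, neg_neg]
    have htriv : ∀ u : V, d₁ • u = -u → (g * b₁ * g⁻¹ * b₁) • u = u := by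
      by_contra hcon
      have h2 := F.unique_neg h hδB hβ hδd hβd hy₁0 hy₁d (by rw [← hδ _ hy₁d, k1]) hy₁β hcon hβn
      obtain ⟨u, hu1, hu2⟩ := hno g gtriv'
      exact hu2 ((hδ u hu1).trans (h2 u hu1))
    intro v _
    obtain ⟨v₀, v₁, e0, e1, rfl⟩ := F.decomp_neg h v
    rw [smul_add, gtriv' v₀ e0, hδ v₁ e1, htriv v₁ e1]
  · intro c hc hcx
    rcases h.commOn_or_antiOn F.d₁_mem hc.1 with h1 | h1
    · exact hy₁0 (h.eq_of_add_eq (a₀ := c • x) (a₁ := 0) (by rw [h1, F.d₁_x]) (by simp) hy1 hy₁d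
        (by rw [hcx, add_zero])).2.symm
    · exact hy0 (h.eq_of_add_eq (a₀ := 0) (a₁ := c • x) (by simp) (by rw [h1, F.d₁_x]) hy1 hy₁d
        (by rw [hcx, zero_add])).1.symm

end EvenHeisenberg

set_option synthInstance.maxSize 1000 in
/-- A group of order prime to `3` permuting three points fixes one of them. -/
theorem exists_fixed_of_three {G X : Type*} [Group G] (h3 : ¬ 3 ∣ Nat.card G)
    (K : Subgroup G) (ρ : G →* Equiv.Perm X) (t : Fin 3 → X) (ht : Function.Injective t)
    (hK : ∀ k ∈ K, ∀ i, ∃ j, ρ k (t i) = t j) : ∃ i, ∀ k ∈ K, ρ k (t i) = t i := by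
  have : ∀ k : K, ∃ σ : Equiv.Perm (Fin 3), ∀ i, ρ k (t i) = t (σ i) := by
    intro k
    choose f hf using hK k k.2
    have hinj : Function.Injective f := fun i j hij => by
      have := (hf i).trans ((congrArg t hij).trans (hf j).symm)
      exact ht ((ρ k).injective this)
    exact ⟨Equiv.ofBijective f (Finite.injective_iff_bijective.1 hinj), hf⟩
  choose σ hσ using this
  have hmul : ∀ k l : K, σ (k * l) = σ k * σ l := fun k l => by
    ext1 i
    apply ht
    rw [← hσ, Subgroup.coe_mul, map_mul, Equiv.Perm.mul_apply, hσ, hσ, Equiv.Perm.mul_apply]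
  have hone : σ 1 = 1 := by simpa using hmul 1 1
  have hpow : ∀ (k : K) (n : ℕ), σ (k ^ n) = σ k ^ n := fun k n => by
    induction n with
    | zero => simp [hone]
    | succ n ih => rw [pow_succ, pow_succ, hmul, ih]
  have hfix : ∀ k : K, ∃ i, σ k i = i := by
    intro k
    have hcop : Nat.Coprime 3 (orderOf (k : G)) := by
      rw [Nat.Prime.coprime_iff_not_dvd Nat.prime_three]
      exact fun h => h3 (h.trans (orderOf_dvd_natCard _))
    rw [Subgroup.orderOf_coe] at hcop
    obtain ⟨m, hm⟩ := exists_pow_eq_self_of_coprime hcop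
    have h1 : (σ k ^ 3) ^ m = σ k := by rw [← hpow, ← hpow, hm]
    have h2 : ∀ τ : Equiv.Perm (Fin 3), (∃ i, τ i = i) ∨ τ ^ 3 = 1 := by decide
    rcases h2 (σ k) with h2 | h2
    · exact h2
    · rw [h2, one_pow] at h1
      exact ⟨0, by rw [← h1]; rfl⟩
  by_contra hcon
  push Not at hcon
  have hmove : ∀ i, ∃ k : K, σ k i ≠ i := fun i => by
    obtain ⟨k, hk, hne⟩ := hcon i
    exact ⟨⟨k, hk⟩, fun h => hne (by rw [hσ ⟨k, hk⟩, h])⟩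
  obtain ⟨k₀, h0⟩ := hmove 0
  obtain ⟨k₁, h1⟩ := hmove 1
  obtain ⟨k₂, h2⟩ := hmove 2
  have key : ∀ τ₀ τ₁ τ₂ : Equiv.Perm (Fin 3), τ₀ 0 ≠ 0 → τ₁ 1 ≠ 1 → τ₂ 2 ≠ 2 →
      ¬ ((∃ i, τ₀ i = i) ∧ (∃ i, τ₁ i = i) ∧ (∃ i, τ₂ i = i) ∧ (∃ i, (τ₀ * τ₁) i = i) ∧
        (∃ i, (τ₀ * τ₂) i = i) ∧ ∃ i, (τ₁ * τ₂) i = i) := by decide +kernel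
  refine key _ _ _ h0 h1 h2 ⟨hfix _, hfix _, hfix _, ?_, ?_, ?_⟩
  all_goals rw [← hmul]; exact hfix _

namespace EvenHeisenberg

variable {p : ℕ} {G V : Type*} [Group G] [AddCommGroup V] [DistribMulAction G V]
  {B : Subgroup G} {z : G} {b c c' d d₁ b₁ d₂ b₂ : G} {x a : V}

theorem Frame.ext (h : EvenHeisenberg p V B z) (F : Frame B d₁ b₁ d₂ b₂ x a)
    (he : ∀ e : V, d₁ • e = e → d₂ • e = e → c • e = c' • e ∧ c • b₂ • e = c' • b₂ • e ∧
      c • b₁ • e = c' • b₁ • e ∧ c • b₁ • b₂ • e = c' • b₁ • b₂ • e) (u : V) : c • u = c' • u := by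
  obtain ⟨v, w, hv, hw, rfl⟩ := F.decomp_neg h u
  obtain ⟨e, f, he1, he2, hf1, hf2, rfl⟩ := F.decomp h hv
  obtain ⟨e', f', he1', he2', hf1', hf2', hw'⟩ := F.decomp h (u := b₁ • w)
    (by rw [F.d₁_b₁, hw, smul_neg, neg_neg])
  have hw2 : w = b₁ • e' + b₁ • b₂ • f' := by rw [← smul_add, ← hw', F.b₁_sq]
  rw [hw2]
  simp only [smul_add]
  rw [(he e he1 he2).1, (he f hf1 hf2).2.1, (he e' he1' he2').2.2.1, (he f' hf1' hf2').2.2.2]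

theorem Frame.centralizer (h : EvenHeisenberg p V B z) (F : Frame B d₁ b₁ d₂ b₂ x a)
    (hc : c ∈ B) (hcx : c • x = x) :
    (∀ u : V, c • u = u) ∨ (∀ u : V, c • u = d₁ • u) ∨ (∀ u : V, c • u = d₂ • u) ∨
      ∀ u : V, c • u = d₁ • d₂ • u := by
  have h1 := h.commOn_of_smul_eq F.d₁_mem hc F.x_ne (Or.inl F.d₁_x) (Or.inl hcx)
  have h2 := h.commOn_of_smul_eq F.d₂_mem hc F.x_ne (Or.inl F.d₂_x) (Or.inl hcx)
  have ht := F.reg c hc h1 h2 x F.x_ne F.d₁_x F.d₂_x hcx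
  rcases h.commOn_or_antiOn hc F.b₁_mem with h3 | h3 <;>
    rcases h.commOn_or_antiOn hc F.b₂_mem with h4 | h4
  · refine Or.inl fun u => ?_
    have := F.ext h (c := c) (c' := 1) (fun e he1 he2 => ?_) u
    · rwa [one_smul] at this
    · simp only [h3 _, h4 _, ht e he1 he2, one_smul, and_self]
  · refine Or.inr (Or.inr (Or.inl fun u => F.ext h (fun e he1 he2 => ?_) u))
    simp only [h3 _, h4 _, ht e he1 he2, he2, ← F.b₁_d₂ _, F.d₂_b₂ _, smul_neg, and_self]
  · refine Or.inr (Or.inl fun u => F.ext h (fun e he1 he2 => ?_) u)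
    simp only [h3 _, h4 _, ht e he1 he2, he1, F.d₁_b₂ _, F.d₁_b₁ _, and_self]
  · refine Or.inr (Or.inr (Or.inr fun u => ?_))
    rw [← mul_smul]
    refine F.ext h (fun e he1 he2 => ?_) u
    simp only [mul_smul, h3 _, h4 _, ht e he1 he2, he1, he2, F.d₁_b₂ _, F.d₁_b₁ _, ← F.b₁_d₂ _,
      F.d₂_b₂ _, smul_neg, neg_neg, and_self]

theorem Frame.good_or_bad (h : EvenHeisenberg p V B z) (h3 : p = 3)
    (F : Frame B d₁ b₁ d₂ b₂ x a) :
    Good B (⊤ : AddSubgroup V) ∨ Bad V B d₁ ∨ Bad V B d₂ ∨ Bad V B (d₁ * d₂) := by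
  let φ := MulAction.toPermHom G V
  have hφ : ∀ (g : G) (v : V), φ g v = g • v := fun g v => rfl
  let ρ : G →* Equiv.Perm (Equiv.Perm V) := (MulAut.toPerm _).comp (MulAut.conj.comp φ)
  have hρ : ∀ g k : G, ρ g (φ k) = φ (g * k * g⁻¹) := fun g k => by
    simp only [map_mul, map_inv]; rfl
  have hext : ∀ g k : G, φ g = φ k ↔ ∀ v : V, g • v = k • v := fun g k => Equiv.ext_iff
  have hcomm : ∀ g k : G, ρ g (φ k) = φ k → CommOn V k g := fun g k hgk v => by
    rw [hρ, hext] at hgk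
    have := hgk (g • v)
    rwa [mul_smul, mul_smul, inv_smul_smul, eq_comm] at this
  have hb1 : b₁ • x ≠ 0 := (smul_ne_zero_iff_ne b₁).2 F.x_ne
  have hb2 : b₂ • x ≠ 0 := (smul_ne_zero_iff_ne b₂).2 F.x_ne
  have m1 : d₁ • b₁ • x = -(b₁ • x) := by rw [F.d₁_b₁, F.d₁_x]
  have m2 : d₂ • b₁ • x = b₁ • x := by rw [← F.b₁_d₂, F.d₂_x]
  have m3 : d₁ • b₂ • x = b₂ • x := by rw [F.d₁_b₂, F.d₁_x]
  have m4 : d₂ • b₂ • x = -(b₂ • x) := by rw [F.d₂_b₂, F.d₂_x]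
  have e1 : b₁ • x ≠ -(b₁ • x) := fun h0 => hb1 (h.eq_zero_of_neg h0)
  have e2 : b₂ • x ≠ -(b₂ • x) := fun h0 => hb2 (h.eq_zero_of_neg h0)
  let s : Fin 3 → G := ![d₁, d₂, d₁ * d₂]
  have hs : ∀ i, s i ∈ B ∧ s i • x = x ∧ ¬ ∀ u : V, s i • u = u := by
    intro i
    fin_cases i
    · exact ⟨F.d₁_mem, F.d₁_x, fun h0 => e1 ((h0 _).symm.trans m1)⟩
    · exact ⟨F.d₂_mem, F.d₂_x, fun h0 => e2 ((h0 _).symm.trans m4)⟩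
    · refine ⟨mul_mem F.d₁_mem F.d₂_mem, ?_, fun h0 => e1 ((h0 _).symm.trans ?_)⟩
      · change (d₁ * d₂) • x = x
        rw [mul_smul, F.d₂_x, F.d₁_x]
      · change (d₁ * d₂) • b₁ • x = _
        rw [mul_smul, m2, m1]
  have hinj : Function.Injective fun i => φ (s i) := by
    intro i j hij
    have h1 := (hext _ _).1 hij (b₁ • x)
    have h2 := (hext _ _).1 hij (b₂ • x)
    fin_cases i <;> fin_cases j <;> first | rfl | exfalso
    all_goals simp [s, mul_smul, m1, m2, m3, m4, e1, e2, e1.symm, e2.symm, smul_neg] at h1 h2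
  obtain ⟨i, hi⟩ := exists_fixed_of_three (by rw [← h3]; exact h.not_dvd)
    (MulAction.stabilizer G x) ρ (fun i => φ (s i)) hinj (by
      intro k hk i
      rw [MulAction.mem_stabilizer_iff] at hk
      obtain ⟨hB, hx, hn⟩ := hs i
      simp only [hρ, hext]
      rcases F.centralizer h (h.normal k _ hB)
        (by rw [mul_smul, mul_smul, inv_smul_eq_self_of hk, hx, hk]) with h1 | h1 | h1 | h1
      · refine absurd (fun u => ?_) hn
        have := h1 (k • u)
        rwa [mul_smul, mul_smul, inv_smul_smul, smul_left_cancel_iff] at this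
      · exact ⟨0, h1⟩
      · exact ⟨1, h1⟩
      · exact ⟨2, fun v => by rw [h1]; exact (mul_smul _ _ _).symm⟩)
  have hi' : ∀ g : G, g • x = x → CommOn V (s i) g := fun g hg => hcomm g _ (hi g hg)
  by_contra! hcon
  obtain ⟨hg, n1, n2, n3⟩ := hcon
  fin_cases i
  · exact hg (F.good_of_not_bad h hi' n1)
  · exact hg (F.swap.good_of_not_bad h hi' n2)
  · exact hg (F.mul_left.good_of_not_bad h hi' n3)

/-- Two commuting bad involutions with dual involutions lead to an element of order `3`. -/
theorem not_bad_pair (h : EvenHeisenberg p V B z) (h3 : p = 3) (hx : x ≠ 0)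
    {d d' β γ : G} (hd : d ∈ B) (hd' : d' ∈ B) (hβ : β ∈ B) (hγ : γ ∈ B) (hdd : CommOn V d d')
    (hds : SqOn V d) (hds' : SqOn V d') (hβs : SqOn V β) (hγs : SqOn V γ)
    (hdβ : CommOn V d β) (hdβ' : AntiOn V d' β) (hdγ : AntiOn V d γ) (hdγ' : CommOn V d' γ)
    (hb : Bad V B d) (hb' : Bad V B d') : False := by
  -- conjugating by the extension of `β` maps `d'` to `d' * d`
  have key : ∀ {d d' β : G}, d ∈ B → d' ∈ B → β ∈ B → CommOn V d d' → SqOn V d → SqOn V d' →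
      SqOn V β → CommOn V d β → AntiOn V d' β → Bad V B d → ∃ g : G, CommOn V d g ∧
        ∀ v : V, g • d' • v = d' • d • g • v := by
    intro d d' β hd hd' hβ hdd hds hds' hβs hdβ hdβ' hb
    obtain ⟨g, hg0, hg1⟩ := hb β hβ d' hd' hβs hdβ hdd hdβ'.symm
    have hdec : ∀ u : V, ∃ v w : V, d • v = v ∧ d • w = -w ∧ u = v + w := fun u => by
      obtain ⟨v, -, w, -, h1, h2, h3⟩ := h.exists_add (U := ⊤) (d := d)
        ⟨hd, by rw [AddSubgroup.setStab_top]; trivial⟩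
        (h.mul_self_of_sqOn hd hds hx) (v := u) trivial
      exact ⟨v, w, h1, h2, h3⟩
    have hgd : CommOn V d g := fun u => by
      obtain ⟨v, w, hv, hw, rfl⟩ := hdec u
      rw [smul_add, smul_add, smul_add, smul_add, hg0 v hv, hg1 w hw, hv, hw, hg0 v hv, smul_neg,
        hg1 w hw, hdβ, hw, smul_neg]
    refine ⟨g, hgd, fun u => ?_⟩
    obtain ⟨v, w, hv, hw, rfl⟩ := hdec u
    simp only [smul_add]
    rw [hg0 v hv, hg1 w hw, hg0 (d' • v) (by rw [hdd, hv]),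
      hg1 (d' • w) (by rw [hdd, hw, smul_neg]),
      hv, hdβ, hw, smul_neg, smul_neg, hdβ', neg_neg]
  obtain ⟨g, hg, hgd⟩ := key hd hd' hβ hdd hds hds' hβs hdβ hdβ' hb
  obtain ⟨k, hk, hkd⟩ := key hd' hd hγ hdd.symm hds' hds hγs hdγ' hdγ hb'
  have s1 : ∀ v : V, (g * k) • d • v = d' • (g * k) • v := fun v => by
    rw [mul_smul, mul_smul, hkd, ← hg, hgd, hdd, hds]
  have s2 : ∀ v : V, (g * k) • d' • v = d' • d • (g * k) • v := fun v => by
    rw [mul_smul, mul_smul, ← hk, hgd]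
  have s3 : ∀ v : V, (g * k) ^ 3 • d • v = d • (g * k) ^ 3 • v := fun v => by
    simp only [pow_succ, pow_zero, one_mul, mul_smul (g * k * (g * k)), mul_smul (g * k) (g * k)]
    rw [s1, s2, s2, s1, ← hdd, hds']
  have hcop : Nat.Coprime 3 (orderOf (g * k)) := by
    rw [Nat.Prime.coprime_iff_not_dvd Nat.prime_three, ← h3]
    exact fun h0 => h.not_dvd (h0.trans (orderOf_dvd_natCard _))
  obtain ⟨m, hm⟩ := exists_pow_eq_self_of_coprime hcop
  have s4 : ∀ (n : ℕ) (v : V), ((g * k) ^ 3) ^ n • d • v = d • ((g * k) ^ 3) ^ n • v := by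
    intro n
    induction n with
    | zero => simp
    | succ n ih => intro v; rw [pow_succ, mul_smul, s3, ih, mul_smul]
  have s5 : ∀ v : V, d' • v = d • v := fun v => by
    have h1 := s4 m ((g * k)⁻¹ • v)
    rwa [hm, s1, smul_inv_smul] at h1
  have h1 := hdβ' x
  rw [s5, s5, hdβ] at h1
  exact hx ((smul_eq_zero_iff_eq d).1 ((smul_eq_zero_iff_eq β).1 (h.eq_zero_of_neg h1)))

theorem Bad.conj (h : EvenHeisenberg p V B z) (hb : Bad V B d) {g : G}
    (hg : ∀ v : V, g • d • v = c • g • v) : Bad V B c := by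
  intro β hβ γ hγ hβs hcβ hcγ hβγ
  have hconj : ∀ e : G, ∀ v : V, (g⁻¹ * e * g⁻¹⁻¹) • v = g⁻¹ • e • g • v := fun e v => by
    rw [mul_smul, mul_smul, inv_inv]
  have hd : ∀ v : V, d • v = g⁻¹ • c • g • v := fun v => by rw [eq_inv_smul_iff, hg]
  obtain ⟨k, hk0, hk1⟩ := hb _ (h.normal g⁻¹ β hβ) _ (h.normal g⁻¹ γ hγ)
    (fun v => by rw [hconj, hconj, smul_inv_smul, hβs, inv_smul_smul])
    (fun v => by rw [hconj, hconj, hd, hd, smul_inv_smul, smul_inv_smul, hcβ])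
    (fun v => by rw [hconj, hconj, hd, hd, smul_inv_smul, smul_inv_smul, hcγ])
    (fun v => by
      rw [hconj, hconj, hconj, hconj, smul_inv_smul, smul_inv_smul, hβγ, smul_neg])
  refine ⟨g * k * g⁻¹, fun u hu => ?_, fun u hu => ?_⟩
  · rw [mul_smul, mul_smul, hk0 _ (by rw [hd, smul_inv_smul, hu]), smul_inv_smul]
  · rw [mul_smul, mul_smul, hk1 _ (by rw [hd, smul_inv_smul, hu, smul_neg]), hconj, smul_inv_smul,
      smul_inv_smul]

theorem Frame.good_of_bad (h : EvenHeisenberg p V B z) (h3 : p = 3)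
    (F : Frame B d₁ b₁ d₂ b₂ x a) (hb : Bad V B d₁) : Good B (⊤ : AddSubgroup V) := by
  obtain ⟨g, hg0, hg1⟩ := hb d₂ F.d₂_mem b₂ F.b₂_mem F.d₂_sq F.d₁_d₂ F.d₁_b₂ F.d₂_b₂
  have hg : ∀ v : V, g • b₁ • v = (b₁ * d₂) • g • v := fun u => by
    obtain ⟨v, w, hv, hw, rfl⟩ := F.decomp_neg h u
    rw [smul_add, smul_add, smul_add, smul_add, hg0 v hv, hg1 w hw,
      hg1 (b₁ • v) (by rw [F.d₁_b₁, hv]), hg0 (b₁ • w) (by rw [F.d₁_b₁, hw, smul_neg, neg_neg]),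
      mul_smul, mul_smul, F.d₂_sq, F.b₁_d₂]
  have hg' : ∀ v : V, g⁻¹ • (b₁ * d₂) • v = b₁ • g⁻¹ • v := fun v => by
    rw [inv_smul_eq_iff, hg, smul_inv_smul]
  -- the involutions `b₁` and `b₁ * d₂` are not both bad
  have hnot : Bad V B b₁ → Bad V B (b₁ * d₂) → False := by
    refine h.not_bad_pair h3 F.x_ne F.b₁_mem (mul_mem F.b₁_mem F.d₂_mem) F.b₂_mem
      (mul_mem F.d₁_mem F.b₂_mem) (fun v => ?_) F.b₁_sq (fun v => ?_) F.b₂_sq (fun v => ?_)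
      F.b₁_b₂ (fun v => ?_) (fun v => ?_) (fun v => ?_)
    · simp only [mul_smul, F.b₁_d₂ _]
    · simp only [mul_smul, ← F.b₁_d₂ _, F.d₂_sq _, F.b₁_sq _]
    · simp only [mul_smul, F.d₁_b₂ _, F.d₁_sq _, F.b₂_sq _]
    · simp only [mul_smul, F.d₂_b₂ _, F.b₁_b₂ _, smul_neg]
    · simp only [mul_smul, F.d₁_b₁.symm _, F.b₁_b₂ _]
    · simp only [mul_smul, ← F.d₁_d₂ _, F.d₂_b₂ _, F.d₁_b₁.symm _, F.b₁_b₂ _, smul_neg, neg_neg]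
  rcases (F.rotate h).good_or_bad h h3 with h1 | h1 | h1 | h1
  · exact h1
  · exact (hnot h1 (h1.conj h hg)).elim
  · exact (h.not_bad_pair h3 F.x_ne F.d₁_mem F.d₂_mem F.b₂_mem F.b₁_mem F.d₁_d₂ F.d₁_sq F.d₂_sq
      F.b₂_sq F.b₁_sq F.d₁_b₂ F.d₂_b₂ F.d₁_b₁ F.b₁_d₂.symm hb h1).elim
  · exact (hnot (h1.conj h hg') h1).elim

theorem Frame.good_of_three (h : EvenHeisenberg p V B z) (h3 : p = 3)
    (F : Frame B d₁ b₁ d₂ b₂ x a) : Good B (⊤ : AddSubgroup V) := by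
  rcases F.good_or_bad h h3 with h1 | h1 | h1 | h1
  · exact h1
  · exact F.good_of_bad h h3 h1
  · exact F.swap.good_of_bad h h3 h1
  · exact F.mul_left.good_of_bad h h3 h1

end EvenHeisenberg

namespace EvenHeisenberg

/-- Coordinates with respect to `u, b₂ u, b₁ u, b₁ b₂ u`. -/
abbrev Quad : Type := ZMod 5 × ZMod 5 × ZMod 5 × ZMod 5

/-- Multiplies by `-1` when `c` is true. -/
def Quad.sgn (c : Bool) (q : ZMod 5) : ZMod 5 := if c then -q else q

/-- The action of the monomial `m b₁ ^ a₁ b₂ ^ a₂ d₁ ^ c₁ d₂ ^ c₂` in coordinates. -/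
def Quad.op (m : ZMod 5) (a₁ a₂ c₁ c₂ : Bool) (q : Quad) : Quad :=
  let r₀ := m * q.1
  let r₁ := m * Quad.sgn c₂ q.2.1
  let r₂ := m * Quad.sgn c₁ q.2.2.1
  let r₃ := m * Quad.sgn c₁ (Quad.sgn c₂ q.2.2.2)
  match a₁, a₂ with
  | false, false => (r₀, r₁, r₂, r₃)
  | false, true => (r₁, r₀, r₃, r₂)
  | true, false => (r₂, r₃, r₀, r₁)
  | true, true => (r₃, r₂, r₁, r₀)

theorem Quad.op_regular : ∀ (m : ZMod 5) (a₁ a₂ c₁ c₂ : Bool),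
    Quad.op m a₁ a₂ c₁ c₂ (0, 1, 1, 1) = (0, 1, 1, 1) →
      m = 1 ∧ a₁ = false ∧ a₂ = false ∧ c₁ = false ∧ c₂ = false := by decide +kernel

theorem Quad.op_ne : ∀ (m : ZMod 5) (a₁ a₂ c₁ c₂ : Bool),
    Quad.op m a₁ a₂ c₁ c₂ (1, 0, 1, 3) ≠ (0, 1, 1, 1) := by decide +kernel

/-- Necessary conditions for a monomial to be a noncentral involution. -/
def Quad.IsInv (m : ZMod 5) (a₁ a₂ c₁ c₂ : Bool) : Prop :=
  (a₁ || a₂ || c₁ || c₂) = true ∧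
    Quad.op m a₁ a₂ c₁ c₂ (Quad.op m a₁ a₂ c₁ c₂ (1, 1, 1, 1)) = (1, 1, 1, 1)

instance (m : ZMod 5) (a₁ a₂ c₁ c₂ : Bool) : Decidable (Quad.IsInv m a₁ a₂ c₁ c₂) :=
  inferInstanceAs (Decidable (_ ∧ _))

set_option synthInstance.maxSize 1000 in
theorem Quad.op_rigid : ∀ (m : ZMod 5) (a₁ a₂ c₁ c₂ : Bool), Quad.IsInv m a₁ a₂ c₁ c₂ →
    ∀ (m' : ZMod 5) (a₁' a₂' c₁' c₂' : Bool), Quad.IsInv m' a₁' a₂' c₁' c₂' →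
    (1, 0, 1, 3) + (3 : ZMod 5) • Quad.op m a₁ a₂ c₁ c₂ (0, 1, 1, 1) =
      Quad.op m' a₁' a₂' c₁' c₂' (0, 1, 1, 1) →
    m = 2 ∧ a₁ = true ∧ a₂ = false ∧ c₁ = true ∧ c₂ = false := by decide +kernel

variable {p : ℕ} {G V : Type*} [Group G] [AddCommGroup V] [DistribMulAction G V]
  {B : Subgroup G} {z : G} {c j d₁ b₁ d₂ b₂ : G} {u : V}

/-- The vector with given coordinates. -/
def Quad.vec [Module (ZMod 5) V] (b₁ b₂ : G) (u : V) (q : Quad) : V :=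
  q.1 • u + q.2.1 • b₂ • u + q.2.2.1 • b₁ • u + q.2.2.2 • b₁ • b₂ • u

theorem smul_zmod_smul [Module (ZMod 5) V] (g : G) (m : ZMod 5) (v : V) :
    g • m • v = m • g • v :=
  ZMod.map_smul (DistribSMul.toAddMonoidHom V g) m v

theorem Frame.exists_smul (F : Frame B d₁ b₁ d₂ b₂ u 0) [Module (ZMod 5) V] {v : V}
    (h1 : d₁ • v = v) (h2 : d₂ • v = v) : ∃ m : ZMod 5, v = m • u := by
  obtain ⟨m, n, rfl⟩ := F.span v h1 h2
  exact ⟨m, by rw [smul_zero, add_zero, Int.cast_smul_eq_zsmul]⟩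

theorem Frame.exists_vec (h : EvenHeisenberg p V B z) [Module (ZMod 5) V]
    (F : Frame B d₁ b₁ d₂ b₂ u 0) (v : V) : ∃ q, v = Quad.vec b₁ b₂ u q := by
  obtain ⟨v, w, hv, hw, rfl⟩ := F.decomp_neg h v
  obtain ⟨e, f, he1, he2, hf1, hf2, rfl⟩ := F.decomp h hv
  obtain ⟨e', f', he1', he2', hf1', hf2', hw'⟩ := F.decomp h (u := b₁ • w)
    (by rw [F.d₁_b₁, hw, smul_neg, neg_neg])
  have hw2 : w = b₁ • e' + b₁ • b₂ • f' := by rw [← smul_add, ← hw', F.b₁_sq]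
  obtain ⟨m₀, rfl⟩ := F.exists_smul he1 he2
  obtain ⟨m₁, rfl⟩ := F.exists_smul hf1 hf2
  obtain ⟨m₂, rfl⟩ := F.exists_smul he1' he2'
  obtain ⟨m₃, rfl⟩ := F.exists_smul hf1' hf2'
  exact ⟨(m₀, m₁, m₂, m₃), by rw [hw2]; simp only [Quad.vec, smul_zmod_smul]; abel⟩

theorem Frame.vec_op (h : EvenHeisenberg p V B z) [Module (ZMod 5) V]
    (F : Frame B d₁ b₁ d₂ b₂ u 0) (hc : c ∈ B) : ∃ (m : ZMod 5) (a₁ a₂ c₁ c₂ : Bool),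
      ∀ q, c • Quad.vec b₁ b₂ u q = Quad.vec b₁ b₂ u (Quad.op m a₁ a₂ c₁ c₂ q) := by
  have e1 : ∃ a₁ : Bool, ∀ v : V, d₁ • c • v = if a₁ then -(c • d₁ • v) else c • d₁ • v := by
    rcases h.commOn_or_antiOn F.d₁_mem hc with h1 | h1
    exacts [⟨false, h1⟩, ⟨true, h1⟩]
  have e2 : ∃ a₂ : Bool, ∀ v : V, d₂ • c • v = if a₂ then -(c • d₂ • v) else c • d₂ • v := by
    rcases h.commOn_or_antiOn F.d₂_mem hc with h1 | h1
    exacts [⟨false, h1⟩, ⟨true, h1⟩]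
  have e3 : ∃ c₁ : Bool, ∀ v : V, c • b₁ • v = if c₁ then -(b₁ • c • v) else b₁ • c • v := by
    rcases h.commOn_or_antiOn hc F.b₁_mem with h1 | h1
    exacts [⟨false, h1⟩, ⟨true, h1⟩]
  have e4 : ∃ c₂ : Bool, ∀ v : V, c • b₂ • v = if c₂ then -(b₂ • c • v) else b₂ • c • v := by
    rcases h.commOn_or_antiOn hc F.b₂_mem with h1 | h1
    exacts [⟨false, h1⟩, ⟨true, h1⟩]
  obtain ⟨a₁, h1⟩ := e1
  obtain ⟨a₂, h2⟩ := e2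
  obtain ⟨c₁, h3⟩ := e3
  obtain ⟨c₂, h4⟩ := e4
  have e5 : ∃ m : ZMod 5, (if a₁ then b₁ else 1) • (if a₂ then b₂ else 1) • c • u = m • u := by
    refine F.exists_smul ?_ ?_ <;> cases a₁ <;> cases a₂ <;>
      simp [F.d₁_b₁ _, F.d₁_b₂ _, ← F.b₁_d₂ _, F.d₂_b₂ _, h1, h2, F.d₁_x, F.d₂_x, smul_neg]
  obtain ⟨m, hm⟩ := e5
  have e6 : c • u = (if a₁ then b₁ else 1) • (if a₂ then b₂ else 1) • m • u := by
    rw [← hm]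
    cases a₁ <;> cases a₂ <;> simp [← F.b₁_b₂ _, F.b₁_sq _, F.b₂_sq _]
  refine ⟨m, a₁, a₂, c₁, c₂, fun q => ?_⟩
  have s1 : b₁ • b₁ • u = u := F.b₁_sq u
  have s2 : b₂ • b₂ • u = u := F.b₂_sq u
  have s3 : b₁ • b₁ • b₂ • u = b₂ • u := F.b₁_sq _
  have s4 : b₂ • b₁ • u = b₁ • b₂ • u := (F.b₁_b₂ u).symm
  have s5 : b₂ • b₁ • b₂ • u = b₁ • u := by rw [← F.b₁_b₂, F.b₂_sq]
  cases a₁ <;> cases a₂ <;> cases c₁ <;> cases c₂ <;>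
    simp only [Quad.vec, Quad.op, Quad.sgn, smul_add, smul_zmod_smul, h3, h4, e6, if_true,
      if_false, Bool.false_eq_true, one_smul, s1, s2, s3, s4, s5, smul_neg, neg_neg] <;>
    generalize b₁ • b₂ • u = u₃ <;> generalize b₁ • u = u₂ <;> generalize b₂ • u = u₁ <;>
    module

theorem Frame.vec_injective (h : EvenHeisenberg p V B z) [Module (ZMod 5) V]
    (F : Frame B d₁ b₁ d₂ b₂ u 0) : Function.Injective (Quad.vec b₁ b₂ u) := by
  have : Fact (Nat.Prime 5) := ⟨Nat.prime_five⟩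
  have key : ∀ q : Quad, Quad.vec b₁ b₂ u q = 0 → q = 0 := by
    rintro ⟨q₀, q₁, q₂, q₃⟩ hq
    have hz : ∀ {v : V}, v + v = 0 → v = 0 := fun {v} hv => h.eq_zero_of_two (by rwa [two_nsmul])
    have i1 : d₁ • b₁ • u = -(b₁ • u) := by rw [F.d₁_b₁, F.d₁_x]
    have i2 : d₂ • b₁ • u = b₁ • u := by rw [← F.b₁_d₂, F.d₂_x]
    have i3 : d₁ • b₂ • u = b₂ • u := by rw [F.d₁_b₂, F.d₁_x]
    have i4 : d₂ • b₂ • u = -(b₂ • u) := by rw [F.d₂_b₂, F.d₂_x]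
    have i5 : d₁ • b₁ • b₂ • u = -(b₁ • b₂ • u) := by rw [F.d₁_b₁, i3]
    have i6 : d₂ • b₁ • b₂ • u = -(b₁ • b₂ • u) := by rw [← F.b₁_d₂, i4, smul_neg]
    simp only [Quad.vec] at hq
    have h1 := congrArg (d₁ • ·) hq
    have h2 := congrArg (d₂ • ·) hq
    have h3 := congrArg (d₂ • ·) h1
    simp only [smul_add, smul_zmod_smul, smul_zero, smul_neg, F.d₁_x, F.d₂_x, i1, i2, i3, i4,
      i5, i6, neg_neg] at h1 h2 h3
    have n1 : b₁ • u ≠ 0 := (smul_ne_zero_iff_ne b₁).2 F.x_ne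
    have n2 : b₂ • u ≠ 0 := (smul_ne_zero_iff_ne b₂).2 F.x_ne
    have n3 : b₁ • b₂ • u ≠ 0 := (smul_ne_zero_iff_ne b₁).2 n2
    have n0 := F.x_ne
    clear i1 i2 i3 i4 i5 i6
    generalize b₁ • b₂ • u = u₃ at *
    generalize b₁ • u = u₂ at *
    generalize b₂ • u = u₁ at *
    have r0 : q₀ • u = 0 := hz <| hz <| by linear_combination (norm := module) hq + h1 + h2 + h3
    have r1 : q₁ • u₁ = 0 := hz <| hz <| by linear_combination (norm := module) hq + h1 - h2 - h3
    have r2 : q₂ • u₂ = 0 := hz <| hz <| by linear_combination (norm := module) hq - h1 + h2 - h3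
    have r3 : q₃ • u₃ = 0 := hz <| hz <| by linear_combination (norm := module) hq - h1 - h2 + h3
    rw [smul_eq_zero_iff_left ‹_›] at r0 r1 r2 r3
    rw [r0, r1, r2, r3]; rfl
  intro q q' hq
  rw [← sub_eq_zero]
  refine key _ ?_
  rw [← sub_eq_zero] at hq
  rw [← hq]
  simp only [Quad.vec, Prod.fst_sub, Prod.snd_sub, sub_smul]
  abel

theorem Quad.vec_add [Module (ZMod 5) V] (q q' : Quad) :
    Quad.vec b₁ b₂ u (q + q') = Quad.vec b₁ b₂ u q + Quad.vec b₁ b₂ u q' := by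
  simp only [Quad.vec, Prod.fst_add, Prod.snd_add, add_smul]
  abel

theorem Quad.vec_smul [Module (ZMod 5) V] (m : ZMod 5) (q : Quad) :
    Quad.vec b₁ b₂ u (m • q) = m • Quad.vec b₁ b₂ u q := by
  simp only [Quad.vec, Prod.smul_fst, Prod.smul_snd, smul_add, smul_eq_mul, mul_smul]

theorem Quad.op_smul (m : ZMod 5) (q : Quad) : Quad.op m false false false false q = m • q := rfl

theorem Frame.good_of_five (h : EvenHeisenberg p V B z) (h5 : p = 5)
    (F : Frame B d₁ b₁ d₂ b₂ u 0) (hj : j ∈ B) (hju : j • u = (2 : ℕ) • u) :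
    Good B (⊤ : AddSubgroup V) := by
  subst h5
  let _ : Module (ZMod 5) V := AddCommGroup.zmodModule h.nsmul
  have hinj := F.vec_injective h
  have i1 : d₁ • b₁ • u = -(b₁ • u) := by rw [F.d₁_b₁, F.d₁_x]
  have i2 : d₂ • b₁ • u = b₁ • u := by rw [← F.b₁_d₂, F.d₂_x]
  have i3 : d₁ • b₂ • u = b₂ • u := by rw [F.d₁_b₂, F.d₁_x]
  have i4 : d₂ • b₂ • u = -(b₂ • u) := by rw [F.d₂_b₂, F.d₂_x]
  have i5 : d₁ • b₁ • b₂ • u = -(b₁ • b₂ • u) := by rw [F.d₁_b₁, i3]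
  have i6 : d₂ • b₁ • b₂ • u = -(b₁ • b₂ • u) := by rw [← F.b₁_d₂, i4, smul_neg]
  have hd1 : ∀ q, d₁ • Quad.vec b₁ b₂ u q =
      Quad.vec b₁ b₂ u (Quad.op 1 false false true false q) := fun q => by
    simp only [Quad.vec, Quad.op, Quad.sgn, smul_add, smul_zmod_smul, F.d₁_x, i1, i3, i5]
    simp
  have hd2 : ∀ q, d₂ • Quad.vec b₁ b₂ u q =
      Quad.vec b₁ b₂ u (Quad.op 1 false false false true q) := fun q => by
    simp only [Quad.vec, Quad.op, Quad.sgn, smul_add, smul_zmod_smul, F.d₂_x, i2, i4, i6]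
    simp
  have hb1 : ∀ q, b₁ • Quad.vec b₁ b₂ u q =
      Quad.vec b₁ b₂ u (Quad.op 1 true false false false q) := fun q => by
    simp only [Quad.vec, Quad.op, Quad.sgn, smul_add, smul_zmod_smul, F.b₁_sq _]
    simp
    abel
  have hbeta : ∃ c ∈ B, ∀ q, c • Quad.vec b₁ b₂ u q =
      Quad.vec b₁ b₂ u (Quad.op 2 true false true false q) := by
    obtain ⟨m, a₁, a₂, c₁, c₂, hq⟩ := F.vec_op h hj
    have h0 := hq (1, 0, 0, 0)
    have h1 : j • Quad.vec b₁ b₂ u (1, 0, 0, 0) = Quad.vec b₁ b₂ u (2, 0, 0, 0) := by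
      simp only [Quad.vec, one_smul, zero_smul, add_zero, hju]
      rw [two_nsmul, two_smul]
    have h2 : ∀ (m : ZMod 5) (a₁ a₂ c₁ c₂ : Bool), Quad.op m a₁ a₂ c₁ c₂ (1, 0, 0, 0) =
      (2, 0, 0, 0) → m = 2 ∧ a₁ = false ∧ a₂ = false := by decide +kernel
    obtain ⟨rfl, rfl, rfl⟩ := h2 _ _ _ _ _ (hinj (h0.symm.trans h1))
    cases c₁ <;> cases c₂
    · refine ⟨b₁ * d₁ * j, mul_mem (mul_mem F.b₁_mem F.d₁_mem) hj, fun q => ?_⟩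
      simp only [mul_smul, hq, hd1, hb1]
      simp [Quad.op, Quad.sgn]
    · refine ⟨b₁ * d₁ * d₂ * j, mul_mem (mul_mem (mul_mem F.b₁_mem F.d₁_mem) F.d₂_mem) hj,
        fun q => ?_⟩
      simp only [mul_smul, hq, hd1, hd2, hb1]
      simp [Quad.op, Quad.sgn]
    · refine ⟨b₁ * j, mul_mem F.b₁_mem hj, fun q => ?_⟩
      simp only [mul_smul, hq, hb1]
      simp [Quad.op, Quad.sgn]
    · refine ⟨b₁ * d₂ * j, mul_mem (mul_mem F.b₁_mem F.d₂_mem) hj, fun q => ?_⟩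
      simp only [mul_smul, hq, hd2, hb1]
      simp [Quad.op, Quad.sgn]
  obtain ⟨β, hβ, hβq⟩ := hbeta
  have hinv : ∀ c ∈ B, SqOn V c → (¬ ∃ m : ZMod 5, ∀ v : V, c • v = m • v) →
      ∃ (m : ZMod 5) (a₁ a₂ c₁ c₂ : Bool), Quad.IsInv m a₁ a₂ c₁ c₂ ∧
      ∀ q, c • Quad.vec b₁ b₂ u q = Quad.vec b₁ b₂ u (Quad.op m a₁ a₂ c₁ c₂ q) := by
    intro c hc hs hn
    obtain ⟨m, a₁, a₂, c₁, c₂, hq⟩ := F.vec_op h hc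
    refine ⟨m, a₁, a₂, c₁, c₂, ⟨?_, hinj ?_⟩, hq⟩
    · by_contra! hcon
      simp only [ne_eq, Bool.or_eq_true, not_or, Bool.not_eq_true] at hcon
      obtain ⟨⟨⟨rfl, rfl⟩, rfl⟩, rfl⟩ := hcon
      refine hn ⟨m, fun v => ?_⟩
      obtain ⟨q, rfl⟩ := F.exists_vec h v
      rw [hq, Quad.op_smul, Quad.vec_smul]
    · rw [← hq, ← hq, hs]
  have hconj : ∀ (g c : G), c ∈ B → SqOn V c → (¬ ∃ m : ZMod 5, ∀ v : V, c • v = m • v) →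
      g * c * g⁻¹ ∈ B ∧ SqOn V (g * c * g⁻¹) ∧
        ¬ ∃ m : ZMod 5, ∀ v : V, (g * c * g⁻¹) • v = m • v := by
    intro g c hc hs hn
    refine ⟨h.normal g c hc, fun v => ?_, fun ⟨m, hm⟩ => hn ⟨m, fun v => ?_⟩⟩
    · simp only [mul_smul, inv_smul_smul, hs _, smul_inv_smul]
    · have := hm (g • v)
      rwa [mul_smul, mul_smul, inv_smul_smul, ← smul_zmod_smul, smul_left_cancel_iff] at this
  have hβs : SqOn V β := fun v => by
    obtain ⟨q, rfl⟩ := F.exists_vec h v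
    rw [hβq, hβq]
    congr 1
    revert q
    decide +kernel
  have hβn : ¬ ∃ m : ZMod 5, ∀ v : V, β • v = m • v := fun ⟨m, hm⟩ => by
    have := hm (Quad.vec b₁ b₂ u (1, 0, 0, 0))
    rw [hβq, ← Quad.vec_smul] at this
    revert m
    have key : ∀ m : ZMod 5, Quad.op 2 true false true false (1, 0, 0, 0) ≠ m • (1, 0, 0, 0) := by
      decide +kernel
    exact fun m _ h => key m (hinj h)
  have hdn : ¬ ∃ m : ZMod 5, ∀ v : V, d₂ • v = m • v := fun ⟨m, hm⟩ => by
    have := hm (Quad.vec b₁ b₂ u (1, 1, 0, 0))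
    rw [hd2, ← Quad.vec_smul] at this
    revert m
    have key : ∀ m : ZMod 5, Quad.op 1 false false false true (1, 1, 0, 0) ≠ m • (1, 1, 0, 0) := by
      decide +kernel
    exact fun m _ h => key m (hinj h)
  have hz : Quad.vec b₁ b₂ u 0 = 0 := by simp [Quad.vec]
  have hreg : IsRegOn B ⊤ (Quad.vec b₁ b₂ u (0, 1, 1, 1)) := by
    intro c hc hcx v _
    obtain ⟨m, a₁, a₂, c₁, c₂, hq⟩ := F.vec_op h hc.1
    rw [hq] at hcx
    obtain ⟨rfl, rfl, rfl, rfl, rfl⟩ := Quad.op_regular _ _ _ _ _ (hinj hcx)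
    obtain ⟨q, rfl⟩ := F.exists_vec h v
    rw [hq, Quad.op_smul, one_smul]
  refine ⟨Quad.vec b₁ b₂ u (0, 1, 1, 1), trivial, Quad.vec b₁ b₂ u (1, 0, 1, 3), trivial,
    Quad.vec b₁ b₂ u (0, 1, 1, 1), trivial, ?_, ?_, ?_, hreg, hreg, ?_⟩
  · rw [← hz]
    exact fun h0 => absurd (hinj h0) (by decide)
  · rw [← hz]
    exact fun h0 => absurd (hinj h0) (by decide)
  · intro g _ hgx hgy v _
    obtain ⟨k1, k2, k3⟩ := hconj g β hβ hβs hβn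
    obtain ⟨l1, l2, l3⟩ := hconj g d₂ F.d₂_mem F.d₂_sq hdn
    obtain ⟨m, a₁, a₂, c₁, c₂, hP, hq⟩ := hinv _ k1 k2 k3
    obtain ⟨m', a₁', a₂', c₁', c₂', hQ, hq'⟩ := hinv _ l1 l2 l3
    have hr : d₂ • Quad.vec b₁ b₂ u (0, 1, 1, 1) = Quad.vec b₁ b₂ u (1, 0, 1, 3) +
        (3 : ZMod 5) • β • Quad.vec b₁ b₂ u (0, 1, 1, 1) := by
      rw [hd2, hβq, ← Quad.vec_smul, ← Quad.vec_add]
      congr 1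
    have hr' : (g * d₂ * g⁻¹) • Quad.vec b₁ b₂ u (0, 1, 1, 1) = Quad.vec b₁ b₂ u (1, 0, 1, 3) +
        (3 : ZMod 5) • (g * β * g⁻¹) • Quad.vec b₁ b₂ u (0, 1, 1, 1) := by
      simp only [mul_smul, inv_smul_eq_self_of hgx]
      rw [hr, smul_add, hgy, smul_zmod_smul]
    rw [hq, hq', ← Quad.vec_smul, ← Quad.vec_add] at hr'
    obtain ⟨rfl, rfl, rfl, rfl, rfl⟩ :=
      Quad.op_rigid _ _ _ _ _ hP _ _ _ _ _ hQ (hinj hr').symm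
    have hg : ∀ q, g • Quad.vec b₁ b₂ u q = Quad.vec b₁ b₂ u q →
        g • Quad.vec b₁ b₂ u (Quad.op 2 true false true false q) =
          Quad.vec b₁ b₂ u (Quad.op 2 true false true false q) := by
      intro q hgq
      nth_rewrite 1 [← hβq]
      rw [← hq, mul_smul, mul_smul, inv_smul_eq_self_of hgq]
    have hgx' := hg _ hgx
    have hgy' := hg _ hgy
    have hsolve : ∀ q : Quad, ∃ s t s' t' : ZMod 5, q = s • (0, 1, 1, 1) + t • (1, 0, 1, 3) +
        s' • Quad.op 2 true false true false (0, 1, 1, 1) +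
        t' • Quad.op 2 true false true false (1, 0, 1, 3) := by
      rintro ⟨q₀, q₁, q₂, q₃⟩
      refine ⟨3 * q₀ + 3 * q₂ + 3 * q₃, q₁ + 3 * q₂ + q₃, q₀ + q₁ + 4 * q₂,
        q₀ + 2 * q₁ + 3 * q₃, ?_⟩
      revert q₀ q₁ q₂ q₃
      decide +kernel
    obtain ⟨q, rfl⟩ := F.exists_vec h v
    obtain ⟨s, t, s', t', rfl⟩ := hsolve q
    simp only [Quad.vec_add, Quad.vec_smul, smul_add, smul_zmod_smul, hgx, hgy, hgx', hgy']
  · intro c hc hcy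
    obtain ⟨m, a₁, a₂, c₁, c₂, hq⟩ := F.vec_op h hc.1
    rw [hq] at hcy
    exact Quad.op_ne _ _ _ _ _ (hinj hcy)

end EvenHeisenberg

/-- The action of the setwise stabilizer of `U` on `U`. -/
instance AddSubgroup.setStabAction {G V : Type*} [Group G] [AddCommGroup V] [DistribMulAction G V]
    (U : AddSubgroup V) : DistribMulAction (U.setStab G) U where
  smul h v := ⟨h.1 • v.1, (h.2 v.1).2 v.2⟩
  one_smul _ := Subtype.ext (one_smul _ _)
  mul_smul _ _ _ := Subtype.ext (mul_smul _ _ _)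
  smul_zero _ := Subtype.ext (smul_zero _)
  smul_add _ _ _ := Subtype.ext (smul_add _ _ _)

theorem AddSubgroup.setStab_coe_smul {G V : Type*} [Group G] [AddCommGroup V]
    [DistribMulAction G V] {U : AddSubgroup V} (g : U.setStab G) (v : U) :
    ((g • v : U) : V) = (g : G) • (v : V) := rfl

namespace EvenHeisenberg

variable {p : ℕ} {G V : Type*} [Group G] [AddCommGroup V] [DistribMulAction G V]
  {B : Subgroup G} {z : G} {U : AddSubgroup V} {b c d e d₁ b₁ d₂ b₂ : G} {x a : V}

theorem restrict (h : EvenHeisenberg p V B z) (U : AddSubgroup V) :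
    EvenHeisenberg p U (B.subgroupOf (U.setStab G)) ⟨z, h.neg_mem_stab.2⟩ where
  prime := h.prime
  odd := h.odd
  nsmul v := Subtype.ext (h.nsmul v.1)
  not_dvd h' := h.not_dvd (h'.trans (Subgroup.card_subgroup_dvd_card _))
  normal g b hb := h.normal g.1 b.1 hb
  mem := h.mem
  neg v := Subtype.ext (h.neg v.1)
  mul_self := Subtype.ext h.mul_self
  cent g := Subtype.ext (h.cent g.1)
  comm a ha b hb := by
    simp only [Subtype.ext_iff]
    exact h.comm a.1 ha b.1 hb
  sq b hb := by
    simp only [Subtype.ext_iff]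
    exact h.sq b.1 hb

theorem irred_restrict (hirr : IsIrredOn (B ⊓ U.setStab G) U) :
    IsIrredOn (B.subgroupOf (U.setStab G)) (⊤ : AddSubgroup U) := by
  obtain ⟨x, hx, hx0⟩ := (U.bot_or_exists_ne_zero).resolve_left hirr.1
  refine ⟨fun h0 => hx0 ?_, fun W _ hW => ?_⟩
  · have : (⟨x, hx⟩ : U) ∈ (⊤ : AddSubgroup U) := trivial
    rw [h0, AddSubgroup.mem_bot] at this
    exact congrArg Subtype.val this
  · have key := hirr.2 (W.map U.subtype) (by rintro _ ⟨w, -, rfl⟩; exact w.2) (by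
      rintro b hb _ ⟨w, hw, rfl⟩
      exact ⟨(⟨b, hb.2⟩ : U.setStab G) • w, hW _ hb.1 w hw, rfl⟩)
    rcases key with h1 | h1
    · left
      rwa [AddSubgroup.map_eq_bot_iff_of_injective _ U.subtype_injective] at h1
    · right
      rw [eq_top_iff]
      rintro ⟨v, hv⟩ -
      obtain ⟨w, hw, hwv⟩ : v ∈ W.map U.subtype := by rwa [h1]
      have : w = ⟨v, hv⟩ := Subtype.ext hwv
      rwa [← this]

theorem good_of_restrict (hg : Good (B.subgroupOf (U.setStab G)) (⊤ : AddSubgroup U)) :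
    Good B U := by
  obtain ⟨x, -, y, -, w, -, hy, hw, hbase, hx, hwr, hne⟩ := hg
  rw [AddSubgroup.setStab_top] at hbase
  simp only [IsRegOn, AddSubgroup.setStab_top, inf_top_eq] at hx hwr hne
  refine ⟨x, x.2, y, y.2, w, w.2, fun h0 => hy (Subtype.ext h0), fun h0 => hw (Subtype.ext h0),
    fun g hg hgx hgy v hv => ?_, fun g hg hgx v hv => ?_, fun g hg hgx v hv => ?_,
    fun g hg hgy => ?_⟩
  · exact congrArg Subtype.val
      (hbase ⟨g, hg⟩ trivial (Subtype.ext hgx) (Subtype.ext hgy) ⟨v, hv⟩ trivial)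
  · exact congrArg Subtype.val (hx ⟨g, hg.2⟩ hg.1 (Subtype.ext hgx) ⟨v, hv⟩ trivial)
  · exact congrArg Subtype.val (hwr ⟨g, hg.2⟩ hg.1 (Subtype.ext hgx) ⟨v, hv⟩ trivial)
  · exact hne ⟨g, hg.2⟩ hg.1 (Subtype.ext hgy)

theorem coe_mem_spanTwo {x a v : U} (hv : v ∈ spanTwo x a) : (v : V) ∈ spanTwo (x : V) (a : V) := by
  obtain ⟨m, n, rfl⟩ := hv
  exact ⟨m, n, rfl⟩

theorem isSmall_of_restrict (hs : IsSmall p (B.subgroupOf (U.setStab G)) (⊤ : AddSubgroup U)) :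
    IsSmall p B U := by
  obtain ⟨x, -, a, -, hx0, hspan, hreg, hp⟩ := hs
  simp only [IsRegOn, AddSubgroup.setStab_top, inf_top_eq] at hreg hp
  refine ⟨x, x.2, a, a.2, fun h0 => hx0 (Subtype.ext h0), fun v hv => ?_,
    fun v hv hv0 g hg hgv w hw => ?_, ?_⟩
  · exact coe_mem_spanTwo (hspan (AddSubgroup.mem_top ⟨v, hv⟩))
  · exact congrArg Subtype.val (hreg ⟨v, hv⟩ trivial (fun h0 => hv0 (congrArg Subtype.val h0))
      ⟨g, hg.2⟩ hg.1 (Subtype.ext hgv) ⟨w, hw⟩ trivial)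
  · refine hp.imp_right fun ⟨h5, ha, j, hj, hjx⟩ => ⟨h5, ?_, j, ⟨hj, j.2⟩, ?_⟩
    · exact congrArg Subtype.val ha
    · exact congrArg Subtype.val hjx

theorem CommOn.mul_right (h1 : CommOn V c d) (h2 : CommOn V c e) : CommOn V c (d * e) :=
  fun v => by rw [mul_smul, h1, h2, mul_smul]

theorem AntiOn.mul_comm_right (h1 : AntiOn V c d) (h2 : CommOn V c e) : AntiOn V c (d * e) :=
  fun v => by rw [mul_smul, h1, h2, mul_smul]

theorem AntiOn.mul_right (h1 : AntiOn V c d) (h2 : AntiOn V c e) : CommOn V c (d * e) :=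
  fun v => by rw [mul_smul, h1, h2, mul_smul, smul_neg, neg_neg]

theorem SqOn.commOn_self (c : G) : CommOn V c c := fun _ => rfl

theorem commOn_of_eq (h1 : c * d = d * c) : CommOn V c d := fun v => by
  rw [← mul_smul, h1, mul_smul]

/-- An involution up to sign anticommuting with an involution can be made an involution. -/
theorem exists_sqOn (h : EvenHeisenberg p V B z) (hd : d ∈ B) (hb : b ∈ B) (hds : SqOn V d)
    (hdb : AntiOn V d b) : ∃ b' ∈ B, SqOn V b' ∧ AntiOn V d b' ∧
      ∀ c, CommOn V c d → CommOn V c b → CommOn V c b' := by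
  rcases h.sq b hb with h1 | h1
  · exact ⟨b, hb, fun v => by rw [← mul_smul, h1, one_smul], hdb, fun c _ hc => hc⟩
  · refine ⟨b * d, mul_mem hb hd, fun v => ?_, hdb.mul_comm_right (SqOn.commOn_self d),
      fun c h2 h3 => h3.mul_right h2⟩
    rw [mul_smul, mul_smul, hdb, smul_neg, ← mul_smul b b, h1, h.neg, neg_neg, hds]

/-- An involution whose fixed space is small. -/
def RankOne (p : ℕ) (V : Type*) {G : Type*} [Group G] [AddCommGroup V] [DistribMulAction G V]
    (B : Subgroup G) (z : G) : Prop :=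
  ∃ d ∈ B, ∃ b ∈ B, d * d = 1 ∧ d * b = z * (b * d) ∧ IsSmall p B (fixedIn (⊤ : AddSubgroup V) d)

theorem good_of_rankOne_restrict (h : EvenHeisenberg p V B z) (hd₁ : d₁ ∈ B) (hb₁ : b₁ ∈ B)
    (hd₁s : d₁ * d₁ = 1) (hdb₁ : d₁ * b₁ = z * (b₁ * d₁))
    (hr : RankOne p (fixedIn (⊤ : AddSubgroup V) d₁)
      (B.subgroupOf ((fixedIn (⊤ : AddSubgroup V) d₁).setStab G)) ⟨z, h.neg_mem_stab.2⟩) :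
    Good B (⊤ : AddSubgroup V) := by
  obtain ⟨d₂, hd₂, b₂, hb₂, hd₂s, hdb₂, x, hx, a, ha, hx0, hspan, hreg, hp⟩ := hr
  have hx0' : (x : V) ≠ 0 := fun h0 => hx0 (Subtype.ext h0)
  have hfix : ∀ w : fixedIn (⊤ : AddSubgroup V) d₁, d₁ • (w : V) = w := fun w => w.2.2
  have hcomm : ∀ c : (fixedIn (⊤ : AddSubgroup V) d₁).setStab G, (c : G) ∈ B →
      CommOn V d₁ c := fun c hc =>
    commOn_of_eq (h.commute_of_smul_eq hd₁ hc (hfix x) hx0' (hfix (c • x)))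
  have s1 : SqOn V d₁ := fun v => by rw [← mul_smul, hd₁s, one_smul]
  have s2 : SqOn V (d₂ : G) := fun v => by
    rw [← mul_smul, ← Subgroup.coe_mul, hd₂s, Subgroup.coe_one, one_smul]
  have a1 : AntiOn V d₁ b₁ := h.anti_smul hdb₁
  have a2 : AntiOn V (d₂ : G) b₂ := h.anti_smul (congrArg Subtype.val hdb₂)
  obtain ⟨b₂', hb₂', s3, a2', k2⟩ := h.exists_sqOn hd₂ hb₂ s2 a2
  have c1 : CommOn V d₁ d₂ := hcomm d₂ hd₂
  have c2 : CommOn V d₁ b₂' := k2 _ c1 (hcomm b₂ hb₂)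
  obtain ⟨b, hb, ab, cb⟩ : ∃ b ∈ B, AntiOn V d₁ b ∧ CommOn V d₂.1 b := by
    rcases h.commOn_or_antiOn hd₂ hb₁ with h1 | h1
    · exact ⟨b₁, hb₁, a1, h1⟩
    · exact ⟨b₁ * b₂', mul_mem hb₁ hb₂', a1.mul_comm_right c2, h1.mul_right a2'⟩
  obtain ⟨b', hb', ab', cb', cb''⟩ : ∃ b ∈ B, AntiOn V d₁ b ∧ CommOn V d₂.1 b ∧
      CommOn V b₂' b := by
    rcases h.commOn_or_antiOn hb₂' hb with h1 | h1
    · exact ⟨b, hb, ab, cb, h1⟩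
    · exact ⟨b * d₂, mul_mem hb hd₂, ab.mul_comm_right c1, cb.mul_right (SqOn.commOn_self _),
        h1.mul_right a2'.symm⟩
  obtain ⟨b₁', hb₁', s4, a1', k1⟩ := h.exists_sqOn hd₁ hb' s1 ab'
  have F : Frame B d₁ b₁' d₂ b₂' (x : V) (a : V) :=
    { d₁_mem := hd₁
      b₁_mem := hb₁'
      d₂_mem := hd₂
      b₂_mem := hb₂'
      d₁_sq := s1
      b₁_sq := s4
      d₂_sq := s2
      b₂_sq := s3
      d₁_b₁ := a1'
      d₂_b₂ := a2'
      d₁_d₂ := c1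
      d₁_b₂ := c2
      b₁_d₂ := (k1 _ c1.symm cb').symm
      b₁_b₂ := (k1 _ c2.symm cb'').symm
      d₁_x := hfix x
      d₂_x := congrArg Subtype.val hx.2
      d₁_a := hfix a
      d₂_a := congrArg Subtype.val ha.2
      x_ne := hx0'
      span := fun v h1 h2 => coe_mem_spanTwo
        (hspan (show (⟨v, trivial, h1⟩ : fixedIn (⊤ : AddSubgroup V) d₁) ∈ _ from
          ⟨trivial, Subtype.ext h2⟩))
      reg := by
        intro c hc h1 h2 v hv0 hv1 hv2 hcv w hw1 hw2
        have hst : c ∈ (fixedIn (⊤ : AddSubgroup V) d₁).setStab G := fun v => by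
          simp only [mem_fixedIn, AddSubgroup.mem_top, true_and]
          rw [h1, smul_left_cancel_iff]
        refine congrArg Subtype.val (hreg ⟨v, trivial, hv1⟩ ⟨trivial, Subtype.ext hv2⟩
          (fun h0 => hv0 (congrArg Subtype.val h0)) ⟨c, hst⟩ ⟨hc, fun v => ?_⟩
          (Subtype.ext hcv) ⟨w, trivial, hw1⟩ ⟨trivial, Subtype.ext hw2⟩)
        simp only [mem_fixedIn, AddSubgroup.mem_top, true_and, Subtype.ext_iff,
          AddSubgroup.setStab_coe_smul]
        rw [h2, smul_left_cancel_iff] }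
  rcases hp with h3 | ⟨h5, rfl, j, hj, hjx⟩
  · exact F.good_of_three h h3
  · exact Frame.good_of_five h h5 F (j := j) hj.1 (congrArg Subtype.val hjx)

theorem good_or_isSmall_or_rankOne (n : ℕ) : ∀ (G : Type u) (V : Type v) [Group G]
    [AddCommGroup V] [DistribMulAction G V] [Finite V] (p : ℕ) (B : Subgroup G) (z : G),
    Nat.card V < n → EvenHeisenberg p V B z → IsIrredOn B (⊤ : AddSubgroup V) →
    Good B (⊤ : AddSubgroup V) ∨ IsSmall p B (⊤ : AddSubgroup V) ∨ RankOne p V B z := by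
  induction n with
  | zero => exact fun _ _ _ _ _ _ _ _ _ hn => absurd hn (Nat.not_lt_zero _)
  | succ n ih =>
    intro G V _ _ _ _ p B z hn h hirr
    have hirr' : IsIrredOn (B ⊓ (⊤ : AddSubgroup V).setStab G) (⊤ : AddSubgroup V) := by
      rwa [AddSubgroup.setStab_top, inf_top_eq]
    by_cases hno : ∀ d ∈ B ⊓ (⊤ : AddSubgroup V).setStab G, d * d = 1 →
        ∀ b ∈ B ⊓ (⊤ : AddSubgroup V).setStab G, d * b = b * d
    · exact (h.good_or_isSmall_of_involutions_central hirr' hno).imp_right Or.inl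
    · push Not at hno
      obtain ⟨d, hd, hd2, b, hb, hdb⟩ := hno
      have hdb' := (h.comm d hd.1 b hb.1).resolve_left hdb
      obtain ⟨x, hx, hx0⟩ := ((⊤ : AddSubgroup V).bot_or_exists_ne_zero).resolve_left hirr.1
      have hne : fixedIn (⊤ : AddSubgroup V) d ≠ ⊤ := by
        intro h0
        have h1 : ∀ v : V, d • v = v := fun v =>
          (show v ∈ fixedIn (⊤ : AddSubgroup V) d by rw [h0]; trivial).2
        have h2 := h.anti_smul hdb' x
        rw [h1, h1] at h2
        exact hx0 ((smul_eq_zero_iff_eq b).1 (h.eq_zero_of_neg h2))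
      have hlt : Nat.card (fixedIn (⊤ : AddSubgroup V) d) < n := by
        have := AddSubgroup.card_le_card_addGroup (fixedIn (⊤ : AddSubgroup V) d)
        have h1 := lt_of_le_of_ne this fun h' => hne (AddSubgroup.eq_top_of_card_eq _ h')
        omega
      rcases ih _ _ p _ _ hlt (h.restrict (fixedIn (⊤ : AddSubgroup V) d))
        (irred_restrict (h.fixedIn_irred hirr' hd hd2 hb hdb')) with h1 | h1 | h1
      · exact Or.inl (h.good_step hd hd2 hb hdb' (good_of_restrict h1))
      · exact Or.inr (Or.inr ⟨d, hd.1, b, hb.1, hd2, hdb', isSmall_of_restrict h1⟩)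
      · exact Or.inl (h.good_of_rankOne_restrict hd.1 hb.1 hd2 hdb' h1)

theorem hasBase [Finite V] (h : EvenHeisenberg p V B z)
    (hirr : IsIrredOn B (⊤ : AddSubgroup V)) : HasBase G V := by
  have htop : ∀ g : G, g ∈ (⊤ : AddSubgroup V).setStab G := fun g => by
    rw [AddSubgroup.setStab_top]; trivial
  rcases good_or_isSmall_or_rankOne _ G V p B z (Nat.lt_succ_self _) h hirr with h1 | h1 | h1
  · obtain ⟨x, -, y, -, w, -, -, -, hb, -⟩ := h1
    exact ⟨x, y, fun g hx hy v => hb g (htop g) hx hy v trivial⟩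
  · obtain ⟨x, -, a, -, -, hs, -⟩ := h1
    exact ⟨x, a, fun g hx hy v => smul_eq_of_mem_spanTwo hx hy (hs (AddSubgroup.mem_top v))⟩
  · obtain ⟨d, hd, b, hb, hd2, hdb, x, hx, a, ha, hx0, hspan, hreg, -⟩ := h1
    have hb := h.smul_eq_of_base (U := ⊤) ⟨hd, htop d⟩ hd2 ⟨hb, htop b⟩ hdb hx hx0 ha hx hx0
      (hreg x hx hx0) (hreg x hx hx0)
      fun g _ hgx hga v hv => smul_eq_of_mem_spanTwo hgx hga (hspan hv)
    exact ⟨x, a + b • x, fun g hx hy v => hb g (htop g) hx hy v trivial⟩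

end EvenHeisenberg

section Homogeneous

variable {G V : Type*} [Group G] [AddCommGroup V] [DistribMulAction G V] {B : Subgroup G}
  {W : AddSubgroup V}

/-- `φ` commutes with the action of `B`. -/
def IsHomOn (B : Subgroup G) (W : AddSubgroup V) (φ : W →+ V) : Prop :=
  ∀ b ∈ B, ∀ w w' : W, (w' : V) = b • (w : V) → φ w' = b • φ w

/-- `V` is generated by the images of the `B`-homomorphisms from `W`. -/
def IsHomogeneousOn (B : Subgroup G) (W : AddSubgroup V) : Prop :=
  ∀ v : V, v ∈ AddSubgroup.closure {v | ∃ φ : W →+ V, IsHomOn B W φ ∧ ∃ w, φ w = v}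

theorem IsHomOn.eq_zero (hirr : IsIrredOn B W) (hW : ∀ b ∈ B, ∀ w ∈ W, b • w ∈ W) {φ : W →+ V}
    (hφ : IsHomOn B W φ) {w : W} (hw : w ≠ 0) (h : φ w = 0) : φ = 0 := by
  have key := hirr.2 (φ.ker.map W.subtype) (by rintro _ ⟨w, -, rfl⟩; exact w.2) (by
    rintro b hb _ ⟨w, hw, rfl⟩
    refine ⟨⟨b • w.1, hW b hb _ w.2⟩, ?_, rfl⟩
    have hw' : φ w = 0 := hw
    change φ _ = 0
    rw [hφ b hb w _ rfl, hw', smul_zero])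
  rcases key with h1 | h1
  · rw [AddSubgroup.map_eq_bot_iff_of_injective _ W.subtype_injective] at h1
    have : w ∈ φ.ker := h
    rw [h1, AddSubgroup.mem_bot] at this
    exact absurd this hw
  · ext v
    obtain ⟨v', hv', hv⟩ : (v : V) ∈ φ.ker.map W.subtype := by rw [h1]; exact v.2
    have : v' = v := Subtype.ext hv
    rw [← this]
    exact hv'

theorem IsHomOn.sub {φ ψ : W →+ V} (hφ : IsHomOn B W φ) (hψ : IsHomOn B W ψ) :
    IsHomOn B W (φ - ψ) := fun b hb w w' h => by
  rw [AddMonoidHom.sub_apply, AddMonoidHom.sub_apply, hφ b hb w w' h, hψ b hb w w' h, smul_sub]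

theorem IsHomOn.comp {φ : W →+ V} (hφ : IsHomOn B W φ) (f : V →+ V)
    (hf : ∀ b ∈ B, ∀ v, f (b • v) = b • f v) : IsHomOn B W (f.comp φ) := fun b hb w w' h => by
  rw [AddMonoidHom.comp_apply, hφ b hb w w' h, hf b hb, AddMonoidHom.comp_apply]

/-- Two additive maps agreeing on all images of homomorphisms are equal. -/
theorem IsHomogeneousOn.ext (hhom : IsHomogeneousOn B W) {f f' : V →+ V}
    (h : ∀ φ : W →+ V, IsHomOn B W φ → ∀ w, f (φ w) = f' (φ w)) (v : V) : f v = f' v := by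
  have : AddSubgroup.closure {v | ∃ φ : W →+ V, IsHomOn B W φ ∧ ∃ w, φ w = v} ≤
      (f - f').ker := by
    rw [AddSubgroup.closure_le]
    rintro _ ⟨φ, hφ, w, rfl⟩
    change (f - f') _ = 0
    rw [AddMonoidHom.sub_apply, h φ hφ, sub_self]
  have h1 : (f - f') v = 0 := this (hhom v)
  rwa [AddMonoidHom.sub_apply, sub_eq_zero] at h1

/-- If `B` acts noncommutatively on the simple module `W`, then the endomorphisms it generates
include one which is neither injective nor zero. -/
theorem exists_zeroDivisor [Finite V] (hirr : IsIrredOn B W)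
    (hW : ∀ b ∈ B, ∀ w ∈ W, b • w ∈ W)
    (hnc : ∃ b ∈ B, ∃ c ∈ B, ∃ w ∈ W, b • c • w ≠ c • b • w) :
    ∃ w₁ w₂ w₁' : W, w₂ ≠ 0 ∧ w₁' ≠ 0 ∧
      ∃ f : V →+ V, ∀ φ : W →+ V, IsHomOn B W φ → f (φ w₁) = φ w₁' ∧ f (φ w₂) = 0 := by
  let act : B → AddMonoid.End W := fun b =>
    { toFun := fun w => ⟨b.1 • w.1, hW b b.2 _ w.2⟩
      map_zero' := Subtype.ext (smul_zero _)
      map_add' := fun _ _ => Subtype.ext (smul_add _ _ _) }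
  let R : Subring (AddMonoid.End W) := Subring.closure (Set.range act)
  have hR : ∀ ρ ∈ R, ∃ f : V →+ V, ∀ φ : W →+ V, IsHomOn B W φ → ∀ w, f (φ w) = φ (ρ w) := by
    intro ρ hρ
    induction hρ using Subring.closure_induction with
    | mem x hx =>
      obtain ⟨b, rfl⟩ := hx
      exact ⟨DistribSMul.toAddMonoidHom V b.1, fun φ hφ w => (hφ b b.2 w _ rfl).symm⟩
    | zero => exact ⟨0, fun φ _ w => by simp⟩
    | one => exact ⟨AddMonoidHom.id V, fun φ _ w => rfl⟩
    | add x y _ _ hx hy =>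
      obtain ⟨f, hf⟩ := hx
      obtain ⟨g, hg⟩ := hy
      exact ⟨f + g, fun φ hφ w => by
        rw [AddMonoidHom.add_apply, hf φ hφ, hg φ hφ, ← map_add]; rfl⟩
    | neg x _ hx =>
      obtain ⟨f, hf⟩ := hx
      exact ⟨-f, fun φ hφ w => by rw [AddMonoidHom.neg_apply, hf φ hφ, ← map_neg]; rfl⟩
    | mul x y _ _ hx hy =>
      obtain ⟨f, hf⟩ := hx
      obtain ⟨g, hg⟩ := hy
      exact ⟨f.comp g, fun φ hφ w => by
        rw [AddMonoidHom.comp_apply, hg φ hφ, hf φ hφ]; rfl⟩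
  by_contra! hcon
  have hzero : ∀ ρ ∈ R, ∀ w : W, w ≠ 0 → ρ w = 0 → ρ = 0 := by
    intro ρ hρ w hw hρw
    by_contra hne
    obtain ⟨w₁, hw₁⟩ : ∃ w₁, ρ w₁ ≠ 0 := by
      by_contra! h0
      exact hne (AddMonoidHom.ext h0)
    obtain ⟨f, hf⟩ := hR ρ hρ
    obtain ⟨φ, hφ, h1⟩ := hcon w₁ w (ρ w₁) hw hw₁ f
    exact h1 (hf φ hφ w₁) (by rw [hf φ hφ, hρw, map_zero])
  have : Finite (AddMonoid.End W) := Finite.of_injective (fun f : AddMonoid.End W => (f : W → W))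
    DFunLike.coe_injective
  obtain ⟨b, hb, c, hc, w, hw, hne⟩ := hnc
  have hw0 : (⟨w, hw⟩ : W) ≠ 0 := fun h0 => hne (by
    have : w = 0 := congrArg Subtype.val h0
    simp [this])
  have : Nontrivial R := ⟨⟨0, 1, fun h0 => hw0 (by
    have h1 := congrArg Subtype.val h0
    exact (DFunLike.congr_fun h1 (⟨w, hw⟩ : W)).symm)⟩⟩
  have : NoZeroDivisors R := ⟨fun {a b} hab => by
    by_contra! h0
    obtain ⟨ha, hb⟩ := h0
    obtain ⟨v, hv⟩ : ∃ v, b.1 v ≠ 0 := by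
      by_contra! h0
      exact hb (Subtype.ext (AddMonoidHom.ext h0))
    refine ha (Subtype.ext (hzero a.1 a.2 _ hv ?_))
    have h1 := congrArg Subtype.val hab
    exact DFunLike.congr_fun h1 v⟩
  have : IsDomain R := NoZeroDivisors.to_isDomain R
  have hcomm := (Finite.isDomain_to_isField R).mul_comm
    ⟨act ⟨b, hb⟩, Subring.subset_closure ⟨_, rfl⟩⟩ ⟨act ⟨c, hc⟩, Subring.subset_closure ⟨_, rfl⟩⟩
  have h1 := DFunLike.congr_fun (congrArg Subtype.val hcomm) (⟨w, hw⟩ : W)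
  exact hne (congrArg Subtype.val h1)

end Homogeneous

variable {G V : Type u} [Group G] [AddCommGroup V] [DistribMulAction G V] [Finite G] [Finite V]
  {B : Subgroup G} {W : AddSubgroup V}

/-- A base exists if a normal subgroup acts homogeneously, reducibly and noncommutatively. -/
theorem hasBase_of_homogeneous_reducible {p : ℕ} (hp : p.Prime)
    (ih : BaseBelow.{u} p (Nat.card V)) [Group.IsSolvable G] (hG : ¬ p ∣ Nat.card G)
    (hV : ∀ v : V, p • v = 0) (hB : ∀ g b : G, b ∈ B → g * b * g⁻¹ ∈ B)
    (hirr : IsIrredOn B W) (hW : ∀ b ∈ B, ∀ w ∈ W, b • w ∈ W) (hhom : IsHomogeneousOn B W)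
    (htop : W ≠ ⊤) (hnc : ∃ b ∈ B, ∃ c ∈ B, ∃ v : V, b • c • v ≠ c • b • v) : HasBase G V := by
  have hnc' : ∃ b ∈ B, ∃ c ∈ B, ∃ w ∈ W, b • c • w ≠ c • b • w := by
    by_contra! hcon
    obtain ⟨b, hb, c, hc, v, hv⟩ := hnc
    refine hv ?_
    refine hhom.ext (f := (DistribSMul.toAddMonoidHom V b).comp (DistribSMul.toAddMonoidHom V c))
      (f' := (DistribSMul.toAddMonoidHom V c).comp (DistribSMul.toAddMonoidHom V b))
      (fun φ hφ w => ?_) v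
    change b • c • φ w = c • b • φ w
    rw [← hφ c hc w ⟨c • w.1, hW c hc _ w.2⟩ rfl, ← hφ b hb w ⟨b • w.1, hW b hb _ w.2⟩ rfl,
      ← hφ b hb _ ⟨b • c • w.1, hW b hb _ (hW c hc _ w.2)⟩ rfl]
    exact hφ c hc _ _ (hcon b hb c hc w w.2)
  obtain ⟨w₁, w₂, w₁', hw₂, hw₁', f, hf⟩ := exists_zeroDivisor hirr hW hnc'
  obtain ⟨x, hx, x₁, hx₁, hx0, hbase⟩ := ih.exists_isBaseOn_ne_zero hG hV (W.setStab G) W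
    (fun h hh v hv => (hh v).2 hv) (AddSubgroup.card_lt_of_ne_top htop) hirr.1
  have hBW : ∀ b ∈ B, b ∈ W.setStab G := fun b hb => AddSubgroup.mem_setStab_of_forall (hW b hb)
  obtain ⟨P, hPc, hPW, hPw⟩ := exists_equivariant_proj hp hG hV (W.setStab G) W
    (fun h hh v hv => (hh v).2 hv)
  let x' : W := ⟨x, hx⟩
  have hx' : x' ≠ 0 := fun h0 => hx0 (congrArg Subtype.val h0)
  -- elements fixing `x` stabilize `W`
  have hstab : ∀ g : G, g • x = x → g ∈ W.setStab G := by
    intro g hg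
    have h1 := hirr.2 (W ⊓ W.comap (DistribSMul.toAddMonoidHom V g)) inf_le_left (by
      rintro b hb w ⟨hw, hgw⟩
      refine ⟨hW b hb w hw, ?_⟩
      change g • b • w ∈ W
      have := hW _ (hB g b hb) _ hgw
      change (g * b * g⁻¹) • g • w ∈ W at this
      rwa [mul_smul, mul_smul, inv_smul_smul] at this)
    refine AddSubgroup.mem_setStab_of_forall fun v hv => ?_
    rcases h1 with h1 | h1
    · have : x ∈ W ⊓ W.comap (DistribSMul.toAddMonoidHom V g) :=
        ⟨hx, by change g • x ∈ W; rwa [hg]⟩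
      rw [h1, AddSubgroup.mem_bot] at this
      exact absurd this hx0
    · rw [← h1] at hv
      exact hv.2
  let M : Subgroup G :=
    { carrier := {g | g ∈ W.setStab G ∧ ∀ w ∈ W, g • w = w}
      mul_mem' := fun {a b} ha hb => ⟨Subgroup.mul_mem _ ha.1 hb.1, fun w hw => by
        rw [mul_smul, hb.2 w hw, ha.2 w hw]⟩
      one_mem' := ⟨Subgroup.one_mem _, fun w _ => one_smul _ _⟩
      inv_mem' := fun {a} ha => ⟨Subgroup.inv_mem _ ha.1, fun w hw =>
        inv_smul_eq_self_of (ha.2 w hw)⟩ }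
  have hMB : ∀ m ∈ M, ∀ b ∈ B, ∀ v : V, m • b • v = b • m • v := by
    intro m hm b hb v
    have hc : b⁻¹ * (m * b * m⁻¹) ∈ B := mul_mem (inv_mem hb) (hB m b hb)
    have h1 : ∀ v : V, (b⁻¹ * (m * b * m⁻¹)) • v = v := by
      refine hhom.ext (f := DistribSMul.toAddMonoidHom V _) (f' := AddMonoidHom.id V)
        fun φ hφ w => ?_
      refine (hφ _ hc w w ?_).symm
      rw [mul_smul, mul_smul, mul_smul, inv_smul_eq_self_of (hm.2 w w.2),
        hm.2 _ (hW b hb _ w.2), inv_smul_smul]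
    have h2 := h1 (m • v)
    rwa [mul_smul, mul_smul, mul_smul, inv_smul_smul, inv_smul_eq_iff] at h2
  let U : AddSubgroup V :=
    { carrier := {v | ∃ φ : W →+ V, IsHomOn B W φ ∧ (∀ w, P (φ w) = 0) ∧ φ x' = v}
      zero_mem' := ⟨0, fun b hb w w' _ => by simp, by simp, rfl⟩
      add_mem' := by
        rintro _ _ ⟨φ, hφ, hP, rfl⟩ ⟨ψ, hψ, hP', rfl⟩
        exact ⟨φ + ψ, fun b hb w w' h => by
          rw [AddMonoidHom.add_apply, AddMonoidHom.add_apply, hφ b hb w w' h, hψ b hb w w' h,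
            smul_add], fun w => by rw [AddMonoidHom.add_apply, map_add, hP, hP', add_zero], rfl⟩
      neg_mem' := by
        rintro _ ⟨φ, hφ, hP, rfl⟩
        exact ⟨-φ, fun b hb w w' h => by
          rw [AddMonoidHom.neg_apply, AddMonoidHom.neg_apply, hφ b hb w w' h, smul_neg],
          fun w => by rw [AddMonoidHom.neg_apply, map_neg, hP, neg_zero], rfl⟩ }
  have hMφ : ∀ m ∈ M, ∀ φ : W →+ V, IsHomOn B W φ →
      IsHomOn B W ((DistribSMul.toAddMonoidHom V m).comp φ) := fun m hm φ hφ =>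
    hφ.comp _ fun b hb v => hMB m hm b hb v
  have hUtop : U ≠ ⊤ := by
    intro h0
    obtain ⟨φ, -, hP, h1⟩ : x ∈ U := by rw [h0]; trivial
    have := hP x'
    rw [h1, hPw x hx] at this
    exact hx0 this
  obtain ⟨_, ⟨φ₁, hφ₁, hP₁, rfl⟩, _, ⟨φ₂, hφ₂, hP₂, rfl⟩, hbU⟩ := ih.exists_isBaseOn hG hV M U (by
    rintro m hm _ ⟨φ, hφ, hP, rfl⟩
    exact ⟨_, hMφ m hm φ hφ, fun w => by
      change P (m • φ w) = 0
      rw [hPc m hm.1, hP, smul_zero], rfl⟩) (AddSubgroup.card_lt_of_ne_top hUtop)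
  refine ⟨x, x₁ + (φ₁ w₁ + φ₂ w₂), fun g hgx hgy => ?_⟩
  have hg := hstab g hgx
  have hPy : P (x₁ + (φ₁ w₁ + φ₂ w₂)) = x₁ := by
    rw [map_add, map_add, hP₁, hP₂, hPw _ hx₁, add_zero, add_zero]
  have hgx₁ : g • x₁ = x₁ := by
    rw [← hPy, ← hPc g hg, hgy]
  have hgM : g ∈ M := ⟨hg, hbase g hg hgx hgx₁⟩
  have hsum : g • φ₁ w₁ + g • φ₂ w₂ = φ₁ w₁ + φ₂ w₂ := by
    rw [smul_add, smul_add, hgx₁, add_right_inj] at hgy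
    exact hgy
  let ψ : (W →+ V) → (W →+ V) := fun φ => (DistribSMul.toAddMonoidHom V g).comp φ - φ
  have hψ : ∀ φ w, ψ φ w = g • φ w - φ w := fun φ w => rfl
  have hψh : ∀ φ, IsHomOn B W φ → IsHomOn B W (ψ φ) := fun φ hφ => (hMφ g hgM φ hφ).sub hφ
  have h0 : ψ φ₁ w₁ + ψ φ₂ w₂ = 0 := by
    rw [hψ, hψ, sub_add_sub_comm, hsum, sub_self]
  have h1 : ψ φ₁ w₁' = 0 := by
    have := congrArg f h0
    rwa [map_add, (hf _ (hψh _ hφ₁)).1, (hf _ (hψh _ hφ₂)).2, add_zero, map_zero] at this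
  have h2 : ψ φ₁ = 0 := (hψh _ hφ₁).eq_zero hirr hW hw₁' h1
  have h3 : ψ φ₂ = 0 := by
    refine (hψh _ hφ₂).eq_zero hirr hW hw₂ ?_
    rwa [h2, AddMonoidHom.zero_apply, zero_add] at h0
  have hfix := hbU g hgM (sub_eq_zero.1 ((hψ φ₁ x').symm.trans (DFunLike.congr_fun h2 x')))
    (sub_eq_zero.1 ((hψ φ₂ x').symm.trans (DFunLike.congr_fun h3 x')))
  refine hhom.ext (f := DistribSMul.toAddMonoidHom V g) (f' := AddMonoidHom.id V)
    fun φ hφ w => ?_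
  change g • φ w = φ w
  have hQ : IsHomOn B W ((AddMonoidHom.id V - P).comp φ) := hφ.comp _ fun b hb v => by
    simp only [AddMonoidHom.sub_apply, AddMonoidHom.id_apply, hPc b (hBW b hb), smul_sub]
  have h4 : ψ ((AddMonoidHom.id V - P).comp φ) = 0 := by
    refine (hψh _ hQ).eq_zero hirr hW hx' ?_
    rw [hψ, sub_eq_zero]
    refine hfix _ ⟨_, hQ, fun w => ?_, rfl⟩
    simp only [AddMonoidHom.comp_apply, AddMonoidHom.sub_apply, AddMonoidHom.id_apply, map_sub,
      hPw _ (hPW _), sub_self]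
  have h5 : g • (φ w - P (φ w)) = φ w - P (φ w) :=
    sub_eq_zero.1 ((hψ _ w).symm.trans (DFunLike.congr_fun h4 w))
  rwa [smul_sub, hgM.2 _ (hPW _), sub_left_inj] at h5

section Coloring

/-- There is a colouring of `Ω` with `p` colours such that every element of `S` preserving it acts
trivially on `Ω`. -/
def HasRigidColoring (p : ℕ) (S Ω : Type*) [Group S] [MulAction S Ω] : Prop :=
  ∃ c : Ω → ZMod p, ∀ g : S, (∀ ω, c (g • ω) = c ω) → ∀ ω : Ω, g • ω = ω

variable {p : ℕ} {S Ω : Type*} [Group S] [MulAction S Ω]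

theorem HasRigidColoring.of_subMulAction (Δ : SubMulAction S Ω) (h : HasRigidColoring p S Δ)
    (h' : HasRigidColoring p S (Δᶜ : SubMulAction S Ω)) : HasRigidColoring p S Ω := by
  classical
  obtain ⟨c, hc⟩ := h
  obtain ⟨d, hd⟩ := h'
  have hmem : ∀ ω : Ω, ω ∈ (Δᶜ : SubMulAction S Ω) ↔ ω ∉ Δ := fun _ => Iff.rfl
  refine ⟨fun ω => if h : ω ∈ Δ then c ⟨ω, h⟩ else d ⟨ω, (hmem ω).2 h⟩, fun g hg ω => ?_⟩
  by_cases hω : ω ∈ Δ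
  · refine congrArg Subtype.val (hc g (fun δ => ?_) ⟨ω, hω⟩)
    have := hg δ
    simp only [δ.2, Δ.smul_mem g δ.2, dite_true] at this
    exact this
  · refine congrArg Subtype.val (hd g (fun δ => ?_) ⟨ω, (hmem ω).2 hω⟩)
    have := hg δ
    have h2 : (δ : Ω) ∉ Δ := (hmem _).1 δ.2
    have h3 : g • (δ : Ω) ∉ Δ := (hmem _).1 ((Δᶜ : SubMulAction S Ω).smul_mem g δ.2)
    simp only [h2, h3, dite_false] at this
    exact this

theorem eq_zero_of_coloring_shift [Finite S] (hp : p.Prime) (hS : ¬ p ∣ Nat.card S) {g : S}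
    {Δ : Set Ω} (hΔ : ∀ ω ∈ Δ, g • ω ∈ Δ) {f : Ω → ZMod p} {k : ZMod p}
    (hf : ∀ ω ∈ Δ, f (g • ω) = f ω + k) (hne : Δ.Nonempty) : k = 0 := by
  obtain ⟨ω, hω⟩ := hne
  have key : ∀ n : ℕ, g ^ n • ω ∈ Δ ∧ f (g ^ n • ω) = f ω + n • k := by
    intro n
    induction n with
    | zero => simpa using hω
    | succ n ih =>
      rw [pow_succ', mul_smul, hf _ ih.1, ih.2, succ_nsmul, add_assoc]
      exact ⟨hΔ _ ih.1, rfl⟩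
  have h1 := (key (Nat.card S)).2
  rw [pow_card_eq_one', one_smul] at h1
  exact eq_zero_of_coprime_nsmul hp hS (by simp) (by simpa using h1)

/-- The class of `ω` under an invariant equivalence relation, as a set with an action of its
stabiliser. -/
def Setoid.stabilizerOfClass (r : Setoid Ω) (hr : ∀ (g : S) x y, r x y → r (g • x) (g • y))
    (ω : Ω) : Subgroup S where
  carrier := {g | r (g • ω) ω}
  mul_mem' {a b} ha hb := by
    rw [Set.mem_ofPred_eq, mul_smul]
    exact r.trans (hr a _ _ hb) ha
  one_mem' := by
    rw [Set.mem_ofPred_eq, one_smul]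
  inv_mem' {a} ha := by
    have := hr a⁻¹ _ _ ha
    rw [inv_smul_smul] at this
    exact r.symm this

/-- The class of `ω` as a sub-action of its stabiliser. -/
def Setoid.classAction (r : Setoid Ω) (hr : ∀ (g : S) x y, r x y → r (g • x) (g • y))
    (ω : Ω) : SubMulAction (r.stabilizerOfClass hr ω) Ω where
  carrier := {x | r x ω}
  smul_mem' h _ hx := r.trans (hr h _ _ hx) h.2

/-- The action on the quotient by an invariant equivalence relation. -/
abbrev Setoid.quotientAction (r : Setoid Ω) (hr : ∀ (g : S) x y, r x y → r (g • x) (g • y)) :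
    MulAction S (Quotient r) where
  smul g := Quotient.map (fun x => g • x) (fun x y => hr g x y)
  one_smul q := by
    induction q using Quotient.inductionOn with
    | h x => exact congrArg _ (one_smul S x)
  mul_smul a b q := by
    induction q using Quotient.inductionOn with
    | h x => exact congrArg _ (mul_smul a b x)

theorem HasRigidColoring.of_setoid [Finite S] (hp : p.Prime) (hS : ¬ p ∣ Nat.card S)
    [MulAction.IsPretransitive S Ω] (r : Setoid Ω)
    (hr : ∀ (g : S) x y, r x y → r (g • x) (g • y)) (ω₀ : Ω)
    (hq : ∃ c : Quotient r → ZMod p, ∀ g : S, (∀ x : Ω, c ⟦g • x⟧ = c ⟦x⟧) → ∀ x, r (g • x) x)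
    (hc : HasRigidColoring p (r.stabilizerOfClass hr ω₀) (r.classAction hr ω₀)) :
    HasRigidColoring p S Ω := by
  classical
  obtain ⟨c, hc'⟩ := hq
  obtain ⟨f₀, hf₀⟩ := hc
  let f : Ω → ZMod p := fun x => if h : x ∈ r.classAction hr ω₀ then f₀ ⟨x, h⟩ else 0
  have hf : ∀ g : S, r (g • ω₀) ω₀ → (∀ x, r x ω₀ → f (g • x) = f x) →
      ∀ x, r x ω₀ → g • x = x := by
    intro g hg h x hx
    refine congrArg Subtype.val (hf₀ ⟨g, hg⟩ (fun δ => ?_) ⟨x, hx⟩)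
    have h1 := h δ δ.2
    have h2 : g • (δ : Ω) ∈ r.classAction hr ω₀ := r.trans (hr g _ _ δ.2) hg
    simp only [f, δ.2, h2, dite_true] at h1
    exact h1
  choose t ht using fun q : Quotient r => MulAction.exists_smul_eq S ω₀ q.out
  have htc : ∀ x : Ω, r (t ⟦x⟧ • ω₀) x := fun x => by
    rw [ht]; exact Quotient.mk_out x
  have hti : ∀ x : Ω, r ((t ⟦x⟧)⁻¹ • x) ω₀ := fun x => by
    have := hr (t ⟦x⟧)⁻¹ _ _ (htc x)
    rw [inv_smul_smul] at this
    exact r.symm this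
  refine ⟨fun x => f ((t ⟦x⟧)⁻¹ • x) + c ⟦x⟧, fun g hg => ?_⟩
  have hcq : ∀ x : Ω, ⟦t ⟦x⟧ • ω₀⟧ = (⟦x⟧ : Quotient r) := fun x => Quotient.sound (htc x)
  have hmv : ∀ x y : Ω, r y ω₀ → (⟦t ⟦x⟧ • y⟧ : Quotient r) = ⟦x⟧ := fun x y hy =>
    (Quotient.sound (hr _ _ _ hy)).trans (hcq x)
  have hgq : ∀ x y : Ω, (⟦x⟧ : Quotient r) = ⟦y⟧ → (⟦g • x⟧ : Quotient r) = ⟦g • y⟧ := fun x y h =>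
    Quotient.sound (hr g _ _ (Quotient.exact h))
  have hshift : ∀ x y : Ω, r y ω₀ →
      f (((t ⟦g • x⟧)⁻¹ * g * t ⟦x⟧) • y) = f y + (c ⟦x⟧ - c ⟦g • x⟧) := by
    intro x y hy
    have h1 := hg (t ⟦x⟧ • y)
    simp only [hmv x y hy, hgq _ _ (hmv x y hy), inv_smul_smul] at h1
    rw [mul_smul, mul_smul]
    linear_combination h1
  have hst : ∀ x y : Ω, r y ω₀ → r (((t ⟦g • x⟧)⁻¹ * g * t ⟦x⟧) • y) ω₀ := by
    intro x y hy
    rw [mul_smul, mul_smul]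
    have h1 := hti (g • t ⟦x⟧ • y)
    rwa [hgq _ _ (hmv x y hy)] at h1
  have hzero : ∀ x : Ω, c ⟦x⟧ - c ⟦g • x⟧ = 0 := fun x =>
    eq_zero_of_coloring_shift hp hS (Δ := {y | r y ω₀}) (hst x) (hshift x) ⟨ω₀, r.refl _⟩
  have hblock := hc' g fun x => (sub_eq_zero.1 (hzero x)).symm
  intro x
  have h1 := hf _ (hst x ω₀ (r.refl _)) (fun y hy => by rw [hshift x y hy, hzero x, add_zero])
    _ (hti x)
  rw [mul_smul, mul_smul, smul_inv_smul, Quotient.sound (hblock x)] at h1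
  exact smul_left_cancel _ h1

end Coloring

section AffineStructure

theorem exists_normal_elementary_abelian {S : Type*} [Group S] [Finite S] [Group.IsSolvable S]
    [Nontrivial S] : ∃ (r : ℕ) (A : Subgroup S), r.Prime ∧ r ∣ Nat.card S ∧ A.Normal ∧ A ≠ ⊥ ∧
      (∀ a ∈ A, ∀ b ∈ A, a * b = b * a) ∧ ∀ a ∈ A, a ^ r = 1 := by
  classical
  have hex : ∃ n, derivedSeries S n = ⊥ := Group.IsSolvable.solvable
  obtain ⟨k, hk⟩ : ∃ k, Nat.find hex = k + 1 := by
    refine Nat.exists_eq_succ_of_ne_zero fun h => ?_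
    have := Nat.find_spec hex
    rw [h, derivedSeries_zero] at this
    exact top_ne_bot this
  have hbot := Nat.find_spec hex
  rw [hk, derivedSeries_succ] at hbot
  have hne : derivedSeries S k ≠ ⊥ := Nat.find_min hex (by omega)
  set D := derivedSeries S k with hD
  have hnorm : D.Normal := derivedSeries_normal S k
  have hcomm : ∀ a ∈ D, ∀ b ∈ D, a * b = b * a := fun a ha b hb => by
    have h1 := Subgroup.commutator_mem_commutator ha hb
    rw [hbot] at h1
    exact commutatorElement_eq_one_iff_mul_comm.1 (Subgroup.mem_bot.1 h1)
  obtain ⟨r, hr, hrD⟩ := Nat.exists_prime_and_dvd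
    (fun h => hne (Subgroup.card_eq_one.1 h) : Nat.card D ≠ 1)
  have : Fact r.Prime := ⟨hr⟩
  refine ⟨r, ⟨⟨⟨{a | a ∈ D ∧ a ^ r = 1}, ?_⟩, ?_⟩, ?_⟩, hr, hrD.trans D.card_subgroup_dvd_card,
    ⟨?_⟩, ?_, fun a ha b hb => hcomm a ha.1 b hb.1, fun a ha => ha.2⟩
  · rintro a b ⟨ha, ha'⟩ ⟨hb, hb'⟩
    exact ⟨D.mul_mem ha hb, by rw [Commute.mul_pow (hcomm a ha b hb), ha', hb', one_mul]⟩
  · exact ⟨D.one_mem, one_pow _⟩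
  · rintro a ⟨ha, ha'⟩
    exact ⟨D.inv_mem ha, by rw [inv_pow, ha', inv_one]⟩
  · rintro a ⟨ha, ha'⟩ g
    exact ⟨hnorm.conj_mem a ha g, by rw [conj_pow, ha', mul_one, mul_inv_cancel]⟩
  · intro h
    obtain ⟨a, ha⟩ := exists_prime_orderOf_dvd_card' r hrD
    have h1 : (a : S) ∈ (⊥ : Subgroup S) := by
      rw [← h]
      exact ⟨a.2, by rw [← Subgroup.coe_pow, ← ha, pow_orderOf_eq_one, Subgroup.coe_one]⟩
    rw [Subgroup.mem_bot, OneMemClass.coe_eq_one] at h1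
    rw [h1, orderOf_one] at ha
    exact hr.one_lt.ne ha

theorem exists_addChar_of_elementary_abelian {S : Type*} [Group S] [Finite S] {r : ℕ}
    [Fact r.Prime] {A : Subgroup S} (hcomm : ∀ a ∈ A, ∀ b ∈ A, a * b = b * a)
    (hexp : ∀ a ∈ A, a ^ r = 1) : ∃ (m : ℕ) (φ : (Fin m → ZMod r) → S), Function.Injective φ ∧
      (∀ x y, φ (x + y) = φ x * φ y) ∧ ∀ a, a ∈ A ↔ ∃ x, φ x = a := by
  let _ : CommGroup A :=
    { A.toGroup with mul_comm := fun a b => Subtype.ext (hcomm a a.2 b b.2) }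
  let _ : Module (ZMod r) (Additive A) := AddCommGroup.zmodModule (n := r) fun x =>
    congrArg Additive.ofMul (Subtype.ext (hexp x.toMul x.toMul.2))
  let f := (Module.finBasis (ZMod r) (Additive A)).equivFun
  refine ⟨_, fun x => ((f.symm x).toMul : S), fun x y h => ?_, fun x y => ?_, fun a => ⟨?_, ?_⟩⟩
  · exact f.symm.injective (Additive.toMul.injective (Subtype.ext h))
  · exact congrArg (fun z => (z.toMul : S)) (map_add f.symm x y)
  · intro ha
    exact ⟨f (Additive.ofMul ⟨a, ha⟩),
      congrArg (fun z => (z.toMul : S)) (f.symm_apply_apply (Additive.ofMul ⟨a, ha⟩))⟩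
  · rintro ⟨x, rfl⟩
    exact Subtype.prop _

/-- A primitive solvable permutation group is an affine group over a prime field. -/
theorem exists_affine_structure {S Ω : Type*} [Group S] [MulAction S Ω] [Finite S]
    [Group.IsSolvable S] [Nontrivial S] [FaithfulSMul S Ω] [Nonempty Ω]
    (hprim : ∀ s : Setoid Ω, (∀ (g : S) x y, s x y → s (g • x) (g • y)) → s = ⊥ ∨ s = ⊤) :
    ∃ (r m : ℕ) (e : (Fin m → ZMod r) ≃ Ω), r.Prime ∧ r ∣ Nat.card S ∧
      (∀ g : S, ∃ (L : (Fin m → ZMod r) →+ (Fin m → ZMod r)) (b : Fin m → ZMod r),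
        ∀ x, g • e x = e (L x + b)) ∧ ∀ b, ∃ g : S, ∀ x, g • e x = e (x + b) := by
  obtain ⟨r, A, hr, hrS, hA, hA1, hcomm, hexp⟩ := exists_normal_elementary_abelian (S := S)
  have : Fact r.Prime := ⟨hr⟩
  obtain ⟨m, φ, hφ, hadd, hmem⟩ := exists_addChar_of_elementary_abelian hcomm hexp
  let ω₀ : Ω := Classical.arbitrary Ω
  have htrans : ∀ ω : Ω, ∃ a ∈ A, a • ω₀ = ω := by
    rcases hprim (MulAction.orbitRel A Ω) (fun g x y h => by
      obtain ⟨a, ha⟩ := MulAction.orbitRel_apply.1 h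
      refine MulAction.orbitRel_apply.2 ⟨⟨_, hA.conj_mem a a.2 g⟩, ?_⟩
      change (g * (a : S) * g⁻¹) • g • y = g • x
      rw [smul_smul, inv_mul_cancel_right, mul_smul]
      exact congrArg _ ha) with h | h
    · refine (hA1 ((Subgroup.eq_bot_iff_forall _).2 fun a ha => ?_)).elim
      refine FaithfulSMul.eq_of_smul_eq_smul (α := Ω) fun ω => ?_
      have h1 : (MulAction.orbitRel A Ω) (a • ω) ω := MulAction.orbitRel_apply.2 ⟨⟨a, ha⟩, rfl⟩
      rw [h] at h1
      rw [one_smul]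
      exact h1
    · intro ω
      have h1 : (MulAction.orbitRel A Ω) ω ω₀ := by rw [h]; trivial
      obtain ⟨a, ha⟩ := MulAction.orbitRel_apply.1 h1
      exact ⟨a, a.2, ha⟩
  have hfree : ∀ a ∈ A, ∀ b ∈ A, a • ω₀ = b • ω₀ → a = b := by
    intro a ha b hb h
    refine FaithfulSMul.eq_of_smul_eq_smul (α := Ω) fun ω => ?_
    obtain ⟨c, hc, rfl⟩ := htrans ω
    rw [smul_smul, smul_smul, hcomm a ha c hc, hcomm b hb c hc, mul_smul, mul_smul, h]
  have hin : ∀ x, φ x ∈ A := fun x => (hmem _).2 ⟨x, rfl⟩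
  let e : (Fin m → ZMod r) ≃ Ω := Equiv.ofBijective (fun x => φ x • ω₀)
    ⟨fun x y h => hφ (hfree _ (hin x) _ (hin y) h), fun ω => by
      obtain ⟨a, ha, h⟩ := htrans ω
      obtain ⟨x, rfl⟩ := (hmem a).1 ha
      exact ⟨x, h⟩⟩
  have he : ∀ x, e x = φ x • ω₀ := fun _ => rfl
  refine ⟨r, m, e, hr, hrS, fun g => ?_, fun b => ⟨φ b, fun x => ?_⟩⟩
  · choose L hL using fun x => (hmem (g * φ x * g⁻¹)).1 (hA.conj_mem _ (hin x) g)
    obtain ⟨b, hb⟩ := e.surjective (g • ω₀)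
    refine ⟨AddMonoidHom.mk' L fun x y => hφ ?_, b, fun x => ?_⟩
    · rw [hL, hadd, hadd, hL, hL]
      group
    · rw [he, he, hadd, AddMonoidHom.mk'_apply, hL, mul_smul _ (φ b), ← he b, hb, smul_smul,
        smul_smul, inv_mul_cancel_right]
  · rw [he, he, add_comm, hadd, mul_smul]

end AffineStructure

section AffineColoring

/-- There is a `p`-colouring of `𝔽_r ^ m` preserved by no nontrivial affine bijection. -/
def RigidAffine (p r m : ℕ) : Prop :=
  ∃ c : (Fin m → ZMod r) → ZMod p,
    ∀ (L : (Fin m → ZMod r) →+ (Fin m → ZMod r)) (b : Fin m → ZMod r),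
    Function.Injective L → (∀ x, c (L x + b) = c x) → ∀ x, L x + b = x

theorem exists_coloring_of_disjoint {E : Type*} {p n : ℕ} (hn : n < p) (P : Fin n → E → Prop)
    (hP : ∀ i j x, P i x → P j x → i = j) :
    ∃ c : E → ZMod p, ∀ x y, c x = c y → ∀ i, P i x ↔ P i y := by
  classical
  let k : E → ℕ := fun x => if h : ∃ i, P i x then (h.choose : ℕ) + 1 else 0
  have hk : ∀ x i, P i x ↔ k x = i + 1 := by
    intro x i
    by_cases h : ∃ i, P i x
    · have h1 : k x = (h.choose : ℕ) + 1 := dif_pos h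
      rw [h1]
      constructor
      · intro h2
        rw [hP _ _ _ h.choose_spec h2]
      · intro h2
        have h3 : h.choose = i := Fin.ext (by omega)
        rw [← h3]
        exact h.choose_spec
    · have h1 : k x = 0 := dif_neg h
      rw [h1]
      exact ⟨fun h2 => (h ⟨i, h2⟩).elim, fun h2 => by omega⟩
  have hlt : ∀ x, k x < p := by
    intro x
    by_cases h : ∃ i, P i x
    · have h1 : k x = (h.choose : ℕ) + 1 := dif_pos h
      have := h.choose.2
      omega
    · have h1 : k x = 0 := dif_neg h
      omega
  refine ⟨fun x => (k x : ZMod p), fun x y h i => ?_⟩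
  rw [hk, hk, show k x = k y from ?_]
  have := (ZMod.natCast_eq_natCast_iff' _ _ _).1 h
  rwa [Nat.mod_eq_of_lt (hlt x), Nat.mod_eq_of_lt (hlt y)] at this

variable {r m : ℕ}

/-- The standard basis vector with index `k`, and zero if `m ≤ k`. -/
def stdVec (m r k : ℕ) : Fin m → ZMod r := fun i => if (i : ℕ) = k then 1 else 0

theorem stdVec_self {k : ℕ} (h : k < m) : stdVec m r k ⟨k, h⟩ = 1 := if_pos rfl

theorem stdVec_ne {k : ℕ} {i : Fin m} (h : (i : ℕ) ≠ k) : stdVec m r k i = 0 := if_neg h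

theorem stdVec_inj [Fact r.Prime] {k l : ℕ} (hk : k < m) (h : stdVec m r k = stdVec m r l) :
    k = l := by
  by_contra hne
  have h1 := congrFun h ⟨k, hk⟩
  rw [stdVec_self, stdVec_ne hne] at h1
  exact one_ne_zero h1

theorem stdVec_ne_zero [Fact r.Prime] {k : ℕ} (hk : k < m) : stdVec m r k ≠ 0 := fun h => by
  have h1 := congrFun h ⟨k, hk⟩
  rw [stdVec_self] at h1
  exact one_ne_zero h1

theorem stdVec_add_ne_zero [Fact r.Prime] {k l : ℕ} (hk : k < m) (h : k ≠ l) :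
    stdVec m r k + stdVec m r l ≠ 0 := fun h' => by
  have h1 := congrFun h' ⟨k, hk⟩
  rw [Pi.add_apply, stdVec_self, stdVec_ne h, Pi.zero_apply, add_zero] at h1
  exact one_ne_zero h1

theorem stdVec_add_ne_stdVec [Fact r.Prime] {k l n : ℕ} (hk : k < m) (hl : l < m) (h : k ≠ l) :
    stdVec m r k + stdVec m r l ≠ stdVec m r n := fun h' => by
  by_cases hkn : k = n
  · subst hkn
    exact stdVec_ne_zero hl (add_eq_left.1 h')
  · have h1 := congrFun h' ⟨k, hk⟩
    rw [Pi.add_apply, stdVec_self, stdVec_ne h, stdVec_ne hkn, add_zero] at h1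
    exact one_ne_zero h1

theorem eq_or_eq_of_stdVec_add [Fact r.Prime] {i k l n : ℕ} (hi : i < m) (h : i ≠ k)
    (he : stdVec m r i + stdVec m r k = stdVec m r l + stdVec m r n) : i = l ∨ i = n := by
  by_contra! hne
  have h1 := congrFun he ⟨i, hi⟩
  rw [Pi.add_apply, Pi.add_apply, stdVec_self, stdVec_ne h, stdVec_ne hne.1, stdVec_ne hne.2,
    add_zero, add_zero] at h1
  exact one_ne_zero h1

theorem eq_self_of_stdVec [Fact r.Prime] {L : (Fin m → ZMod r) →+ (Fin m → ZMod r)}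
    (h : ∀ k < m, L (stdVec m r k) = stdVec m r k) (x : Fin m → ZMod r) : L x = x := by
  have h1 : L = AddMonoidHom.id _ := by
    refine AddMonoidHom.functions_ext _ _ _ fun i a => ?_
    have h2 : (Pi.single i a : Fin m → ZMod r) = a.val • stdVec m r i := by
      funext j
      rw [Pi.smul_apply]
      by_cases hj : j = i
      · subst hj
        rw [Pi.single_eq_same, stdVec_self, nsmul_eq_mul, mul_one, ZMod.natCast_zmod_val]
      · rw [Pi.single_eq_of_ne hj, stdVec_ne (fun h => hj (Fin.ext h)), smul_zero]
    rw [h2, map_nsmul, h i i.2]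
    rfl
  rw [h1]
  rfl

/-- A linear map that moves each standard vector to a standard vector and respects the path
`0 - 1 - 2 - ⋯` is the identity as soon as it fixes an initial segment. -/
theorem eq_self_of_path [Fact r.Prime] {L : (Fin m → ZMod r) →+ (Fin m → ZMod r)}
    (hL : Function.Injective L) {s : ℕ} (h0 : ∀ k ≤ s, k < m → L (stdVec m r k) = stdVec m r k)
    (hstep : ∀ i, s ≤ i → i + 1 < m → (∀ k ≤ i, L (stdVec m r k) = stdVec m r k) →
      ∃ k < m, L (stdVec m r (i + 1)) = stdVec m r k ∧
        ∃ l, l + 1 < m ∧ stdVec m r i + stdVec m r k = stdVec m r l + stdVec m r (l + 1))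
    (x : Fin m → ZMod r) : L x = x := by
  refine eq_self_of_stdVec (fun k hk => ?_) x
  induction k using Nat.strong_induction_on with
  | _ k ih =>
    by_cases hks : k ≤ s
    · exact h0 k hks hk
    obtain ⟨i, rfl⟩ : ∃ i, k = i + 1 := ⟨k - 1, by omega⟩
    have ih' : ∀ k ≤ i, L (stdVec m r k) = stdVec m r k := fun k hk' => ih k (by omega) (by omega)
    obtain ⟨k, hkm, hk1, l, hl, hk2⟩ := hstep i (by omega) hk ih'
    have hki : ¬ k ≤ i := fun h => by
      rw [← ih' k h] at hk1
      have := stdVec_inj hk (hL hk1)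
      omega
    have h1 := eq_or_eq_of_stdVec_add (by omega) (by omega : i ≠ k) hk2
    rw [add_comm] at hk2
    have h2 := eq_or_eq_of_stdVec_add hkm (by omega : k ≠ i) hk2
    rw [hk1, show k = i + 1 by omega]

theorem rigidAffine_of_five_le {p : ℕ} (hp : 5 ≤ p) [Fact r.Prime] : RigidAffine p r m := by
  rcases Nat.eq_zero_or_pos m with rfl | hm
  · exact ⟨fun _ => 0, fun _ _ _ _ _ => Subsingleton.elim _ _⟩
  let P : Fin 4 → (Fin m → ZMod r) → Prop :=
    ![fun x => x = 0, fun x => x = stdVec m r 0,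
      fun x => ∃ k, k + 1 < m ∧ x = stdVec m r (k + 1),
      fun x => ∃ k, k + 1 < m ∧ x = stdVec m r k + stdVec m r (k + 1)]
  obtain ⟨c, hc⟩ := exists_coloring_of_disjoint (by omega : 4 < p) P (by
    have h01 : ∀ x, P 0 x → ¬ P 1 x := fun x h h' => stdVec_ne_zero hm (h'.symm.trans h)
    have h02 : ∀ x, P 0 x → ¬ P 2 x := by
      rintro x h ⟨k, hk, h'⟩
      exact stdVec_ne_zero hk (h'.symm.trans h)
    have h03 : ∀ x, P 0 x → ¬ P 3 x := by
      rintro x h ⟨k, hk, h'⟩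
      exact stdVec_add_ne_zero (by omega : k < m) (by omega) (h'.symm.trans h)
    have h12 : ∀ x, P 1 x → ¬ P 2 x := by
      rintro x h ⟨k, hk, h'⟩
      have := stdVec_inj hk (h'.symm.trans h)
      omega
    have h13 : ∀ x, P 1 x → ¬ P 3 x := by
      rintro x h ⟨k, hk, h'⟩
      exact stdVec_add_ne_stdVec (by omega) hk (by omega) (h'.symm.trans h)
    have h23 : ∀ x, P 2 x → ¬ P 3 x := by
      rintro x ⟨l, hl, h⟩ ⟨k, hk, h'⟩
      exact stdVec_add_ne_stdVec (by omega) hk (by omega) (h'.symm.trans h)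
    intro i j x hi hj
    fin_cases i <;> fin_cases j <;> first
      | rfl
      | exact (h01 x hi hj).elim
      | exact (h02 x hi hj).elim
      | exact (h03 x hi hj).elim
      | exact (h12 x hi hj).elim
      | exact (h13 x hi hj).elim
      | exact (h23 x hi hj).elim
      | exact (h01 x hj hi).elim
      | exact (h02 x hj hi).elim
      | exact (h03 x hj hi).elim
      | exact (h12 x hj hi).elim
      | exact (h13 x hj hi).elim
      | exact (h23 x hj hi).elim)
  refine ⟨c, fun L b hL h => ?_⟩
  have hb : b = 0 := by
    have : L 0 + b = 0 := (hc _ _ (h 0) 0).2 rfl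
    rwa [map_zero, zero_add] at this
  subst hb
  simp only [add_zero] at h ⊢
  refine eq_self_of_path hL (s := 0) (fun k hk _ => ?_) (fun i _ hi ih => ?_)
  · obtain rfl : k = 0 := by omega
    exact (hc _ _ (h (stdVec m r 0)) 1).2 rfl
  · obtain ⟨k, hk, h1⟩ := (hc _ _ (h (stdVec m r (i + 1))) 2).2 ⟨i, hi, rfl⟩
    refine ⟨k + 1, hk, h1, ?_⟩
    obtain ⟨l, hl, h2⟩ := (hc _ _ (h (stdVec m r i + stdVec m r (i + 1))) 3).2 ⟨i, hi, rfl⟩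
    rw [map_add, ih i le_rfl, h1] at h2
    exact ⟨l, hl, h2⟩

end AffineColoring

section AffineColoring

variable {r m : ℕ}

theorem sum_stdVec {k : ℕ} (hk : k < m) : ∑ i, stdVec m r k i = 1 := by
  rw [Finset.sum_eq_single ⟨k, hk⟩, stdVec_self]
  · intro i _ hi
    exact stdVec_ne fun h => hi (Fin.ext h)
  · intro h
    exact (h (Finset.mem_univ _)).elim

/-- The middle colour class of the `3`-colouring used for affine spaces of characteristic at
least five. -/
def PathClass (m r : ℕ) (x : Fin m → ZMod r) : Prop :=
  x = stdVec m r 0 ∨ x = stdVec m r 0 + stdVec m r 0 ∨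
    (∃ k, k + 1 < m ∧ x = stdVec m r (k + 1)) ∨
    ∃ k, k + 1 < m ∧ x = stdVec m r k + stdVec m r (k + 1)

theorem PathClass.sum {x : Fin m → ZMod r} (hm : 0 < m) (hx : PathClass m r x) :
    ∑ i, x i = 1 ∨ ∑ i, x i = 2 := by
  have h2 : ∀ k l, k < m → l < m → ∑ i, (stdVec m r k + stdVec m r l) i = 2 := fun k l hk hl => by
    simp only [Pi.add_apply, Finset.sum_add_distrib]
    rw [sum_stdVec hk, sum_stdVec hl, one_add_one_eq_two]
  rcases hx with rfl | rfl | ⟨k, hk, rfl⟩ | ⟨k, hk, rfl⟩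
  · exact Or.inl (sum_stdVec hm)
  · exact Or.inr (h2 0 0 hm hm)
  · exact Or.inl (sum_stdVec hk)
  · exact Or.inr (h2 _ _ (by omega) hk)

theorem PathClass.apply {x : Fin m → ZMod r} (hx : PathClass m r x) {j : Fin m} (hj : (j : ℕ) ≠ 0) :
    x j = 0 ∨ x j = 1 := by
  have h1 : ∀ k, stdVec m r k j = 0 ∨ stdVec m r k j = 1 := fun k => by
    unfold stdVec; split_ifs <;> simp
  rcases hx with rfl | rfl | ⟨k, hk, rfl⟩ | ⟨k, hk, rfl⟩
  · exact h1 0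
  · rw [Pi.add_apply, stdVec_ne hj]; simp
  · exact h1 _
  · by_cases h : (j : ℕ) = k
    · rw [Pi.add_apply, stdVec_ne (by omega : (j : ℕ) ≠ k + 1), add_zero]
      exact h1 k
    · rw [Pi.add_apply, stdVec_ne h, zero_add]
      exact h1 _

theorem PathClass.eq_of_add_self [Fact r.Prime] (h2 : (2 : ZMod r) ≠ 0) (h3 : (3 : ZMod r) ≠ 0)
    (hm : 0 < m) {x : Fin m → ZMod r} (hx : PathClass m r x) (hxx : PathClass m r (x + x)) :
    x = stdVec m r 0 := by
  have hcoord : ∀ j : Fin m, (j : ℕ) ≠ 0 → x j ≠ 1 := fun j hj h => by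
    have := hxx.apply hj
    rw [Pi.add_apply, h, one_add_one_eq_two] at this
    rcases this with h | h
    · exact h2 h
    · exact one_ne_zero (by linear_combination h : (1 : ZMod r) = 0)
  rcases hx with h | rfl | ⟨k, hk, rfl⟩ | ⟨k, hk, rfl⟩
  · exact h
  · exfalso
    rcases hxx with h | h | ⟨k, hk, h⟩ | ⟨k, hk, h⟩
    · have := congrFun h ⟨0, hm⟩
      simp only [Pi.add_apply, stdVec_self] at this
      exact h3 (by linear_combination this)
    · have := congrFun h ⟨0, hm⟩
      simp only [Pi.add_apply, stdVec_self] at this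
      exact h2 (by linear_combination this)
    · have := congrFun h ⟨k + 1, hk⟩
      simp only [Pi.add_apply, stdVec_self] at this
      rw [stdVec_ne (by simp)] at this
      exact one_ne_zero (by linear_combination -this : (1 : ZMod r) = 0)
    · have := congrFun h ⟨k + 1, hk⟩
      simp only [Pi.add_apply, stdVec_self] at this
      rw [stdVec_ne (by simp), stdVec_ne (by simp)] at this
      exact one_ne_zero (by linear_combination -this : (1 : ZMod r) = 0)
  · exact (hcoord ⟨k + 1, hk⟩ (by simp) (stdVec_self hk)).elim
  · refine (hcoord ⟨k + 1, hk⟩ (by simp) ?_).elim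
    rw [Pi.add_apply, stdVec_self, stdVec_ne (by simp), zero_add]

theorem rigidAffine_three [Fact r.Prime] (h2 : (2 : ZMod r) ≠ 0) (h3 : (3 : ZMod r) ≠ 0) :
    RigidAffine 3 r m := by
  rcases Nat.eq_zero_or_pos m with rfl | hm
  · exact ⟨fun _ => 0, fun _ _ _ _ _ => Subsingleton.elim _ _⟩
  have h1 : (1 : ZMod r) ≠ 0 := one_ne_zero
  obtain ⟨c, hc⟩ := exists_coloring_of_disjoint (by omega : 2 < 3)
    (![fun x => x = 0, PathClass m r] : Fin 2 → (Fin m → ZMod r) → Prop) (by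
      have h01 : ∀ x : Fin m → ZMod r, x = 0 → ¬ PathClass m r x := by
        rintro x rfl h
        rcases h.sum hm with h | h
        · exact h1 (by simpa using h.symm)
        · exact h2 (by simpa using h.symm)
      intro i j x hi hj
      fin_cases i <;> fin_cases j <;> first
        | rfl
        | exact (h01 x hi hj).elim
        | exact (h01 x hj hi).elim)
  refine ⟨c, fun L b hL h => ?_⟩
  have hb : b = 0 := by
    have : L 0 + b = 0 := (hc _ _ (h 0) 0).2 rfl
    rwa [map_zero, zero_add] at this
  subst hb
  simp only [add_zero] at h ⊢
  have hX : ∀ x, PathClass m r x → PathClass m r (L x) := fun x hx => (hc _ _ (h x) 1).2 hx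
  refine eq_self_of_path hL (s := 0) (fun k hk _ => ?_) (fun i _ hi ih => ?_)
  · obtain rfl : k = 0 := by omega
    refine PathClass.eq_of_add_self h2 h3 hm (hX _ (Or.inl rfl)) ?_
    rw [← map_add]
    exact hX _ (Or.inr (Or.inl rfl))
  · have hQ := hX _ (Or.inr (Or.inr (Or.inr ⟨i, hi, rfl⟩)))
    rw [map_add, ih i le_rfl] at hQ
    rcases hX _ (Or.inr (Or.inr (Or.inl ⟨i, hi, rfl⟩))) with hx | hx | ⟨k, hk, hx⟩ | ⟨k, hk, hx⟩
    · rw [← ih 0 (by omega)] at hx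
      have := stdVec_inj hi (hL hx)
      omega
    · rw [← ih 0 (by omega), ← map_add] at hx
      have := congrFun (hL hx) ⟨i + 1, hi⟩
      rw [Pi.add_apply, stdVec_self, stdVec_ne (by simp), add_zero] at this
      exact (h1 this).elim
    · refine ⟨k + 1, hk, hx, ?_⟩
      rw [hx] at hQ
      rcases hQ with h4 | h4 | ⟨l, hl, h4⟩ | ⟨l, hl, h4⟩
      · exfalso
        have h5 : ∑ j, (stdVec m r i + stdVec m r (k + 1)) j = 1 := by rw [h4, sum_stdVec hm]
        simp only [Pi.add_apply, Finset.sum_add_distrib] at h5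
        rw [sum_stdVec (by omega), sum_stdVec hk] at h5
        exact h1 (by linear_combination h5)
      · exfalso
        have := congrFun h4 ⟨k + 1, hk⟩
        simp only [Pi.add_apply, stdVec_self] at this
        rw [stdVec_ne (by simp : ((⟨k + 1, hk⟩ : Fin m) : ℕ) ≠ 0), add_zero] at this
        by_cases hik : i = k + 1
        · subst hik
          rw [stdVec_self] at this
          exact h2 (by linear_combination this)
        · rw [stdVec_ne (fun h => hik h.symm)] at this
          exact h1 (by linear_combination this)
      · exfalso
        have h5 : ∑ j, (stdVec m r i + stdVec m r (k + 1)) j = 1 := by rw [h4, sum_stdVec hl]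
        simp only [Pi.add_apply, Finset.sum_add_distrib] at h5
        rw [sum_stdVec (by omega), sum_stdVec hk] at h5
        exact h1 (by linear_combination h5)
      · exact ⟨l, hl, h4⟩
    · exfalso
      rw [hx] at hQ
      have h5 := hQ.sum hm
      simp only [Pi.add_apply, Finset.sum_add_distrib] at h5
      rw [sum_stdVec (by omega), sum_stdVec (by omega), sum_stdVec hk] at h5
      rcases h5 with h5 | h5
      · exact h2 (by linear_combination h5)
      · exact h1 (by linear_combination h5)

end AffineColoring

section BinaryColoring

variable {m : ℕ}

theorem stdVec_add_apply_eq_one {a b : ℕ} (hab : a ≠ b) (j : Fin m) :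
    (stdVec m 2 a + stdVec m 2 b) j = 1 ↔ (j : ℕ) = a ∨ (j : ℕ) = b := by
  rw [Pi.add_apply]
  unfold stdVec
  split_ifs <;> first | (exfalso; omega) | simp_all

theorem stdVec_add_add_apply_eq_one {a b c : ℕ} (hab : a ≠ b) (hac : a ≠ c) (hbc : b ≠ c)
    (j : Fin m) : (stdVec m 2 a + stdVec m 2 b + stdVec m 2 c) j = 1 ↔
      (j : ℕ) = a ∨ (j : ℕ) = b ∨ (j : ℕ) = c := by
  rw [Pi.add_apply, Pi.add_apply]
  unfold stdVec
  split_ifs <;> first | (exfalso; omega) | simp_all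

/-- The origin and the standard basis of `𝔽₂ ^ m`. -/
def SimplexClass (m : ℕ) (x : Fin m → ZMod 2) : Prop := x = 0 ∨ ∃ k < m, x = stdVec m 2 k

/-- The edges of the path on the standard basis of `𝔽₂ ^ m`, together with the sum of the first
three basis vectors. -/
def EdgeClass (m : ℕ) (x : Fin m → ZMod 2) : Prop :=
  (∃ k, k + 1 < m ∧ x = stdVec m 2 k + stdVec m 2 (k + 1)) ∨
    x = stdVec m 2 0 + stdVec m 2 1 + stdVec m 2 2

theorem EdgeClass.apply {x : Fin m → ZMod 2} (h : EdgeClass m x) :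
    (∃ l, l + 1 < m ∧ ∀ j : Fin m, x j = 1 ↔ (j : ℕ) = l ∨ (j : ℕ) = l + 1) ∨
      ∀ j : Fin m, x j = 1 ↔ (j : ℕ) = 0 ∨ (j : ℕ) = 1 ∨ (j : ℕ) = 2 := by
  rcases h with ⟨k, hk, rfl⟩ | rfl
  · exact Or.inl ⟨k, hk, stdVec_add_apply_eq_one (by omega)⟩
  · exact Or.inr (stdVec_add_add_apply_eq_one (by omega) (by omega) (by omega))

theorem EdgeClass.adjacent (hm : 5 ≤ m) {a b : ℕ} (ha : a < m) (hb : b < m) (hab : a ≠ b)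
    (h : EdgeClass m (stdVec m 2 a + stdVec m 2 b)) : a = b + 1 ∨ b = a + 1 := by
  rcases h.apply with ⟨l, hl, h⟩ | h
  · have h1 := h ⟨a, ha⟩
    have h2 := h ⟨b, hb⟩
    rw [stdVec_add_apply_eq_one hab] at h1 h2
    dsimp only at h1 h2
    omega
  · have h0 := h ⟨0, by omega⟩
    have h1 := h ⟨1, by omega⟩
    have h2 := h ⟨2, by omega⟩
    rw [stdVec_add_apply_eq_one hab] at h0 h1 h2
    dsimp only at h0 h1 h2
    omega

theorem EdgeClass.le_two {a b c : ℕ} (ha : a < m) (hb : b < m) (hc : c < m)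
    (hab : a ≠ b) (hac : a ≠ c) (hbc : b ≠ c)
    (h : EdgeClass m (stdVec m 2 a + stdVec m 2 b + stdVec m 2 c)) : a ≤ 2 ∧ b ≤ 2 ∧ c ≤ 2 := by
  rcases h.apply with ⟨l, hl, h⟩ | h
  all_goals
    have h1 := h ⟨a, ha⟩
    have h2 := h ⟨b, hb⟩
    have h3 := h ⟨c, hc⟩
    rw [stdVec_add_add_apply_eq_one hab hac hbc] at h1 h2 h3
    dsimp only at h1 h2 h3
    omega

/-- Characterisation of the origin in `SimplexClass` by means of `EdgeClass`. -/
def IsSimplexOrigin (m : ℕ) (a : Fin m → ZMod 2) : Prop :=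
  ∀ b, SimplexClass m b → b ≠ a → ∃ c, SimplexClass m c ∧ c ≠ a ∧ c ≠ b ∧ EdgeClass m (a + b + c)

theorem isSimplexOrigin_zero (hm : 5 ≤ m) : IsSimplexOrigin m 0 := by
  have : Fact (Nat.Prime 2) := ⟨Nat.prime_two⟩
  rintro b (rfl | ⟨k, hk, rfl⟩) hb
  · exact (hb rfl).elim
  by_cases hk' : k + 1 < m
  · refine ⟨_, Or.inr ⟨k + 1, hk', rfl⟩, stdVec_ne_zero hk', fun h => ?_, ?_⟩
    · have := stdVec_inj hk' h
      omega
    · rw [zero_add]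
      exact Or.inl ⟨k, hk', rfl⟩
  · obtain ⟨l, rfl⟩ : ∃ l, k = l + 1 := ⟨k - 1, by omega⟩
    refine ⟨_, Or.inr ⟨l, by omega, rfl⟩, stdVec_ne_zero (by omega), fun h => ?_, ?_⟩
    · have := stdVec_inj hk h.symm
      omega
    · rw [zero_add, add_comm]
      exact Or.inl ⟨l, hk, rfl⟩

theorem not_isSimplexOrigin_stdVec (hm : 5 ≤ m) {i : ℕ} (hi : i < m) :
    ¬ IsSimplexOrigin m (stdVec m 2 i) := by
  have : Fact (Nat.Prime 2) := ⟨Nat.prime_two⟩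
  intro h
  obtain ⟨b, hb, hbi⟩ : ∃ b < m, (i ≤ 2 ∧ b = 4) ∨ (3 ≤ i ∧ b = 0) := by
    by_cases h : i ≤ 2
    · exact ⟨4, by omega, Or.inl ⟨h, rfl⟩⟩
    · exact ⟨0, by omega, Or.inr ⟨by omega, rfl⟩⟩
  have hne : i ≠ b := by omega
  obtain ⟨c, hc, hci, hcb, hE⟩ := h _ (Or.inr ⟨b, hb, rfl⟩) fun h => hne (stdVec_inj hb h).symm
  rcases hc with rfl | ⟨k, hk, rfl⟩
  · rw [add_zero] at hE
    have := hE.adjacent hm hi hb hne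
    omega
  · have := hE.le_two hi hb hk hne (fun h => hci (by rw [h])) (fun h => hcb (by rw [h]))
    omega

theorem rigidAffine_three_two_of_five_le (hm : 5 ≤ m) : RigidAffine 3 2 m := by
  have : Fact (Nat.Prime 2) := ⟨Nat.prime_two⟩
  obtain ⟨c, hc⟩ := exists_coloring_of_disjoint (by omega : 2 < 3)
    (![SimplexClass m, EdgeClass m] : Fin 2 → (Fin m → ZMod 2) → Prop) (by
      have h01 : ∀ x : Fin m → ZMod 2, SimplexClass m x → ¬ EdgeClass m x := by
        intro x hx hE
        have : ∃ i j : Fin m, i ≠ j ∧ x i = 1 ∧ x j = 1 := by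
          rcases hE.apply with ⟨l, hl, h⟩ | h
          · exact ⟨⟨l, by omega⟩, ⟨l + 1, hl⟩, by simp, (h _).2 (by simp), (h _).2 (by simp)⟩
          · exact ⟨⟨0, by omega⟩, ⟨1, by omega⟩, by simp, (h _).2 (by simp), (h _).2 (by simp)⟩
        obtain ⟨i, j, hij, h1, h2⟩ := this
        rcases hx with rfl | ⟨k, hk, rfl⟩
        · exact zero_ne_one h1
        · have h3 : ∀ j : Fin m, stdVec m 2 k j = 1 → (j : ℕ) = k := fun j hj => by
            by_contra h
            rw [stdVec_ne h] at hj
            exact zero_ne_one hj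
          exact hij (Fin.ext ((h3 i h1).trans (h3 j h2).symm))
      intro i j x hi hj
      fin_cases i <;> fin_cases j <;> first
        | rfl
        | exact (h01 x hi hj).elim
        | exact (h01 x hj hi).elim)
  refine ⟨c, fun L b hL h => ?_⟩
  have hA : ∀ x, SimplexClass m (L x + b) ↔ SimplexClass m x := fun x => hc _ _ (h x) 0
  have hB : ∀ x, EdgeClass m (L x + b) ↔ EdgeClass m x := fun x => hc _ _ (h x) 1
  have hbb : b + b = 0 := funext fun i => CharTwo.add_self_eq_zero (b i)
  have hb : b = 0 := by
    have h1 : IsSimplexOrigin m (L 0 + b) := by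
      intro y hy hyb
      obtain ⟨y, rfl⟩ : ∃ x, L x + b = y := by
        obtain ⟨x, hx⟩ := Finite.surjective_of_injective hL (y - b)
        exact ⟨x, by rw [hx, sub_add_cancel]⟩
      obtain ⟨z, hz, hz0, hzy, hE⟩ := isSimplexOrigin_zero hm y ((hA y).1 hy)
        (fun h => hyb (by rw [h]))
      refine ⟨L z + b, (hA z).2 hz, fun h => hz0 (hL (add_right_cancel h)),
        fun h => hzy (hL (add_right_cancel h)), ?_⟩
      have h2 := (hB _).2 hE
      rwa [show L 0 + b + (L y + b) + (L z + b) = L (0 + y + z) + b from ?_]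
      rw [map_add, map_add]
      linear_combination (norm := module) hbb
    rcases (hA 0).2 (Or.inl rfl) with h2 | ⟨k, hk, h2⟩
    · rwa [map_zero, zero_add] at h2
    · rw [h2] at h1
      exact (not_isSimplexOrigin_stdVec hm hk h1).elim
  subst hb
  simp only [add_zero] at hA hB ⊢
  have hπ : ∀ k, k < m → ∃ l < m, L (stdVec m 2 k) = stdVec m 2 l := fun k hk => by
    rcases (hA (stdVec m 2 k)).2 (Or.inr ⟨k, hk, rfl⟩) with h1 | h1
    · exact (stdVec_ne_zero hk (hL (h1.trans (map_zero L).symm))).elim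
    · exact h1
  have hinj : ∀ i j k l, i < m → i ≠ j → L (stdVec m 2 i) = stdVec m 2 k →
      L (stdVec m 2 j) = stdVec m 2 l → k ≠ l := by
    rintro i j k l hi hij h1 h2 rfl
    exact hij (stdVec_inj hi (hL (h1.trans h2.symm)))
  have hadj : ∀ i k l, i + 1 < m → k < m → l < m → L (stdVec m 2 i) = stdVec m 2 k →
      L (stdVec m 2 (i + 1)) = stdVec m 2 l → k = l + 1 ∨ l = k + 1 := by
    intro i k l hi hk hl h1 h2
    refine EdgeClass.adjacent hm hk hl (hinj _ _ _ _ (by omega) (by omega) h1 h2) ?_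
    rw [← h1, ← h2, ← map_add, hB]
    exact Or.inl ⟨i, hi, rfl⟩
  obtain ⟨a0, ha0, h0⟩ := hπ 0 (by omega)
  obtain ⟨a1, ha1, h1⟩ := hπ 1 (by omega)
  obtain ⟨a2, ha2, h2⟩ := hπ 2 (by omega)
  obtain ⟨a3, ha3, h3⟩ := hπ 3 (by omega)
  have hle : a0 ≤ 2 ∧ a1 ≤ 2 ∧ a2 ≤ 2 := by
    refine EdgeClass.le_two ha0 ha1 ha2 (hinj _ _ _ _ (by omega) (by omega) h0 h1)
      (hinj _ _ _ _ (by omega) (by omega) h0 h2) (hinj _ _ _ _ (by omega) (by omega) h1 h2) ?_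
    rw [← h0, ← h1, ← h2, ← map_add, ← map_add, hB]
    exact Or.inr rfl
  have d01 := hinj _ _ _ _ (by omega) (by omega) h0 h1
  have d02 := hinj _ _ _ _ (by omega) (by omega) h0 h2
  have d03 := hinj _ _ _ _ (by omega) (by omega) h0 h3
  have d12 := hinj _ _ _ _ (by omega) (by omega) h1 h2
  have d13 := hinj _ _ _ _ (by omega) (by omega) h1 h3
  have d23 := hinj _ _ _ _ (by omega) (by omega) h2 h3
  have e01 := hadj _ _ _ (by omega) ha0 ha1 h0 h1
  have e12 := hadj _ _ _ (by omega) ha1 ha2 h1 h2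
  have e23 := hadj _ _ _ (by omega) ha2 ha3 h2 h3
  obtain ⟨rfl, rfl, rfl, rfl⟩ : a0 = 0 ∧ a1 = 1 ∧ a2 = 2 ∧ a3 = 3 := by omega
  refine eq_self_of_path hL (s := 3) (fun k hk _ => ?_) (fun i hs hi ih => ?_)
  · interval_cases k <;> assumption
  · obtain ⟨k, hk, hk1⟩ := hπ (i + 1) hi
    refine ⟨k, hk, hk1, ?_⟩
    rcases hadj i i k hi (by omega) hk (ih i le_rfl) hk1 with h4 | rfl
    · refine ⟨k, by omega, ?_⟩
      rw [← h4, add_comm]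
    · exact ⟨i, hk, rfl⟩

end BinaryColoring

section BinaryColoring

theorem rigidAffine_three_of_le_one {m : ℕ} (hm : m ≤ 1) : RigidAffine 3 2 m := by
  refine ⟨fun x => if ∀ i, x i = 0 then 0 else 1, fun L b _ h x => ?_⟩
  have h01 : ∀ a : ZMod 2, a = 0 ∨ a = 1 := by decide
  have hsub : ∀ i j : Fin m, i = j := fun i j => Fin.ext (by omega)
  have h1 := h x
  funext i
  have hall : ∀ y : Fin m → ZMod 2, (∀ j, y j = 0) ↔ y i = 0 := fun y =>
    ⟨fun h => h i, fun h j => by rw [hsub j i, h]⟩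
  simp only [hall] at h1
  rcases h01 ((L x + b) i) with h2 | h2 <;> rcases h01 (x i) with h3 | h3 <;>
    simp_all

/-- A `3`-colouring of the `16` bit vectors of length four. -/
def hypercubeColor (n : ℕ) : ZMod 3 :=
  [2, 1, 0, 1, 1, 1, 2, 0, 1, 2, 2, 2, 2, 0, 1, 0].getD n 0

/-- The number with given four binary digits. -/
def bitEncode (x : Fin 4 → ZMod 2) : ℕ :=
  (x 0).val + 2 * (x 1).val + 4 * (x 2).val + 8 * (x 3).val

theorem bitEncode_lt (x : Fin 4 → ZMod 2) : bitEncode x < 16 := by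
  have h0 := ZMod.val_lt (x 0)
  have h1 := ZMod.val_lt (x 1)
  have h2 := ZMod.val_lt (x 2)
  have h3 := ZMod.val_lt (x 3)
  unfold bitEncode
  omega

theorem bitEncode_injective : Function.Injective bitEncode := by
  intro x y h
  have hx := fun i => ZMod.val_lt (x i)
  have hy := fun i => ZMod.val_lt (y i)
  unfold bitEncode at h
  have hx0 := hx 0
  have hx1 := hx 1
  have hx2 := hx 2
  have hx3 := hx 3
  have hy0 := hy 0
  have hy1 := hy 1
  have hy2 := hy 2
  have hy3 := hy 3
  funext i
  refine ZMod.val_injective 2 ?_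
  fin_cases i <;> dsimp <;> omega

theorem bitEncode_add (x y : Fin 4 → ZMod 2) :
    bitEncode (x + y) = bitEncode x ^^^ bitEncode y := by
  have key : ∀ a b c d a' b' c' d' : ZMod 2,
      (a + a').val + 2 * (b + b').val + 4 * (c + c').val + 8 * (d + d').val =
        (a.val + 2 * b.val + 4 * c.val + 8 * d.val) ^^^
          (a'.val + 2 * b'.val + 4 * c'.val + 8 * d'.val) := by
    decide +kernel
  exact key _ _ _ _ _ _ _ _

set_option synthInstance.maxSize 2000 in
theorem hypercubeColor_rigid : ∀ b : Fin 16, hypercubeColor (b : ℕ) = hypercubeColor 0 →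
    ∀ s : Fin 16, hypercubeColor ((s : ℕ) ^^^ b) = hypercubeColor 1 →
    ∀ t : Fin 16, hypercubeColor ((t : ℕ) ^^^ b) = hypercubeColor 2 →
      hypercubeColor ((s : ℕ) ^^^ t ^^^ b) = hypercubeColor 3 →
    ∀ u : Fin 16, hypercubeColor ((u : ℕ) ^^^ b) = hypercubeColor 4 →
      hypercubeColor ((s : ℕ) ^^^ u ^^^ b) = hypercubeColor 5 →
      hypercubeColor ((t : ℕ) ^^^ u ^^^ b) = hypercubeColor 6 →
      hypercubeColor ((s : ℕ) ^^^ t ^^^ u ^^^ b) = hypercubeColor 7 →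
    ∀ v : Fin 16, hypercubeColor ((v : ℕ) ^^^ b) = hypercubeColor 8 →
      hypercubeColor ((s : ℕ) ^^^ v ^^^ b) = hypercubeColor 9 →
      hypercubeColor ((t : ℕ) ^^^ v ^^^ b) = hypercubeColor 10 →
      hypercubeColor ((s : ℕ) ^^^ t ^^^ v ^^^ b) = hypercubeColor 11 →
      hypercubeColor ((u : ℕ) ^^^ v ^^^ b) = hypercubeColor 12 →
      hypercubeColor ((s : ℕ) ^^^ u ^^^ v ^^^ b) = hypercubeColor 13 →
      hypercubeColor ((t : ℕ) ^^^ u ^^^ v ^^^ b) = hypercubeColor 14 →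
      hypercubeColor ((s : ℕ) ^^^ t ^^^ u ^^^ v ^^^ b) = hypercubeColor 15 →
      s = 1 ∧ t = 2 ∧ u = 4 ∧ v = 8 ∧ b = 0 := by
  decide +kernel

theorem rigidAffine_three_two_four : RigidAffine 3 2 4 := by
  have : Fact (Nat.Prime 2) := ⟨Nat.prime_two⟩
  refine ⟨fun x => hypercubeColor (bitEncode x), fun L b hL h => ?_⟩
  have h0 : bitEncode (stdVec 4 2 0) = 1 := by decide
  have h1 : bitEncode (stdVec 4 2 1) = 2 := by decide
  have h2 : bitEncode (stdVec 4 2 2) = 4 := by decide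
  have h3 : bitEncode (stdVec 4 2 3) = 8 := by decide
  have hz : bitEncode 0 = 0 := rfl
  have hfull := h (stdVec 4 2 0 + stdVec 4 2 1 + stdVec 4 2 2 + stdVec 4 2 3)
  have key := hypercubeColor_rigid ⟨bitEncode b, bitEncode_lt b⟩
    (by simpa [hz] using h 0)
    ⟨bitEncode (L (stdVec 4 2 0)), bitEncode_lt _⟩
    (by simpa [bitEncode_add, h0] using h (stdVec 4 2 0))
    ⟨bitEncode (L (stdVec 4 2 1)), bitEncode_lt _⟩
    (by simpa [bitEncode_add, h1] using h (stdVec 4 2 1))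
    (by simpa [bitEncode_add, h0, h1] using h (stdVec 4 2 0 + stdVec 4 2 1))
    ⟨bitEncode (L (stdVec 4 2 2)), bitEncode_lt _⟩
    (by simpa [bitEncode_add, h2] using h (stdVec 4 2 2))
    (by simpa [bitEncode_add, h0, h2] using h (stdVec 4 2 0 + stdVec 4 2 2))
    (by simpa [bitEncode_add, h1, h2] using h (stdVec 4 2 1 + stdVec 4 2 2))
    (by simpa [bitEncode_add, h0, h1, h2] using h (stdVec 4 2 0 + stdVec 4 2 1 + stdVec 4 2 2))
    ⟨bitEncode (L (stdVec 4 2 3)), bitEncode_lt _⟩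
    (by simpa [bitEncode_add, h3] using h (stdVec 4 2 3))
    (by simpa [bitEncode_add, h0, h3] using h (stdVec 4 2 0 + stdVec 4 2 3))
    (by simpa [bitEncode_add, h1, h3] using h (stdVec 4 2 1 + stdVec 4 2 3))
    (by simpa [bitEncode_add, h0, h1, h3] using h (stdVec 4 2 0 + stdVec 4 2 1 + stdVec 4 2 3))
    (by simpa [bitEncode_add, h2, h3] using h (stdVec 4 2 2 + stdVec 4 2 3))
    (by simpa [bitEncode_add, h0, h2, h3] using h (stdVec 4 2 0 + stdVec 4 2 2 + stdVec 4 2 3))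
    (by simpa [bitEncode_add, h1, h2, h3] using h (stdVec 4 2 1 + stdVec 4 2 2 + stdVec 4 2 3))
    (by simpa [bitEncode_add, h0, h1, h2, h3] using hfull)
  obtain ⟨k0, k1, k2, k3, kb⟩ := key
  replace kb := congrArg Fin.val kb
  rw [bitEncode_injective (kb.trans hz.symm)]
  simp only [add_zero]
  refine eq_self_of_stdVec fun k hk => bitEncode_injective ?_
  interval_cases k
  · exact (congrArg Fin.val k0).trans h0.symm
  · exact (congrArg Fin.val k1).trans h1.symm
  · exact (congrArg Fin.val k2).trans h2.symm
  · exact (congrArg Fin.val k3).trans h3.symm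

end BinaryColoring

section OctalTables

/-- The value table of the linear map of `𝔽₂ ^ 3` with the given values on the standard basis,
where vectors are encoded by their binary digits. -/
def octTable (a b c n : ℕ) : ℕ :=
  [0, a, b, a ^^^ b, c, a ^^^ c, b ^^^ c, a ^^^ b ^^^ c].getD n 0

set_option synthInstance.maxSize 2000 in
theorem octTable_order : ∀ a b c : Fin 8, (∀ n : Fin 8, octTable a b c n = 0 → n = 0) →
    (∀ n : Fin 8, (octTable a b c)^[4] n = n) ∨ (∀ n : Fin 8, (octTable a b c)^[3] n = n) ∨
      ∀ n : Fin 8, octTable a b c n = n → n = 0 := by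
  decide +kernel

set_option synthInstance.maxSize 2000 in
theorem octTable_exists_order_three : ∀ a b c : Fin 8,
    (∀ n : Fin 8, octTable a b c n = 0 → n = 0) → (∀ n : Fin 8, octTable a b c n = n → n = 0) →
    ∀ s t : Fin 8, (∀ n : Fin 8, octTable 1 s t n = 0 → n = 0) →
      (s = 2 ∧ t = 4) ∨ ∃ i : Fin 7,
        (∀ n : Fin 8, (fun k => octTable 1 s t ((octTable a b c)^[i] k))^[3] n = n) ∧
          ∃ n : Fin 8, octTable 1 s t ((octTable a b c)^[i] n) ≠ n := by
  decide +kernel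

end OctalTables

section SmallAffine

variable {S Ω : Type*} [Group S] [MulAction S Ω] {m : ℕ} {e : (Fin m → ZMod 2) ≃ Ω}

theorem exists_moved_of_primitive (hm : 2 ≤ m)
    (hprim : ∀ s : Setoid Ω, (∀ (g : S) x y, s x y → s (g • x) (g • y)) → s = ⊥ ∨ s = ⊤)
    (haff : ∀ g : S, ∃ (L : (Fin m → ZMod 2) →+ (Fin m → ZMod 2)) (b : Fin m → ZMod 2),
        ∀ x, g • e x = e (L x + b))
    (htr : ∀ b, ∃ g : S, ∀ x, g • e x = e (x + b)) {v : Fin m → ZMod 2} (hv : v ≠ 0) :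
    ∃ g : S, g • e 0 = e 0 ∧ g • e v ≠ e v := by
  have : Fact (Nat.Prime 2) := ⟨Nat.prime_two⟩
  by_contra! hfix
  have hvv : v + v = 0 := funext fun i => CharTwo.add_self_eq_zero (v i)
  let W : AddSubgroup (Fin m → ZMod 2) :=
    { carrier := {x | x = 0 ∨ x = v}
      add_mem' := by
        rintro a b (rfl | rfl) (rfl | rfl)
        · exact Or.inl (add_zero _)
        · exact Or.inr (zero_add _)
        · exact Or.inr (add_zero _)
        · exact Or.inl hvv
      zero_mem' := Or.inl rfl
      neg_mem' := by
        rintro a (rfl | rfl)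
        · exact Or.inl neg_zero
        · exact Or.inr (neg_eq_of_add_eq_zero_left hvv) }
  let s : Setoid Ω :=
    { r := fun x y => e.symm x - e.symm y ∈ W
      iseqv := ⟨fun x => by rw [sub_self]; exact W.zero_mem,
        fun h => by rw [← neg_sub]; exact W.neg_mem h,
        fun h h' => by rw [← sub_add_sub_cancel]; exact W.add_mem h h'⟩ }
  have hs : ∀ x y, s x y ↔ e.symm x - e.symm y ∈ W := fun _ _ => Iff.rfl
  have hinv : ∀ (g : S) x y, s x y → s (g • x) (g • y) := by
    intro g x y h
    obtain ⟨x, rfl⟩ := e.surjective x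
    obtain ⟨y, rfl⟩ := e.surjective y
    obtain ⟨L, b, hL⟩ := haff g
    obtain ⟨t, ht⟩ := htr (-b)
    have hLv : L v = v := by
      have h1 : ∀ x, (t * g) • e x = e (L x) := fun x => by
        rw [mul_smul, hL, ht, add_neg_cancel_right]
      have h2 := hfix (t * g) (by rw [h1, map_zero])
      rw [h1] at h2
      exact e.injective h2
    rw [hs, e.symm_apply_apply, e.symm_apply_apply] at h
    rw [hs, hL, hL, e.symm_apply_apply, e.symm_apply_apply, add_sub_add_right_eq_sub, ← map_sub]
    rcases h with h | h
    · rw [h, map_zero]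
      exact W.zero_mem
    · rw [h, hLv]
      exact Or.inr rfl
  rcases hprim s hinv with h | h
  · have h1 : s (e v) (e 0) := by
      rw [hs, e.symm_apply_apply, e.symm_apply_apply, sub_zero]
      exact Or.inr rfl
    rw [h] at h1
    exact hv (e.injective h1)
  · have h1 : ∀ x, x ∈ W := fun x => by
      have h2 : s (e x) (e 0) := by rw [h]; trivial
      rwa [hs, e.symm_apply_apply, e.symm_apply_apply, sub_zero] at h2
    have h0 := (h1 (stdVec m 2 0)).resolve_left (stdVec_ne_zero (by omega))
    have h1 := (h1 (stdVec m 2 1)).resolve_left (stdVec_ne_zero (by omega))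
    have := stdVec_inj (by omega) (h0.trans h1.symm)
    omega

theorem false_of_primitive_four [Finite S] (h3 : ¬ 3 ∣ Nat.card S) {e : (Fin 2 → ZMod 2) ≃ Ω}
    (hprim : ∀ s : Setoid Ω, (∀ (g : S) x y, s x y → s (g • x) (g • y)) → s = ⊥ ∨ s = ⊤)
    (haff : ∀ g : S, ∃ (L : (Fin 2 → ZMod 2) →+ (Fin 2 → ZMod 2)) (b : Fin 2 → ZMod 2),
        ∀ x, g • e x = e (L x + b))
    (htr : ∀ b, ∃ g : S, ∀ x, g • e x = e (x + b)) : False := by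
  let w : Fin 3 → (Fin 2 → ZMod 2) := ![![1, 0], ![0, 1], ![1, 1]]
  have hw : ∀ x : Fin 2 → ZMod 2, x = 0 ∨ ∃ j, x = w j := by decide
  have hw0 : ∀ j, w j ≠ 0 := by decide
  have hwi : Function.Injective w := by decide
  obtain ⟨i, hi⟩ := exists_fixed_of_three h3 (MulAction.stabilizer S (e 0))
    (MulAction.toPermHom S Ω) (fun i => e (w i)) (fun i j h => hwi (e.injective h)) (by
      intro k hk i
      obtain ⟨x, hx⟩ := e.surjective (k • e (w i))
      rcases hw x with rfl | ⟨j, rfl⟩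
      · rw [← MulAction.mem_stabilizer_iff.1 hk] at hx
        exact (hw0 i (e.injective (smul_left_cancel _ hx)).symm).elim
      · exact ⟨j, hx.symm⟩)
  obtain ⟨g, hg, hg'⟩ := exists_moved_of_primitive le_rfl hprim haff htr (hw0 i)
  exact hg' (hi g hg)

/-- The number with given three binary digits. -/
def octEncode (x : Fin 3 → ZMod 2) : ℕ := (x 0).val + 2 * (x 1).val + 4 * (x 2).val

theorem octEncode_lt : ∀ x, octEncode x < 8 := by decide +kernel

theorem octEncode_injective : Function.Injective octEncode := by decide +kernel

theorem octEncode_add : ∀ x y, octEncode (x + y) = octEncode x ^^^ octEncode y := by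
  decide +kernel

theorem eq_sum_of_octEncode : ∀ x : Fin 3 → ZMod 2, ∃ a b c : Fin 2,
    x = (a : ℕ) • stdVec 3 2 0 + (b : ℕ) • stdVec 3 2 1 + (c : ℕ) • stdVec 3 2 2 := by
  decide +kernel

theorem octEncode_map (L : (Fin 3 → ZMod 2) →+ (Fin 3 → ZMod 2)) (x : Fin 3 → ZMod 2) :
    octEncode (L x) = octTable (octEncode (L (stdVec 3 2 0))) (octEncode (L (stdVec 3 2 1)))
      (octEncode (L (stdVec 3 2 2))) (octEncode x) := by
  have h0 : octEncode (stdVec 3 2 0) = 1 := by decide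
  have h1 : octEncode (stdVec 3 2 1) = 2 := by decide
  have h2 : octEncode (stdVec 3 2 2) = 4 := by decide
  have hz : octEncode 0 = 0 := rfl
  obtain ⟨a, b, c, rfl⟩ := eq_sum_of_octEncode x
  fin_cases a <;> fin_cases b <;> fin_cases c <;>
    simp [octEncode_add, h0, h1, h2, hz, octTable]

theorem eq_one_of_pow_three [Finite S] (h3 : ¬ 3 ∣ Nat.card S) {g : S} (h : g ^ 3 = 1) : g = 1 := by
  rw [← orderOf_eq_one_iff]
  rcases (Nat.dvd_prime Nat.prime_three).1 (orderOf_dvd_of_pow_eq_one h) with h1 | h1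
  · exact h1
  · exact (h3 (h1 ▸ orderOf_dvd_natCard g)).elim

theorem hasRigidColoring_eight [Finite S] [FaithfulSMul S Ω] (h3 : ¬ 3 ∣ Nat.card S)
    {e : (Fin 3 → ZMod 2) ≃ Ω}
    (hprim : ∀ s : Setoid Ω, (∀ (g : S) x y, s x y → s (g • x) (g • y)) → s = ⊥ ∨ s = ⊤)
    (haff : ∀ g : S, ∃ (L : (Fin 3 → ZMod 2) →+ (Fin 3 → ZMod 2)) (b : Fin 3 → ZMod 2),
        ∀ x, g • e x = e (L x + b))
    (htr : ∀ b, ∃ g : S, ∀ x, g • e x = e (x + b)) : HasRigidColoring 3 S Ω := by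
  classical
  have : Fact (Nat.Prime 2) := ⟨Nat.prime_two⟩
  have hz : octEncode 0 = 0 := rfl
  let k : Ω → ℕ := fun ω => octEncode (e.symm ω)
  have hk : Function.Injective k := octEncode_injective.comp e.symm.injective
  have hk0 : k (e 0) = 0 := by
    simp only [k, e.symm_apply_apply]; exact hz
  let v : Fin 3 → ZMod 2 := stdVec 3 2 0
  have hkv : k (e v) = 1 := by
    simp only [k, e.symm_apply_apply]; decide
  have hsurj : ∀ n : Fin 8, ∃ ω, k ω = n := by
    have : ∀ n : Fin 8, ∃ x, octEncode x = n := by decide +kernel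
    intro n
    obtain ⟨x, hx⟩ := this n
    exact ⟨e x, by simpa only [k, e.symm_apply_apply] using hx⟩
  have hlt : ∀ ω, k ω < 8 := fun ω => octEncode_lt _
  have hcode : ∀ g : S, g • e 0 = e 0 → ∃ a b c : Fin 8, ∀ ω, k (g • ω) = octTable a b c (k ω) := by
    intro g hg
    obtain ⟨L, b, hL⟩ := haff g
    have hb : b = 0 := by
      rw [hL, map_zero, zero_add] at hg
      exact e.injective hg
    subst hb
    refine ⟨⟨_, octEncode_lt (L (stdVec 3 2 0))⟩, ⟨_, octEncode_lt (L (stdVec 3 2 1))⟩,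
      ⟨_, octEncode_lt (L (stdVec 3 2 2))⟩, fun ω => ?_⟩
    obtain ⟨x, rfl⟩ := e.surjective ω
    simp only [k, hL, e.symm_apply_apply, add_zero]
    exact octEncode_map L x
  have hker : ∀ g : S, g • e 0 = e 0 → ∀ a b c : Fin 8, (∀ ω, k (g • ω) = octTable a b c (k ω)) →
      ∀ n : Fin 8, octTable a b c n = 0 → n = 0 := by
    intro g hg a b c h n hn
    obtain ⟨ω, hω⟩ := hsurj n
    rw [← hω, ← h, ← hk0, ← hg] at hn
    have := smul_left_cancel g (hk hn)
    rw [this, hk0] at hω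
    exact Fin.ext hω.symm
  have hiter : ∀ (g : S) (f : ℕ → ℕ), (∀ ω, k (g • ω) = f (k ω)) →
      ∀ (i : ℕ) (ω : Ω), k (g ^ i • ω) = f^[i] (k ω) := by
    intro g f h i
    induction i with
    | zero => intro ω; simp
    | succ i ih => intro ω; rw [pow_succ, mul_smul, ih, h, Function.iterate_succ_apply]
  have hone : ∀ g : S, (∀ ω, k (g • ω) = k ω) → g = 1 := fun g hg =>
    FaithfulSMul.eq_of_smul_eq_smul (α := Ω) fun ω => by rw [one_smul]; exact hk (hg ω)
  obtain ⟨g, hg, a, b, c, habc, hfree⟩ : ∃ g : S, g • e 0 = e 0 ∧ ∃ a b c : Fin 8,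
      (∀ ω, k (g • ω) = octTable a b c (k ω)) ∧ ∀ n : Fin 8, octTable a b c n = n → n = 0 := by
    by_contra! hno
    have h4 : ∀ g : S, g • e 0 = e 0 → g ^ 4 = 1 := by
      intro g hg
      obtain ⟨a, b, c, h⟩ := hcode g hg
      rcases octTable_order a b c (hker g hg a b c h) with h1 | h1 | h1
      · refine hone _ fun ω => ?_
        rw [hiter g _ h]
        exact h1 ⟨k ω, hlt ω⟩
      · have h5 : g = 1 := eq_one_of_pow_three h3 (hone _ fun ω => by
          rw [hiter g _ h]
          exact h1 ⟨k ω, hlt ω⟩)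
        rw [h5, one_pow]
      · obtain ⟨n, hn, hn0⟩ := hno g hg a b c h
        exact (hn0 (h1 n hn)).elim
    have hp : IsPGroup 2 (MulAction.stabilizer S (e 0)) := fun g =>
      ⟨2, Subtype.ext (h4 g g.2)⟩
    have hcard : Nat.card Ω = 8 := by
      rw [← Nat.card_congr e]
      simp
    have : Finite Ω := Finite.of_equiv _ e
    obtain ⟨ω, hω, hne⟩ := hp.exists_fixed_point_of_prime_dvd_card_of_fixed_point Ω
      (by rw [hcard]; norm_num) (a := e 0) (fun g => g.2)
    obtain ⟨x, rfl⟩ := e.surjective ω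
    obtain ⟨g, hg, hg'⟩ := exists_moved_of_primitive (by omega) hprim haff htr
      (v := x) (fun h => hne (by rw [h]))
    exact hg' (hω ⟨g, hg⟩)
  obtain ⟨col, hcol⟩ := exists_coloring_of_disjoint (by omega : 2 < 3)
    (![fun ω => ω = e 0, fun ω => ω = e v] : Fin 2 → Ω → Prop) (by
      have h01 : ∀ ω : Ω, ω = e 0 → ¬ ω = e v := fun ω h h' =>
        stdVec_ne_zero (by omega) (e.injective (h'.symm.trans h))
      intro i j x hi hj
      fin_cases i <;> fin_cases j <;> first
        | rfl
        | exact (h01 x hi hj).elim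
        | exact (h01 x hj hi).elim)
  refine ⟨col, fun t ht ω => ?_⟩
  have ht0 : t • e 0 = e 0 := (hcol _ _ (ht (e 0)) 0).2 rfl
  have htv : t • e v = e v := (hcol _ _ (ht (e v)) 1).2 rfl
  obtain ⟨a', b', c', h'⟩ := hcode t ht0
  obtain rfl : a' = 1 := by
    have h1 := h' (e v)
    rw [htv, hkv] at h1
    exact Fin.ext h1.symm
  rcases octTable_exists_order_three a b c (hker g hg a b c habc) hfree b' c'
    (hker t ht0 1 b' c' h') with ⟨rfl, rfl⟩ | ⟨i, h5, n, hn⟩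
  · have h6 : ∀ n : Fin 8, octTable 1 2 4 n = n := by decide +kernel
    exact hk ((h' ω).trans (h6 ⟨k ω, hlt ω⟩))
  · have h7 : ∀ ω, k ((t * g ^ (i : ℕ)) • ω) = octTable 1 b' c' ((octTable a b c)^[i] (k ω)) :=
      fun ω => by
        rw [mul_smul, h', hiter g _ habc]
        rfl
    have h8 : t * g ^ (i : ℕ) = 1 := eq_one_of_pow_three h3 (hone _ fun ω => by
      rw [hiter _ (fun k => octTable 1 b' c' ((octTable a b c)^[i] k)) h7]
      exact h5 ⟨k ω, hlt ω⟩)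
    obtain ⟨ω, hω⟩ := hsurj n
    refine (hn ?_).elim
    rw [← hω, ← h7, h8, one_smul]

end SmallAffine

section Coloring

variable {p : ℕ} {S Ω : Type*} [Group S] [MulAction S Ω]

theorem RigidAffine.hasRigidColoring {r m : ℕ} (h : RigidAffine p r m)
    (e : (Fin m → ZMod r) ≃ Ω)
    (haff : ∀ g : S, ∃ (L : (Fin m → ZMod r) →+ (Fin m → ZMod r)) (b : Fin m → ZMod r),
        ∀ x, g • e x = e (L x + b)) : HasRigidColoring p S Ω := by
  obtain ⟨c, hc⟩ := h
  refine ⟨fun ω => c (e.symm ω), fun g hg ω => ?_⟩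
  obtain ⟨L, b, hL⟩ := haff g
  obtain ⟨x, rfl⟩ := e.surjective ω
  rw [hL]
  refine congrArg e (hc L b (fun y z hyz => ?_) (fun y => ?_) x)
  · have : g • e y = g • e z := by rw [hL, hL, hyz]
    exact e.injective (smul_left_cancel g this)
  · have := hg (e y)
    simp only [hL, e.symm_apply_apply] at this
    exact this

theorem hasRigidColoring_of_primitive_of_faithful (hp : p.Prime) (hp2 : p ≠ 2) [Finite S]
    [Group.IsSolvable S] [FaithfulSMul S Ω] [Nonempty Ω] (hS : ¬ p ∣ Nat.card S)
    (hprim : ∀ s : Setoid Ω, (∀ (g : S) x y, s x y → s (g • x) (g • y)) → s = ⊥ ∨ s = ⊤) :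
    HasRigidColoring p S Ω := by
  rcases subsingleton_or_nontrivial S with hsub | hnt
  · exact ⟨fun _ => 0, fun g _ ω => by rw [Subsingleton.elim g 1, one_smul]⟩
  obtain ⟨r, m, e, hr, hrS, haff, htr⟩ := exists_affine_structure hprim
  have : Fact r.Prime := ⟨hr⟩
  by_cases hp5 : 5 ≤ p
  · exact (rigidAffine_of_five_le hp5).hasRigidColoring e haff
  have hp3 : p = 3 := by
    have := hp.two_le
    interval_cases p
    · exact (hp2 rfl).elim
    · rfl
    · exact absurd hp (by norm_num)
  subst hp3
  have hr3 : r ≠ 3 := fun h => hS (h ▸ hrS)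
  by_cases hr2 : r = 2
  · subst hr2
    by_cases hm1 : m ≤ 1
    · exact (rigidAffine_three_of_le_one hm1).hasRigidColoring e haff
    by_cases hm5 : 5 ≤ m
    · exact (rigidAffine_three_two_of_five_le hm5).hasRigidColoring e haff
    obtain rfl | rfl | rfl : m = 2 ∨ m = 3 ∨ m = 4 := by omega
    · exact (false_of_primitive_four hS hprim haff htr).elim
    · exact hasRigidColoring_eight hS hprim haff htr
    · exact rigidAffine_three_two_four.hasRigidColoring e haff
  · refine (rigidAffine_three ?_ ?_).hasRigidColoring e haff
    · intro h
      have h1 := (ZMod.natCast_eq_zero_iff 2 r).1 (by exact_mod_cast h)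
      exact hr2 ((Nat.prime_dvd_prime_iff_eq hr Nat.prime_two).1 h1)
    · intro h
      have h1 := (ZMod.natCast_eq_zero_iff 3 r).1 (by exact_mod_cast h)
      exact hr3 ((Nat.prime_dvd_prime_iff_eq hr Nat.prime_three).1 h1)

theorem hasRigidColoring_of_primitive (hp : p.Prime) (hp2 : p ≠ 2) [Finite S]
    [Group.IsSolvable S] [Nonempty Ω] (hS : ¬ p ∣ Nat.card S)
    (hprim : ∀ s : Setoid Ω, (∀ (g : S) x y, s x y → s (g • x) (g • y)) → s = ⊥ ∨ s = ⊤) :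
    HasRigidColoring p S Ω := by
  let ρ := MulAction.toPermHom S Ω
  have hsolv : Group.IsSolvable ρ.range :=
    Group.isSolvable_of_surjective ρ.rangeRestrict_surjective
  have hfin : Finite ρ.range := Finite.of_surjective _ ρ.rangeRestrict_surjective
  obtain ⟨c, hc⟩ := hasRigidColoring_of_primitive_of_faithful (S := ρ.range) (Ω := Ω) hp hp2
    (fun h => hS (h.trans (Subgroup.card_range_dvd ρ)))
    (fun s hs => hprim s fun g x y h => hs ⟨ρ g, g, rfl⟩ x y h)
  exact ⟨c, fun g hg ω => hc ⟨ρ g, g, rfl⟩ hg ω⟩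

/-- A finite solvable permutation group of order prime to the odd prime `p` preserves no more than
trivially some colouring with `p` colours. -/
theorem hasRigidColoring_of_solvable (hp : p.Prime) (hp2 : p ≠ 2) (S Ω : Type u) [Group S]
    [MulAction S Ω] [Finite S] [Finite Ω] [Group.IsSolvable S] (hS : ¬ p ∣ Nat.card S) :
    HasRigidColoring p S Ω := by
  classical
  generalize hn : Nat.card Ω = n
  induction n using Nat.strong_induction_on generalizing S Ω with
  | _ n ih =>
    subst hn
    rcases isEmpty_or_nonempty Ω with hE | ⟨⟨ω₀⟩⟩
    · exact ⟨fun _ => 0, fun g _ ω => hE.elim ω⟩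
    by_cases htr : ∀ ω, ∃ g : S, g • ω₀ = ω
    · by_cases hprim : ∀ s : Setoid Ω, (∀ (g : S) x y, s x y → s (g • x) (g • y)) → s = ⊥ ∨ s = ⊤
      · have : Nonempty Ω := ⟨ω₀⟩
        exact hasRigidColoring_of_primitive hp hp2 hS hprim
      push Not at hprim
      obtain ⟨s, hs, hbot, htop⟩ := hprim
      have : MulAction.IsPretransitive S Ω := MulAction.isPretransitive_iff_base ω₀ |>.2 htr
      refine HasRigidColoring.of_setoid hp hS s hs ω₀ ?_ ?_
      · let _ := s.quotientAction hs
        obtain ⟨c, hc⟩ := ih (Nat.card (Quotient s)) (by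
          by_contra! hle
          have h := (Quotient.mk_surjective (s := s)).bijective_of_nat_card_le hle
          exact hbot (Setoid.ext fun x y =>
            ⟨fun hxy => h.1 (Quotient.sound hxy), fun hxy => hxy ▸ s.refl x⟩)) S (Quotient s) hS rfl
        exact ⟨c, fun g hg x => Quotient.exact (hc g (fun q => by
          induction q using Quotient.inductionOn with
          | h x => exact hg x) ⟦x⟧)⟩
      · refine ih (Nat.card (s.classAction hs ω₀)) ?_ _ _
          (card_subgroup_not_dvd hS _) rfl
        obtain ⟨x, hx⟩ : ∃ x, ¬ s x ω₀ := by
          by_contra! h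
          exact htop (Setoid.ext fun x y => ⟨fun _ => trivial,
            fun _ => s.trans (h x) (s.symm (h y))⟩)
        exact Finite.card_subtype_lt hx
    · push Not at htr
      obtain ⟨ω₁, hω₁⟩ := htr
      let Δ : SubMulAction S Ω :=
        { carrier := MulAction.orbit S ω₀
          smul_mem' := fun g ω hω => MulAction.mem_orbit_of_mem_orbit g hω }
      refine HasRigidColoring.of_subMulAction Δ (ih _ ?_ S Δ hS rfl) (ih _ ?_ S _ hS rfl)
      · refine Finite.card_subtype_lt (x := ω₁) ?_
        rintro ⟨g, hg⟩
        exact hω₁ g hg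
      · refine Finite.card_subtype_lt (x := ω₀) ?_
        exact fun h => h (MulAction.mem_orbit_self ω₀)

end Coloring

section Imprimitive

variable {G V : Type u} [Group G] [AddCommGroup V] [DistribMulAction G V]

theorem iSupIndep.eq_zero_of_sum_eq_zero {Ω V : Type*} [AddCommGroup V] [Fintype Ω]
    {U : Ω → AddSubgroup V} (hind : iSupIndep U) (f : Ω → V) (hf : ∀ ω, f ω ∈ U ω)
    (h : ∑ ω, f ω = 0) (ω : Ω) : f ω = 0 := by
  classical
  refine (AddSubgroup.disjoint_def.1 (hind ω)) (hf ω) ?_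
  rw [← Finset.add_sum_erase _ _ (Finset.mem_univ ω)] at h
  rw [eq_neg_of_add_eq_zero_left h]
  refine AddSubgroup.neg_mem _ (AddSubgroup.sum_mem _ fun j hj => ?_)
  exact (le_iSup₂_of_le (f := fun j (_ : j ≠ ω) => U j) j (Finset.ne_of_mem_erase hj) le_rfl) (hf j)

/-- A group permuting transitively the summands of a proper decomposition has a base of size two,
provided that this is known for smaller spaces. -/
theorem hasBase_of_imprimitive [Finite G] [Finite V] {p : ℕ} (hp : p.Prime) (hp2 : p ≠ 2)
    (ih : BaseBelow.{u} p (Nat.card V)) [Group.IsSolvable G] (hG : ¬ p ∣ Nat.card G)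
    (hV : ∀ v : V, p • v = 0) {Ω : Type u} [Finite Ω] [MulAction G Ω]
    [MulAction.IsPretransitive G Ω] (U : Ω → AddSubgroup V)
    (hU : ∀ (g : G) ω, ∀ v ∈ U ω, g • v ∈ U (g • ω)) (hind : iSupIndep U) (hsup : ⨆ ω, U ω = ⊤)
    (ω₀ : Ω) (hb : U ω₀ ≠ ⊥) (ht : U ω₀ ≠ ⊤) : HasBase G V := by
  classical
  have : Fact p.Prime := ⟨hp⟩
  let _ := Fintype.ofFinite Ω
  obtain ⟨c, hc⟩ := hasRigidColoring_of_solvable hp hp2 G Ω hG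
  obtain ⟨x, hx, y, hy, hx0, hxy⟩ := ih.exists_isBaseOn_ne_zero hG hV
    (MulAction.stabilizer G ω₀) (U ω₀) (fun h hh v hv => by
      have := hU h ω₀ v hv
      rwa [MulAction.mem_stabilizer_iff.1 hh] at this)
    (AddSubgroup.card_lt_of_ne_top ht) hb
  choose t ht using fun ω => MulAction.exists_smul_eq G ω₀ ω
  have hcomp : ∀ (g : G) (f : Ω → V), (∀ ω, f ω ∈ U ω) → g • (∑ ω, f ω) = ∑ ω, f ω →
      ∀ ω, g • f ω = f (g • ω) := by
    intro g f hf hsum ω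
    have h1 : ∑ ω, (g • f (g⁻¹ • ω) - f ω) = 0 := by
      rw [Finset.sum_sub_distrib, sub_eq_zero, ← hsum, Finset.smul_sum]
      exact Equiv.sum_comp (MulAction.toPerm g⁻¹) (fun ω => g • f ω)
    have h2 := hind.eq_zero_of_sum_eq_zero _ (fun ω => AddSubgroup.sub_mem _ (by
      have := hU g _ _ (hf (g⁻¹ • ω))
      rwa [smul_inv_smul] at this) (hf ω)) h1 (g • ω)
    rw [inv_smul_smul] at h2
    exact sub_eq_zero.1 h2
  have hmem : ∀ ω, ∀ v ∈ U ω₀, t ω • v ∈ U ω := fun ω v hv => by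
    have := hU (t ω) ω₀ v hv
    rwa [ht] at this
  refine ⟨∑ ω, t ω • x, ∑ ω, t ω • (y + (c ω).val • x), fun g hgx hgy => ?_⟩
  have h1 := hcomp g _ (fun ω => hmem ω x hx) hgx
  have h2 := hcomp g _ (fun ω => hmem ω _
    (AddSubgroup.add_mem _ hy (AddSubgroup.nsmul_mem _ hx _))) hgy
  have h3 : ∀ ω, ((t (g • ω))⁻¹ * g * t ω) • x = x := fun ω => by
    rw [mul_smul, mul_smul, h1, inv_smul_smul]
  have h4 : ∀ ω, ((t (g • ω))⁻¹ * g * t ω) • y + (c ω).val • x = y + (c (g • ω)).val • x :=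
    fun ω => by
      have h := congrArg (fun v => (t (g • ω))⁻¹ • v) (h2 ω)
      simp only [inv_smul_smul] at h
      rw [← h, ← mul_smul, ← mul_smul, smul_add, smul_nsmul_comm, h3]
  have h5 : ∀ ω, c (g • ω) = c ω := fun ω => by
    let d : ℤ := ((c (g • ω)).val : ℤ) - ((c ω).val : ℤ)
    have hd : d • x = 0 := by
      refine eq_zero_of_smul_eq_add (y := y) hp hG hV
        (g := (t (g • ω))⁻¹ * g * t ω) ?_ ?_
      · rw [smul_zsmul_comm, h3]
      · rw [sub_zsmul, natCast_zsmul, natCast_zsmul, ← sub_eq_add_neg, ← add_sub_assoc, ← h4,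
          add_sub_cancel_right]
    have hpd : (p : ℤ) ∣ d := by
      have ho : addOrderOf x = p := addOrderOf_eq_prime (hV x) hx0
      rw [← ho]
      exact addOrderOf_dvd_iff_zsmul_eq_zero.2 hd
    have := (ZMod.intCast_zmod_eq_zero_iff_dvd d p).2 hpd
    simp only [d, Int.cast_sub, Int.cast_natCast, ZMod.natCast_zmod_val] at this
    exact sub_eq_zero.1 this
  have h6 := hc g h5
  have h7 : ∀ ω, ∀ v ∈ U ω, g • v = v := fun ω v hv => by
    have hfix := hxy ((t (g • ω))⁻¹ * g * t ω) (by
      rw [MulAction.mem_stabilizer_iff, mul_smul, mul_smul, ht, inv_smul_eq_iff, ht])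
      (h3 ω) (add_right_cancel ((h4 ω).trans (by rw [h5]))) ((t ω)⁻¹ • v) (by
        have := hU (t ω)⁻¹ ω v hv
        rwa [inv_smul_eq_iff.2 (ht ω).symm] at this)
    rwa [h6, mul_smul, mul_smul, smul_inv_smul, smul_left_cancel_iff] at hfix
  have h8 : ⨆ ω, U ω ≤ fixedIn ⊤ g := iSup_le fun ω v hv => ⟨trivial, h7 ω v hv⟩
  rw [hsup] at h8
  exact fun v => (h8 (AddSubgroup.mem_top v)).2

end Imprimitive

section HomSpan

variable {G V : Type*} [Group G] [AddCommGroup V] [DistribMulAction G V] {B : Subgroup G}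
  {W W' : AddSubgroup V}

/-- The sum of the images of all `B`-homomorphisms from `W`. -/
def homSpan (B : Subgroup G) (W : AddSubgroup V) : AddSubgroup V :=
  AddSubgroup.closure {v | ∃ φ : W →+ V, IsHomOn B W φ ∧ ∃ w, φ w = v}

theorem IsHomOn.mem_homSpan {φ : W →+ V} (h : IsHomOn B W φ) (w : W) : φ w ∈ homSpan B W :=
  AddSubgroup.subset_closure ⟨φ, h, w, rfl⟩

theorem le_homSpan (B : Subgroup G) (W : AddSubgroup V) : W ≤ homSpan B W := fun w hw =>
  IsHomOn.mem_homSpan (φ := W.subtype) (fun _ _ _ _ h => h) ⟨w, hw⟩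

theorem smul_mem_homSpan (hB : ∀ g b : G, b ∈ B → g * b * g⁻¹ ∈ B) (g : G) {v : V}
    (hv : v ∈ homSpan B W) : g • v ∈ homSpan B (g • W) := by
  induction hv using AddSubgroup.closure_induction with
  | mem x hx =>
    obtain ⟨φ, hφ, w, rfl⟩ := hx
    have hW : ∀ u : (g • W : AddSubgroup V), g⁻¹ • u.1 ∈ W := fun u =>
      AddSubgroup.mem_pointwise_smul_iff_inv_smul_mem.1 u.2
    let ψ : (g • W : AddSubgroup V) →+ V :=
      { toFun := fun u => g • φ ⟨g⁻¹ • u.1, hW u⟩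
        map_zero' := by
          have : (⟨g⁻¹ • ((0 : (g • W : AddSubgroup V)) : V), hW 0⟩ : W) = 0 :=
            Subtype.ext (smul_zero _)
          rw [this, map_zero, smul_zero]
        map_add' := fun a b => by
          rw [← smul_add, ← map_add]
          exact congrArg (fun w => g • φ w) (Subtype.ext (smul_add _ _ _)) }
    have hψ : IsHomOn B (g • W) ψ := by
      intro b hb u u' huu'
      change g • φ _ = b • g • φ _
      rw [hφ (g⁻¹ * b * g) (by simpa using hB g⁻¹ b hb) ⟨g⁻¹ • u.1, hW u⟩ _ (by
        simp only [huu', smul_smul]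
        congr 1
        group), smul_smul, smul_smul]
      congr 1
      group
    have h := hψ.mem_homSpan ⟨g • w.1, AddSubgroup.smul_mem_pointwise_smul _ _ _ w.2⟩
    have h' : ψ ⟨g • w.1, AddSubgroup.smul_mem_pointwise_smul _ _ _ w.2⟩ = g • φ w :=
      congrArg (fun w => g • φ w) (Subtype.ext (inv_smul_smul _ _))
    rwa [h'] at h
  | zero => rw [smul_zero]; exact AddSubgroup.zero_mem _
  | add x y _ _ hx hy => rw [smul_add]; exact AddSubgroup.add_mem _ hx hy
  | neg x _ hx => rw [smul_neg]; exact AddSubgroup.neg_mem _ hx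

theorem smul_homSpan (hB : ∀ g b : G, b ∈ B → g * b * g⁻¹ ∈ B) (g : G) (W : AddSubgroup V) :
    g • homSpan B W = homSpan B (g • W) := by
  ext v
  rw [AddSubgroup.mem_pointwise_smul_iff_inv_smul_mem]
  constructor <;> intro h
  · simpa using smul_mem_homSpan hB g h
  · simpa using smul_mem_homSpan hB g⁻¹ h

theorem homSpan_eq_of_hom (hirr : IsIrredOn B W) (hW : ∀ b ∈ B, ∀ w ∈ W, b • w ∈ W)
    (hirr' : IsIrredOn B W') {φ : W →+ V} (hφ : IsHomOn B W φ) (hφ0 : φ ≠ 0)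
    (him : ∀ w, φ w ∈ W') : homSpan B W = homSpan B W' := by
  have hinj : Function.Injective (φ.codRestrict W' him) := by
    rw [injective_iff_map_eq_zero]
    intro w hw
    by_contra hw0
    exact hφ0 (hφ.eq_zero hirr hW hw0 (congrArg Subtype.val hw))
  have hrange : φ.range = W' := by
    refine (hirr'.2 φ.range (by rintro _ ⟨w, rfl⟩; exact him w) ?_).resolve_left ?_
    · rintro b hb _ ⟨w, rfl⟩
      exact ⟨⟨b • w.1, hW b hb _ w.2⟩, hφ b hb w _ rfl⟩
    · intro h
      exact hφ0 (AddMonoidHom.range_eq_bot_iff.1 h)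
  have hsurj : Function.Surjective (φ.codRestrict W' him) := by
    rintro ⟨w', hw'⟩
    rw [← hrange] at hw'
    obtain ⟨w, hw⟩ := hw'
    exact ⟨w, Subtype.ext hw⟩
  let e := AddEquiv.ofBijective (φ.codRestrict W' him) ⟨hinj, hsurj⟩
  have he : ∀ w, (e w : V) = φ w := fun _ => rfl
  apply le_antisymm
  · refine (AddSubgroup.closure_le _).2 ?_
    rintro _ ⟨ψ, hψ, w, rfl⟩
    have hcomp : IsHomOn B W' (ψ.comp e.symm.toAddMonoidHom) := by
      intro b hb u u' huu'
      refine hψ b hb (e.symm u) (e.symm u') ?_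
      have : e.symm u' = ⟨b • (e.symm u).1, hW b hb _ (e.symm u).2⟩ := by
        rw [AddEquiv.symm_apply_eq]
        refine Subtype.ext ?_
        rw [he, hφ b hb (e.symm u) _ rfl, ← he, e.apply_symm_apply, huu']
      rw [this]
    have := hcomp.mem_homSpan (e w)
    simpa using this
  · refine (AddSubgroup.closure_le _).2 ?_
    rintro _ ⟨ψ, hψ, w, rfl⟩
    have hcomp : IsHomOn B W (ψ.comp e.toAddMonoidHom) := by
      intro b hb u u' huu'
      exact hψ b hb (e u) (e u') (by rw [he, he]; exact hφ b hb u u' huu')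
    have := hcomp.mem_homSpan (e.symm w)
    simpa using this

theorem homSpan_mem_of_le_sSup [Finite G] {p : ℕ} (hp : p.Prime) (hG : ¬ p ∣ Nat.card G)
    (hV : ∀ v : V, p • v = 0) (hirr' : IsIrredOn B W') (hW' : ∀ b ∈ B, ∀ w ∈ W', b • w ∈ W')
    (T : Set (AddSubgroup V)) (hT : ∀ U ∈ T, ∃ W : AddSubgroup V, IsIrredOn B W ∧
      (∀ b ∈ B, ∀ w ∈ W, b • w ∈ W) ∧ U = homSpan B W) (hle : W' ≤ sSup T) :
    homSpan B W' ∈ T := by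
  obtain ⟨P, hP, hPW, hPw⟩ := exists_equivariant_proj hp hG hV B W' hW'
  by_contra hcon
  have hker : sSup T ≤ P.ker := by
    refine sSup_le fun U hU => ?_
    obtain ⟨W, hW1, hW2, rfl⟩ := hT U hU
    refine (AddSubgroup.closure_le _).2 ?_
    rintro _ ⟨φ, hφ, w, rfl⟩
    by_contra hne
    have h0 : P.comp φ ≠ 0 := fun h => hne (DFunLike.congr_fun h w)
    exact hcon (homSpan_eq_of_hom hW1 hW2 hirr' (hφ.comp P hP) h0 (fun w => hPW _) ▸ hU)
  refine hirr'.1 ((AddSubgroup.eq_bot_iff_forall _).2 fun w hw => ?_)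
  rw [← hPw w hw]
  exact hker (hle hw)

theorem exists_isIrredOn_le [Finite V] {U : AddSubgroup V} (hU : ∀ b ∈ B, ∀ w ∈ U, b • w ∈ U)
    (hb : U ≠ ⊥) : ∃ W ≤ U, IsIrredOn B W ∧ ∀ b ∈ B, ∀ w ∈ W, b • w ∈ W := by
  obtain ⟨W, ⟨hWU, hWb, hW⟩, hmin⟩ := wellFounded_lt.has_min
    {W : AddSubgroup V | W ≤ U ∧ W ≠ ⊥ ∧ ∀ b ∈ B, ∀ w ∈ W, b • w ∈ W} ⟨U, le_rfl, hb, hU⟩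
  refine ⟨W, hWU, ⟨hWb, fun X hX hXB => ?_⟩, hW⟩
  by_contra! h
  exact hmin X ⟨hX.trans hWU, h.1, hXB⟩ (lt_of_le_of_ne hX h.2)

theorem smul_bot_addSubgroup (g : G) : g • (⊥ : AddSubgroup V) = ⊥ :=
  AddSubgroup.map_bot _

theorem smul_mem_sSup {T : Set (AddSubgroup V)} {g : G}
    (h : ∀ U ∈ T, ∀ v ∈ U, g • v ∈ sSup T) {v : V} (hv : v ∈ sSup T) : g • v ∈ sSup T :=
  (sSup_le (fun U hU v hv => h U hU v hv) :
    sSup T ≤ (sSup T).comap (DistribSMul.toAddMonoidHom V g)) hv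

theorem IsIrredOn.smul (hB : ∀ g b : G, b ∈ B → g * b * g⁻¹ ∈ B) (g : G)
    (h : IsIrredOn B W) : IsIrredOn B (g • W) := by
  refine ⟨fun hb => h.1 ?_, fun X hX hXB => ?_⟩
  · rw [← inv_smul_smul g W, hb, smul_bot_addSubgroup]
  · have := h.2 (g⁻¹ • X) (by
      rw [← inv_smul_smul g W]
      exact AddSubgroup.pointwise_smul_le_pointwise_smul_iff.2 hX) (fun b hb w hw => by
      rw [AddSubgroup.mem_pointwise_smul_iff_inv_smul_mem, inv_inv] at hw ⊢
      have := hXB _ (hB g b hb) _ hw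
      rwa [smul_smul, inv_mul_cancel_right, mul_smul] at this)
    rcases this with h' | h'
    · left
      rw [← smul_inv_smul g X, h', smul_bot_addSubgroup]
    · right
      rw [← h', smul_inv_smul]

theorem smul_mem_smul_of_stable (hB : ∀ g b : G, b ∈ B → g * b * g⁻¹ ∈ B) (g : G)
    (hW : ∀ b ∈ B, ∀ w ∈ W, b • w ∈ W) : ∀ b ∈ B, ∀ w ∈ g • W, b • w ∈ g • W := by
  intro b hb w hw
  rw [AddSubgroup.mem_pointwise_smul_iff_inv_smul_mem] at hw ⊢
  have := hW (g⁻¹ * b * g) (by simpa using hB g⁻¹ b hb) _ hw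
  rwa [smul_smul, mul_inv_cancel_right, mul_smul] at this

end HomSpan

/-- If `V` is not homogeneous for some normal subgroup, then it has a base of size two. -/
theorem hasBase_of_not_homogeneous {G V : Type u} [Group G] [AddCommGroup V]
    [DistribMulAction G V] [Finite G] [Finite V] {p : ℕ} (hp : p.Prime) (hp2 : p ≠ 2)
    (ih : BaseBelow.{u} p (Nat.card V)) [Group.IsSolvable G] (hG : ¬ p ∣ Nat.card G)
    (hV : ∀ v : V, p • v = 0) {B : Subgroup G} {W : AddSubgroup V}
    (hB : ∀ g b : G, b ∈ B → g * b * g⁻¹ ∈ B) (hirr : IsIrredOn B W)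
    (hW : ∀ b ∈ B, ∀ w ∈ W, b • w ∈ W) (hhom : ¬ IsHomogeneousOn B W) : HasBase G V := by
  have hne : homSpan B W ≠ ⊥ := fun h => hirr.1 (le_bot_iff.1 (h ▸ le_homSpan B W))
  have hT : ∀ U ∈ MulAction.orbit G (homSpan B W), ∃ W : AddSubgroup V, IsIrredOn B W ∧
      (∀ b ∈ B, ∀ w ∈ W, b • w ∈ W) ∧ U = homSpan B W := by
    rintro _ ⟨g, rfl⟩
    exact ⟨g • W, hirr.smul hB g, smul_mem_smul_of_stable hB g hW, smul_homSpan hB g W⟩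
  have hstab : ∀ U ∈ MulAction.orbit G (homSpan B W), ∀ b ∈ B, ∀ v ∈ U, b • v ∈ U := by
    intro U hU b hb
    obtain ⟨X, -, hX, rfl⟩ := hT U hU
    have hle : homSpan B X ≤ (homSpan B X).comap (DistribSMul.toAddMonoidHom V b) := by
      refine (AddSubgroup.closure_le _).2 ?_
      rintro _ ⟨φ, hφ, w, rfl⟩
      have := hφ.mem_homSpan ⟨b • w.1, hX b hb _ w.2⟩
      rwa [hφ b hb w _ rfl] at this
    exact fun v hv => hle hv
  have hind : sSupIndep (MulAction.orbit G (homSpan B W)) := by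
    intro U hU
    rw [disjoint_iff]
    by_contra hcon
    obtain ⟨W', hle, hirr', hW'⟩ := exists_isIrredOn_le (B := B)
      (U := U ⊓ sSup (MulAction.orbit G (homSpan B W) \ {U})) (fun b hb w hw =>
      ⟨hstab U hU b hb w hw.1, smul_mem_sSup
        (fun X hX v hv => le_sSup hX (hstab X hX.1 b hb v hv)) hw.2⟩) hcon
    have h1 := homSpan_mem_of_le_sSup hp hG hV hirr' hW' {U} (by
      rintro _ rfl
      exact hT _ hU) (by rw [sSup_singleton]; exact hle.trans inf_le_left)
    have h2 := homSpan_mem_of_le_sSup hp hG hV hirr' hW' _ (fun X hX => hT X hX.1)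
      (hle.trans inf_le_right)
    exact h2.2 h1
  by_cases hsup : sSup (MulAction.orbit G (homSpan B W)) = ⊤
  · refine hasBase_of_imprimitive hp hp2 ih hG hV (Ω := MulAction.orbit G (homSpan B W))
      (fun U => U.1) (fun g U v hv => AddSubgroup.smul_mem_pointwise_smul _ _ _ hv)
      ((sSupIndep_iff _).1 hind) (by rw [← sSup_eq_iSup', hsup]) ⟨_, MulAction.mem_orbit_self _⟩
      hne fun h => hhom fun v => ?_
    have : v ∈ homSpan B W := by
      have h' : homSpan B W = ⊤ := h
      rw [h']
      trivial
    exact this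
  · refine hasBase_of_reducible hp ih hG hV _ (fun h v hv => ?_) (fun h => hne ?_) hsup
    · refine smul_mem_sSup (fun U hU v hv => ?_) hv
      exact le_sSup (MulAction.mem_orbit_of_mem_orbit h hU)
        (AddSubgroup.smul_mem_pointwise_smul _ _ _ hv)
    · exact le_bot_iff.1 (h ▸ le_sSup (MulAction.mem_orbit_self _))

section ClassTwo

variable {G : Type*} [Group G]

theorem pow_mul_eq_of_mul_eq {a b c : G} (h : b * a = c * (a * b)) (hcb : Commute c b) (n : ℕ) :
    b ^ n * a = c ^ n * (a * b ^ n) := by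
  induction n with
  | zero => simp
  | succ n ih =>
    calc b ^ (n + 1) * a = b * (b ^ n * a) := by rw [pow_succ', mul_assoc]
      _ = b * (c ^ n * (a * b ^ n)) := by rw [ih]
      _ = c ^ n * (b * a) * b ^ n := by
        rw [← mul_assoc b, ← (hcb.pow_left n).eq]; simp only [mul_assoc]
      _ = c ^ (n + 1) * (a * b ^ (n + 1)) := by
        rw [h, pow_succ, pow_succ']; simp only [mul_assoc]

theorem mul_pow_of_mul_eq {a b c : G} (h : b * a = c * (a * b)) (hca : Commute c a)
    (hcb : Commute c b) (n : ℕ) : (a * b) ^ n = c ^ n.choose 2 * (a ^ n * b ^ n) := by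
  induction n with
  | zero => simp
  | succ n ih =>
    calc (a * b) ^ (n + 1) = c ^ n.choose 2 * (a ^ n * (b ^ n * a) * b) := by
          rw [pow_succ, ih]; simp only [mul_assoc]
      _ = c ^ n.choose 2 * (a ^ n * c ^ n * (a * b ^ n) * b) := by
          rw [pow_mul_eq_of_mul_eq h hcb]; simp only [mul_assoc]
      _ = c ^ n.choose 2 * c ^ n * (a ^ n * a * (b ^ n * b)) := by
          rw [← (hca.pow_pow n n).eq]; simp only [mul_assoc]
      _ = c ^ (n + 1).choose 2 * (a ^ (n + 1) * b ^ (n + 1)) := by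
          rw [← pow_succ, ← pow_succ, ← pow_add]
          congr 2
          rw [Nat.choose_succ_succ' n 1, Nat.choose_one_right, add_comm]

/-- A group in which a power map is multiplicative with central kernel, and with all `r`-th powers
in a central cyclic subgroup, is abelian. -/
theorem commute_of_pow_mem_zpowers {B : Subgroup G} {z : G} {r s : ℕ} (hr : r.Prime) (hzB : z ∈ B)
    (hz : ∀ b ∈ B, Commute z b) (hpow : ∀ b ∈ B, b ^ r ∈ Subgroup.zpowers z)
    (hmul : ∀ a ∈ B, ∀ b ∈ B, (a * b) ^ (r * s) = a ^ (r * s) * b ^ (r * s))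
    (hK : ∀ b ∈ B, b ^ (r * s) = 1 → ∀ c ∈ B, Commute b c) :
    ∀ a ∈ B, ∀ b ∈ B, Commute a b := by
  intro a ha b hb
  obtain ⟨i, hi⟩ := Subgroup.mem_zpowers_iff.1 (hpow a ha)
  obtain ⟨j, hj⟩ := Subgroup.mem_zpowers_iff.1 (hpow b hb)
  have hai : a ^ (r * s) = z ^ (i * s) := by rw [pow_mul, ← hi, zpow_mul, zpow_natCast]
  have hbj : b ^ (r * s) = z ^ (j * s) := by rw [pow_mul, ← hj, zpow_mul, zpow_natCast]
  by_cases hdvd : (r : ℤ) ∣ i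
  · obtain ⟨l, rfl⟩ := hdvd
    have h1 := hK (a * z ^ (-l)) (B.mul_mem ha (B.zpow_mem hzB _)) (by
      rw [hmul a ha _ (B.zpow_mem hzB _), hai, ← zpow_natCast, ← zpow_mul, ← zpow_add]
      convert zpow_zero z using 2
      push_cast
      ring) b hb
    have h2 := h1.mul_left ((hz b hb).zpow_left l)
    rwa [mul_assoc, ← zpow_add, neg_add_cancel, zpow_zero, mul_one] at h2
  · obtain ⟨u, v, huv⟩ : IsCoprime i (r : ℤ) :=
      ((Nat.prime_iff_prime_int.1 hr).coprime_iff_not_dvd.2 hdvd).symm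
    have hak : a ^ (-(j * u)) ∈ B := B.zpow_mem ha _
    have hzl : z ^ (-(j * v)) ∈ B := B.zpow_mem hzB _
    have hak' : (a ^ (-(j * u))) ^ (r * s) = z ^ (i * s * -(j * u)) := by
      rw [← zpow_natCast, ← zpow_mul, mul_comm, zpow_mul, zpow_natCast, hai, ← zpow_mul]
    have hzl' : (z ^ (-(j * v))) ^ (r * s) = z ^ (-(j * v) * (r * s : ℕ)) := by
      rw [← zpow_natCast, ← zpow_mul]
    have h1 := hK (b * (a ^ (-(j * u)) * z ^ (-(j * v)))) (B.mul_mem hb (B.mul_mem hak hzl)) (by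
      rw [hmul b hb _ (B.mul_mem hak hzl), hmul _ hak _ hzl, hbj, hak', hzl',
        ← zpow_add, ← zpow_add]
      convert zpow_zero z using 2
      push_cast
      linear_combination (-(j * s : ℤ)) * huv) a ha
    have h2 := h1.mul_left ((hz a ha).zpow_left (j * v))
    have h3 := h2.mul_left ((Commute.refl a).zpow_left (j * u))
    have h4 : b * (a ^ (-(j * u)) * z ^ (-(j * v))) * z ^ (j * v) * a ^ (j * u) = b := by group
    rw [h4] at h3
    exact h3.symm

theorem exists_zpow_eq_of_pow_prime {a ζ z : G} {r : ℕ} (hr : r.Prime)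
    (hζ : ζ ∈ Subgroup.zpowers a) (hz : z ∈ Subgroup.zpowers a) (hζr : ζ ^ r = 1) (hζ1 : ζ ≠ 1)
    (hzr : z ^ r = 1) : ∃ k : ℤ, z = ζ ^ k := by
  obtain ⟨i, rfl⟩ := Subgroup.mem_zpowers_iff.1 hζ
  obtain ⟨j, rfl⟩ := Subgroup.mem_zpowers_iff.1 hz
  rw [← zpow_natCast, ← zpow_mul, ← orderOf_dvd_iff_zpow_eq_one] at hζr hzr
  rw [ne_eq, ← orderOf_dvd_iff_zpow_eq_one] at hζ1
  generalize hn : orderOf a = n at *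
  have hrp : Prime (r : ℤ) := Nat.prime_iff_prime_int.1 hr
  have hrn : (r : ℤ) ∣ n := by
    by_contra h
    exact hζ1 ((hrp.coprime_iff_not_dvd.2 h).symm.dvd_of_dvd_mul_right hζr)
  obtain ⟨m, hm⟩ := hrn
  rw [hm] at hζr hzr hζ1
  rw [mul_comm (r : ℤ)] at hζr hzr
  obtain ⟨i, rfl⟩ := Int.dvd_of_mul_dvd_mul_right hrp.ne_zero hζr
  obtain ⟨j, rfl⟩ := Int.dvd_of_mul_dvd_mul_right hrp.ne_zero hzr
  have hi : ¬ (r : ℤ) ∣ i := fun h => hζ1 (by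
    rw [mul_comm (r : ℤ)]; exact mul_dvd_mul_left m h)
  obtain ⟨u, v, huv⟩ := (hrp.coprime_iff_not_dvd.2 hi)
  refine ⟨v * j, ?_⟩
  rw [← zpow_mul, zpow_eq_zpow_iff_modEq, Int.modEq_iff_dvd, hn, hm]
  exact ⟨-(u * j), by linear_combination (m * j) * huv⟩

end ClassTwo

section Heisenberg

variable {G : Type*} [Group G]

/-- The elements of `B` whose `n`-th power lies in `A`, if taking the `n`-th power is
multiplicative modulo `A`. -/
def powPreimage (B A : Subgroup G) (n : ℕ)
    (h : ∀ a ∈ B, ∀ b ∈ B, a ^ n ∈ A → b ^ n ∈ A → (a * b) ^ n ∈ A) : Subgroup G where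
  carrier := {b | b ∈ B ∧ b ^ n ∈ A}
  mul_mem' {a b} ha hb := ⟨B.mul_mem ha.1 hb.1, h a ha.1 b hb.1 ha.2 hb.2⟩
  one_mem' := ⟨B.one_mem, by rw [one_pow]; exact A.one_mem⟩
  inv_mem' {a} ha := ⟨B.inv_mem ha.1, by rw [inv_pow]; exact A.inv_mem ha.2⟩

theorem powPreimage_normal {B A : Subgroup G} (hB : B.Normal) (hA : A.Normal) (n : ℕ)
    (h : ∀ a ∈ B, ∀ b ∈ B, a ^ n ∈ A → b ^ n ∈ A → (a * b) ^ n ∈ A) :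
    (powPreimage B A n h).Normal :=
  ⟨fun b hb g => ⟨hB.conj_mem b hb.1 g, by rw [conj_pow]; exact hA.conj_mem _ hb.2 g⟩⟩

theorem exists_prime_pow_mem {A : Subgroup G} [Finite G] {b : G} (hb : b ∉ A) :
    ∃ r : ℕ, r.Prime ∧ ∃ k : ℕ, b ^ k ∉ A ∧ (b ^ k) ^ r ∈ A := by
  classical
  have hex : ∃ n : ℕ, 0 < n ∧ b ^ n ∈ A :=
    ⟨orderOf b, orderOf_pos b, by rw [pow_orderOf_eq_one]; exact A.one_mem⟩
  obtain ⟨hpos, hmem⟩ := Nat.find_spec hex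
  have hne : Nat.find hex ≠ 1 := fun h => hb (by rwa [h, pow_one] at hmem)
  have hr := Nat.minFac_prime hne
  refine ⟨_, hr, Nat.find hex / (Nat.find hex).minFac, fun h => ?_, ?_⟩
  · exact Nat.find_min hex (Nat.div_lt_self hpos hr.one_lt)
      ⟨Nat.div_pos (Nat.minFac_le hpos) hr.pos, h⟩
  · rw [← pow_mul, Nat.div_mul_cancel (Nat.minFac_dvd _)]
    exact hmem

/-- If a maximal abelian normal subgroup `A` of a finite solvable group is cyclic and does not
contain its centralizer, then the centralizer contains a normal subgroup which is almost
extraspecial. -/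
theorem exists_heisenberg_subgroup [Finite G] [Group.IsSolvable G] {A : Subgroup G}
    (hAn : A.Normal) [IsCyclic A]
    (hmax : ∀ N : Subgroup G, N.Normal → (∀ a ∈ N, ∀ b ∈ N, Commute a b) → A ≤ N → N ≤ A)
    (hC : ¬ Subgroup.centralizer (A : Set G) ≤ A) :
    ∃ (r : ℕ) (B : Subgroup G), r.Prime ∧ B.Normal ∧ (∀ a ∈ A, ∀ b ∈ B, Commute a b) ∧
      (∃ a ∈ B, ∃ b ∈ B, ¬ Commute a b) ∧ (∀ b ∈ B, b ^ r ∈ A) ∧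
      (∀ a ∈ B, ∀ b ∈ B, ∃ c, c ∈ A ∧ c ∈ B ∧ a * b = c * (b * a) ∧ c ^ r = 1) ∧
      ((r ≠ 2 ∧ ∀ b ∈ B, b ^ r = 1) ∨ (r = 2 ∧ ∀ b ∈ B, b ^ 4 = 1)) := by
  have hAc : ∀ a ∈ A, ∀ b ∈ A, Commute a b := by
    intro a ha b hb
    obtain ⟨z, hz⟩ := IsCyclic.exists_generator (α := A)
    obtain ⟨i, hi⟩ := Subgroup.mem_zpowers_iff.1 (hz ⟨a, ha⟩)
    obtain ⟨j, hj⟩ := Subgroup.mem_zpowers_iff.1 (hz ⟨b, hb⟩)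
    have := (Commute.refl z).zpow_zpow i j
    rw [hi, hj] at this
    exact congrArg Subtype.val this
  obtain ⟨B, ⟨hBn, hBC, hBA⟩, hmin⟩ := wellFounded_lt.has_min
    {N : Subgroup G | N.Normal ∧ N ≤ Subgroup.centralizer (A : Set G) ∧ ¬ N ≤ A}
    ⟨_, inferInstance, le_rfl, hC⟩
  have hcen : ∀ a ∈ A, ∀ b ∈ B, Commute a b := fun a ha b hb =>
    Subgroup.mem_centralizer_iff.1 (hBC hb) a ha
  have key : ∀ N : Subgroup G, N.Normal → N ≤ B → ¬ N ≤ A → N = B := by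
    intro N hN hNB hNA
    by_contra hne
    exact hmin N ⟨hN, hNB.trans hBC, hNA⟩ (lt_of_le_of_ne hNB hne)
  have hBnc : ∃ a ∈ B, ∃ b ∈ B, ¬ Commute a b := by
    by_contra! hcon
    refine hBA (le_trans le_sup_right (hmax (A ⊔ B) inferInstance ?_ le_sup_left))
    intro x hx y hy
    obtain ⟨a, ha, b, hb, rfl⟩ := Subgroup.mem_sup_of_normal_right.1 hx
    obtain ⟨a', ha', b', hb', rfl⟩ := Subgroup.mem_sup_of_normal_right.1 hy
    exact ((hAc a ha a' ha').mul_right (hcen a ha b' hb')).mul_left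
      ((hcen a' ha' b hb).symm.mul_right (hcon b hb b' hb'))
  have hcomm : ⁅B, B⁆ ≤ A := by
    by_contra hcon
    have hne : B ≠ ⊥ := fun h => hBA (h ▸ bot_le)
    exact (Group.IsSolvable.commutator_lt_of_ne_bot hne).ne
      (key _ inferInstance (Subgroup.commutator_le_right _ _) hcon)
  have hcomm' : ∀ a ∈ B, ∀ b ∈ B, ∃ c, c ∈ A ∧ c ∈ B ∧ a * b = c * (b * a) := by
    intro a ha b hb
    exact ⟨_, hcomm (Subgroup.commutator_mem_commutator ha hb),
      Subgroup.commutator_le_right _ _ (Subgroup.commutator_mem_commutator ha hb), by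
        rw [commutatorElement_def]; group⟩
  obtain ⟨b₀, hb₀, hb₀A⟩ := SetLike.not_le_iff_exists.1 hBA
  obtain ⟨r, hr, k, hk, hkr⟩ := exists_prime_pow_mem hb₀A
  have hpowmul : ∀ a ∈ B, ∀ b ∈ B, a ^ r ∈ A → b ^ r ∈ A → (a * b) ^ r ∈ A := by
    intro a ha b hb har hbr
    rw [← QuotientGroup.eq_one_iff] at har hbr ⊢
    obtain ⟨c, hcA, -, hc⟩ := hcomm' a ha b hb
    have hab : Commute (a : G ⧸ A) (b : G ⧸ A) := by
      change ((a * b : G) : G ⧸ A) = ((b * a : G) : G ⧸ A)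
      rw [hc, QuotientGroup.mk_mul, (QuotientGroup.eq_one_iff c).2 hcA, one_mul]
    rw [QuotientGroup.mk_pow, QuotientGroup.mk_mul, hab.mul_pow, ← QuotientGroup.mk_pow,
      ← QuotientGroup.mk_pow, har, hbr, one_mul]
  have hpow : ∀ b ∈ B, b ^ r ∈ A := by
    have := key (powPreimage B A r hpowmul) (powPreimage_normal hBn hAn r hpowmul)
      (fun b hb => hb.1) (fun h => hk (h ⟨B.pow_mem hb₀ k, hkr⟩))
    intro b hb
    rw [← this] at hb
    exact hb.2
  have hcommr : ∀ a ∈ B, ∀ b ∈ B, ∃ c, c ∈ A ∧ c ∈ B ∧ a * b = c * (b * a) ∧ c ^ r = 1 := by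
    intro a ha b hb
    obtain ⟨c, hcA, hcB, hc⟩ := hcomm' a ha b hb
    refine ⟨c, hcA, hcB, hc, ?_⟩
    have h1 := pow_mul_eq_of_mul_eq hc (hcen c hcA a ha) r
    rw [(hcen _ (hpow a ha) b hb).eq] at h1
    exact (right_eq_mul.1 h1)
  refine ⟨r, B, hr, hBn, hcen, hBnc, hpow, hcommr, ?_⟩
  obtain ⟨z, hz⟩ := IsCyclic.exists_generator (α := (B.subgroupOf A))
  have hzB : ((z : A) : G) ∈ B := z.2
  have hgen : ∀ b ∈ B, b ∈ A → b ∈ Subgroup.zpowers ((z : A) : G) := by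
    intro b hb hbA
    obtain ⟨i, hi⟩ := Subgroup.mem_zpowers_iff.1 (hz ⟨⟨b, hbA⟩, hb⟩)
    exact Subgroup.mem_zpowers_iff.2 ⟨i, congrArg (fun x : B.subgroupOf A => ((x : A) : G)) hi⟩
  have hexp : ∀ s : ℕ, r ∣ (r * s).choose 2 → ∀ b ∈ B, b ^ (r * s) = 1 := by
    intro s hs
    have hmul : ∀ a ∈ B, ∀ b ∈ B, (a * b) ^ (r * s) = a ^ (r * s) * b ^ (r * s) := by
      intro a ha b hb
      obtain ⟨c, hcA, hcB, hc, hcr⟩ := hcommr b hb a ha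
      obtain ⟨t, ht⟩ := hs
      rw [mul_pow_of_mul_eq hc (hcen c hcA a ha) (hcen c hcA b hb), ht, pow_mul, hcr, one_pow,
        one_mul]
    have hmul' : ∀ a ∈ B, ∀ b ∈ B, a ^ (r * s) ∈ (⊥ : Subgroup G) → b ^ (r * s) ∈ (⊥ : Subgroup G) →
        (a * b) ^ (r * s) ∈ (⊥ : Subgroup G) := by
      intro a ha b hb har hbr
      rw [hmul a ha b hb]
      exact Subgroup.mul_mem _ har hbr
    have hK := key (powPreimage B ⊥ (r * s) hmul') (powPreimage_normal hBn inferInstance _ hmul')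
      (fun b hb => hb.1) (fun hKA => by
        obtain ⟨a, ha, b, hb, hab⟩ := hBnc
        exact hab (commute_of_pow_mem_zpowers hr hzB (fun b hb => hcen _ z.1.2 b hb)
          (fun b hb => hgen _ (B.pow_mem hb r) (hpow b hb)) hmul
          (fun b hb hbs c hc => hcen b (hKA ⟨hb, hbs⟩) c hc) a ha b hb))
    intro b hb
    rw [← hK] at hb
    exact hb.2
  by_cases hr2 : r = 2
  · subst hr2
    exact Or.inr ⟨rfl, hexp 2 (by decide)⟩
  · refine Or.inl ⟨hr2, fun b hb => ?_⟩
    have := hexp 1 (by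
      rw [mul_one]
      exact hr.dvd_choose_self two_ne_zero (lt_of_le_of_ne hr.two_le (Ne.symm hr2))) b hb
    rwa [mul_one] at this

end Heisenberg

section Homogeneous

variable {G V : Type*} [Group G] [AddCommGroup V] [DistribMulAction G V] {A : Subgroup G}

/-- The ring of endomorphisms generated by the elements of `A`. -/
def endRing (V : Type*) [AddCommGroup V] [DistribMulAction G V] (A : Subgroup G) :
    Subring (AddMonoid.End V) :=
  Subring.closure (DistribMulAction.toAddMonoidEnd G V '' A)

theorem toAddMonoidEnd_mem_endRing {a : G} (ha : a ∈ A) :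
    DistribMulAction.toAddMonoidEnd G V a ∈ endRing V A :=
  Subring.subset_closure ⟨a, ha, rfl⟩

theorem endRing_apply_smul (hA : ∀ a ∈ A, ∀ b ∈ A, Commute a b) {ρ : AddMonoid.End V}
    (hρ : ρ ∈ endRing V A) {a : G} (ha : a ∈ A) (v : V) : ρ (a • v) = a • ρ v := by
  have hle : endRing V A ≤ Subring.centralizer {DistribMulAction.toAddMonoidEnd G V a} := by
    refine Subring.closure_le.2 ?_
    rintro _ ⟨b, hb, rfl⟩
    rw [SetLike.mem_coe, Subring.mem_centralizer_iff]
    rintro _ rfl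
    rw [← map_mul, ← map_mul, (hA a ha b hb).eq]
  have h := Subring.mem_centralizer_iff.1 (hle hρ) _ rfl
  exact (DFunLike.congr_fun h v).symm

theorem endRing_apply_hom {W : AddSubgroup V} (hW : ∀ a ∈ A, ∀ w ∈ W, a • w ∈ W)
    {ρ : AddMonoid.End V} (hρ : ρ ∈ endRing V A) (w : W) :
    ∃ w' : W, ∀ φ : W →+ V, IsHomOn A W φ → ρ (φ w) = φ w' := by
  induction hρ using Subring.closure_induction generalizing w with
  | mem x hx =>
    obtain ⟨a, ha, rfl⟩ := hx
    exact ⟨⟨a • w.1, hW a ha _ w.2⟩, fun φ hφ => (hφ a ha w _ rfl).symm⟩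
  | zero => exact ⟨0, fun φ _ => by simp⟩
  | one => exact ⟨w, fun φ _ => rfl⟩
  | add x y _ _ hx hy =>
    obtain ⟨w₁, h₁⟩ := hx w
    obtain ⟨w₂, h₂⟩ := hy w
    exact ⟨w₁ + w₂, fun φ hφ => by rw [map_add, ← h₁ φ hφ, ← h₂ φ hφ]; rfl⟩
  | neg x _ hx =>
    obtain ⟨w₁, h₁⟩ := hx w
    exact ⟨-w₁, fun φ hφ => by rw [map_neg, ← h₁ φ hφ]; rfl⟩
  | mul x y _ _ hx hy =>
    obtain ⟨w₂, h₂⟩ := hy w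
    obtain ⟨w₁, h₁⟩ := hx w₂
    exact ⟨w₁, fun φ hφ => by rw [← h₁ φ hφ, ← h₂ φ hφ]; rfl⟩

theorem endRing_eq_zero [Finite V] (hA : ∀ a ∈ A, ∀ b ∈ A, Commute a b)
    (hhom : ∀ W : AddSubgroup V, IsIrredOn A W → (∀ a ∈ A, ∀ w ∈ W, a • w ∈ W) →
      IsHomogeneousOn A W) {ρ : AddMonoid.End V} (hρ : ρ ∈ endRing V A) {v : V} (hv : v ≠ 0)
    (h : ρ v = 0) : ρ = 0 := by
  obtain ⟨W, hWle, hirr, hW⟩ := exists_isIrredOn_le (B := A) (U := AddMonoidHom.ker ρ)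
    (fun a ha w hw => by
      have hw' : ρ w = 0 := hw
      change ρ _ = 0
      rw [endRing_apply_smul hA hρ ha, hw', smul_zero])
    (fun hbot => hv (by
      have : v ∈ AddMonoidHom.ker ρ := h
      rwa [hbot, AddSubgroup.mem_bot] at this))
  refine AddMonoidHom.ext fun u => (hhom W hirr hW).ext (f := ρ) (f' := 0) (fun φ hφ w => ?_) u
  obtain ⟨w', hw'⟩ := endRing_apply_hom hW hρ w
  have h1 := hw' W.subtype (fun _ _ _ _ h => h)
  have h2 : w' = 0 := Subtype.ext (h1.symm.trans (hWle w.2))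
  have h3 := hw' φ hφ
  rw [h2, map_zero] at h3
  exact h3

theorem eq_one_of_smul_eq_self [Finite V] (hA : ∀ a ∈ A, ∀ b ∈ A, Commute a b)
    (hhom : ∀ W : AddSubgroup V, IsIrredOn A W → (∀ a ∈ A, ∀ w ∈ W, a • w ∈ W) →
      IsHomogeneousOn A W) [FaithfulSMul G V] {a : G} (ha : a ∈ A) {v : V} (hv : v ≠ 0)
    (h : a • v = v) : a = 1 := by
  have h0 := endRing_eq_zero hA hhom
    ((endRing V A).sub_mem (toAddMonoidEnd_mem_endRing ha) (endRing V A).one_mem) hv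
    (sub_eq_zero.2 h)
  refine FaithfulSMul.eq_of_smul_eq_smul (α := V) fun u => ?_
  rw [one_smul]
  exact sub_eq_zero.1 (DFunLike.congr_fun h0 u)

theorem isCyclic_of_homogeneous [Finite G] [Finite V] [Nontrivial V]
    (hA : ∀ a ∈ A, ∀ b ∈ A, Commute a b)
    (hhom : ∀ W : AddSubgroup V, IsIrredOn A W → (∀ a ∈ A, ∀ w ∈ W, a • w ∈ W) →
      IsHomogeneousOn A W) [FaithfulSMul G V] : IsCyclic A := by
  have hcomm : IsMulCommutative (endRing V A) := Subring.isMulCommutative_closure (by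
    rintro _ ⟨a, ha, rfl⟩ _ ⟨b, hb, rfl⟩
    rw [← map_mul, ← map_mul, (hA a ha b hb).eq])
  let _ : CommRing (endRing V A) := { (endRing V A).toRing with mul_comm := hcomm.is_comm.comm }
  have hnt : Nontrivial (endRing V A) := by
    obtain ⟨v, hv⟩ := exists_ne (0 : V)
    refine ⟨0, 1, fun h => hv ?_⟩
    exact (DFunLike.congr_fun (congrArg Subtype.val h) v).symm
  have hzd : NoZeroDivisors (endRing V A) := ⟨fun {x y} hxy => by
    by_contra! hne
    obtain ⟨v, hv⟩ : ∃ v, y.1 v ≠ 0 := by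
      by_contra! h
      exact hne.2 (Subtype.ext (AddMonoidHom.ext h))
    exact hne.1 (Subtype.ext (endRing_eq_zero hA hhom x.2 hv
      (DFunLike.congr_fun (congrArg Subtype.val hxy) v)))⟩
  have hdom : IsDomain (endRing V A) := NoZeroDivisors.to_isDomain _
  let f : A →* endRing V A :=
    { toFun := fun a => ⟨DistribMulAction.toAddMonoidEnd G V a.1, toAddMonoidEnd_mem_endRing a.2⟩
      map_one' := Subtype.ext (map_one _)
      map_mul' := fun a b => Subtype.ext (map_mul _ _ _) }
  refine isCyclic_of_injective_ringHom f fun a b hab => Subtype.ext ?_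
  refine FaithfulSMul.eq_of_smul_eq_smul (α := V) fun u => ?_
  exact DFunLike.congr_fun (congrArg Subtype.val hab) u

end Homogeneous

theorem exists_maximal_abelian_normal (G : Type*) [Group G] [Finite G] :
    ∃ A : Subgroup G, A.Normal ∧ (∀ a ∈ A, ∀ b ∈ A, Commute a b) ∧
      ∀ N : Subgroup G, N.Normal → (∀ a ∈ N, ∀ b ∈ N, Commute a b) → A ≤ N → N ≤ A := by
  obtain ⟨A, ⟨hn, hc⟩, hmax⟩ := wellFounded_gt.has_min
    {N : Subgroup G | N.Normal ∧ ∀ a ∈ N, ∀ b ∈ N, Commute a b}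
    ⟨⊥, inferInstance, fun a ha b hb => by rw [Subgroup.mem_bot.1 ha]; exact Commute.one_left b⟩
  refine ⟨A, hn, hc, fun N hN hNc hAN => ?_⟩
  by_contra h
  exact hmax N ⟨hN, hNc⟩ (lt_of_le_not_ge hAN h)

section Main

variable {G V : Type u} [Group G] [AddCommGroup V] [DistribMulAction G V] [Finite G] [Finite V]

theorem hasBase_of_faithful {p : ℕ} (hp : p.Prime) (hp2 : p ≠ 2)
    (ih : BaseBelow.{u} p (Nat.card V)) [Group.IsSolvable G] (hG : ¬ p ∣ Nat.card G)
    (hV : ∀ v : V, p • v = 0) [FaithfulSMul G V] : HasBase G V := by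
  rcases subsingleton_or_nontrivial V with hsub | hnt
  · exact ⟨0, 0, fun g _ _ v => Subsingleton.elim _ _⟩
  by_contra hbase
  have hhom : ∀ N : Subgroup G, N.Normal → ∀ W : AddSubgroup V, IsIrredOn N W →
      (∀ a ∈ N, ∀ w ∈ W, a • w ∈ W) → IsHomogeneousOn N W := by
    intro N hN W hirr hW
    by_contra hcon
    exact hbase (hasBase_of_not_homogeneous hp hp2 ih hG hV
      (fun g b hb => hN.conj_mem b hb g) hirr hW hcon)
  have hirr : ∀ N : Subgroup G, N.Normal → (∃ a ∈ N, ∃ b ∈ N, ¬ Commute a b) →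
      IsIrredOn N (⊤ : AddSubgroup V) := by
    intro N hN ⟨a, ha, b, hb, hab⟩
    obtain ⟨W, -, hW1, hW2⟩ := exists_isIrredOn_le (B := N) (U := (⊤ : AddSubgroup V))
      (fun _ _ _ _ => trivial) top_ne_bot
    by_cases hWt : W = ⊤
    · exact hWt ▸ hW1
    refine (hbase (hasBase_of_homogeneous_reducible hp ih hG hV
      (fun g b hb => hN.conj_mem b hb g) hW1 hW2 (hhom N hN W hW1 hW2) hWt
      ⟨a, ha, b, hb, ?_⟩)).elim
    by_contra! hcon
    refine hab (FaithfulSMul.eq_of_smul_eq_smul (α := V) fun u => ?_)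
    rw [mul_smul, mul_smul, hcon]
  obtain ⟨A, hAn, hAc, hmax⟩ := exists_maximal_abelian_normal G
  have hreg : ∀ a ∈ A, ∀ v : V, v ≠ 0 → a • v = v → a = 1 := fun a ha v hv h =>
    eq_one_of_smul_eq_self hAc (hhom A hAn) ha hv h
  have hcyc : IsCyclic A := isCyclic_of_homogeneous hAc (hhom A hAn)
  obtain ⟨⟨a, haA⟩, hgen⟩ := hcyc.exists_generator
  have hgen' : ∀ b ∈ A, b ∈ Subgroup.zpowers a := by
    intro b hb
    obtain ⟨i, hi⟩ := Subgroup.mem_zpowers_iff.1 (hgen ⟨b, hb⟩)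
    exact Subgroup.mem_zpowers_iff.2 ⟨i, congrArg Subtype.val hi⟩
  obtain ⟨x, hx⟩ := exists_ne (0 : V)
  by_cases hC : Subgroup.centralizer (A : Set G) ≤ A
  · refine hbase ⟨x, a • x, fun g hgx hgy => ?_⟩
    have hga : g * a = a * g := by
      have h1 : a⁻¹ * (g * a * g⁻¹) = 1 := by
        refine hreg _ (A.mul_mem (A.inv_mem haA) (hAn.conj_mem a haA g)) x hx ?_
        rw [mul_smul, mul_smul, mul_smul, inv_smul_eq_self_of hgx, hgy, inv_smul_smul]
      rw [inv_mul_eq_one] at h1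
      exact (eq_mul_inv_iff_mul_eq.1 h1).symm
    have hgA : g ∈ A := hC (Subgroup.mem_centralizer_iff.2 fun b hb => by
      obtain ⟨i, rfl⟩ := Subgroup.mem_zpowers_iff.1 (hgen' b hb)
      exact ((Commute.zpow_right hga i).eq).symm)
    rw [hreg g hgA x hx hgx]
    exact one_smul G
  obtain ⟨r, B, hr, hBn, hcen, hnc, hpow, hcomm, hexp⟩ :=
    exists_heisenberg_subgroup hAn hmax hC
  have hBirr := hirr B hBn hnc
  obtain ⟨a₀, ha₀, b₀, hb₀, hab⟩ := hnc
  obtain ⟨ζ, hζA, hζB, hζ, hζr⟩ := hcomm a₀ ha₀ b₀ hb₀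
  have : Fact r.Prime := ⟨hr⟩
  have hζ1 : ζ ≠ 1 := fun h => hab (by rw [h, one_mul] at hζ; exact hζ)
  rcases hexp with ⟨hr2, hexp⟩ | ⟨rfl, hexp⟩
  · have hzpow : ∀ z ∈ A, z ^ r = 1 → ∃ k : ℤ, z = ζ ^ k := fun z hz hzr =>
      exists_zpow_eq_of_pow_prime hr (hgen' ζ hζA) (hgen' z hz) hζr hζ1 hzr
    have h : OddHeisenberg p r V B ζ :=
      { prime := hp
        odd := hp2
        nsmul := hV
        rprime := hr
        rodd := hr2
        not_dvd := fun hpr => hG (hpr.trans (by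
          rw [← orderOf_eq_prime_iff.2 ⟨hζr, hζ1⟩]
          exact orderOf_dvd_natCard ζ))
        normal := fun g b hb => hBn.conj_mem b hb g
        mem := hζB
        fixed := fun v hv => by
          by_contra hv0
          exact hζ1 (hreg ζ hζA v hv0 hv)
        norm := fun g => hzpow _ (hAn.conj_mem ζ hζA g) (by
          rw [conj_pow, hζr, mul_one, mul_inv_cancel])
        cent := fun b hb => (hcen ζ hζA b hb).symm
        comm := fun a ha b hb => by
          obtain ⟨c, hcA, -, hc, hcr⟩ := hcomm a ha b hb
          obtain ⟨k, rfl⟩ := hzpow c hcA hcr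
          exact ⟨k, hc⟩
        exp := hexp }
    exact hbase (h.hasBase hBirr)
  · have hinv : ∀ c ∈ A, c ^ 2 = 1 → c ≠ 1 → ∀ v : V, c • v = -v := by
      intro c hc hc2 hc1 v
      by_contra hne
      refine hc1 (hreg c hc (c • v + v) (fun h => hne (eq_neg_of_add_eq_zero_left h)) ?_)
      rw [smul_add, ← mul_smul, ← sq, hc2, one_smul, add_comm]
    have huniq : ∀ c ∈ A, c ^ 2 = 1 → c = 1 ∨ c = ζ := by
      intro c hc hc2
      by_cases hc1 : c = 1
      · exact Or.inl hc1
      · refine Or.inr (FaithfulSMul.eq_of_smul_eq_smul (α := V) fun u => ?_)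
        rw [hinv c hc hc2 hc1, hinv ζ hζA hζr hζ1]
    have h : EvenHeisenberg p V B ζ :=
      { prime := hp
        odd := hp2
        nsmul := hV
        not_dvd := hG
        normal := fun g b hb => hBn.conj_mem b hb g
        mem := hζB
        neg := hinv ζ hζA hζr hζ1
        mul_self := by rw [← sq, hζr]
        cent := fun g => by
          refine FaithfulSMul.eq_of_smul_eq_smul (α := V) fun u => ?_
          rw [mul_smul, mul_smul, hinv ζ hζA hζr hζ1, hinv ζ hζA hζr hζ1, smul_neg]
        comm := fun a ha b hb => by
          obtain ⟨c, hcA, -, hc, hcr⟩ := hcomm a ha b hb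
          rcases huniq c hcA hcr with rfl | rfl
          · exact Or.inl (by rw [hc, one_mul])
          · exact Or.inr hc
        sq := fun b hb => by
          rw [← sq]
          exact huniq _ (hpow b hb) (by rw [← pow_mul]; exact hexp b hb) }
    exact hbase (h.hasBase hBirr)

theorem baseBelow {p : ℕ} (hp : p.Prime) (hp2 : p ≠ 2) (n : ℕ) : BaseBelow.{u} p n := by
  induction n with
  | zero => exact fun _ _ _ _ _ _ _ _ _ _ h => absurd h (Nat.not_lt_zero _)
  | succ n ih =>
    intro G V _ _ _ _ _ hsolv hG hV hcard
    have ih' : BaseBelow.{u} p (Nat.card V) :=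
      fun G' V' _ _ _ _ _ h1 h2 h3 h4 => ih G' V' h1 h2 h3
        (lt_of_lt_of_le h4 (Nat.lt_succ_iff.1 hcard))
    let H := (MulAction.toPermHom G V).range
    have hsurj := (MulAction.toPermHom G V).rangeRestrict_surjective
    let _ : DistribMulAction H V :=
      { (inferInstance : MulAction H V) with
        smul_zero := by
          rintro ⟨_, g, rfl⟩
          exact smul_zero g
        smul_add := by
          rintro ⟨_, g, rfl⟩ v w
          exact smul_add g v w }
    have hfaith : FaithfulSMul H V := ⟨fun h => Subtype.ext (Equiv.ext h)⟩
    have hH : Group.IsSolvable H := Group.isSolvable_of_surjective hsurj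
    have hfin : Finite H := Finite.of_surjective _ hsurj
    obtain ⟨x, y, hxy⟩ := hasBase_of_faithful (G := H) hp hp2 ih'
      (fun h => hG (h.trans (Subgroup.card_range_dvd _))) hV
    exact ⟨x, y, fun g hx hy v => hxy ⟨_, g, rfl⟩ hx hy v⟩

end Main

/-- **Halasi–Podoski, Theorem 1.**
Let `p` be an odd prime, `V` a finite vector space over `𝔽_p`, and `G ≤ GL(V)` a solvable
linear group with `gcd(|G|, |V|) = 1`.  Then there exist `x, y ∈ V` such that
`C_G(x) ∩ C_G(y) = 1`, i.e. the only element of `G` fixing both `x` and `y` is the identity. -/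
theorem solvable_coprime_linear_group_has_base_of_size_two
    (p : ℕ) (hp : p.Prime) (hp2 : p ≠ 2)
    (V : Type*) [AddCommGroup V] [Module (ZMod p) V] [Finite V]
    (G : Subgroup (LinearMap.GeneralLinearGroup (ZMod p) V))
    (hsolv : IsSolvable G)
    (hcop : Nat.Coprime (Nat.card G) (Nat.card V)) :
    ∃ x y : V,
      ∀ g ∈ G, (g : V →ₗ[ZMod p] V) x = x → (g : V →ₗ[ZMod p] V) y = y → g = 1 := by
  have hV : ∀ v : V, p • v = 0 := fun v => by
    rw [← Nat.cast_smul_eq_nsmul (ZMod p), CharP.cast_eq_zero, zero_smul]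
  have hinj : Function.Injective
      (fun g : LinearMap.GeneralLinearGroup (ZMod p) V => (g • · : V → V)) :=
    fun g h hgh => Units.ext (LinearMap.ext fun v => congrFun hgh v)
  have hfin : Finite (LinearMap.GeneralLinearGroup (ZMod p) V) := Finite.of_injective _ hinj
  rcases subsingleton_or_nontrivial V with hsub | hnt
  · exact ⟨0, 0, fun g _ _ _ => Units.ext (LinearMap.ext fun v => Subsingleton.elim _ _)⟩
  have hG : ¬ p ∣ Nat.card G := by
    intro h
    obtain ⟨v, hv⟩ := exists_ne (0 : V)
    have : Fact p.Prime := ⟨hp⟩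
    have hpV : p ∣ Nat.card V := by
      rw [← addOrderOf_eq_prime (hV v) hv]
      exact addOrderOf_dvd_natCard v
    exact hp.one_lt.ne' (Nat.dvd_one.1 (hcop ▸ Nat.dvd_gcd h hpV))
  obtain ⟨x, y, hxy⟩ := baseBelow hp hp2 (Nat.card V + 1) G V hsolv hG hV (Nat.lt_succ_self _)
  exact ⟨x, y, fun g hg hx hy => Units.ext (LinearMap.ext fun v => hxy ⟨g, hg⟩ hx hy v)⟩
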